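/- Let ψ be a d-dimensional random variable with E_P[|ψ|] < ∞. Let 𝒬(ψ) denote the family of probability measures Q equivalent to P such that E_Q[|ψ|] < ∞ and some right-continuous adapted version S^Q of the Q-martingale S^Q_t = E_Q[ψ | F_t], t ≥ 0, has the MRP (i.e., Q is the unique probability measure equivalent to P under which S^Q is a local martingale). If 𝒬(ψ) is nonempty, then for every ε > 0 there exists Q ∈ 𝒬(ψ) such that |dQ/dP − 1| ≤ ε holds P-almost surely. -/

import Mathlib

open MeasureTheory Filter Set
open scoped ENNReal NNReal
noncomputable section

/-- A stopping time with values in `[0, ∞]` relative to the filtration `F`. -/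

def IsStoppingTimeENN {Ω : Type*} {m : MeasurableSpace Ω}
    (F : Filtration ℝ≥0 m) (τ : Ω → ℝ≥0∞) : Prop :=
  ∀ t : ℝ≥0, MeasurableSet[F t] {ω | τ ω ≤ (t : ℝ≥0∞)}

/-- The process `M` stopped at the `[0, ∞]`-valued random time `τ`,
i.e. `t ↦ M_{t ∧ τ}`. -/

def stoppedAtENN {Ω E : Type*} (M : ℝ≥0 → Ω → E) (τ : Ω → ℝ≥0∞) : ℝ≥0 → Ω → E :=
  fun t ω => if τ ω ≤ (t : ℝ≥0∞) then M (τ ω).toNNReal ω else M t ω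

/-- A right-continuous adapted process `S` is a local martingale under `R` if there is a
nondecreasing sequence of `[0, ∞]`-valued stopping times `τ n ↑ ∞` pointwise such that every
stopped process `S^{τ n}` is an `R`-martingale. -/

def IsLocalMartingale {Ω : Type*} {m : MeasurableSpace Ω} {E : Type*}
    [NormedAddCommGroup E] [NormedSpace ℝ E] [CompleteSpace E]
    (F : Filtration ℝ≥0 m) (S : ℝ≥0 → Ω → E) (R : Measure Ω) : Prop :=
  ∃ τ : ℕ → Ω → ℝ≥0∞,
    (∀ n, IsStoppingTimeENN F (τ n)) ∧
    (∀ ω, Monotone fun n => τ n ω) ∧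
    (∀ ω, (⨆ n, τ n ω) = ∞) ∧
    (∀ n, Martingale (stoppedAtENN S (τ n)) F R)

/-- `S` has the Martingale Representation Property relative to the reference measure `P` and
the measure `Q`: by Jacod's theorem this is taken to mean that `Q` is the unique probability
measure equivalent to `P` under which `S` is a local martingale. -/

def HasMRP {Ω : Type*} {m : MeasurableSpace Ω} {E : Type*}
    [NormedAddCommGroup E] [NormedSpace ℝ E] [CompleteSpace E]
    (F : Filtration ℝ≥0 m) (S : ℝ≥0 → Ω → E) (P Q : Measure Ω) : Prop :=
  IsLocalMartingale F S Q ∧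
    ∀ R : Measure Ω, IsProbabilityMeasure R → (R ≪ P ∧ P ≪ R) →
      IsLocalMartingale F S R → R = Q

set_option linter.unusedSectionVars false
open Finset (abs_sum_le_sum_abs mul_sum sum_add_distrib sum_congr sum_empty sum_eq_zero sum_le_sum sum_mul sum_nonneg sum_range_succ)
open Real (norm_eq_abs)
lemma mul_left_le {a b c : ℝ} (h : b ≤ c) (ha : 0 ≤ a) : a * b ≤ a * c := mul_le_mul_of_nonneg_left h ha
lemma mul_right_le {a b c : ℝ} (h : b ≤ c) (ha : 0 ≤ a) : b * a ≤ c * a := mul_le_mul_of_nonneg_right h ha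
abbrev IsPr {Ω : Type*} {m : MeasurableSpace Ω} (μ : Measure Ω) : Prop := IsProbabilityMeasure μ
section Disc
variable {Ω : Type*} {m : MeasurableSpace Ω} {Q : Measure Ω} [IsPr Q]
def ind (A : Set Ω) : Ω → ℝ := A.indicator (fun _ => (1:ℝ))
end Disc
section Disc2
variable {Ω : Type*} {m : MeasurableSpace Ω}
lemma ind_sm {G : MeasurableSpace Ω} {A : Set Ω} (hA : MeasurableSet[G] A) :
 StronglyMeasurable[G] (ind A) := stronglyMeasurable_const.indicator hA
lemma ind_abs (A : Set Ω) (w : Ω) : |ind A w| ≤ 1 := by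
  unfold ind; by_cases h : w ∈ A <;> simp [h]
lemma ind_nn (A : Set Ω) (w : Ω) : 0 ≤ ind A w := by
  unfold ind; by_cases h : w ∈ A <;> simp [h]
lemma ind_le_one (A : Set Ω) (w : Ω) : ind A w ≤ 1 := by
  unfold ind; by_cases h : w ∈ A <;> simp [h]
lemma ind_mem {A : Set Ω} {w : Ω} (h : w ∈ A) : ind A w = 1 := by simp [ind, h]
lemma ind_nmem {A : Set Ω} {w : Ω} (h : w ∉ A) : ind A w = 0 := by simp [ind, h]
lemma int_ind_mul (Q : Measure Ω) {A : Set Ω} (hA : MeasurableSet A) (f : Ω → ℝ) :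
 ∫ w, ind A w * f w ∂Q = ∫ w in A, f w ∂Q := by
  rw [← integral_indicator hA]
  congr 1; ext w; by_cases h : w ∈ A <;> simp [ind, h]
lemma int_ind (Q : Measure Ω) [IsFiniteMeasure Q] {A : Set Ω} (hA : MeasurableSet A) :
 ∫ w, ind A w ∂Q = Q.real A := by
  unfold ind; rw [integral_indicator hA]; simp
lemma int_mul {Q : Measure Ω} {φ X : Ω → ℝ} {c : ℝ} (hφ : AEStronglyMeasurable φ Q)
 (hb : ∀ᵐ w ∂Q, |φ w| ≤ c) (hX : Integrable X Q) : Integrable (fun w => φ w * X w) Q := hX.bdd_mul hφ (by simpa [norm_eq_abs] using hb)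
lemma int_lin3 {Q : Measure Ω} {a b c : Ω → ℝ} (k : ℝ) (ha : Integrable a Q) (hb : Integrable b Q)
 (hc : Integrable c Q) :
 ∫ w, (a w - k * b w + c w) ∂Q = ∫ w, a w ∂Q - k * ∫ w, b w ∂Q + ∫ w, c w ∂Q := by
  have h1 : ∫ w, (a w - k * b w + c w) ∂Q = ∫ w, (a w - k * b w) ∂Q + ∫ w, c w ∂Q := integral_add (f := fun w => a w - k * b w) (ha.sub (hb.const_mul k)) hc
  rw [h1, integral_sub ha (hb.const_mul k), integral_const_mul]
lemma sm_min {G : MeasurableSpace Ω} {f : Ω → ℝ} (hf : StronglyMeasurable[G] f) (c : ℝ) :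
 StronglyMeasurable[G] (fun w => min (f w) c) := (hf.measurable.min measurable_const).stronglyMeasurable
variable {Q : Measure Ω} [IsPr Q]
lemma pull {G : MeasurableSpace Ω} (hG : G ≤ m) {φ X : Ω → ℝ}
 (hφ : StronglyMeasurable[G] φ) (hφX : Integrable (fun w => φ w * X w) Q)
 (hX : Integrable X Q) :
 ∫ w, φ w * (Q[X | G]) w ∂Q = ∫ w, φ w * X w ∂Q := by
  have h := condExp_mul_of_stronglyMeasurable_left (μ := Q) hφ hφX hX
  rw [← integral_condExp (μ := Q) hG (f := fun w => φ w * X w)]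
  exact integral_congr_ae h.symm
lemma pull_int {G : MeasurableSpace Ω} {φ X : Ω → ℝ}
 (hφ : StronglyMeasurable[G] φ) (hφX : Integrable (fun w => φ w * X w) Q)
 (hX : Integrable X Q) :
 Integrable (fun w => φ w * (Q[X | G]) w) Q := by
  have h := condExp_mul_of_stronglyMeasurable_left (μ := Q) hφ hφX hX
  exact integrable_condExp.congr h
variable {O : Filtration ℕ m}
lemma mg_int {X : ℕ → Ω → ℝ} (hX : Martingale X O Q) {i j : ℕ} (hij : i ≤ j) {φ : Ω → ℝ}
 (hφ : StronglyMeasurable[O i] φ) (hi : Integrable (fun w => φ w * X j w) Q) :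
 ∫ w, φ w * X j w ∂Q = ∫ w, φ w * X i w ∂Q := by
  rw [← pull (O.le i) hφ hi (hX.integrable j)]
  refine integral_congr_ae ?_
  filter_upwards [hX.2 i j hij] with w h
  rw [h]
lemma mg_int_int {X : ℕ → Ω → ℝ} (hX : Martingale X O Q) {i j : ℕ} (hij : i ≤ j) {φ : Ω → ℝ}
 (hφ : StronglyMeasurable[O i] φ) (hi : Integrable (fun w => φ w * X j w) Q) :
 Integrable (fun w => φ w * X i w) Q := by
  refine (pull_int hφ hi (hX.integrable j)).congr ?_
  filter_upwards [hX.2 i j hij] with w h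
  rw [h]
lemma int_bdd {f : Ω → ℝ} {c : ℝ} (hf : AEStronglyMeasurable f Q)
 (hb : ∀ᵐ w ∂Q, |f w| ≤ c) : Integrable f Q := Integrable.of_bound hf c (by simpa [norm_eq_abs] using hb)
lemma aesm_of {G : MeasurableSpace Ω} (hG : G ≤ m) {f : Ω → ℝ} (hf : StronglyMeasurable[G] f) :
 AEStronglyMeasurable[m] f Q := (hf.mono hG).aestronglyMeasurable
lemma energy_inc {X : ℕ → Ω → ℝ} (hX : Martingale X O Q) {c : ℝ}
 (hb : ∀ i, ∀ᵐ w ∂Q, |X i w| ≤ c) {E : ℕ → Set Ω} (hE : ∀ i, MeasurableSet[O i] (E i))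
 (hmono : Monotone E) (N : ℕ) :
 ∑ i ∈ Finset.range N, ∫ w, ind (E i) w * (X (i+1) w - X i w)^2 ∂Q
 ≤ ∫ w, ind (E N) w * (X N w)^2 ∂Q := by
  have hmeas : ∀ i, AEStronglyMeasurable (X i) Q := fun i => aesm_of (O.le i) (hX.1 i)
  have hsq : ∀ i, Integrable (fun w => (X i w)^2) Q := fun i =>
    int_bdd (c := c^2) ((hmeas i).pow 2) (by
      filter_upwards [hb i] with w h
      rw [abs_pow]; exact pow_le_pow_left₀ (abs_nonneg _) h 2)
  have hind : ∀ j i, Integrable (fun w => ind (E j) w * (X i w)^2) Q := fun j i =>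
    int_mul (c := 1) (aesm_of (O.le j) (ind_sm (hE j))) (ae_of_all _ (ind_abs _)) (hsq i)
  induction N with
  | zero =>
    simp only [Finset.range_zero, sum_empty]
    exact integral_nonneg fun w => mul_nonneg (ind_nn _ _) (sq_nonneg _)
  | succ N ih =>
    rw [sum_range_succ]
    have hφ : StronglyMeasurable[O N] (fun w => ind (E N) w * X N w) := (ind_sm (hE N)).mul (hX.1 N)
    have hφb : ∀ᵐ w ∂Q, |ind (E N) w * X N w| ≤ c := by
      filter_upwards [hb N] with w h
      rw [abs_mul]
      calc _ ≤ 1 * |X N w| := mul_right_le (ind_abs _ _) (abs_nonneg _)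
        _ ≤ c := by simpa using h
    have hcross : Integrable (fun w => (ind (E N) w * X N w) * X (N+1) w) Q := int_mul (aesm_of (O.le N) hφ) hφb (hX.integrable _)
    have h1 := mg_int hX (Nat.le_succ N) hφ hcross
    have h2 : ∫ w, ind (E N) w * (X (N+1) w - X N w)^2 ∂Q
        = ∫ w, ind (E N) w * (X (N+1) w)^2 ∂Q - ∫ w, ind (E N) w * (X N w)^2 ∂Q := by
      have e1 : ∀ w, ind (E N) w * (X (N+1) w - X N w)^2
          = ind (E N) w * (X (N+1) w)^2 - 2 * ((ind (E N) w * X N w) * X (N+1) w)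
            + ind (E N) w * (X N w)^2 := fun w => by ring
      simp_rw [e1]
      rw [int_lin3 2 (hind _ _) hcross (hind _ _)]
      have h3 : ∫ w, (ind (E N) w * X N w) * X (N+1) w ∂Q = ∫ w, ind (E N) w * (X N w)^2 ∂Q := by
        rw [h1]; congr 1; ext w; ring
      rw [h3]; ring
    rw [h2]
    have h4 : ∫ w, ind (E N) w * (X (N+1) w)^2 ∂Q ≤ ∫ w, ind (E (N+1)) w * (X (N+1) w)^2 ∂Q := by
      refine integral_mono (hind _ _) (hind _ _) fun w => ?_
      refine mul_right_le ?_ (sq_nonneg _)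
      by_cases h : w ∈ E N
      · rw [ind_mem h, ind_mem (hmono (Nat.le_succ N) h)]
      · rw [ind_nmem h]; exact ind_nn _ _
    linarith
lemma energy_min {X : ℕ → Ω → ℝ} (hX : Martingale X O Q)
 (h0 : ∀ i, ∀ᵐ w ∂Q, 0 ≤ X i w) {c : ℝ} (hc : 0 < c) (N : ℕ) :
 ∑ i ∈ Finset.range N, ∫ w, (min (X (i+1) w) c - min (X i w) c)^2 ∂Q
 ≤ 2 * c * ∫ w, X 0 w ∂Q := by
  set T : ℕ → Ω → ℝ := fun i w => min (X i w) c with hT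
  have hTm : ∀ i, StronglyMeasurable[O i] (T i) := fun i => sm_min (hX.1 i) c
  have hT0 : ∀ i, ∀ᵐ w ∂Q, 0 ≤ T i w ∧ T i w ≤ c := fun i => by
    filter_upwards [h0 i] with w h
    exact ⟨le_min h hc.le, min_le_right _ _⟩
  have hTb : ∀ i, ∀ᵐ w ∂Q, |T i w| ≤ c := fun i => by
    filter_upwards [hT0 i] with w h
    rw [abs_of_nonneg h.1]; exact h.2
  have hTi : ∀ i, Integrable (T i) Q := fun i => int_bdd (aesm_of (O.le i) (hTm i)) (hTb i)
  have hTT : ∀ i j, Integrable (fun w => T i w * T j w) Q := fun i j =>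
    int_mul (aesm_of (O.le i) (hTm i)) (hTb i) (hTi j)
  have hsup : ∀ i, ∫ w, (c - T i w) * T (i+1) w ∂Q ≤ ∫ w, (c - T i w) * T i w ∂Q := by
    intro i
    have hφ : StronglyMeasurable[O i] (fun w => c - T i w) := stronglyMeasurable_const.sub (hTm i)
    have hφb : ∀ᵐ w ∂Q, |c - T i w| ≤ c := by
      filter_upwards [hT0 i] with w h
      rw [abs_of_nonneg (by linarith [h.2])]; linarith [h.1]
    have hI : Integrable (fun w => (c - T i w) * T (i+1) w) Q := int_mul (aesm_of (O.le i) hφ) hφb (hTi _)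
    rw [← pull (O.le i) hφ hI (hTi _)]
    refine integral_mono_ae (pull_int hφ hI (hTi _))
      (int_mul (aesm_of (O.le i) hφ) hφb (hTi _)) ?_
    have a1 : Q[T (i+1) | O i] ≤ᵐ[Q] Q[X (i+1) | O i] := condExp_mono (hTi _) (hX.integrable _) (ae_of_all _ fun w => min_le_left _ _)
    have a2 : Q[T (i+1) | O i] ≤ᵐ[Q] Q[(fun _ => c) | O i] := condExp_mono (hTi _) (integrable_const _) (ae_of_all _ fun w => min_le_right _ _)
    rw [condExp_const (O.le i)] at a2
    filter_upwards [a1, a2, hX.2 i (i+1) (Nat.le_succ i), hT0 i] with w b1 b2 b3 b4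
    refine mul_left_le ?_ (by linarith [b4.2])
    exact le_min (b3 ▸ b1) b2
  have key : ∑ i ∈ Finset.range N, ∫ w, (T (i+1) w - T i w)^2 ∂Q
      ≤ (∫ w, T N w * T N w ∂Q - ∫ w, T 0 w * T 0 w ∂Q)
        + 2 * c * (∫ w, T 0 w ∂Q - ∫ w, T N w ∂Q) := by
    induction N with
    | zero => simp
    | succ N ih =>
      rw [sum_range_succ]
      have e : ∫ w, (T (N+1) w - T N w)^2 ∂Q = ∫ w, T (N+1) w * T (N+1) w ∂Q
          - 2 * ∫ w, T N w * T (N+1) w ∂Q + ∫ w, T N w * T N w ∂Q := by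
        have e1 : ∀ w, (T (N+1) w - T N w)^2 = T (N+1) w * T (N+1) w
          - 2 * (T N w * T (N+1) w) + T N w * T N w := fun w => by ring
        simp_rw [e1]
        rw [int_lin3 2 (hTT _ _) (hTT _ _) (hTT _ _)]
      have s := hsup N
      simp_rw [sub_mul] at s
      rw [integral_sub ((hTi _).const_mul c) (hTT _ _), integral_sub ((hTi _).const_mul c) (hTT _ _),
        integral_const_mul, integral_const_mul] at s
      rw [e]; linarith
  refine key.trans ?_
  have k1 : ∫ w, T N w * T N w ∂Q ≤ c * ∫ w, T N w ∂Q := by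
    rw [← integral_const_mul]
    refine integral_mono_ae (hTT _ _) ((hTi _).const_mul c) ?_
    filter_upwards [hT0 N] with w h
    exact mul_right_le h.2 h.1
  have k2 : 0 ≤ ∫ w, T N w ∂Q := integral_nonneg_of_ae (by filter_upwards [hT0 N] with w h using h.1)
  have k3 : 0 ≤ ∫ w, T 0 w * T 0 w ∂Q := integral_nonneg fun w => mul_self_nonneg _
  have k4 : ∫ w, T 0 w ∂Q ≤ ∫ w, X 0 w ∂Q := integral_mono (hTi 0) (hX.integrable 0) fun w => min_le_left _ _
  nlinarith
def stay (Y : ℕ → Ω → ℝ) (c : ℝ) (i : ℕ) : Set Ω := {w | ∀ r ≤ i, Y r w ≤ c}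
lemma stay_anti (Y : ℕ → Ω → ℝ) (c : ℝ) : Antitone (stay Y c) := fun _ _ h _ hw r hr => hw r (hr.trans h)
end Disc2
section Disc3
variable {Ω : Type*} {m : MeasurableSpace Ω} {Q : Measure Ω} [IsPr Q]
  {O : Filtration ℕ m}
lemma stay_meas {Y : ℕ → Ω → ℝ} (hY : ∀ i, StronglyMeasurable[O i] (Y i)) (c : ℝ) (i : ℕ) :
 MeasurableSet[O i] (stay Y c i) := by
  have : stay Y c i = ⋂ r : ℕ, ⋂ _ : r ≤ i, {w | Y r w ≤ c} := by
    ext w; simp [stay]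
  rw [this]
  refine MeasurableSet.iInter fun r => MeasurableSet.iInter fun hr => ?_
  have h1 : Measurable[O i] (Y r) := ((hY r).mono (O.mono hr)).measurable
  exact measurableSet_le h1 measurable_const
lemma int_indm {A : Set Ω} (hA : MeasurableSet[m] A) {f : Ω → ℝ} (hf : Integrable f Q) :
 Integrable (fun w => ind A w * f w) Q := int_mul (c := 1) (aesm_of le_rfl (ind_sm hA)) (ae_of_all _ (ind_abs _)) hf
lemma jump_le {X : ℕ → Ω → ℝ} (hX : Martingale X O Q) {A : ℕ → Set Ω}
 (hA : ∀ i, MeasurableSet[O i] (A i)) (hanti : Antitone A) (N : ℕ)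
 (h0 : 0 ≤ᵐ[Q] X 0) :
 ∑ i ∈ Finset.range N, ∫ w, ind (A i \ A (i+1)) w * X (i+1) w ∂Q
 ≤ ∫ w, ind (A N)ᶜ w * X N w ∂Q := by
  induction N with
  | zero =>
    simp only [Finset.range_zero, sum_empty]
    refine integral_nonneg_of_ae ?_
    filter_upwards [h0] with w h using mul_nonneg (ind_nn _ _) h
  | succ N ih =>
    rw [sum_range_succ]
    have hc : MeasurableSet[O N] (A N)ᶜ := (hA N).compl
    have hd : MeasurableSet[m] (A N \ A (N+1)) := ((O.le N) _ (hA N)).diff ((O.le (N+1)) _ (hA (N+1)))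
    have h1 := mg_int hX (Nat.le_succ N) (ind_sm hc)
      (int_indm ((O.le N) _ hc) (hX.integrable (N+1)))
    have h2 : ∫ w, ind (A (N+1))ᶜ w * X (N+1) w ∂Q = ∫ w, ind (A N)ᶜ w * X (N+1) w ∂Q
        + ∫ w, ind (A N \ A (N+1)) w * X (N+1) w ∂Q := by
      rw [← integral_add (int_indm ((O.le N) _ hc) (hX.integrable (N+1)))
        (int_indm hd (hX.integrable (N+1)))]
      congr 1; ext w
      by_cases h : w ∈ A (N+1)
      · have h' := hanti (Nat.le_succ N) h
        simp [ind, h, h']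
      · by_cases h' : w ∈ A N <;> simp [ind, h, h']
    rw [h2]
    have h1' : ∫ w, ind (A N)ᶜ w * X (N+1) w ∂Q = ∫ w, ind (A N)ᶜ w * X N w ∂Q := h1
    linarith
lemma jump_le' {X : ℕ → Ω → ℝ} (hX : Martingale X O Q) {A : ℕ → Set Ω}
 (hA : ∀ i, MeasurableSet[O i] (A i)) (hanti : Antitone A) (N : ℕ)
 (h0 : ∀ i, 0 ≤ᵐ[Q] X i) :
 ∑ i ∈ Finset.range N, ∫ w, ind (A i \ A (i+1)) w * X (i+1) w ∂Q ≤ ∫ w, X 0 w ∂Q := by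
  refine (jump_le hX hA hanti N (h0 0)).trans ?_
  have h := mg_int hX (Nat.zero_le N) (φ := fun _ => 1) stronglyMeasurable_const
    (by simpa using hX.integrable N)
  simp only [one_mul] at h
  rw [← h]
  refine integral_mono_ae (int_indm ((O.le N) _ (hA N).compl) (hX.integrable N))
    (hX.integrable N) ?_
  filter_upwards [h0 N] with w h
  exact mul_le_of_le_one_left h (ind_le_one _ _)
lemma maximal_stay {X : ℕ → Ω → ℝ} (hX : Martingale X O Q) (h0 : ∀ i, 0 ≤ᵐ[Q] X i)
 {c : ℝ} (N : ℕ) :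
 c * Q.real (stay X c N)ᶜ ≤ ∫ w, X 0 w ∂Q := by
  have hm : ∀ i, MeasurableSet[O i] (stay X c i) := stay_meas hX.1 c
  have hmm : ∀ i, MeasurableSet[m] (stay X c i) := fun i => (O.le i) _ (hm i)
  have key : c * Q.real (stay X c N)ᶜ ≤ ∫ w, ind (stay X c N)ᶜ w * X N w ∂Q := by
    induction N with
    | zero =>
      rw [← int_ind Q (hmm 0).compl, ← integral_const_mul]
      refine integral_mono ((int_bdd (c := 1) (aesm_of le_rfl (ind_sm (hmm 0).compl))
        (ae_of_all _ (ind_abs _))).const_mul c) (int_indm (hmm 0).compl (hX.integrable 0)) ?_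
      intro w
      by_cases h : w ∈ stay X c 0
      · simp [ind, h]
      · have : c < X 0 w := by
          simpa [stay] using h
        simp only [ind_mem (show w ∈ (stay X c 0)ᶜ from h)]; linarith
    | succ N ih =>
      have hd : MeasurableSet[m] (stay X c N \ stay X c (N+1)) := (hmm N).diff (hmm (N+1))
      have h1 := mg_int hX (Nat.le_succ N) (ind_sm (hm N).compl)
        (int_indm (hmm N).compl (hX.integrable (N+1)))
      have h1' : ∫ w, ind (stay X c N)ᶜ w * X (N+1) w ∂Q
        = ∫ w, ind (stay X c N)ᶜ w * X N w ∂Q := h1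
      have hs : ∀ w, ind (stay X c (N+1))ᶜ w
          = ind (stay X c N)ᶜ w + ind (stay X c N \ stay X c (N+1)) w := by
        intro w
        by_cases h : w ∈ stay X c (N+1)
        · have h' := stay_anti X c (Nat.le_succ N) h
          simp [ind, h, h']
        · by_cases h' : w ∈ stay X c N <;> simp [ind, h, h']
      have i1 : ∀ {B : Set Ω}, MeasurableSet[m] B → Integrable (ind B) Q := fun hB =>
        int_bdd (c := 1) (aesm_of le_rfl (ind_sm hB)) (ae_of_all _ (ind_abs _))
      rw [← int_ind Q (hmm (N+1)).compl]
      simp_rw [hs, add_mul]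
      rw [integral_add (i1 (hmm N).compl) (i1 hd), int_ind Q (hmm N).compl,
        integral_add (int_indm (hmm N).compl (hX.integrable (N+1)))
        (int_indm hd (hX.integrable (N+1))), h1', mul_add]
      refine add_le_add ih ?_
      rw [← integral_const_mul]
      refine integral_mono ((i1 hd).const_mul c) (int_indm hd (hX.integrable (N+1))) ?_
      intro w
      by_cases h : w ∈ stay X c N \ stay X c (N+1)
      · have : c < X (N+1) w := by
          obtain ⟨ha, hb⟩ := h
          by_contra hcon
          push Not at hcon
          refine hb fun r hr => ?_
          rcases Nat.lt_or_ge r (N+1) with h | h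
          · exact ha r (by omega)
          · have : r = N+1 := le_antisymm hr h
            rw [this]; exact hcon
        simp only [ind_mem h]; linarith
      · simp [ind_nmem h]
  refine key.trans ?_
  have h := mg_int hX (Nat.zero_le N) (φ := fun _ => 1) stronglyMeasurable_const
    (by simpa using hX.integrable N)
  simp only [one_mul] at h
  rw [← h]
  refine integral_mono_ae (int_indm (hmm N).compl (hX.integrable N)) (hX.integrable N) ?_
  filter_upwards [h0 N] with w h
  exact mul_le_of_le_one_left h (ind_le_one _ _)
lemma cs_sum {a b : ℕ → Ω → ℝ} (s : Finset ℕ) (ha : ∀ i, Integrable (fun w => (a i w)^2) Q)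
 (hb : ∀ i, Integrable (fun w => (b i w)^2) Q) (hab : ∀ i, Integrable (fun w => a i w * b i w) Q)
 {α β : ℝ} (hα : ∑ i ∈ s, ∫ w, (a i w)^2 ∂Q ≤ α) (hβ : ∑ i ∈ s, ∫ w, (b i w)^2 ∂Q ≤ β) :
 |∑ i ∈ s, ∫ w, a i w * b i w ∂Q| ≤ √α * √β := by
  set A := ∑ i ∈ s, ∫ w, (a i w)^2 ∂Q
  set B := ∑ i ∈ s, ∫ w, (b i w)^2 ∂Q
  set C := ∑ i ∈ s, ∫ w, a i w * b i w ∂Q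
  have hA0 : 0 ≤ A := sum_nonneg fun i _ => integral_nonneg fun w => sq_nonneg _
  have hB0 : 0 ≤ B := sum_nonneg fun i _ => integral_nonneg fun w => sq_nonneg _
  have key : ∀ t : ℝ, 0 ≤ A * (t * t) + (-2 * C) * t + B := by
    intro t
    have : A * (t*t) + (-2*C) * t + B = ∑ i ∈ s, ∫ w, (t * a i w - b i w)^2 ∂Q := by
      have e : ∀ i, ∫ w, (t * a i w - b i w)^2 ∂Q = t*t * ∫ w, (a i w)^2 ∂Q
          - (2*t) * ∫ w, a i w * b i w ∂Q + ∫ w, (b i w)^2 ∂Q := by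
        intro i
        rw [← integral_const_mul, ← int_lin3 (2*t) ((ha i).const_mul (t*t)) (hab i) (hb i)]
        congr 1; ext w; ring
      simp_rw [e]
      rw [sum_add_distrib, Finset.sum_sub_distrib, ← mul_sum, ← mul_sum]
      ring
    rw [this]
    exact sum_nonneg fun i _ => integral_nonneg fun w => sq_nonneg _
  have hd := discrim_le_zero key
  unfold discrim at hd
  have h2 : C^2 ≤ A * B := by nlinarith
  rw [← Real.sqrt_mul (hA0.trans hα)]
  rw [← Real.sqrt_sq_eq_abs]
  refine Real.sqrt_le_sqrt (h2.trans ?_)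
  exact mul_le_mul hα hβ hB0 (hA0.trans hα)
lemma energy_one {L : ℕ → Ω → ℝ} (hL : Martingale L O Q) {c : ℝ}
 (hb : ∀ i, ∀ᵐ w ∂Q, |L i w| ≤ c) (N : ℕ) :
 ∑ i ∈ Finset.range N, ∫ w, (L (i+1) w - L i w)^2 ∂Q ≤ c^2 := by
  have h := energy_inc hL hb (E := fun _ => Set.univ) (fun i => MeasurableSet.univ)
    (fun _ _ _ => le_rfl) N
  simp only [ind, Set.indicator_univ, one_mul] at h
  refine h.trans ?_
  have : ∫ w, (L N w)^2 ∂Q ≤ ∫ w, c^2 ∂Q := by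
    refine integral_mono_ae (int_bdd (c := c^2) ((aesm_of (O.le N) (hL.1 N)).pow 2) ?_)
      (integrable_const _) ?_
    · filter_upwards [hb N] with w h
      rw [abs_pow]; exact pow_le_pow_left₀ (abs_nonneg _) h 2
    · filter_upwards [hb N] with w h
      rw [← sq_abs]; exact pow_le_pow_left₀ (abs_nonneg _) h 2
  simpa using this
lemma weak_core {L Xp Xm : ℕ → Ω → ℝ} (hL : Martingale L O Q) (hLb : ∀ i, ∀ᵐ w ∂Q, |L i w| ≤ 1)
 (hp : Martingale Xp O Q) (hp0 : ∀ i, 0 ≤ᵐ[Q] Xp i)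
 (hm : Martingale Xm O Q) (hm0 : ∀ i, 0 ≤ᵐ[Q] Xm i)
 {φ : ℕ → Ω → ℝ} (hφ : ∀ i, StronglyMeasurable[O i] (φ i)) (hφb : ∀ i w, |φ i w| ≤ 1)
 {e : ℝ} (he : ∫ w, (Xp 0 w + Xm 0 w) ∂Q = e) (N : ℕ) :
 |∑ i ∈ Finset.range N, ∫ w, ind (stay (fun i w => Xp i w + Xm i w) 1 i) w * φ i w *
 (L (i+1) w - L i w) * ((Xp (i+1) w - Xm (i+1) w) - (Xp i w - Xm i w)) ∂Q|
 ≤ 2 * √e + 4 * e := by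
  set Y : ℕ → Ω → ℝ := fun i w => Xp i w + Xm i w with hY
  have hYm : Martingale Y O Q := hp.add hm
  have hY0 : ∀ i, 0 ≤ᵐ[Q] Y i := fun i => by
    filter_upwards [hp0 i, hm0 i] with w h1 h2 using add_nonneg h1 h2
  set A := stay Y 1 with hA
  have hAm : ∀ i, MeasurableSet[O i] (A i) := stay_meas hYm.1 1
  have hAmm : ∀ i, MeasurableSet[m] (A i) := fun i => (O.le i) _ (hAm i)
  set dX : ℕ → Ω → ℝ := fun i w => (Xp (i+1) w - Xm (i+1) w) - (Xp i w - Xm i w) with hdX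
  set dL : ℕ → Ω → ℝ := fun i w => L (i+1) w - L i w with hdL
  have hsm : ∀ {X : ℕ → Ω → ℝ}, Martingale X O Q → ∀ i, AEStronglyMeasurable[m] (X i) Q := fun hX i => aesm_of (O.le i) (hX.1 i)
  have hdLm : ∀ i, AEStronglyMeasurable[m] (dL i) Q := fun i => (hsm hL (i+1)).sub (hsm hL i)
  have hφm : ∀ i, AEStronglyMeasurable[m] (φ i) Q := fun i => aesm_of (O.le i) (hφ i)
  have hdXi : ∀ i, Integrable (dX i) Q := fun i =>
    ((hp.integrable (i+1)).sub (hm.integrable (i+1))).sub ((hp.integrable i).sub (hm.integrable i))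
  have hdLb : ∀ i, ∀ᵐ w ∂Q, |dL i w| ≤ 2 := fun i => by
    filter_upwards [hLb i, hLb (i+1)] with w h1 h2
    exact (abs_sub _ _).trans (by linarith)
  set a : ℕ → Ω → ℝ := fun i w => φ i w * dL i w with ha
  set b : ℕ → Ω → ℝ := fun i w => ind (A (i+1)) w * dX i w with hb
  have ham : ∀ i, AEStronglyMeasurable[m] (a i) Q := fun i => (hφm i).mul (hdLm i)
  have hab2 : ∀ i, ∀ᵐ w ∂Q, |a i w| ≤ 2 := fun i => by
    filter_upwards [hdLb i] with w h
    rw [ha, abs_mul]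
    calc _ ≤ 1 * 2 := mul_le_mul (hφb i w) h (abs_nonneg _) zero_le_one
      _ = 2 := by norm_num
  have hbi : ∀ i, Integrable (b i) Q := fun i => int_indm (hAmm (i+1)) (hdXi i)
  have hbb : ∀ i, ∀ᵐ w ∂Q, (b i w)^2 ≤ 2 * ((min (Xp (i+1) w) 1 - min (Xp i w) 1)^2
      + (min (Xm (i+1) w) 1 - min (Xm i w) 1)^2) ∧ |b i w| ≤ 4 := fun i => by
    filter_upwards [hp0 i, hp0 (i+1), hm0 i, hm0 (i+1)] with w h1 h2 h3 h4
    simp only [Pi.zero_apply] at h1 h2 h3 h4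
    by_cases h : w ∈ A (i+1)
    · have e1 : Xp i w + Xm i w ≤ 1 := h i (Nat.le_succ i)
      have e2 : Xp (i+1) w + Xm (i+1) w ≤ 1 := h (i+1) le_rfl
      simp only [hb, ind_mem h, hdX, one_mul]
      rw [min_eq_left (by linarith), min_eq_left (by linarith), min_eq_left (by linarith),
        min_eq_left (by linarith)]
      constructor
      · nlinarith [sq_nonneg ((Xp (i+1) w - Xp i w) + (Xm (i+1) w - Xm i w))]
      · rw [abs_le]; constructor <;> linarith
    · simp only [hb, ind_nmem h, zero_mul]
      constructor
      · have : (0:ℝ)^2 = 0 := by norm_num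
        rw [this]; positivity
      · simp
  have hb2 : ∀ i, Integrable (fun w => (b i w)^2) Q := fun i =>
    int_bdd (c := 4^2) ((hbi i).1.pow 2) (by
      filter_upwards [hbb i] with w h
      rw [abs_pow]; exact pow_le_pow_left₀ (abs_nonneg _) h.2 2)
  have ha2 : ∀ i, Integrable (fun w => (a i w)^2) Q := fun i =>
    int_bdd (c := 2^2) ((ham i).pow 2) (by
      filter_upwards [hab2 i] with w h
      rw [abs_pow]; exact pow_le_pow_left₀ (abs_nonneg _) h 2)
  have hdL2 : ∀ i, Integrable (fun w => (dL i w)^2) Q := fun i =>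
    int_bdd (c := 2^2) ((hdLm i).pow 2) (by
      filter_upwards [hdLb i] with w h
      rw [abs_pow]; exact pow_le_pow_left₀ (abs_nonneg _) h 2)
  have habi : ∀ i, Integrable (fun w => a i w * b i w) Q := fun i =>
    int_mul (ham i) (hab2 i) (hbi i)
  have hα : ∑ i ∈ Finset.range N, ∫ w, (a i w)^2 ∂Q ≤ 1 := by
    refine (sum_le_sum fun i _ => integral_mono (ha2 i) (hdL2 i) fun w => ?_).trans
      ((energy_one hL hLb N).trans (by norm_num))
    simp only [ha, mul_pow]
    have : (φ i w)^2 ≤ 1 := by rw [← sq_abs]; exact pow_le_one₀ (abs_nonneg _) (hφb i w)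
    exact mul_le_of_le_one_left (sq_nonneg _) this
  have hminI : ∀ {X : ℕ → Ω → ℝ}, Martingale X O Q → (∀ i, 0 ≤ᵐ[Q] X i) → ∀ i,
      Integrable (fun w => (min (X (i+1) w) 1 - min (X i w) 1)^2) Q := fun {X} hX h0 i => by
    refine int_bdd (c := 1) (((aesm_of (O.le (i+1)) (sm_min (hX.1 (i+1)) 1)).sub
      (aesm_of (O.le i) (sm_min (hX.1 i) 1))).pow 2) ?_
    filter_upwards [h0 i, h0 (i+1)] with w h1 h2
    rw [abs_of_nonneg (sq_nonneg _), ← sq_abs]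
    refine pow_le_one₀ (abs_nonneg _) ?_
    have k1 : 0 ≤ min (X i w) 1 := le_min h1 zero_le_one
    have k2 : 0 ≤ min (X (i+1) w) 1 := le_min h2 zero_le_one
    rw [abs_le]; constructor <;> linarith [min_le_right (X i w) 1, min_le_right (X (i+1) w) 1]
  have hβ : ∑ i ∈ Finset.range N, ∫ w, (b i w)^2 ∂Q ≤ 4 * e := by
    have h1 := energy_min hp hp0 one_pos N
    have h2 := energy_min hm hm0 one_pos N
    have h3 : ∑ i ∈ Finset.range N, ∫ w, (b i w)^2 ∂Q ≤ ∑ i ∈ Finset.range N,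
        2 * ((∫ w, (min (Xp (i+1) w) 1 - min (Xp i w) 1)^2 ∂Q)
        + ∫ w, (min (Xm (i+1) w) 1 - min (Xm i w) 1)^2 ∂Q) := by
      refine sum_le_sum fun i _ => ?_
      rw [← integral_add (hminI hp hp0 i) (hminI hm hm0 i), ← integral_const_mul]
      refine integral_mono_ae (hb2 i) (((hminI hp hp0 i).add (hminI hm hm0 i)).const_mul 2) ?_
      filter_upwards [hbb i] with w h using h.1
    rw [← mul_sum, sum_add_distrib] at h3
    rw [integral_add (hp.integrable 0) (hm.integrable 0)] at he
    linarith
  have hcs := cs_sum (Q := Q) (Finset.range N) ha2 hb2 habi hα hβ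
  set J : ℕ → Ω → ℝ := fun i w => ind (A i \ A (i+1)) w * (φ i w * dL i w * dX i w) with hJ
  have hJi0 : ∀ i, Integrable (fun w => φ i w * dL i w * dX i w) Q := fun i =>
    int_mul (ham i) (hab2 i) (hdXi i)
  have hJi : ∀ i, Integrable (J i) Q := fun i =>
    int_indm ((hAmm i).diff (hAmm (i+1))) (hJi0 i)
  have hJb : ∀ i, |∫ w, J i w ∂Q| ≤ 4 * ∫ w, ind (A i \ A (i+1)) w * Y (i+1) w ∂Q := by
    intro i
    rw [← integral_const_mul]
    refine abs_integral_le_integral_abs.trans ?_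
    refine integral_mono_ae (hJi i).abs ((int_indm ((hAmm i).diff (hAmm (i+1)))
      (hYm.integrable (i+1))).const_mul 4) ?_
    filter_upwards [hab2 i, hp0 i, hp0 (i+1), hm0 i, hm0 (i+1)] with w h h1 h2 h3 h4
    simp only [Pi.zero_apply] at h1 h2 h3 h4
    by_cases hw : w ∈ A i \ A (i+1)
    · have e1 : Xp i w + Xm i w ≤ 1 := hw.1 i le_rfl
      have e2 : 1 < Xp (i+1) w + Xm (i+1) w := by
        by_contra hcon
        push Not at hcon
        refine hw.2 fun r hr => ?_
        rcases Nat.lt_or_ge r (i+1) with h | h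
        · exact hw.1 r (by omega)
        · have : r = i+1 := le_antisymm hr h
          rw [this]; exact hcon
      simp only [hJ, ind_mem hw, one_mul]
      rw [abs_mul]
      have e3 : |dX i w| ≤ 2 * Y (i+1) w := by
        simp only [hdX, hY]
        rw [abs_le]; constructor <;> linarith
      calc _ ≤ 2 * (2 * Y (i+1) w) := mul_le_mul h e3 (abs_nonneg _) (by norm_num)
        _ = _ := by ring
    · simp [hJ, ind_nmem hw]
  have hsplit : ∀ i, ∫ w, ind (A i) w * φ i w * dL i w * dX i w ∂Q
      = ∫ w, a i w * b i w ∂Q + ∫ w, J i w ∂Q := by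
    intro i
    rw [← integral_add (habi i) (hJi i)]
    congr 1; ext w
    simp only [ha, hb, hJ]
    by_cases h : w ∈ A (i+1)
    · have h' := stay_anti Y 1 (Nat.le_succ i) h
      rw [ind_mem h, ind_mem (show w ∈ A i from h'), ind_nmem (fun hh => hh.2 h)]; ring
    · by_cases h' : w ∈ A i
      · rw [ind_nmem h, ind_mem h', ind_mem (show w ∈ A i \ A (i+1) from ⟨h', h⟩)]; ring
      · rw [ind_nmem h, ind_nmem h', ind_nmem (fun hh => h' hh.1)]; ring
  change |∑ i ∈ Finset.range N, ∫ w, ind (A i) w * φ i w * dL i w * dX i w ∂Q| ≤ _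
  rw [sum_congr rfl fun i _ => hsplit i]
  rw [sum_add_distrib]
  refine (abs_add_le _ _).trans (add_le_add ?_ ?_)
  · refine hcs.trans (le_of_eq ?_)
    rw [Real.sqrt_one, one_mul, Real.sqrt_mul (by norm_num)]
    congr 1
    rw [show (4:ℝ) = 2^2 by norm_num]; exact Real.sqrt_sq (by norm_num)
  · refine (abs_sum_le_sum_abs _ _).trans ((sum_le_sum fun i _ => hJb i).trans ?_)
    rw [← mul_sum]
    have := jump_le' hYm hAm (stay_anti Y 1) N hY0
    rw [he] at this
    linarith
end Disc3
section Select
lemma ultra_lim {α : Type*} (U : Ultrafilter α) {f : α → ℝ} {C : ℝ}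
 (h : ∀ᶠ x in (U : Filter α), |f x| ≤ C) : ∃ l, Tendsto f U (nhds l) := by
  have h1 : (↑(U.map f) : Filter ℝ) ≤ 𝓟 (Icc (-C) C) := by
    rw [le_principal_iff, Ultrafilter.mem_coe, Ultrafilter.mem_map]
    filter_upwards [h] with x hx
    exact abs_le.1 hx
  obtain ⟨l, -, hl⟩ := (isCompact_Icc (a := -C) (b := C)).ultrafilter_le_nhds _ h1
  exact ⟨l, hl⟩
variable {X : Type*} [MeasurableSpace X]
theorem selection_nat (ν : ℕ → Measure X) [∀ n, IsFiniteMeasure (ν n)] {C : ℝ}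
 (hC : ∀ n, (ν n).real univ ≤ C) {B : ℕ → Set X} (hBm : ∀ j, MeasurableSet (B j)) {δ : ℝ}
 (hδ : 0 < δ) (hB : ∀ j, ∀ᶠ n in atTop, δ ≤ (ν n).real (B j))
 {R : ℕ → ℕ → Set X} {ε : ℕ → ℕ → ℝ}
 (hR : ∀ a k, ∀ᶠ n in atTop, (ν n).real (R a k) ≤ ε a k) (hε : ∀ a, Summable (ε a)) :
 ∃ U : Ultrafilter X, (∀ a, ∀ᶠ k in atTop, (R a k)ᶜ ∈ U) ∧ ∃ᶠ j in atTop, B j ∈ U := by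
  set H : Ultrafilter ℕ := hyperfilter ℕ with hH
  have hHle : (H : Filter ℕ) ≤ atTop := by
    rw [← Nat.cofinite_eq_atTop]; exact hyperfilter_le_cofinite
  have hbd : ∀ S : Set X, ∀ n, |(ν n).real S| ≤ C := fun S n => by
    rw [abs_of_nonneg measureReal_nonneg]
    exact (measureReal_mono (subset_univ S)).trans (hC n)
  have hex : ∀ S : Set X, ∃ l, Tendsto (fun n => (ν n).real S) H (nhds l) := fun S =>
    ultra_lim H (C := C) (Eventually.of_forall (hbd S))
  choose M hM using hex
  have hMC : ∀ S, M S ≤ C := fun S => le_of_tendsto (hM S)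
    (Eventually.of_forall fun n => (le_abs_self _).trans (hbd S n))
  have hsub : ∀ S T, M (S ∪ T) ≤ M S + M T := fun S T =>
    le_of_tendsto_of_tendsto (hM _) ((hM S).add (hM T))
      (Eventually.of_forall fun n => measureReal_union_le S T)
  have hmono : ∀ S T, S ⊆ T → M S ≤ M T := fun S T h =>
    le_of_tendsto_of_tendsto (hM _) (hM T) (Eventually.of_forall fun n => measureReal_mono h)
  have hsplit : ∀ S T, MeasurableSet T → M S = M (S ∩ T) + M (S \ T) := fun S T hT =>
    tendsto_nhds_unique (hM S) (by
      refine ((hM (S ∩ T)).add (hM (S \ T))).congr fun n => ?_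
      exact measureReal_inter_add_sdiff hT)
  have hpos : ∀ S, 0 < M S → S.Nonempty := fun S h => by
    by_contra hcon
    rw [not_nonempty_iff_eq_empty] at hcon
    have h0 : M S = 0 := tendsto_nhds_unique (hM S) (by simp [hcon])
    linarith
  have hMB : ∀ j, δ ≤ M (B j) := fun j => ge_of_tendsto (hM _) (hHle (hB j))
  have hMR : ∀ a k, M (R a k) ≤ ε a k := fun a k => le_of_tendsto (hM _) (hHle (hR a k))
  have hM0 : ∀ S, 0 ≤ M S := fun S => ge_of_tendsto (hM S)
    (Eventually.of_forall fun n => measureReal_nonneg)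
  set W : ℕ → ℕ → Set X := fun J K => ⋃ j ∈ Finset.Ico J K, B j with hW
  have hWm : ∀ J K, MeasurableSet (W J K) := fun J K =>
    Finset.measurableSet_biUnion _ fun j _ => hBm j
  have hWmono : ∀ {J J' K K'}, J ≤ J' → K' ≤ K → W J' K' ⊆ W J K := by
    intro J J' K K' h1 h2 x hx
    simp only [hW, mem_iUnion, Finset.mem_Ico] at hx ⊢
    obtain ⟨j, ⟨hj1, hj2⟩, hj⟩ := hx
    exact ⟨j, ⟨by omega, by omega⟩, hj⟩
  have hbdd : ∀ J, BddAbove (range fun K => M (W J K)) := fun J =>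
    ⟨C, by rintro _ ⟨K, rfl⟩; exact hMC _⟩
  have hK : ∀ J, ∃ K, J < K ∧ (⨆ K, M (W J K)) - δ / 8 * (1/2)^J < M (W J K) := by
    intro J
    have : (⨆ K, M (W J K)) - δ / 8 * (1/2)^J < ⨆ K, M (W J K) := by
      have : 0 < δ / 8 * (1/2)^J := by positivity
      linarith
    obtain ⟨K, hK⟩ := exists_lt_of_lt_ciSup this
    exact ⟨max K (J+1), by omega, hK.trans_le (hmono _ _ (hWmono le_rfl (le_max_left _ _)))⟩
  choose K hKJ hKM using hK
  have hdiff : ∀ J J', J ≤ J' → M (W J' (K J') \ W J (K J)) ≤ δ / 8 * (1/2)^J := by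
    intro J J' hJ
    have h1 : M (W J (max (K J) (K J'))) ≤ ⨆ K, M (W J K) := le_ciSup (hbdd J) _
    have h2 := hsplit (W J (max (K J) (K J'))) (W J (K J)) (hWm _ _)
    rw [inter_eq_self_of_subset_right (hWmono le_rfl (le_max_left _ _))] at h2
    have h3 := hmono (W J' (K J') \ W J (K J)) (W J (max (K J) (K J')) \ W J (K J))
      (sdiff_subset_sdiff_left (hWmono hJ (le_max_right _ _)))
    have := hKM J
    linarith
  have htail : ∀ a, ∃ k0, ∀ k1, ∑ k ∈ Finset.Ico k0 k1, ε a k ≤ δ / 8 * (1/2)^a := by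
    intro a
    have hc := (hε a).hasSum.tendsto_sum_nat.cauchySeq
    rw [Metric.cauchySeq_iff'] at hc
    obtain ⟨k0, hk0⟩ := hc (δ / 8 * (1/2)^a) (by positivity)
    refine ⟨k0, fun k1 => ?_⟩
    rcases le_total k0 k1 with h | h
    · rw [Finset.sum_Ico_eq_sub _ h]
      have := hk0 k1 h
      rw [Real.dist_eq] at this
      exact (le_abs_self _).trans this.le
    · rw [Finset.Ico_eq_empty (by omega)]; simp; positivity
  choose k0 hk0 using htail
  have hgeo : ∀ N : ℕ, ∑ a ∈ Finset.range N, δ / 8 * (1/2:ℝ)^a ≤ δ / 4 := by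
    intro N
    rw [← mul_sum]
    have : ∑ a ∈ Finset.range N, (1/2:ℝ)^a ≤ 2 := by
      have := summable_geometric_two.sum_le_tsum (Finset.range N) (fun _ _ => by positivity)
      rwa [tsum_geometric_two] at this
    nlinarith
  set V1 : ℕ → Set X := fun N => ⋃ J ∈ Finset.range N, (W J (K J))ᶜ with hV1
  set V2 : ℕ → Set X := fun N => ⋃ a ∈ Finset.range N, ⋃ k ∈ Finset.Ico (k0 a) N, R a k with hV2
  have hfin : ∀ (s : Finset ℕ) (S : ℕ → Set X), M (⋃ i ∈ s, S i) ≤ ∑ i ∈ s, M (S i) := by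
    intro s S
    induction s using Finset.induction_on with
    | empty =>
      have : M (∅ : Set X) = 0 := tendsto_nhds_unique (hM ∅) (by simp)
      simp [this]
    | insert i s hi ih =>
      rw [Finset.set_biUnion_insert, Finset.sum_insert hi]
      exact (hsub _ _).trans (by linarith)
  set T : ℕ → Set X := fun N => ((⋃ J ∈ Finset.range N, (W J (K J))ᶜ) ∪ V2 N)ᶜ with hT
  have hTne : ∀ N, (T N).Nonempty := by
    intro N
    set WN := W N (K N)
    have h0 : δ ≤ M WN := (hMB N).trans (hmono _ _ (by
      intro x hx
      simp only [WN, hW, mem_iUnion, Finset.mem_Ico]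
      exact ⟨N, ⟨le_rfl, hKJ N⟩, hx⟩))
    have h1 : M (⋃ J ∈ Finset.range N, (WN \ W J (K J))) ≤ δ / 4 := ((hfin _ _).trans (sum_le_sum fun J hJ =>
        hdiff J N (by rw [Finset.mem_range] at hJ; omega))).trans (hgeo N)
    have h2 : M (V2 N) ≤ δ / 4 := ((hfin _ _).trans (sum_le_sum fun a _ => (hfin _ _).trans
        ((sum_le_sum fun k _ => hMR a k).trans (hk0 a N)))).trans (hgeo N)
    have h3 : WN ⊆ ((⋃ J ∈ Finset.range N, (WN \ W J (K J))) ∪ V2 N) ∪ T N := by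
      intro x hx
      by_cases hxT : x ∈ T N
      · exact Or.inr hxT
      · left
        simp only [hT, mem_compl_iff, not_not] at hxT
        rcases hxT with h | h
        · left
          simp only [mem_iUnion] at h ⊢
          obtain ⟨J, hJ, h⟩ := h
          exact ⟨J, hJ, hx, h⟩
        · exact Or.inr h
    have h4 := (hmono _ _ h3).trans ((hsub _ _).trans (add_le_add_left (hsub _ _) _))
    exact hpos _ (by linarith)
  have hTanti : Antitone T := by
    intro N N' h
    simp only [hT]
    refine compl_subset_compl.2 (union_subset_union ?_ ?_)
    · exact biUnion_subset_biUnion_left (by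
        intro a ha; simp at ha ⊢; omega)
    · intro x hx
      simp only [hV2, mem_iUnion, Finset.mem_range, Finset.mem_Ico] at hx ⊢
      obtain ⟨a, ha, k, ⟨hk1, hk2⟩, hx⟩ := hx
      exact ⟨a, by omega, k, ⟨hk1, by omega⟩, hx⟩
  have hne : (⨅ N, 𝓟 (T N)).NeBot := by
    refine iInf_neBot_of_directed' (directed_of_isDirected_le ?_) fun N => ?_
    · intro i j hij; exact principal_mono.2 (hTanti hij)
    · exact principal_neBot_iff.2 (hTne N)
  have hTU : ∀ N, T N ∈ Ultrafilter.of (⨅ N, 𝓟 (T N)) := fun N =>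
    Ultrafilter.of_le _ (mem_iInf_of_mem N (mem_principal_self _))
  refine ⟨Ultrafilter.of (⨅ N, 𝓟 (T N)), fun a => ?_, ?_⟩
  · filter_upwards [eventually_ge_atTop (k0 a)] with k hk
    refine mem_of_superset (hTU (max a k + 1)) ?_
    intro x hx hxR
    refine hx (Or.inr ?_)
    simp only [hV2, mem_iUnion, Finset.mem_range, Finset.mem_Ico]
    exact ⟨a, by omega, k, ⟨hk, by omega⟩, hxR⟩
  · rw [frequently_atTop]
    intro J
    have h1 : W J (K J) ∈ Ultrafilter.of (⨅ N, 𝓟 (T N)) := by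
      refine mem_of_superset (hTU (J+1)) ?_
      intro x hx
      by_contra hcon
      refine hx (Or.inl ?_)
      simp only [mem_iUnion, Finset.mem_range]
      exact ⟨J, by omega, hcon⟩
    have h2 := (Ultrafilter.finite_biUnion_mem_iff (Finset.finite_toSet (Finset.Ico J (K J)))).1 h1
    obtain ⟨j, hj, hjU⟩ := h2
    exact ⟨j, by simpa using (Finset.mem_Ico.1 hj).1, hjU⟩
theorem selection {α : Type*} [Countable α] [Nonempty α] (ν : ℕ → Measure X)
 [∀ n, IsFiniteMeasure (ν n)] {C : ℝ}
 (hC : ∀ n, (ν n).real univ ≤ C) {B : ℕ → Set X} (hBm : ∀ j, MeasurableSet (B j)) {δ : ℝ}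
 (hδ : 0 < δ) (hB : ∀ j, ∀ᶠ n in atTop, δ ≤ (ν n).real (B j))
 {R : α → ℕ → Set X} {ε : α → ℕ → ℝ}
 (hR : ∀ a k, ∀ᶠ n in atTop, (ν n).real (R a k) ≤ ε a k) (hε : ∀ a, Summable (ε a)) :
 ∃ U : Ultrafilter X, (∀ a, ∀ᶠ k in atTop, (R a k)ᶜ ∈ U) ∧ ∃ᶠ j in atTop, B j ∈ U := by
  obtain ⟨g, hg⟩ := exists_surjective_nat α
  obtain ⟨U, h1, h2⟩ := selection_nat ν hC hBm hδ hB (R := fun a => R (g a))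
    (ε := fun a => ε (g a)) (fun a k => hR _ _) (fun a => hε _)
  refine ⟨U, fun a => ?_, h2⟩
  obtain ⟨a', rfl⟩ := hg a
  exact h1 a'
end Select
section AbsU
lemma summable_aux {E : Type*} [NormedAddCommGroup E] {e : ℕ → E} {c : ℝ}
 (h : ∀ k, ‖e k‖ ≤ c * (1/16)^k) : Summable fun k => √‖e k‖ := by
  refine Summable.of_nonneg_of_le (fun k => Real.sqrt_nonneg _) (fun k => ?_)
    ((summable_geometric_of_lt_one (r := (1/4:ℝ)) (by norm_num) (by norm_num)).mul_left (√c))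
  refine (Real.sqrt_le_sqrt (h k)).trans (le_of_eq ?_)
  have e1 : (1/16:ℝ)^k = ((1/4)^k)^2 := by rw [← pow_mul, mul_comm, pow_mul]; norm_num
  rcases le_total 0 c with hc | hc
  · rw [Real.sqrt_mul hc, e1, Real.sqrt_sq (by positivity)]
  · rw [Real.sqrt_eq_zero_of_nonpos hc, zero_mul, Real.sqrt_eq_zero_of_nonpos]
    exact mul_nonpos_of_nonpos_of_nonneg hc (by positivity)
variable {X : Type*} [MeasurableSpace X] {E : Type*} [NormedAddCommGroup E] [NormedSpace ℝ E]
  {ι : Type*} [Fintype ι]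
theorem absU (ν : ℕ → Measure X) [∀ n, IsFiniteMeasure (ν n)] {C : ℝ}
 (hC : ∀ n, (ν n).real univ ≤ C) (u : ℕ → E →ₗ[ℝ] (X → ℝ))
 (F2 : ∀ j, ∃ K, ∀ n f, (ν n).real {x | 1 < |u j f x|} ≤ K * √‖f‖)
 {v : ι → E} {G : Set E} (hG : Dense G)
 (hmult : ∀ g ∈ G, ∃ p : ι → X → ℝ, (∃ c, ∀ i x, |p i x| ≤ c) ∧ ∀ j, ∀ᶠ n in atTop,
 ∀ᵐ x ∂(ν n), u j g x = ∑ i, p i x * u j (v i) x)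
 {B : ℕ → Set X} (hBm : ∀ j, MeasurableSet (B j)) {δ : ℝ}
 (hδ : 0 < δ) (hB : ∀ j, ∀ᶠ n in atTop, δ ≤ (ν n).real (B j))
 {α β γ : Type} [Countable α] [Countable β] [Countable γ] [Nonempty γ]
 {h : α → ℕ → E} (hh : ∀ a, Summable fun k => √‖h a k‖)
 {R : β → ℕ → Set X} {ε : β → ℕ → ℝ}
 (hR : ∀ a k, ∀ᶠ n in atTop, (ν n).real (R a k) ≤ ε a k) (hε : ∀ a, Summable (ε a))
 (η : γ → E) :
 ∃ U : Ultrafilter X, (∀ j a, ∀ᶠ k in atTop, ∀ᶠ x in (U : Filter X), |u j (h a k) x| ≤ 1) ∧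
 (∀ a, ∀ᶠ k in atTop, ∀ᶠ x in (U : Filter X), x ∉ R a k) ∧
 (∃ᶠ j in atTop, ∀ᶠ x in (U : Filter X), x ∈ B j) ∧
 ∃ (η' : γ → ℕ → ℝ) (v' : ι → ℕ → ℝ),
 (∀ c j, Tendsto (u j (η c)) U (nhds (η' c j))) ∧
 (∀ i j, Tendsto (u j (v i)) U (nhds (v' i j))) ∧
 ∀ c, η' c ∈ Submodule.span ℝ (range v') := by
  classical
  choose K hK using F2
  have hg : ∀ c (k : ℕ), ∃ g ∈ G, ‖η c - g‖ ≤ (1/32)^k := by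
    intro c k
    have := Metric.mem_closure_iff.1 (hG (η c)) ((1/32)^k) (by positivity)
    obtain ⟨g, hg, hd⟩ := this
    exact ⟨g, hg, by rw [← dist_eq_norm]; exact hd.le⟩
  choose g hgG hgd using hg
  choose p hpb hp using fun c k => hmult (g c k) (hgG c k)
  obtain ⟨e, he⟩ := Countable.exists_injective_nat ι
  haveI : Countable ι := inferInstance
  set h' : α ⊕ (γ ⊕ (Fin (Fintype.card ι) ⊕ γ)) → ℕ → E := fun a k => match a with
    | .inl a => h a k
    | .inr (.inl c) => ((1/16:ℝ)^k) • η c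
    | .inr (.inr (.inl i)) => ((1/16:ℝ)^k) • v ((Fintype.equivFin ι).symm i)
    | .inr (.inr (.inr c)) => ((2:ℝ)^k) • (η c - g c k) with hh'
  have hh'S : ∀ a, Summable fun k => √‖h' a k‖ := by
    rintro (a | c | i | c)
    · exact hh a
    · refine summable_aux (c := ‖η c‖) fun k => ?_
      simp only [hh']
      rw [norm_smul, Real.norm_of_nonneg (by positivity), mul_comm]
    · refine summable_aux (c := ‖v ((Fintype.equivFin ι).symm i)‖) fun k => ?_
      simp only [hh']
      rw [norm_smul, Real.norm_of_nonneg (by positivity), mul_comm]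
    · refine summable_aux (c := 1) fun k => ?_
      simp only [hh']
      rw [norm_smul, Real.norm_of_nonneg (by positivity), one_mul]
      calc (2:ℝ)^k * ‖η c - g c k‖ ≤ 2^k * (1/32)^k := by gcongr; exact hgd c k
        _ = (1/16)^k := by rw [← mul_pow]; norm_num
  set R' : (ℕ × (α ⊕ (γ ⊕ (Fin (Fintype.card ι) ⊕ γ)))) ⊕ (β ⊕ (γ × ℕ × ℕ)) → ℕ → Set X := fun a k => match a with
    | .inl q => {x | 1 < |u q.1 (h' q.2 k) x|}
    | .inr (.inl b) => R b k
    | .inr (.inr q) => {x | u q.2.2 (g q.1 q.2.1) x ≠ ∑ i, p q.1 q.2.1 i x * u q.2.2 (v i) x}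
    with hR'
  set ε' : (ℕ × (α ⊕ (γ ⊕ (Fin (Fintype.card ι) ⊕ γ)))) ⊕ (β ⊕ (γ × ℕ × ℕ)) → ℕ → ℝ := fun a k => match a with
    | .inl q => K q.1 * √‖h' q.2 k‖
    | .inr (.inl b) => ε b k
    | .inr (.inr q) => 0 with hε'
  obtain ⟨c0⟩ := (inferInstance : Nonempty γ)
  haveI : Nonempty ((ℕ × (α ⊕ (γ ⊕ (Fin (Fintype.card ι) ⊕ γ)))) ⊕ (β ⊕ (γ × ℕ × ℕ))) := ⟨.inr (.inr (c0, 0, 0))⟩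
  obtain ⟨U, hU1, hU2⟩ := selection ν hC hBm hδ hB (R := R') (ε := ε') (by
      rintro (q | b | q) k
      · exact Eventually.of_forall fun n => hK _ _ _
      · exact hR b k
      · filter_upwards [hp q.1 q.2.1 q.2.2] with n hn
        simp only [hR', hε']
        rw [ae_iff] at hn
        rw [measureReal_def, hn]; simp) (by
      rintro (q | b | q)
      · exact (hh'S q.2).mul_left _
      · exact hε b
      · exact summable_zero)
  have hUh : ∀ j a, ∀ᶠ k in atTop, ∀ᶠ x in (U : Filter X), |u j (h' a k) x| ≤ 1 := by
    intro j a
    filter_upwards [hU1 (.inl (j, a))] with k hk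
    filter_upwards [hk] with x hx
    simpa [hR'] using hx
  have hUp : ∀ c k j, ∀ᶠ x in (U : Filter X), u j (g c k) x = ∑ i, p c k i x * u j (v i) x := by
    intro c k j
    obtain ⟨k', hk'⟩ := (hU1 (.inr (.inr (c, k, j)))).exists
    filter_upwards [hk'] with x hx
    simpa [hR'] using hx
  have hbdd : ∀ j a (f : E), (∀ k, h' a k = ((1/16:ℝ)^k) • f) → ∃ l, Tendsto (u j f) U (nhds l) := by
    intro j a f hf
    obtain ⟨k, hk⟩ := (hUh j a).exists
    refine ultra_lim U (C := 16^k) ?_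
    filter_upwards [hk] with x hx
    rw [hf, map_smul, Pi.smul_apply, smul_eq_mul, abs_mul, abs_of_pos (by positivity)] at hx
    have h16 : (0:ℝ) < 16^k := by positivity
    calc |u j f x| = 16^k * ((1/16)^k * |u j f x|) := by
          rw [← mul_assoc, ← mul_pow]; norm_num
      _ ≤ 16^k * 1 := by gcongr
      _ = _ := mul_one _
  choose η' hη' using fun c j => hbdd j (.inr (.inl c)) (η c) (fun k => rfl)
  have hv : ∀ i j, ∃ l, Tendsto (u j (v i)) U (nhds l) := fun i j =>
    hbdd j (.inr (.inr (.inl (Fintype.equivFin ι i)))) (v i) (fun k => by simp [hh'])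
  choose v' hv' using hv
  refine ⟨U, fun j a => hUh j (.inl a), fun b => ?_, hU2, η', v', hη', hv', fun c => ?_⟩
  · filter_upwards [hU1 (.inr (.inl b))] with k hk using hk
  · have hcl : IsClosed (Submodule.span ℝ (range v') : Set (ℕ → ℝ)) := haveI : FiniteDimensional ℝ (Submodule.span ℝ (range v')) := FiniteDimensional.span_of_finite ℝ (finite_range v')
      Submodule.closed_of_finiteDimensional _
    have hpl : ∀ k i, ∃ l, Tendsto (p c k i) U (nhds l) := fun k i => by
      obtain ⟨c', hc'⟩ := hpb c k
      exact ultra_lim U (Eventually.of_forall (hc' i))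
    choose p' hp' using hpl
    refine hcl.mem_of_tendsto (f := fun k => ∑ i, p' k i • v' i) (b := atTop) ?_
      (Eventually.of_forall fun k => Submodule.sum_mem _ fun i _ =>
        Submodule.smul_mem _ _ (Submodule.subset_span ⟨i, rfl⟩))
    rw [tendsto_pi_nhds]
    intro j
    have hlim : ∀ k, Tendsto (u j (g c k)) U (nhds ((∑ i, p' k i • v' i) j)) := by
      intro k
      have : Tendsto (fun x => ∑ i, p c k i x * u j (v i) x) U (nhds (∑ i, p' k i * v' i j)) := tendsto_finsetSum _ fun i _ => (hp' k i).mul (hv' i j)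
      simp only [Finset.sum_apply, Pi.smul_apply, smul_eq_mul]
      refine this.congr' ?_
      filter_upwards [hUp c k j] with x hx using hx.symm
    rw [tendsto_iff_dist_tendsto_zero]
    refine squeeze_zero' (Eventually.of_forall fun _ => dist_nonneg) ?_
      (tendsto_pow_atTop_nhds_zero_of_lt_one (r := (1/2:ℝ)) (by norm_num) (by norm_num))
    filter_upwards [hUh j (.inr (.inr (.inr c)))] with k hk
    rw [dist_comm, Real.dist_eq]
    refine le_of_tendsto (((hη' c j).sub (hlim k)).abs) ?_
    filter_upwards [hk] with x hx
    simp only [hh', map_smul, map_sub, Pi.smul_apply, Pi.sub_apply, smul_eq_mul, abs_mul] at hx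
    rw [abs_of_pos (by positivity)] at hx
    calc |u j (η c) x - u j (g c k) x|
        = (1/2)^k * (2^k * |u j (η c) x - u j (g c k) x|) := by
          rw [← mul_assoc, ← mul_pow]; norm_num
      _ ≤ (1/2)^k * 1 := by gcongr
      _ = _ := mul_one _
theorem absB (ν : ℕ → Measure X) [∀ n, IsFiniteMeasure (ν n)] {C : ℝ}
 (hC : ∀ n, (ν n).real univ ≤ C) (u : ℕ → E →ₗ[ℝ] (X → ℝ)) (hum : ∀ j f, Measurable (u j f))
 (F2 : ∀ j, ∃ K, ∀ n f, (ν n).real {x | 1 < |u j f x|} ≤ K * √‖f‖)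
 {v : ι → E} {G : Set E} (hG : Dense G)
 (hmult : ∀ g ∈ G, ∃ p : ι → X → ℝ, (∃ c, ∀ i x, |p i x| ≤ c) ∧ ∀ j, ∀ᶠ n in atTop,
 ∀ᵐ x ∂(ν n), u j g x = ∑ i, p i x * u j (v i) x)
 (hv : ∀ i, ∀ ρ > 0, ∀ᶠ k in atTop, ∀ᶠ n in atTop, (ν n).real {x | ρ < |u k (v i) x|} ≤ ρ)
 (η : E) {δ : ℝ} (hδ : 0 < δ) :
 ∀ᶠ k in atTop, ∃ᶠ n in atTop, (ν n).real {x | δ < |u k η x|} < δ := by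
  classical
  by_contra hcon
  rw [not_eventually] at hcon
  have hcon' : ∃ᶠ k in atTop, ∀ᶠ n in atTop, δ ≤ (ν n).real {x | δ < |u k η x|} := hcon.mono fun k hk => by simpa [not_frequently] using hk
  have hsub : ∀ N : ℕ, ∃ k, (∀ᶠ n in atTop, δ ≤ (ν n).real {x | δ < |u k η x|}) ∧
      ∀ i, ∀ᶠ n in atTop, (ν n).real {x | (1/2:ℝ)^N < |u k (v i) x|} ≤ (1/2)^N := by
    intro N
    have h1 : ∀ᶠ k in atTop, ∀ i, ∀ᶠ n in atTop,
        (ν n).real {x | (1/2:ℝ)^N < |u k (v i) x|} ≤ (1/2)^N := eventually_all.2 fun i => hv i _ (by positivity)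
    exact (hcon'.and_eventually h1).exists
  choose s hs1 hs2 using hsub
  have hms : ∀ j f, MeasurableSet {x | δ < |u j f x|} := fun j f =>
    measurableSet_lt measurable_const (hum j f).abs
  obtain ⟨U, hU1, hU2, hU3, η', v', hη', hv', hmem⟩ := absU ν hC (fun j => u (s j))
    (fun j => F2 (s j)) hG (v := v)
    (fun g hg => by
      obtain ⟨p, hp, hp2⟩ := hmult g hg
      exact ⟨p, hp, fun j => hp2 (s j)⟩)
    (B := fun j => {x | δ < |u (s j) η x|}) (fun j => hms _ _) hδ hs1
    (α := Empty) (β := Fin (Fintype.card ι)) (γ := Unit) (h := fun a => a.elim) (fun a => a.elim)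
    (R := fun i N => {x | (1/2:ℝ)^N < |u (s N) (v ((Fintype.equivFin ι).symm i)) x|})
    (ε := fun i N => (1/2)^N) (fun i N => hs2 N _) (fun i => summable_geometric_two)
    (fun _ => η)
  have hv0 : ∀ i, Tendsto (v' i) atTop (nhds 0) := by
    intro i
    refine squeeze_zero_norm' ?_
      (tendsto_pow_atTop_nhds_zero_of_lt_one (r := (1/2:ℝ)) (by norm_num) (by norm_num))
    filter_upwards [hU2 (Fintype.equivFin ι i)] with N hN
    rw [norm_eq_abs]
    refine le_of_tendsto (hv' i N).abs ?_
    filter_upwards [hN] with x hx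
    simpa using hx
  have hall : ∀ wv ∈ Submodule.span ℝ (range v'), Tendsto wv atTop (nhds 0) := by
    intro wv hwv
    induction hwv using Submodule.span_induction with
    | mem wv hwv => obtain ⟨i, rfl⟩ := hwv; exact hv0 i
    | zero => exact tendsto_const_nhds
    | add wv wv' _ _ h1 h2 =>
      have h3 := h1.add h2
      rw [add_zero] at h3
      exact h3
    | smul a wv _ h1 =>
      have h3 := h1.const_mul a
      rw [mul_zero] at h3
      exact h3
  have h0 := (hall _ (hmem ())).abs
  rw [abs_zero] at h0
  have h1 : ∀ᶠ j in atTop, |η' () j| < δ := h0.eventually_lt_const hδ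
  obtain ⟨j, hj1, hj2⟩ := (hU3.and_eventually h1).exists
  have : δ ≤ |η' () j| := ge_of_tendsto (hη' () j).abs (by
    filter_upwards [hj1] with x hx using le_of_lt hx)
  linarith
end AbsU
section AbsA
lemma analytic_of_hasSum {a : ℕ → ℝ} {g : ℝ → ℝ}
 (h : ∀ y : ℝ, |y| < 1 → HasSum (fun k => y^k * a k) (g y)) :
 AnalyticOnNhd ℝ g (Ioo (-1) 1) := by
  have hr : (1:ℝ≥0∞) ≤ (FormalMultilinearSeries.ofScalars ℝ a).radius := by
    refine ENNReal.le_of_forall_nnreal_lt fun r hr => ?_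
    refine FormalMultilinearSeries.le_radius_of_summable_norm _ ?_
    have h1 : Summable fun k => ‖(r:ℝ)^k * a k‖ := by
      refine (h r ?_).summable.norm
      rw [abs_of_nonneg r.coe_nonneg]; exact_mod_cast hr
    refine Summable.of_nonneg_of_le (fun k => by positivity) (fun k => ?_) h1
    rw [norm_mul, norm_pow, Real.norm_of_nonneg r.coe_nonneg, mul_comm]
    gcongr
    rw [FormalMultilinearSeries.ofScalars_norm]
  have hB : HasFPowerSeriesOnBall g (FormalMultilinearSeries.ofScalars ℝ a) 0 1 := by
    refine ⟨hr, by simp, fun {y} hy => ?_⟩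
    have hy' : |y| < 1 := by
      have : ‖y‖ₑ < 1 := by simpa [Metric.mem_eball, edist_zero_right] using hy
      rw [← ofReal_norm, ENNReal.ofReal_lt_one] at this
      simpa using this
    rw [zero_add]
    rw [FormalMultilinearSeries.ofScalars_apply_eq']
    simp_rw [smul_eq_mul, mul_comm (a _)]
    exact h y hy'
  intro y hy
  refine hB.analyticAt_of_mem ?_
  rw [Metric.mem_eball, edist_zero_right, ← ofReal_norm, ENNReal.ofReal_lt_one]
  simpa [abs_lt] using hy
theorem absLin {ι : Type*} [Fintype ι] {v : ι → ℕ → ℝ} {b : ℕ → ι → ℕ → ℝ} {Fn : ι → ℝ → ℕ → ℝ}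
 (hb : ∀ k i, b k i ∈ Submodule.span ℝ (range v))
 (hF : ∀ i y j, |y| < 1 → HasSum (fun k => y^k * b k i j) (Fn i y j))
 {y : ℕ → ℝ} (hy : ∀ k, |y k| < 1) (hlim : ∀ i j, Tendsto (fun k => Fn i (y k) j) atTop (nhds (v i j)))
 {S : Set ℝ} (hS : S.Infinite) (hS1 : S ⊆ Icc 0 (1/4)) :
 ∃ x ∈ S, ∀ wv ∈ Submodule.span ℝ (range v), wv ∈ Submodule.span ℝ (range fun i => Fn i x) := by
  classical
  set V := Submodule.span ℝ (range v) with hV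
  have : FiniteDimensional ℝ V := FiniteDimensional.span_of_finite ℝ (finite_range v)
  have hcl : IsClosed (V : Set (ℕ → ℝ)) := Submodule.closed_of_finiteDimensional _
  have hFs : ∀ i y, |y| < 1 → HasSum (fun k => y^k • b k i) (Fn i y) := fun i y hy =>
    Pi.hasSum.2 fun j => by simpa using hF i y j hy
  have hFV : ∀ i y, |y| < 1 → Fn i y ∈ V := fun i y hy =>
    hcl.mem_of_tendsto (hFs i y hy) (Eventually.of_forall fun s =>
      Submodule.sum_mem _ fun k _ => Submodule.smul_mem _ _ (hb k i))
  set v' : ι → V := fun i => ⟨v i, Submodule.subset_span ⟨i, rfl⟩⟩ with hv'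
  set b' : ℕ → ι → V := fun k i => ⟨b k i, hb k i⟩ with hb'
  set F' : ι → ℝ → V := fun i y => if h : |y| < 1 then ⟨Fn i y, hFV i y h⟩ else 0 with hF'
  have hF'e : ∀ i y, |y| < 1 → (F' i y : ℕ → ℝ) = Fn i y := fun i y h => by simp [hF', h]
  have hF's : ∀ i y, |y| < 1 → HasSum (fun k => y^k • b' k i) (F' i y) := fun i y h => by
    have hind : Topology.IsInducing (V.subtype) := Topology.IsInducing.subtypeVal
    rw [← hind.hasSum_iff]
    have e1 : V.subtype (F' i y) = Fn i y := hF'e i y h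
    rw [e1]
    exact hFs i y h
  have hF'lim : ∀ i, Tendsto (fun k => F' i (y k)) atTop (nhds (v' i)) := fun i => by
    rw [tendsto_subtype_rng, tendsto_pi_nhds]
    intro j
    refine (hlim i j).congr fun k => ?_
    rw [hF'e i _ (hy k)]
  set A1 : (ι → ℝ) →ₗ[ℝ] V := Fintype.linearCombination ℝ v' with hA1
  have hA1s : LinearMap.range A1 = ⊤ := by
    rw [hA1, Fintype.range_linearCombination]
    have : range v' = (Subtype.val ⁻¹' (range v) : Set V) := by
      ext wv; constructor
      · rintro ⟨i, rfl⟩; exact ⟨i, rfl⟩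
      · rintro ⟨i, hi⟩; exact ⟨i, Subtype.ext hi⟩
    rw [this]; exact Submodule.span_span_coe_preimage
  obtain ⟨s, hs⟩ := A1.exists_rightInverse_of_surjective hA1s
  set bs := Module.finBasis ℝ V with hbs
  set Mt : ℝ → Matrix (Fin (Module.finrank ℝ V)) (Fin (Module.finrank ℝ V)) ℝ := fun y =>
    LinearMap.toMatrix bs bs ((Fintype.linearCombination ℝ fun i => F' i y) ∘ₗ s) with hMt
  have hMe : ∀ y k l, Mt y k l = ∑ i, s (bs l) i * (bs.coord k) (F' i y) := by
    intro y k l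
    simp [hMt, LinearMap.toMatrix_apply, Fintype.linearCombination_apply]
  have hcont : ∀ k, Continuous (bs.coord k) := fun k => LinearMap.continuous_of_finiteDimensional _
  have hentry : ∀ k l, AnalyticOnNhd ℝ (fun y => Mt y k l) (Ioo (-1) 1) := by
    intro k l
    simp_rw [hMe]
    refine Finset.analyticOnNhd_fun_sum _ fun i _ => ?_
    refine analyticOnNhd_const.mul (analytic_of_hasSum (a := fun n => bs.coord k (b' n i)) ?_)
    intro y hy
    have := (hF's i y hy).map (bs.coord k) (hcont k)
    convert this using 2
    simp
  have hdet : AnalyticOnNhd ℝ (fun y => (Mt y).det) (Ioo (-1) 1) := by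
    simp_rw [Matrix.det_apply']
    refine Finset.analyticOnNhd_fun_sum _ fun σ _ => ?_
    exact analyticOnNhd_const.mul (Finset.analyticOnNhd_fun_prod _ fun i _ => hentry _ _)
  have hdetlim : Tendsto (fun k => (Mt (y k)).det) atTop (nhds 1) := by
    have h1 : Tendsto (fun k => Mt (y k)) atTop (nhds (LinearMap.toMatrix bs bs (A1 ∘ₗ s))) := by
      refine tendsto_pi_nhds.2 fun k => tendsto_pi_nhds.2 fun l => ?_
      simp_rw [hMe]
      have e1 : LinearMap.toMatrix bs bs (A1 ∘ₗ s) k l = ∑ i, s (bs l) i * (bs.coord k) (v' i) := by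
        simp [hA1, LinearMap.toMatrix_apply, Fintype.linearCombination_apply]
      rw [e1]
      exact tendsto_finsetSum _ fun i _ => (((hcont k).tendsto _).comp (hF'lim i)).const_mul _
    rw [hs, LinearMap.toMatrix_id] at h1
    have h2 := (Continuous.matrix_det continuous_id).tendsto
      (1 : Matrix (Fin (Module.finrank ℝ V)) (Fin (Module.finrank ℝ V)) ℝ)
    simp only [id, Matrix.det_one] at h2
    exact h2.comp h1
  have hex : ∃ x ∈ S, (Mt x).det ≠ 0 := by
    by_contra hcon
    push Not at hcon
    obtain ⟨z, hz, hacc⟩ := hS.exists_accPt_of_subset_isCompact isCompact_Icc hS1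
    rw [accPt_iff_frequently_nhdsNE] at hacc
    have hz' : z ∈ Ioo (-1:ℝ) 1 := ⟨by linarith [hz.1], by linarith [hz.2]⟩
    have h0 := hdet.eqOn_zero_of_preconnected_of_frequently_eq_zero isPreconnected_Ioo hz'
      (hacc.mono fun x hx => hcon x hx)
    have h1 : Tendsto (fun k => (Mt (y k)).det) atTop (nhds 0) := by
      refine tendsto_const_nhds.congr fun k => ?_
      exact (h0 (abs_lt.1 (hy k))).symm
    exact zero_ne_one (tendsto_nhds_unique h1 hdetlim)
  obtain ⟨x, hx, hdx⟩ := hex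
  have hx1 : |x| < 1 := by
    have := hS1 hx
    rw [abs_lt]; constructor <;> linarith [this.1, this.2]
  refine ⟨x, hx, fun wv hwv => ?_⟩
  have hunit : IsUnit (LinearMap.det ((Fintype.linearCombination ℝ fun i => F' i x) ∘ₗ s)) := by
    rw [← LinearMap.det_toMatrix bs]
    exact isUnit_iff_ne_zero.2 hdx
  have hsurj : LinearMap.range ((Fintype.linearCombination ℝ fun i => F' i x) ∘ₗ s) = ⊤ := by
    have := LinearMap.range_eq_top.2 (LinearEquiv.ofIsUnitDet (f := (Fintype.linearCombination ℝ fun i => F' i x) ∘ₗ s) (v := bs) (v' := bs) hdx.isUnit).surjective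
    exact this
  obtain ⟨q, hq⟩ := LinearMap.range_eq_top.1 hsurj ⟨wv, hwv⟩
  have hq' := congrArg Subtype.val hq
  simp only [LinearMap.comp_apply, Fintype.linearCombination_apply, Submodule.coe_sum,
    Submodule.coe_smul] at hq'
  rw [← hq']
  refine Submodule.sum_mem _ fun i _ => Submodule.smul_mem _ _ ?_
  rw [hF'e i x hx1]
  exact Submodule.subset_span ⟨i, rfl⟩
end AbsA
section AbsA2
variable {X : Type*} [MeasurableSpace X] {E : Type*} [NormedAddCommGroup E] [NormedSpace ℝ E]
theorem absA {r : ℕ} (ν : ℕ → Measure X) [∀ n, IsFiniteMeasure (ν n)] {C : ℝ}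
 (hC : ∀ n, (ν n).real univ ≤ C) (u : ℕ → E →ₗ[ℝ] (X → ℝ)) (hum : ∀ j f, Measurable (u j f))
 (F2 : ∀ j, ∃ K, ∀ n f, (ν n).real {x | 1 < |u j f x|} ≤ K * √‖f‖)
 {v : Fin r → E} {G : Set E} (hG : Dense G)
 (hmult : ∀ g ∈ G, ∃ p : Fin r → X → ℝ, (∃ c, ∀ i x, |p i x| ≤ c) ∧ ∀ j, ∀ᶠ n in atTop,
 ∀ᵐ x ∂(ν n), u j g x = ∑ i, p i x * u j (v i) x)
 {b : ℕ → Fin r → E} {c : ℝ} (hb : ∀ k i, ‖b k i‖ ≤ c)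
 {Ξ : Fin r → ℝ → E} (hΞ : ∀ i y, 0 ≤ y → y < 1 → HasSum (fun k => y^k • b k i) (Ξ i y))
 (hΞ1 : ∀ i, Tendsto (Ξ i) (nhdsWithin 1 (Iio 1)) (nhds (v i)))
 {x : ℕ → ℝ} (hx : Function.Injective x) (hx0 : ∀ j, 0 ≤ x j) (hx1 : ∀ j, x j ≤ 1/4)
 (hz : ∀ j i, ∀ᶠ n in atTop, ∀ᵐ z ∂(ν n), u j (Ξ i (x j)) z = 0)
 {f : E} {δ : ℝ} (hδ : 0 < δ)
 (hB : ∀ j, ∀ᶠ n in atTop, δ ≤ (ν n).real {z | δ < |u j f z|}) : False := by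
  classical
  have hc0 : 0 ≤ c ∨ r = 0 := by
    rcases Nat.eq_zero_or_pos r with h | h
    · exact Or.inr h
    · exact Or.inl ((norm_nonneg _).trans (hb 0 ⟨0, h⟩))
  have hyex : ∀ k : ℕ, ∃ y : ℝ, 0 ≤ y ∧ y < 1 ∧ ∀ i, ‖Ξ i y - v i‖ ≤ (1/32)^k := by
    intro k
    have h1 : ∀ᶠ y in nhdsWithin (1:ℝ) (Iio 1), ∀ i, ‖Ξ i y - v i‖ ≤ (1/32)^k := by
      refine eventually_all.2 fun i => ?_
      have := Metric.tendsto_nhds.1 (hΞ1 i) ((1/32)^k) (by positivity)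
      filter_upwards [this] with y hy
      rw [← dist_eq_norm]; exact hy.le
    have h2 : ∀ᶠ y in nhdsWithin (1:ℝ) (Iio 1), 0 < y := (eventually_gt_nhds (show (0:ℝ) < 1 by norm_num)).filter_mono nhdsWithin_le_nhds
    have h3 : ∀ᶠ y in nhdsWithin (1:ℝ) (Iio 1), y < 1 := self_mem_nhdsWithin
    obtain ⟨y, h1, h2, h3⟩ := (h1.and (h2.and h3)).exists
    exact ⟨y, h2.le, h3, h1⟩
  choose y hy0 hy1 hyv using hyex
  set yy : ℕ ⊕ ℕ → ℝ := Sum.elim x y with hyy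
  have hyy0 : ∀ q, 0 ≤ yy q := by rintro (q | q); exacts [hx0 q, hy0 q]
  have hyy1 : ∀ q, yy q < 1 := by rintro (q | q); exacts [by have := hx1 q; simp [hyy]; linarith, hy1 q]
  have hKex : ∀ i q (k : ℕ), ∃ K, k ≤ K ∧ ‖Ξ i (yy q) - ∑ l ∈ Finset.range K, (yy q)^l • b l i‖ ≤ (1/32)^k := by
    intro i q k
    have h1 := (hΞ i (yy q) (hyy0 q) (hyy1 q)).tendsto_sum_nat
    have h2 := (Metric.tendsto_nhds.1 h1 ((1/32)^k) (by positivity)).and (eventually_ge_atTop k)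
    obtain ⟨K, h3, h4⟩ := h2.exists
    exact ⟨K, h4, by rw [← dist_eq_norm, dist_comm]; exact h3.le⟩
  choose K hKk hK using hKex
  set h : Fin r ⊕ ((Fin r × (ℕ ⊕ ℕ)) ⊕ Fin r) → ℕ → E := fun a k => match a with
    | .inl i => (((k:ℝ)+1)^4)⁻¹ • b k i
    | .inr (.inl q) => (2:ℝ)^k • (Ξ q.1 (yy q.2) - ∑ l ∈ Finset.range (K q.1 q.2 k), (yy q.2)^l • b l q.1)
    | .inr (.inr i) => (2:ℝ)^k • (Ξ i (y k) - v i) with hh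
  have h2pow : ∀ (k : ℕ) (e : E), ‖e‖ ≤ (1/32)^k → ‖(2:ℝ)^k • e‖ ≤ 1 * (1/16)^k := by
    intro k e he
    rw [norm_smul, Real.norm_of_nonneg (by positivity), one_mul]
    calc (2:ℝ)^k * ‖e‖ ≤ 2^k * (1/32)^k := by gcongr
        _ = (1/16)^k := by rw [← mul_pow]; norm_num
  have hhS : ∀ a, Summable fun k => √‖h a k‖ := by
    rintro (i | q | i)
    · have hs : Summable fun k : ℕ => √c * (((k:ℝ)+1)^2)⁻¹ := by
        refine Summable.mul_left _ ?_
        have := (summable_nat_add_iff 1).2 (Real.summable_nat_pow_inv.2 (show 1 < 2 by norm_num))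
        simpa using this
      refine Summable.of_nonneg_of_le (fun k => Real.sqrt_nonneg _) (fun k => ?_) hs
      simp only [hh]
      have hc : 0 ≤ c := (norm_nonneg _).trans (hb 0 i)
      rw [norm_smul, Real.norm_of_nonneg (by positivity), mul_comm, Real.sqrt_mul (norm_nonneg _)]
      gcongr
      · exact hb k i
      · rw [show (((k:ℝ)+1)^4)⁻¹ = ((((k:ℝ)+1)^2)⁻¹)^2 by rw [inv_pow, ← pow_mul],
          Real.sqrt_sq (by positivity)]
    · exact summable_aux fun k => h2pow k _ (hK _ _ _)
    · exact summable_aux fun k => h2pow k _ (hyv k i)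
  obtain ⟨U, hU1, hU2, hU3, η', v', hη', hv', hmem⟩ := absU ν hC u F2 hG (v := v) hmult
    (B := fun j => {z | δ < |u j f z|}) (fun j => measurableSet_lt measurable_const (hum j f).abs)
    hδ hB (h := h) hhS (β := ℕ × Fin r) (γ := Option (ℕ × Fin r))
    (R := fun q _ => {z | u q.1 (Ξ q.2 (x q.1)) z ≠ 0}) (ε := fun _ _ => 0)
    (fun q _ => by
      filter_upwards [hz q.1 q.2] with n hn
      rw [ae_iff] at hn
      rw [measureReal_def, hn]; simp) (fun _ => summable_zero)
    (fun q => match q with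
      | none => f
      | some q => b q.1 q.2)
  set b' : ℕ → Fin r → ℕ → ℝ := fun k i => η' (some (k, i)) with hb'
  have hbt : ∀ k i j, Tendsto (u j (b k i)) U (nhds (b' k i j)) := fun k i j => hη' (some (k, i)) j
  have hgrow : ∀ i j, ∀ᶠ k : ℕ in atTop, |b' k i j| ≤ ((k:ℝ)+1)^4 := by
    intro i j
    filter_upwards [hU1 j (.inl i)] with k hk
    refine le_of_tendsto (hbt k i j).abs ?_
    filter_upwards [hk] with z hz
    simp only [hh, map_smul, Pi.smul_apply, smul_eq_mul, abs_mul] at hz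
    rwa [abs_of_pos (by positivity), inv_mul_le_iff₀ (by positivity), mul_one] at hz
  have hsum : ∀ i j (t : ℝ), |t| < 1 → Summable fun k => t^k * b' k i j := by
    intro i j t ht
    have h1 : Summable fun k : ℕ => ((k:ℝ)+1)^4 * |t|^k := by
      have h0 := summable_pow_mul_geometric_of_norm_lt_one (R := ℝ) 4 (r := |t|) (by simpa using ht)
      have := (summable_nat_add_iff 1).2 h0
      rcases eq_or_ne t 0 with rfl | h
      · refine summable_of_ne_finset_zero (s := {0}) fun k hk => ?_
        have : k ≠ 0 := by simpa using hk
        simp [this]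
      · refine (this.mul_left |t|⁻¹).congr fun k => ?_
        have : |t| ≠ 0 := by simpa using h
        push_cast; field_simp; ring
    refine Summable.of_norm_bounded_eventually_nat h1 ?_
    filter_upwards [hgrow i j] with k hk
    rw [norm_mul, norm_pow, norm_eq_abs, norm_eq_abs, mul_comm]
    gcongr
  set Fn : Fin r → ℝ → ℕ → ℝ := fun i t j => ∑' k, t^k * b' k i j with hFn
  have hF : ∀ i t j, |t| < 1 → HasSum (fun k => t^k * b' k i j) (Fn i t j) := fun i t j ht =>
    (hsum i j t ht).hasSum
  have habs : ∀ q, |yy q| < 1 := fun q => by rw [abs_of_nonneg (hyy0 q)]; exact hyy1 q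
  have hΞt : ∀ i q j, Tendsto (u j (Ξ i (yy q))) U (nhds (Fn i (yy q) j)) := by
    intro i q j
    rw [Metric.tendsto_nhds]
    intro ε hε
    have hKt : Tendsto (K i q) atTop atTop := tendsto_atTop_mono (hKk i q) tendsto_id
    have h1 := ((hF i (yy q) j (habs q)).tendsto_sum_nat.comp hKt)
    have h2 := Metric.tendsto_nhds.1 h1 (ε/3) (by positivity)
    have h3 : ∀ᶠ k : ℕ in atTop, (1/2:ℝ)^k < ε/3 := (tendsto_pow_atTop_nhds_zero_of_lt_one (r := (1/2:ℝ)) (by norm_num)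
        (by norm_num)).eventually_lt_const (by positivity)
    obtain ⟨k, hk1, hk2, hk3⟩ := ((hU1 j (.inr (.inl (i, q)))).and (h2.and h3)).exists
    have h4 : Tendsto (fun z => ∑ l ∈ Finset.range (K i q k), (yy q)^l * u j (b l i) z) U
        (nhds (∑ l ∈ Finset.range (K i q k), (yy q)^l * b' l i j)) := tendsto_finsetSum _ fun l _ => (hbt l i j).const_mul _
    have h5 := Metric.tendsto_nhds.1 h4 (ε/3) (by positivity)
    filter_upwards [h5, hk1] with z hz5 hz1
    simp only [hh, map_smul, map_sub, map_sum, Pi.smul_apply, Pi.sub_apply, Finset.sum_apply,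
      smul_eq_mul, abs_mul] at hz1
    rw [abs_of_pos (by positivity)] at hz1
    set s1 := ∑ l ∈ Finset.range (K i q k), (yy q)^l * u j (b l i) z
    have h6 : |u j (Ξ i (yy q)) z - s1| ≤ (1/2)^k := by
      calc |u j (Ξ i (yy q)) z - s1|
          = (1/2)^k * (2^k * |u j (Ξ i (yy q)) z - s1|) := by
            rw [← mul_assoc, ← mul_pow]; norm_num
        _ ≤ (1/2)^k * 1 := by gcongr
        _ = _ := mul_one _
    simp only [Function.comp_apply, Real.dist_eq] at hk2 hz5 ⊢
    have h7 := abs_sub_le (u j (Ξ i (yy q)) z) s1 (Fn i (yy q) j)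
    have h8 := abs_sub_le s1 (∑ l ∈ Finset.range (K i q k), (yy q)^l * b' l i j) (Fn i (yy q) j)
    linarith
  have hlim : ∀ i j, Tendsto (fun k => Fn i (y k) j) atTop (nhds (v' i j)) := by
    intro i j
    rw [tendsto_iff_dist_tendsto_zero]
    refine squeeze_zero' (Eventually.of_forall fun _ => dist_nonneg) ?_
      (tendsto_pow_atTop_nhds_zero_of_lt_one (r := (1/2:ℝ)) (by norm_num) (by norm_num))
    filter_upwards [hU1 j (.inr (.inr i))] with k hk
    rw [Real.dist_eq]
    refine le_of_tendsto (((hΞt i (.inr k) j).sub (hv' i j)).abs) ?_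
    filter_upwards [hk] with z hz
    simp only [hh, map_smul, map_sub, Pi.smul_apply, Pi.sub_apply, smul_eq_mul, abs_mul] at hz
    rw [abs_of_pos (by positivity)] at hz
    simp only [hyy, Sum.elim_inr]
    calc |u j (Ξ i (y k)) z - u j (v i) z|
        = (1/2)^k * (2^k * |u j (Ξ i (y k)) z - u j (v i) z|) := by
          rw [← mul_assoc, ← mul_pow]; norm_num
      _ ≤ (1/2)^k * 1 := by gcongr
      _ = _ := mul_one _
  have hJ : {j | ∀ᶠ z in (U : Filter X), z ∈ {z | δ < |u j f z|}}.Infinite := Nat.frequently_atTop_iff_infinite.1 hU3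
  obtain ⟨_, ⟨j, hj, rfl⟩, hspan⟩ := absLin (v := v') (b := b') (Fn := Fn)
    (fun k i => hmem (some (k, i))) hF (y := y) (fun k => habs (.inr k)) hlim
    (hJ.image hx.injOn) (by rintro _ ⟨j, -, rfl⟩; exact ⟨hx0 j, hx1 j⟩)
  have hzero : ∀ wv ∈ Submodule.span ℝ (range fun i => Fn i (x j)), wv j = 0 := by
    intro wv hwv
    induction hwv using Submodule.span_induction with
    | mem wv hwv =>
      obtain ⟨i, rfl⟩ := hwv
      refine tendsto_nhds_unique (hΞt i (.inl j) j) ?_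
      obtain ⟨k, hk⟩ := (hU2 (j, i)).exists
      refine tendsto_const_nhds.congr' ?_
      filter_upwards [hk] with z hz
      simpa [eq_comm, hyy] using hz
    | zero => rfl
    | add wv wv' _ _ h1 h2 => simp [h1, h2]
    | smul a wv _ h1 => simp [h1]
  have h0 := hzero _ (hspan _ (hmem none))
  have : δ ≤ |η' none j| := ge_of_tendsto (hη' none j).abs (by
    filter_upwards [hj] with z hz using le_of_lt hz)
  rw [h0, abs_zero] at this
  linarith
end AbsA2
section WD
variable {Ω : Type*} {m : MeasurableSpace Ω} {P : Measure Ω}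
def wd (P : Measure Ω) (ρ : Ω → ℝ) : Measure Ω := P.withDensity (fun w => ENNReal.ofReal (ρ w))
lemma wd_int {ρ : Ω → ℝ} (hρ : Measurable ρ) (h0 : ∀ w, 0 ≤ ρ w) (g : Ω → ℝ) :
 ∫ w, g w ∂(wd P ρ) = ∫ w, ρ w * g w ∂P := by
  unfold wd
  rw [integral_withDensity_eq_integral_toReal_smul hρ.ennreal_ofReal (ae_of_all _ fun _ => ENNReal.ofReal_lt_top)]
  congr 1; ext w; simp [ENNReal.toReal_ofReal (h0 w)]
lemma wd_itg {ρ : Ω → ℝ} (hρ : Measurable ρ) (h0 : ∀ w, 0 ≤ ρ w) {g : Ω → ℝ} :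
 Integrable g (wd P ρ) ↔ Integrable (fun w => ρ w * g w) P := by
  unfold wd
  rw [integrable_withDensity_iff_integrable_smul' hρ.ennreal_ofReal (ae_of_all _ fun _ => ENNReal.ofReal_lt_top)]
  refine integrable_congr (ae_of_all _ fun w => ?_)
  simp [ENNReal.toReal_ofReal (h0 w)]
lemma wd_ac (ρ : Ω → ℝ) : wd P ρ ≪ P := withDensity_absolutelyContinuous _ _
lemma wd_ac' {ρ : Ω → ℝ} (hρ : Measurable ρ) (h0 : ∀ w, 0 < ρ w) : P ≪ wd P ρ := withDensity_absolutelyContinuous' hρ.ennreal_ofReal.aemeasurable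
    (ae_of_all _ fun w => by simpa using h0 w)
lemma wd_one : wd P (fun _ => 1) = P := by
  unfold wd; simp
lemma wd_real {ρ : Ω → ℝ} (hρ : Measurable ρ) (h0 : ∀ w, 0 ≤ ρ w) {A : Set Ω} (hA : MeasurableSet A)
 [IsFiniteMeasure (wd P ρ)] :
 (wd P ρ).real A = ∫ w, ρ w * ind A w ∂P := by
  rw [← int_ind (wd P ρ) hA, wd_int hρ h0]
end WD
section Level
variable {Ω : Type*} {m : MeasurableSpace Ω} {P : Measure Ω} [IsPr P]
  {O : Filtration ℕ m}
def dm (O : Filtration ℕ m) (Q : Measure Ω) (L : Ω → ℝ) (i : ℕ) : Ω → ℝ := fun w => (Q[L | O (i+1)]) w - (Q[L | O i]) w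
def hb (O : Filtration ℕ m) (P Q : Measure Ω) (L f : Ω → ℝ) (i : ℕ) : Ω → ℝ := P[fun w => dm O Q L i w * f w | O i]
def wb (O : Filtration ℕ m) (P : Measure Ω) (D : Ω → ℝ) (i : ℕ) : Ω → ℝ := P[fun w => (dm O P D i w)^2 | O i]
lemma ce_abs {Q : Measure Ω} [IsFiniteMeasure Q] {L : Ω → ℝ} {c : ℝ} (hc : 0 ≤ c)
 (hb : ∀ᵐ w ∂Q, |L w| ≤ c) (G : MeasurableSpace Ω) : ∀ᵐ w ∂Q, |(Q[L | G]) w| ≤ c := by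
  exact ae_bdd_abs_condExp_of_ae_bdd_abs hb
lemma dm_abs {Q : Measure Ω} [IsFiniteMeasure Q] {L : Ω → ℝ} {c : ℝ} (hc : 0 ≤ c)
 (hb : ∀ᵐ w ∂Q, |L w| ≤ c) (i : ℕ) : ∀ᵐ w ∂Q, |dm O Q L i w| ≤ 2 * c := by
  filter_upwards [ce_abs hc hb (O i), ce_abs hc hb (O (i+1))] with w h1 h2
  unfold dm
  have := abs_sub ((Q[L | O (i+1)]) w) ((Q[L | O i]) w)
  linarith
lemma dm_sm (Q : Measure Ω) (L : Ω → ℝ) (i : ℕ) : StronglyMeasurable[O (i+1)] (dm O Q L i) := stronglyMeasurable_condExp.sub (stronglyMeasurable_condExp.mono (O.mono (Nat.le_succ i)))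
lemma dm_aesm (R Q : Measure Ω) (L : Ω → ℝ) (i : ℕ) : AEStronglyMeasurable (dm O Q L i) R := ((dm_sm Q L i).mono (O.le _)).aestronglyMeasurable
lemma dm_orth {Q : Measure Ω} [IsPr Q] (L : Ω → ℝ) {φ : Ω → ℝ} {i : ℕ}
 (hφ : StronglyMeasurable[O i] φ)
 (hi : Integrable (fun w => φ w * (Q[L|O (i+1)]) w) Q) :
 ∫ w, φ w * dm O Q L i w ∂Q = 0 := by
  have hM : Martingale (fun i => Q[L|O i]) O Q := martingale_condExp L O Q
  have h1 := mg_int hM (Nat.le_succ i) hφ hi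
  have h2 := mg_int_int hM (Nat.le_succ i) hφ hi
  unfold dm
  simp_rw [mul_sub]
  rw [integral_sub hi h2]
  exact sub_eq_zero.2 h1
lemma wb_int {D : Ω → ℝ} (hD : ∀ᵐ w ∂P, |D w| ≤ 1) (i : ℕ) :
 Integrable (fun w => (dm O P D i w)^2) P := int_bdd (c := 4) ((dm_aesm P P D i).pow 2) (by
    filter_upwards [dm_abs (O := O) zero_le_one hD i] with w h
    rw [abs_of_nonneg (sq_nonneg _), ← sq_abs]
    nlinarith [abs_nonneg (dm O P D i w)])
lemma energy_D {D : Ω → ℝ} (hD : ∀ᵐ w ∂P, |D w| ≤ 1) (N : ℕ) :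
 ∑ i ∈ Finset.range N, ∫ w, (dm O P D i w)^2 ∂P ≤ 1 := by
  have := energy_one (martingale_condExp D O P) (c := 1)
    (fun i => ce_abs zero_le_one hD (O i)) N
  simpa [dm] using this
lemma mass_compl {D : Ω → ℝ} (hD : ∀ᵐ w ∂P, |D w| ≤ 1) {A : ℕ → Set Ω}
 (hA : ∀ i, MeasurableSet[O i] (A i)) (hanti : Antitone A) (N : ℕ) :
 ∑ i ∈ Finset.range N, ∫ w, ind (A i)ᶜ w * (dm O P D i w)^2 ∂P ≤ P.real (A N)ᶜ := by
  have hM := energy_inc (martingale_condExp D O P) (c := 1)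
    (fun i => ce_abs zero_le_one hD (O i)) (E := fun i => (A i)ᶜ) (fun i => (hA i).compl)
    (fun i j h => compl_subset_compl.2 (hanti h)) N
  refine hM.trans ?_
  rw [← int_ind P ((O.le N _ (hA N)).compl)]
  have hs : AEStronglyMeasurable (ind (A N)ᶜ) P := aesm_of (O.le N) (ind_sm (hA N).compl)
  refine integral_mono_ae ?_ (int_bdd (c := 1) hs (ae_of_all _ (ind_abs _))) ?_
  · refine int_bdd (c := 1) (hs.mul ((aesm_of (O.le N) stronglyMeasurable_condExp).pow 2)) ?_
    filter_upwards [ce_abs zero_le_one hD (O N)] with w h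
    rw [abs_mul, abs_pow]
    exact mul_le_one₀ (ind_abs _ _) (by positivity) (pow_le_one₀ (abs_nonneg _) h)
  · filter_upwards [ce_abs zero_le_one hD (O N)] with w h
    refine mul_le_of_le_one_right (ind_nn _ _) ?_
    rw [← sq_abs]; exact pow_le_one₀ (abs_nonneg _) h
def Tset (O : Filtration ℕ m) (P Q : Measure Ω) (L f D : Ω → ℝ) (i : ℕ) : Set Ω :=
  {w | wb O P D i w < |hb O P Q L f i w|}
lemma Tset_meas (Q : Measure Ω) (L f D : Ω → ℝ) (i : ℕ) :
 MeasurableSet[O i] (Tset O P Q L f D i) := @measurableSet_lt _ _ _ _ _ (O i) _ _ _ _ _ stronglyMeasurable_condExp.measurable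
    (continuous_abs.measurable.comp stronglyMeasurable_condExp.measurable)
theorem F2_level {ρ : Ω → ℝ} (hρ : Measurable ρ) {κ : ℝ} (hκ : 0 < κ) (hρ1 : ∀ w, κ⁻¹ ≤ ρ w)
 (hρ2 : ∀ w, ρ w ≤ κ) [IsPr (wd P ρ)]
 {L D f : Ω → ℝ} (hLm : Measurable L) {c : ℝ} (hc : 0 < c) (hL : ∀ w, |L w| ≤ c)
 (hD : ∀ᵐ w ∂P, |D w| ≤ 1) (hf : Integrable f P) (N : ℕ) :
 ∑ i ∈ Finset.range N, ∫ w, ind (Tset O P (wd P ρ) L f D i) w * (dm O P D i w)^2 ∂P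
 ≤ (6 * c + κ + 1) * √(∫ w, |f w| ∂P) := by
  set Q := wd P ρ with hQ
  set T := Tset O P Q L f D with hT
  have hρpos : ∀ w, 0 < ρ w := fun w => (inv_pos.2 hκ).trans_le (hρ1 w)
  have hρ0 : ∀ w, 0 ≤ ρ w := fun w => (hρpos w).le
  have hPQ : P ≪ Q := wd_ac' hρ hρpos
  have hQP : Q ≪ P := wd_ac ρ
  set e := ∫ w, |f w| ∂P with he
  have he0 : 0 ≤ e := integral_nonneg fun _ => abs_nonneg _
  have hTm : ∀ i, MeasurableSet[O i] (T i) := fun i => Tset_meas Q L f D i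
  have hTm' : ∀ i, MeasurableSet (T i) := fun i => O.le i _ (hTm i)
  have hwvi := fun i => wb_int (O := O) hD i
  have htriv : ∑ i ∈ Finset.range N, ∫ w, ind (T i) w * (dm O P D i w)^2 ∂P ≤ 1 := by
    refine (sum_le_sum fun i _ => integral_mono (int_indm (hTm' i) (hwvi i)) (hwvi i)
      fun w => ?_).trans (energy_D hD N)
    exact mul_le_of_le_one_left (sq_nonneg _) (ind_le_one _ _)
  rcases lt_or_ge 1 e with h1e | h1e
  · refine htriv.trans ?_
    have : 1 ≤ √e := Real.one_le_sqrt.2 h1e.le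
    nlinarith
  set F : Ω → ℝ := fun w => (ρ w)⁻¹ * f w with hF
  have hFi : Integrable F Q := by
    rw [hQ, wd_itg hρ hρ0]
    refine hf.congr (ae_of_all _ fun w => ?_)
    simp only [hF]; rw [← mul_assoc, mul_inv_cancel₀ (hρpos w).ne', one_mul]
  set Fp : Ω → ℝ := fun w => max (F w) 0 with hFp
  set Fm : Ω → ℝ := fun w => max (-F w) 0 with hFm
  have hFpi : Integrable Fp Q := hFi.pos_part
  have hFmi : Integrable Fm Q := hFi.neg_part
  set Xp : ℕ → Ω → ℝ := fun i => Q[Fp | O i] with hXp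
  set Xm : ℕ → Ω → ℝ := fun i => Q[Fm | O i] with hXm
  have hXpM : Martingale Xp O Q := martingale_condExp _ _ _
  have hXmM : Martingale Xm O Q := martingale_condExp _ _ _
  have hXp0 : ∀ i, 0 ≤ᵐ[Q] Xp i := fun i => condExp_nonneg (ae_of_all _ fun w => le_max_right _ _)
  have hXm0 : ∀ i, 0 ≤ᵐ[Q] Xm i := fun i => condExp_nonneg (ae_of_all _ fun w => le_max_right _ _)
  have heQ : ∫ w, (Xp 0 w + Xm 0 w) ∂Q = e := by
    rw [integral_add (hXpM.integrable 0) (hXmM.integrable 0)]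
    simp only [hXp, hXm]
    rw [integral_condExp (O.le 0), integral_condExp (O.le 0), ← integral_add hFpi hFmi, hQ,
      wd_int hρ hρ0, he]
    congr 1; ext w
    simp only [hFp, hFm]
    have : max (F w) 0 + max (-F w) 0 = |F w| := by
      rcases le_total 0 (F w) with h | h
      · rw [max_eq_left h, max_eq_right (by linarith), abs_of_nonneg h, add_zero]
      · rw [max_eq_right h, max_eq_left (by linarith), abs_of_nonpos h, zero_add]
    rw [this, hF, abs_mul, abs_of_pos (inv_pos.2 (hρpos w)), ← mul_assoc,
      mul_inv_cancel₀ (hρpos w).ne', one_mul]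
  set Y : ℕ → Ω → ℝ := fun i w => Xp i w + Xm i w with hY
  have hYM : Martingale Y O Q := hXpM.add hXmM
  set A := stay Y 1 with hA
  have hAm : ∀ i, MeasurableSet[O i] (A i) := fun i => stay_meas (fun i => hYM.1 i) 1 i
  have hAm' : ∀ i, MeasurableSet (A i) := fun i => O.le i _ (hAm i)
  have hmass : ∑ i ∈ Finset.range N, ∫ w, ind (A i)ᶜ w * (dm O P D i w)^2 ∂P ≤ κ * e := by
    refine (mass_compl hD hAm (stay_anti Y 1) N).trans ?_
    have h1 := maximal_stay hYM (fun i => by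
      filter_upwards [hXp0 i, hXm0 i] with w h1 h2
      exact add_nonneg h1 h2) (c := 1) N
    rw [one_mul, heQ, hQ, wd_real hρ hρ0 (hAm' N).compl] at h1
    have h2 : P.real (A N)ᶜ ≤ κ * ∫ w, ρ w * ind (A N)ᶜ w ∂P := by
      rw [← int_ind P (hAm' N).compl, ← integral_const_mul]
      have hs : AEStronglyMeasurable (ind (A N)ᶜ) P := (ind_sm (hAm' N).compl).aestronglyMeasurable
      refine integral_mono (int_bdd (c := 1) hs (ae_of_all _ (ind_abs _))) ?_ fun w => ?_
      · refine Integrable.const_mul ?_ _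
        refine int_bdd (c := κ) (hρ.aestronglyMeasurable.mul hs) (ae_of_all _ fun w => ?_)
        rw [abs_mul, abs_of_pos (hρpos w)]
        exact (mul_le_of_le_one_right (hρ0 w) (ind_abs _ _)).trans (hρ2 w)
      · have : 1 ≤ κ * ρ w := by
          have := hρ1 w
          rwa [inv_le_iff_one_le_mul₀' hκ] at this
        have h0 := ind_nn (A N)ᶜ w
        dsimp only
        nlinarith
    refine h2.trans ?_
    gcongr
  set sg : ℕ → Ω → ℝ := fun i w => if 0 ≤ hb O P Q L f i w then 1 else -1 with hsg
  have hsgm : ∀ i, StronglyMeasurable[O i] (sg i) := fun i => by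
    refine StronglyMeasurable.ite ?_ stronglyMeasurable_const stronglyMeasurable_const
    exact @measurableSet_le _ _ _ _ _ (O i) _ _ _ _ _ measurable_const
      stronglyMeasurable_condExp.measurable
  set φ : ℕ → Ω → ℝ := fun i w => ind (T i) w * sg i w with hφ
  have hsgb : ∀ i w, |sg i w| ≤ 1 := fun i w => by simp only [hsg]; split_ifs <;> simp
  have hφm : ∀ i, StronglyMeasurable[O i] (φ i) := fun i => (ind_sm (hTm i)).mul (hsgm i)
  have hφb : ∀ i w, |φ i w| ≤ 1 := fun i w => by
    simp only [hφ, abs_mul]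
    exact mul_le_one₀ (ind_abs _ _) (abs_nonneg _) (hsgb i w)
  have hLi : Integrable L Q := int_bdd (c := c) hLm.aestronglyMeasurable (ae_of_all _ hL)
  set Lc : ℕ → Ω → ℝ := fun i => Q[fun w => c⁻¹ * L w | O i] with hLc
  have hLcM : Martingale Lc O Q := martingale_condExp _ _ _
  have hLcb : ∀ i, ∀ᵐ w ∂Q, |Lc i w| ≤ 1 := fun i => ce_abs zero_le_one
    (ae_of_all _ fun w => by
      rw [abs_mul, abs_of_pos (inv_pos.2 hc)]
      calc c⁻¹ * |L w| ≤ c⁻¹ * c := by gcongr; exact hL w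
        _ = 1 := inv_mul_cancel₀ hc.ne') _
  have hLce : ∀ i, ∀ᵐ w ∂Q, Lc i w = c⁻¹ * (Q[L|O i]) w := fun i => by
    have := condExp_smul (μ := Q) c⁻¹ L (O i)
    filter_upwards [this] with w h
    simpa [hLc, Pi.smul_def] using h
  have hcore := weak_core hLcM hLcb hXpM hXp0 hXmM hXm0 hφm hφb heQ N
  have hterm : ∀ i, ∫ w, ind (A i) w * φ i w * (Lc (i+1) w - Lc i w) *
      ((Xp (i+1) w - Xm (i+1) w) - (Xp i w - Xm i w)) ∂Q
      = c⁻¹ * ∫ w, (ind (A i) w * φ i w) * (dm O Q L i w * f w) ∂P := by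
    intro i
    set θ : Ω → ℝ := fun w => ind (A i) w * φ i w with hθ
    have hθm : StronglyMeasurable[O i] θ := (ind_sm (hAm i)).mul (hφm i)
    have hθb : ∀ w, |θ w| ≤ 1 := fun w => by
      simp only [hθ, abs_mul]
      exact mul_le_one₀ (ind_abs _ _) (abs_nonneg _) (hφb i w)
    have hdb := dm_abs (O := O) (Q := Q) hc.le (ae_of_all _ hL) i
    have hθd : StronglyMeasurable[O (i+1)] (fun w => θ w * dm O Q L i w) := (hθm.mono (O.mono (Nat.le_succ i))).mul (dm_sm Q L i)
    have hθdb : ∀ᵐ w ∂Q, |θ w * dm O Q L i w| ≤ 2 * c := by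
      filter_upwards [hdb] with w h
      rw [abs_mul]
      calc _ ≤ 1 * (2*c) := mul_le_mul (hθb w) h (abs_nonneg _) zero_le_one
        _ = _ := one_mul _
    set Fi : ℕ → Ω → ℝ := fun i w => Xp i w - Xm i w with hFi'
    have hFiM : Martingale Fi O Q := hXpM.sub hXmM
    have hitg : ∀ {g : Ω → ℝ}, Integrable g Q → Integrable (fun w => (θ w * dm O Q L i w) * g w) Q := fun hg => int_mul (aesm_of (O.le (i+1)) hθd) hθdb hg
    have h1 : ∫ w, ind (A i) w * φ i w * (Lc (i+1) w - Lc i w) *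
      ((Xp (i+1) w - Xm (i+1) w) - (Xp i w - Xm i w)) ∂Q
        = c⁻¹ * (∫ w, (θ w * dm O Q L i w) * Fi (i+1) w ∂Q
          - ∫ w, (θ w * dm O Q L i w) * Fi i w ∂Q) := by
      rw [← integral_sub (hitg (hFiM.integrable _)) (hitg (hFiM.integrable _)),
        ← integral_const_mul]
      refine integral_congr_ae ?_
      filter_upwards [hLce i, hLce (i+1)] with w e1 e2
      rw [e1, e2]
      simp only [hθ, dm, hFi']
      ring
    have h2 : ∫ w, (θ w * dm O Q L i w) * Fi i w ∂Q = 0 := by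
      have hm : StronglyMeasurable[O i] (fun w => θ w * Fi i w) := hθm.mul (hFiM.1 i)
      have hi : Integrable (fun w => (θ w * Fi i w) * (Q[L|O (i+1)]) w) Q := by
        have := int_mul (Q := Q) (φ := fun w => θ w * (Q[L|O (i+1)]) w) (c := c)
          ((aesm_of (O.le i) hθm).mul (aesm_of (O.le (i+1)) stronglyMeasurable_condExp))
          (by
            filter_upwards [ce_abs hc.le (ae_of_all Q hL) (O (i+1))] with w h
            rw [abs_mul]
            calc _ ≤ 1 * c := mul_le_mul (hθb w) h (abs_nonneg _) zero_le_one
              _ = _ := one_mul _) (hFiM.integrable i)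
        refine this.congr (ae_of_all _ fun w => ?_)
        simp only; ring
      have := dm_orth L hm hi
      rw [← this]
      congr 1; ext w; ring
    have h3 : ∫ w, (θ w * dm O Q L i w) * Fi (i+1) w ∂Q = ∫ w, (θ w * dm O Q L i w) * F w ∂Q := by
      rw [← pull (O.le (i+1)) hθd (hitg hFi) hFi]
      refine integral_congr_ae ?_
      have h4 : Q[F | O (i+1)] =ᵐ[Q] Q[Fp | O (i+1)] - Q[Fm | O (i+1)] := by
        refine (condExp_congr_ae (ae_of_all _ fun w => ?_)).trans (condExp_sub hFpi hFmi _)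
        simp only [hFp, hFm, Pi.sub_apply]
        rcases le_total 0 (F w) with h | h
        · rw [max_eq_left h, max_eq_right (by linarith), sub_zero]
        · rw [max_eq_right h, max_eq_left (by linarith)]; ring
      filter_upwards [h4] with w h
      rw [h]; rfl
    rw [h1, h2, h3, sub_zero, hQ, wd_int hρ hρ0]
    congr 2; ext w
    simp only [hF]
    have := (hρpos w).ne'
    simp only [hθ]
    field_simp
  have hdbP : ∀ i, ∀ᵐ w ∂P, |dm O Q L i w| ≤ 2 * c := fun i =>
    hPQ.ae_le (dm_abs (O := O) (Q := Q) hc.le (ae_of_all _ hL) i)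
  have hdf : ∀ i, Integrable (fun w => dm O Q L i w * f w) P := fun i =>
    int_mul (dm_aesm P Q L i) (hdbP i) hf
  have hlow : ∀ i, ∫ w, ind (A i) w * (ind (T i) w * (dm O P D i w)^2) ∂P
      ≤ ∫ w, (ind (A i) w * φ i w) * (dm O Q L i w * f w) ∂P := by
    intro i
    have hθm : StronglyMeasurable[O i] (fun w => ind (A i) w * φ i w) := (ind_sm (hAm i)).mul (hφm i)
    have hθb : ∀ w, |ind (A i) w * φ i w| ≤ 1 := fun w => by
      simp only [abs_mul]
      exact mul_le_one₀ (ind_abs _ _) (abs_nonneg _) (hφb i w)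
    have hATm : StronglyMeasurable[O i] (fun w => ind (A i) w * ind (T i) w) := (ind_sm (hAm i)).mul (ind_sm (hTm i))
    have hATb : ∀ w, |ind (A i) w * ind (T i) w| ≤ 1 := fun w => by
      rw [abs_mul]; exact mul_le_one₀ (ind_abs _ _) (abs_nonneg _) (ind_abs _ _)
    have i1 : Integrable (fun w => (ind (A i) w * φ i w) * (dm O Q L i w * f w)) P := int_mul (aesm_of (O.le i) hθm) (ae_of_all _ hθb) (hdf i)
    have i2 : Integrable (fun w => (ind (A i) w * ind (T i) w) * (dm O P D i w)^2) P := int_mul (aesm_of (O.le i) hATm) (ae_of_all _ hATb) (hwvi i)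
    simp_rw [← mul_assoc (ind (A i) _) (ind (T i) _)]
    rw [← pull (O.le i) hθm i1 (hdf i), ← pull (O.le i) hATm i2 (hwvi i)]
    refine integral_mono (pull_int hATm i2 (hwvi i)) (pull_int hθm i1 (hdf i)) fun w => ?_
    simp only [hφ]
    by_cases h : w ∈ T i
    · have e1 : sg i w * hb O P Q L f i w = |hb O P Q L f i w| := by
        simp only [hsg]; split_ifs with h0
        · rw [one_mul, abs_of_nonneg h0]
        · rw [abs_of_neg (not_le.1 h0)]; ring
      have e2 : wb O P D i w < |hb O P Q L f i w| := h
      rw [ind_mem h, one_mul, mul_one, mul_assoc]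
      refine mul_left_le ?_ (ind_nn _ _)
      change wb O P D i w ≤ sg i w * hb O P Q L f i w
      rw [e1]; exact e2.le
    · simp [ind_nmem h]
  have hmain : ∑ i ∈ Finset.range N, ∫ w, ind (A i) w * (ind (T i) w * (dm O P D i w)^2) ∂P
      ≤ c * (2 * √e + 4 * e) := by
    refine (sum_le_sum fun i _ => hlow i).trans ?_
    rw [sum_congr rfl fun i _ => hterm i, ← mul_sum] at hcore
    have := (le_abs_self _).trans hcore
    rwa [inv_mul_le_iff₀ hc] at this
  have hfin : ∑ i ∈ Finset.range N, ∫ w, ind (T i) w * (dm O P D i w)^2 ∂P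
      ≤ ∑ i ∈ Finset.range N, ∫ w, ind (A i) w * (ind (T i) w * (dm O P D i w)^2) ∂P
        + ∑ i ∈ Finset.range N, ∫ w, ind (A i)ᶜ w * (dm O P D i w)^2 ∂P := by
    rw [← sum_add_distrib]
    refine sum_le_sum fun i _ => ?_
    have j1 := int_indm (hTm' i) (hwvi i)
    rw [← integral_add (int_indm (hAm' i) j1) (int_indm (hAm' i).compl (hwvi i))]
    refine integral_mono j1 ((int_indm (hAm' i) j1).add
      (int_indm (hAm' i).compl (hwvi i))) fun w => ?_
    have := sq_nonneg (dm O P D i w)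
    by_cases h : w ∈ A i
    · simp [ind_mem h, ind_nmem (show w ∉ (A i)ᶜ from fun h' => h' h)]
    · simp only [Pi.add_apply, ind_nmem h, ind_mem (show w ∈ (A i)ᶜ from h), zero_mul, one_mul, zero_add]
      exact mul_le_of_le_one_left this (ind_le_one _ _)
  have hee : e ≤ √e := by
    have h1 := Real.sq_sqrt he0
    have h2 : √e ≤ 1 := Real.sqrt_le_one.2 h1e
    nlinarith [Real.sqrt_nonneg e]
  have hs0 := Real.sqrt_nonneg e
  calc _ ≤ c * (2 * √e + 4 * e) + κ * e := hfin.trans (add_le_add hmain hmass)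
    _ ≤ c * (2 * √e + 4 * √e) + κ * √e := by gcongr
    _ ≤ _ := by nlinarith
end Level
section System
variable {Ω : Type*} {m : MeasurableSpace Ω} {P : Measure Ω} [IsPr P]
  {I : ℕ → Filtration ℕ m}
def nuD (I : ℕ → Filtration ℕ m) (P : Measure Ω) (D : Ω → ℝ) (n : ℕ) : Measure (ℕ × ℕ × Ω) := ∑ i ∈ Finset.range (2^n), (wd P (fun w => (dm (I n) P D i w)^2)).map (fun w => (n, i, w))
lemma meas_ni (n i : ℕ) : Measurable (fun w : Ω => (n, i, w)) := by fun_prop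
lemma dm_meas {O : Filtration ℕ m} (Q : Measure Ω) (L : Ω → ℝ) (i : ℕ) : Measurable (dm O Q L i) := ((dm_sm Q L i).mono (O.le _)).measurable
lemma wd_fin {ρ : Ω → ℝ} (h : Integrable ρ P) : IsFiniteMeasure (wd P ρ) := by
  unfold wd
  exact isFiniteMeasure_withDensity_ofReal h.2
lemma nuD_fin {D : Ω → ℝ} (hD : ∀ᵐ w ∂P, |D w| ≤ 1) (n : ℕ) : IsFiniteMeasure (nuD I P D n) := by
  unfold nuD
  have : ∀ i, IsFiniteMeasure ((wd P (fun w => (dm (I n) P D i w)^2)).map (fun w => (n, i, w))) := by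
    intro i
    have := wd_fin (wb_int (O := I n) hD i)
    infer_instance
  infer_instance
lemma nuD_real {D : Ω → ℝ} (hD : ∀ᵐ w ∂P, |D w| ≤ 1) (n : ℕ) {S : Set (ℕ × ℕ × Ω)}
 (hS : MeasurableSet S) :
 (nuD I P D n).real S = ∑ i ∈ Finset.range (2^n),
 ∫ w, ind {w | (n, i, w) ∈ S} w * (dm (I n) P D i w)^2 ∂P := by
  have hf : ∀ i, IsFiniteMeasure (wd P (fun w => (dm (I n) P D i w)^2)) := fun i => wd_fin (wb_int (O := I n) hD i)
  unfold nuD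
  rw [Measure.real, Measure.finsetSum_apply, ENNReal.toReal_sum]
  · refine sum_congr rfl fun i _ => ?_
    rw [Measure.map_apply (meas_ni n i) hS]
    change (wd P (fun w => (dm (I n) P D i w)^2)).real _ = _
    rw [wd_real ((dm_meas P D i).pow_const 2) (fun w => sq_nonneg _) (meas_ni n i hS)]
    congr 1; ext w; rw [mul_comm]; rfl
  · intro i _
    exact measure_ne_top _ _
lemma nuD_ae {D : Ω → ℝ} (n : ℕ) {f g : ℕ × ℕ × Ω → ℝ} (hf : Measurable f) (hg : Measurable g)
 (h : ∀ i < 2^n, ∀ᵐ w ∂P, f (n, i, w) = g (n, i, w)) : ∀ᵐ x ∂(nuD I P D n), f x = g x := by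
  unfold nuD
  rw [ae_iff, Measure.finsetSum_apply, sum_eq_zero]
  intro i hi
  rw [← ae_iff, ae_map_iff (meas_ni n i).aemeasurable (measurableSet_eq_fun hf hg)]
  exact (wd_ac _).ae_le (h i (Finset.mem_range.1 hi))
lemma nuD_mass {D : Ω → ℝ} (hD : ∀ᵐ w ∂P, |D w| ≤ 1) (n : ℕ) :
 (nuD I P D n).real univ ≤ 1 := by
  rw [nuD_real hD n MeasurableSet.univ]
  refine le_trans (le_of_eq ?_) (energy_D (O := I n) hD (2^n))
  refine sum_congr rfl fun i _ => ?_
  congr 1; ext w; simp [ind]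
lemma meas_X {f : ℕ × ℕ × Ω → ℝ} (h : ∀ n i, Measurable (fun w => f (n, i, w))) : Measurable f := measurable_from_prod_countable_right fun n => measurable_from_prod_countable_right fun i => h n i
lemma hamel {V : Type*} [AddCommGroup V] [Module ℝ V] (U0 : V → ℕ → ℕ → Ω → ℝ)
 (hm : ∀ f n i, Measurable (U0 f n i))
 (hadd : ∀ f g n i, U0 (f + g) n i =ᵐ[P] fun w => U0 f n i w + U0 g n i w)
 (hsm : ∀ (c : ℝ) f n i, U0 (c • f) n i =ᵐ[P] fun w => c * U0 f n i w) :
 ∃ u : V →ₗ[ℝ] (ℕ × ℕ × Ω → ℝ), (∀ f, Measurable (u f)) ∧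
 ∀ f n i, (fun w => u f (n, i, w)) =ᵐ[P] U0 f n i := by
  let b := Module.Basis.ofVectorSpace ℝ V
  let u : V →ₗ[ℝ] (ℕ × ℕ × Ω → ℝ) := b.constr ℝ (fun k x => U0 (b k) x.1 x.2.1 x.2.2)
  have hu : ∀ k, u (b k) = fun x => U0 (b k) x.1 x.2.1 x.2.2 := fun k => b.constr_basis ℝ _ k
  have key : ∀ f, Measurable (u f) ∧ ∀ n i, (fun w => u f (n, i, w)) =ᵐ[P] U0 f n i := by
    intro f
    have hf : f ∈ Submodule.span ℝ (range b) := by rw [b.span_eq]; trivial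
    induction hf using Submodule.span_induction with
    | mem x h =>
      obtain ⟨k, rfl⟩ := h
      rw [hu k]
      exact ⟨meas_X fun n i => hm _ n i, fun n i => ae_eq_rfl⟩
    | zero =>
      rw [map_zero]
      refine ⟨measurable_const, fun n i => ?_⟩
      have := hsm 0 0 n i
      rw [zero_smul] at this
      filter_upwards [this] with w h
      rw [h, zero_mul]; rfl
    | add x y _ _ hx hy =>
      rw [map_add]
      refine ⟨hx.1.add hy.1, fun n i => ?_⟩
      filter_upwards [hadd x y n i, hx.2 n i, hy.2 n i] with w h1 h2 h3
      rw [h1, ← h2, ← h3]; rfl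
    | smul a x _ hx =>
      rw [map_smul]
      refine ⟨hx.1.const_smul a, fun n i => ?_⟩
      filter_upwards [hsm a x n i, hx.2 n i] with w h1 h2
      rw [h1, ← h2]; rfl
  exact ⟨u, fun f => (key f).1, fun f => (key f).2⟩
lemma hb_add {O : Filtration ℕ m} {Q : Measure Ω} {L f g : Ω → ℝ} {c : ℝ} {i : ℕ}
 (hd : ∀ᵐ w ∂P, |dm O Q L i w| ≤ c) (hf : Integrable f P) (hg : Integrable g P) :
 hb O P Q L (fun w => f w + g w) i =ᵐ[P] fun w => hb O P Q L f i w + hb O P Q L g i w := by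
  have h1 := int_mul (dm_aesm P Q L i) hd hf
  have h2 := int_mul (dm_aesm P Q L i) hd hg
  refine (condExp_congr_ae (ae_of_all _ fun w => ?_)).trans (condExp_add h1 h2 _)
  simp only [Pi.add_apply]; ring
lemma hb_smul {O : Filtration ℕ m} {Q : Measure Ω} {L f : Ω → ℝ} (a : ℝ) (i : ℕ) :
 hb O P Q L (fun w => a * f w) i =ᵐ[P] fun w => a * hb O P Q L f i w := by
  refine (condExp_congr_ae (ae_of_all _ fun w => ?_)).trans
    (condExp_smul a (fun w => dm O Q L i w * f w) _)
  simp only [Pi.smul_apply, smul_eq_mul]; ring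
lemma hb_congr {O : Filtration ℕ m} {Q : Measure Ω} {L f g : Ω → ℝ} {i : ℕ}
 (h : f =ᵐ[P] g) : hb O P Q L f i =ᵐ[P] hb O P Q L g i := by
  refine condExp_congr_ae ?_
  filter_upwards [h] with w h
  simp only [h]
lemma sys_u (Q : Measure Ω) {L : Ω → ℝ} (D : Ω → ℝ) {c : ℝ}
 (hd : ∀ n i, ∀ᵐ w ∂P, |dm (I n) Q L i w| ≤ c) :
 ∃ u : Lp ℝ 1 P →ₗ[ℝ] (ℕ × ℕ × Ω → ℝ), (∀ f, Measurable (u f)) ∧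
 ∀ f n i, (fun w => u f (n, i, w)) =ᵐ[P]
 fun w => hb (I n) P Q L f i w / wb (I n) P D i w := by
  refine hamel (P := P) (fun (f : Lp ℝ 1 P) n i w => hb (I n) P Q L f i w / wb (I n) P D i w) ?_ ?_ ?_
  · intro f n i
    exact ((stronglyMeasurable_condExp.mono ((I n).le i)).measurable).div
      ((stronglyMeasurable_condExp.mono ((I n).le i)).measurable)
  · intro f g n i
    have h1 : hb (I n) P Q L (f + g : Lp ℝ 1 P) i =ᵐ[P] _ := (hb_congr (Lp.coeFn_add f g)).trans
        (hb_add (hd n i) (L1.integrable_coeFn f) (L1.integrable_coeFn g))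
    filter_upwards [h1] with w h
    rw [h, add_div]
  · intro a f n i
    have h1 : hb (I n) P Q L (a • f : Lp ℝ 1 P) i =ᵐ[P] _ := (hb_congr (Lp.coeFn_smul a f)).trans (hb_smul a i)
    filter_upwards [h1] with w h
    rw [h, mul_div_assoc]
lemma wb_nonneg {O : Filtration ℕ m} (D : Ω → ℝ) (i : ℕ) : 0 ≤ᵐ[P] wb O P D i := condExp_nonneg (ae_of_all _ fun _ => sq_nonneg _)
lemma sys_F2 {ρ : Ω → ℝ} (hρ : Measurable ρ) {κ : ℝ} (hκ : 0 < κ) (hρ1 : ∀ w, κ⁻¹ ≤ ρ w)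
 (hρ2 : ∀ w, ρ w ≤ κ) [IsPr (wd P ρ)]
 {L D : Ω → ℝ} (hLm : Measurable L) {c : ℝ} (hc : 0 < c) (hL : ∀ w, |L w| ≤ c)
 (hD : ∀ᵐ w ∂P, |D w| ≤ 1) {u : Lp ℝ 1 P →ₗ[ℝ] (ℕ × ℕ × Ω → ℝ)} (hum : ∀ f, Measurable (u f))
 (hu : ∀ f n i, (fun w => u f (n, i, w)) =ᵐ[P]
 fun w => hb (I n) P (wd P ρ) L f i w / wb (I n) P D i w) (n : ℕ) (f : Lp ℝ 1 P) :
 (nuD I P D n).real {x | 1 < |u f x|} ≤ (6 * c + κ + 1) * √‖f‖ := by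
  have hS : MeasurableSet {x | 1 < |u f x|} := measurableSet_lt measurable_const (hum f).abs
  rw [nuD_real hD n hS]
  have h := F2_level (O := I n) hρ hκ hρ1 hρ2 hLm hc hL hD (L1.integrable_coeFn f) (2^n)
  have hn : ‖f‖ = ∫ w, |f w| ∂P := by
    rw [L1.norm_eq_integral_norm]; rfl
  rw [hn]
  refine le_trans (sum_le_sum fun i _ => ?_) h
  refine integral_mono_ae (int_indm (meas_ni n i hS) (wb_int hD i))
    (int_indm ((I n).le i _ (Tset_meas _ _ _ _ i)) (wb_int hD i)) ?_
  filter_upwards [hu f n i, wb_nonneg (O := I n) (P := P) D i] with w h1 h2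
  refine mul_right_le ?_ (sq_nonneg _)
  by_cases hw : (n, i, w) ∈ {x | 1 < |u f x|}
  · have : w ∈ Tset (I n) P (wd P ρ) L f D i := by
      have h3 : 1 < |u f (n, i, w)| := hw
      rw [h1, abs_div, abs_of_nonneg h2] at h3
      rcases h2.lt_or_eq with h4 | h4
      · rwa [one_lt_div h4] at h3
      · rw [← h4] at h3; simp at h3; linarith
    rw [ind_mem this]; exact ind_le_one _ _
  · rw [ind_nmem (show w ∉ {w | 1 < |u f (n, i, w)|} from hw)]; exact ind_nn _ _
end System
section HM
variable {X E ι : Type*} [MeasurableSpace X] [NormedAddCommGroup E] [NormedSpace ℝ E] [Fintype ι]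
def HMsub (ν : ℕ → Measure X) (u : ℕ → E →ₗ[ℝ] (X → ℝ)) (v : ι → E) : Submodule ℝ E where
  carrier := {g | ∃ p : ι → X → ℝ, (∃ c, ∀ i x, |p i x| ≤ c) ∧ ∀ j, ∀ᶠ n in atTop,
      ∀ᵐ x ∂(ν n), u j g x = ∑ i, p i x * u j (v i) x}
  zero_mem' := ⟨fun _ _ => 0, ⟨0, by simp⟩, fun j => by simp⟩
  add_mem' := by
    rintro a b ⟨p, ⟨c, hc⟩, hp⟩ ⟨q, ⟨c', hc'⟩, hq⟩
    refine ⟨fun i x => p i x + q i x, ⟨c + c', fun i x => (abs_add_le _ _).trans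
      (add_le_add (hc i x) (hc' i x))⟩, fun j => ?_⟩
    filter_upwards [hp j, hq j] with n h1 h2
    filter_upwards [h1, h2] with x e1 e2
    rw [map_add, Pi.add_apply, e1, e2, ← sum_add_distrib]
    exact sum_congr rfl fun i _ => by ring
  smul_mem' := by
    rintro a b ⟨p, ⟨c, hc⟩, hp⟩
    refine ⟨fun i x => a * p i x, ⟨|a| * c, fun i x => ?_⟩, fun j => ?_⟩
    · rw [abs_mul]; exact mul_left_le (hc i x) (abs_nonneg _)
    filter_upwards [hp j] with n h1
    filter_upwards [h1] with x e1
    rw [map_smul, Pi.smul_apply, e1, smul_eq_mul, mul_sum]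
    exact sum_congr rfl fun i _ => by ring
end HM
section Gen
variable {Ω : Type*} {m : MeasurableSpace Ω} {P : Measure Ω} [IsPr P]
  {I : ℕ → Filtration ℕ m} {O : Filtration ℕ m}
lemma hb_zero {Q : Measure Ω} {L g : Ω → ℝ} {c : ℝ} {i : ℕ}
 (hd : ∀ᵐ w ∂P, |dm O Q L i w| ≤ c) (hg : Integrable g P) {G : MeasurableSpace Ω} (hG : G ≤ m)
 (hiG : O (i+1) ≤ G) (h0 : P[g | G] =ᵐ[P] 0) : hb O P Q L g i =ᵐ[P] 0 := by
  have h1 : P[fun w => dm O Q L i w * g w | G] =ᵐ[P] 0 := by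
    refine (condExp_mul_of_stronglyMeasurable_left ((dm_sm Q L i).mono hiG)
      (int_mul (dm_aesm P Q L i) hd hg) hg).trans ?_
    filter_upwards [h0] with w h
    simp [h]
  have h2 := condExp_condExp_of_le (μ := P) (f := fun w => dm O Q L i w * g w)
    ((O.mono (Nat.le_succ i)).trans hiG) hG
  refine h2.symm.trans ?_
  refine (condExp_congr_ae h1).trans ?_
  rw [condExp_zero]
lemma hb_mult {Q : Measure Ω} {L f1 f2 a b : Ω → ℝ} {c k : ℝ} {i : ℕ}
 (hd : ∀ᵐ w ∂P, |dm O Q L i w| ≤ c) (h1 : Integrable f1 P) (h2 : Integrable f2 P)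
 (ha : StronglyMeasurable[O i] a) (hab : ∀ w, |a w| ≤ k)
 (hb' : StronglyMeasurable[O i] b) (hbb : ∀ w, |b w| ≤ k) :
 hb O P Q L (fun w => a w * f1 w + b w * f2 w) i =ᵐ[P]
 fun w => a w * hb O P Q L f1 i w + b w * hb O P Q L f2 i w := by
  have i1 := int_mul (dm_aesm P Q L i) hd h1
  have i2 := int_mul (dm_aesm P Q L i) hd h2
  have j1 := int_mul (aesm_of (Q := P) (O.le i) ha) (ae_of_all _ hab) i1
  have j2 := int_mul (aesm_of (Q := P) (O.le i) hb') (ae_of_all _ hbb) i2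
  have e : hb O P Q L (fun w => a w * f1 w + b w * f2 w) i =ᵐ[P]
      P[fun w => a w * (dm O Q L i w * f1 w) | O i] + P[fun w => b w * (dm O Q L i w * f2 w) | O i] := by
    refine (condExp_congr_ae (ae_of_all _ fun w => ?_)).trans (condExp_add j1 j2 _)
    simp only [Pi.add_apply]; ring
  filter_upwards [e, condExp_mul_of_stronglyMeasurable_left ha j1 i1,
    condExp_mul_of_stronglyMeasurable_left hb' j2 i2] with w e1 e2 e3
  rw [e1, Pi.add_apply]
  exact congrArg₂ (· + ·) e2 e3
lemma gen_mem (href : ∀ n0 n i, n0 ≤ n → (I n (i * 2^(n - n0)) : MeasurableSpace Ω) = I n0 i)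
 {D : Ω → ℝ} {Q : ℕ → Measure Ω} {L : ℕ → Ω → ℝ} {c : ℕ → ℝ}
 (hd : ∀ j n i, ∀ᵐ w ∂P, |dm (I n) (Q j) (L j) i w| ≤ c j)
 {u : ℕ → Lp ℝ 1 P →ₗ[ℝ] (ℕ × ℕ × Ω → ℝ)} (hum : ∀ j f, Measurable (u j f))
 (hu : ∀ j f n i, (fun w => u j f (n, i, w)) =ᵐ[P]
 fun w => hb (I n) P (Q j) (L j) f i w / wb (I n) P D i w)
 {ι : Type*} [Fintype ι] [DecidableEq ι] {v : ι → Lp ℝ 1 P} {n0 i0 : ℕ} {a b : Ω → ℝ} {k : ℝ}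
 (ha : StronglyMeasurable[I n0 i0] a) (hab : ∀ w, |a w| ≤ k)
 (hb' : StronglyMeasurable[I n0 i0] b) (hbb : ∀ w, |b w| ≤ k) {z y : ι} (g : Lp ℝ 1 P)
 (hg : g =ᵐ[P] fun w => a w * v y w + b w * v z w)
 (h0 : P[g | I n0 i0] =ᵐ[P] 0) : g ∈ HMsub (nuD I P D) u v := by
  classical
  set A : ℕ × ℕ × Ω → ℝ := fun x => if i0 * 2^(x.1 - n0) ≤ x.2.1 then a x.2.2 else 0 with hA
  set B : ℕ × ℕ × Ω → ℝ := fun x => if i0 * 2^(x.1 - n0) ≤ x.2.1 then b x.2.2 else 0 with hB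
  have hk : 0 ≤ k := by
    by_contra hk
    have : IsEmpty Ω := ⟨fun w => hk ((abs_nonneg _).trans (hab w))⟩
    have h1 := measure_univ (μ := P)
    rw [univ_eq_empty_iff.2 this, measure_empty] at h1
    exact zero_ne_one h1
  have hAm : Measurable A := meas_X fun n i => by
    simp only [hA]; split_ifs
    · exact (ha.mono ((I n0).le i0)).measurable
    · exact measurable_const
  have hBm : Measurable B := meas_X fun n i => by
    simp only [hB]; split_ifs
    · exact (hb'.mono ((I n0).le i0)).measurable
    · exact measurable_const
  have hAb : ∀ x, |A x| ≤ k := fun x => by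
    simp only [hA]; split_ifs
    · exact hab _
    · simpa using hk
  have hBb : ∀ x, |B x| ≤ k := fun x => by
    simp only [hB]; split_ifs
    · exact hbb _
    · simpa using hk
  refine ⟨fun l x => (if l = y then A x else 0) + (if l = z then B x else 0), ⟨k + k, fun l x => ?_⟩,
    fun j => ?_⟩
  · refine (abs_add_le _ _).trans (add_le_add ?_ ?_)
    · split_ifs
      · exact hAb x
      · simpa using hk
    · split_ifs
      · exact hBb x
      · simpa using hk
  filter_upwards [eventually_ge_atTop n0] with n hn
  have hsum : ∀ x, ∑ l, ((if l = y then A x else 0) + (if l = z then B x else 0)) * u j (v l) x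
      = A x * u j (v y) x + B x * u j (v z) x := by
    intro x
    simp_rw [add_mul, sum_add_distrib, ite_mul, zero_mul]
    simp
  simp_rw [hsum]
  refine nuD_ae n (hum j g) ((hAm.mul (hum j _)).add (hBm.mul (hum j _))) fun i _ => ?_
  filter_upwards [hu j g n i, hu j (v y) n i, hu j (v z) n i, (hb_congr (O := I n) (Q := Q j) (L := L j) (i := i) hg),
    show ∀ᵐ w ∂P, i + 1 ≤ i0 * 2^(n - n0) → hb (I n) P (Q j) (L j) g i w = 0 from by
      by_cases hi : i + 1 ≤ i0 * 2^(n-n0)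
      · have := hb_zero (hd j n i) (L1.integrable_coeFn g) ((I n0).le i0)
          (((I n).mono hi).trans (href n0 n i0 hn).le) h0
        filter_upwards [this] with w h _ using h
      · exact ae_of_all _ fun w h => absurd h hi,
    show ∀ᵐ w ∂P, i0 * 2^(n - n0) ≤ i → hb (I n) P (Q j) (L j) (fun w => a w * v y w + b w * v z w) i w
        = a w * hb (I n) P (Q j) (L j) (v y) i w + b w * hb (I n) P (Q j) (L j) (v z) i w from by
      by_cases hi : i0 * 2^(n-n0) ≤ i
      · have hle : (I n0 i0 : MeasurableSpace Ω) ≤ I n i := (href n0 n i0 hn).ge.trans ((I n).mono hi)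
        have := hb_mult (hd j n i) (L1.integrable_coeFn (v y)) (L1.integrable_coeFn (v z))
          (ha.mono hle) hab (hb'.mono hle) hbb
        filter_upwards [this] with w h _ using h
      · exact ae_of_all _ fun w h => absurd h hi] with w e1 e2 e3 e4 e5 e6
  rw [e1]
  simp only [hA, hB]
  rw [e2, e3]
  by_cases hi : i0 * 2^(n-n0) ≤ i
  · rw [if_pos hi, if_pos hi, e4, e6 hi]; ring
  · rw [if_neg hi, if_neg hi, e5 (by omega)]; ring
end Gen
section Dual
variable {Ω : Type*} {m : MeasurableSpace Ω} {P : Measure Ω} [IsPr P]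
lemma intN {N : Ω → ℝ} (hN : Measurable N) {C : ℝ} (hC : ∀ w, |N w| ≤ C) :
 ∃ Iv : Lp ℝ 1 P →L[ℝ] ℝ, ∀ g : Lp ℝ 1 P, Iv g = ∫ w, N w * g w ∂P := by
  have hi : ∀ g : Lp ℝ 1 P, Integrable (fun w => N w * g w) P := fun g =>
    int_mul hN.aestronglyMeasurable (ae_of_all _ hC) (L1.integrable_coeFn g)
  refine ⟨LinearMap.mkContinuous { toFun := fun g => ∫ w, N w * g w ∂P, map_add' := ?_, map_smul' := ?_ } C ?_,
    fun g => rfl⟩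
  · intro f g
    rw [← integral_add (hi f) (hi g)]
    refine integral_congr_ae ?_
    filter_upwards [Lp.coeFn_add f g] with w h
    rw [h, Pi.add_apply]; ring
  · intro a g
    rw [RingHom.id_apply, smul_eq_mul, ← integral_const_mul]
    refine integral_congr_ae ?_
    filter_upwards [Lp.coeFn_smul a g] with w h
    rw [h, Pi.smul_apply, smul_eq_mul]; ring
  · intro g
    rw [L1.norm_eq_integral_norm, ← integral_const_mul]
    refine norm_integral_le_of_norm_le ((L1.integrable_coeFn g).norm.const_mul C) (ae_of_all _ fun w => ?_)
    rw [norm_mul]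
    exact mul_right_le (hC w) (norm_nonneg _)
lemma dualL1 (ℓ : Lp ℝ 1 P →L[ℝ] ℝ) : ∃ N : Ω → ℝ, Measurable N ∧ (∃ C, ∀ w, |N w| ≤ C) ∧
 ∀ g : Lp ℝ 1 P, ℓ g = ∫ w, N w * g w ∂P := by
  have hml : ∀ f : Lp ℝ 2 P, MemLp f 1 P := fun f => (Lp.memLp f).mono_exponent (by norm_num)
  let T : Lp ℝ 2 P →L[ℝ] Lp ℝ 1 P := LinearMap.mkContinuous
    { toFun := fun f => (hml f).toLp f
      map_add' := fun f g => by
        refine Lp.ext ?_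
        filter_upwards [(hml (f+g)).coeFn_toLp, Lp.coeFn_add f g, (hml f).coeFn_toLp,
          (hml g).coeFn_toLp, Lp.coeFn_add ((hml f).toLp f) ((hml g).toLp g)] with w a b c d e
        rw [a, b, e, Pi.add_apply, Pi.add_apply, c, d]
      map_smul' := fun r f => by
        refine Lp.ext ?_
        filter_upwards [(hml (r • f)).coeFn_toLp, Lp.coeFn_smul r f, (hml f).coeFn_toLp,
          Lp.coeFn_smul r ((hml f).toLp f)] with w a b c e
        rw [a, b, RingHom.id_apply, e, Pi.smul_apply, Pi.smul_apply, c] } 1 (fun f => by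
    change ‖(hml f).toLp f‖ ≤ _
    rw [Lp.norm_toLp, one_mul, Lp.norm_def]
    refine ENNReal.toReal_mono (Lp.eLpNorm_ne_top f) ?_
    exact eLpNorm_le_eLpNorm_of_exponent_le (by norm_num) (Lp.aestronglyMeasurable f))
  have hT : ∀ f, (T f : Ω → ℝ) =ᵐ[P] f := fun f => (hml f).coeFn_toLp
  set N2 : Lp ℝ 2 P := (InnerProductSpace.toDual ℝ _).symm (ℓ.comp T) with hN2
  have hR : ∀ f : Lp ℝ 2 P, ℓ (T f) = ∫ w, N2 w * f w ∂P := by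
    intro f
    have h1 : inner ℝ N2 f = (ℓ.comp T) f := by rw [hN2, InnerProductSpace.toDual_symm_apply]
    rw [L2.inner_def] at h1
    rw [ContinuousLinearMap.comp_apply] at h1
    rw [← h1]
    congr 1; ext w; simp [mul_comm]
  have hN2i : Integrable N2 P := (Lp.memLp N2).integrable (by norm_num)
  have hind : ∀ (A : Set Ω) (hA : MeasurableSet A) (c : ℝ),
      ℓ (indicatorConstLp 1 hA (measure_ne_top P A) c) = c * ∫ w in A, N2 w ∂P := by
    intro A hA c
    have h1 : T (indicatorConstLp 2 hA (measure_ne_top P A) c)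
        = indicatorConstLp 1 hA (measure_ne_top P A) c := by
      refine Lp.ext ?_
      filter_upwards [hT (indicatorConstLp 2 hA (measure_ne_top P A) c),
        indicatorConstLp_coeFn (p := 2) (hs := hA) (hμs := measure_ne_top P A) (c := c),
        indicatorConstLp_coeFn (p := 1) (hs := hA) (hμs := measure_ne_top P A) (c := c)] with w a b e
      rw [a, b, e]
    rw [← h1, hR, ← integral_const_mul, ← integral_indicator hA]
    refine integral_congr_ae ?_
    filter_upwards [indicatorConstLp_coeFn (p := 2) (hs := hA) (hμs := measure_ne_top P A) (c := c)] with w b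
    rw [b]
    by_cases h : w ∈ A <;> simp [h, mul_comm]
  set C := ‖ℓ‖ with hC
  have hbd : ∀ (A : Set Ω), MeasurableSet A → |∫ w in A, N2 w ∂P| ≤ C * P.real A := by
    intro A hA
    have h1 := ℓ.le_opNorm (indicatorConstLp 1 hA (measure_ne_top P A) (1:ℝ))
    rw [hind, one_mul, norm_indicatorConstLp (by norm_num) (by norm_num)] at h1
    simpa using h1
  have hup : ∀ᵐ w ∂P, N2 w ≤ C := by
    refine ae_le_of_forall_setIntegral_le hN2i (integrable_const C) fun s hs _ => ?_
    rw [setIntegral_const, smul_eq_mul, mul_comm]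
    exact (le_abs_self _).trans (hbd s hs)
  have hdn : ∀ᵐ w ∂P, -C ≤ N2 w := by
    refine ae_le_of_forall_setIntegral_le (integrable_const (-C)) hN2i fun s hs _ => ?_
    rw [setIntegral_const, smul_eq_mul]
    have := neg_le_of_abs_le (hbd s hs)
    linarith
  let N : Ω → ℝ := fun w => max (-C) (min (N2 w) C)
  have hNm : Measurable N := measurable_const.max ((Lp.stronglyMeasurable N2).measurable.min measurable_const)
  have hC0 : 0 ≤ C := norm_nonneg _
  have hNC : ∀ w, |N w| ≤ C := fun w => abs_le.2 ⟨le_max_left _ _, max_le (by linarith) (min_le_right _ _)⟩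
  have hNN : N =ᵐ[P] N2 := by
    filter_upwards [hup, hdn] with w h1 h2
    simp only [N]; rw [min_eq_left h1, max_eq_right h2]
  obtain ⟨Iv, hI⟩ := intN (P := P) hNm hNC
  refine ⟨N, hNm, ⟨C, hNC⟩, fun g => ?_⟩
  rw [← hI]
  refine Lp.induction ENNReal.one_ne_top (motive := fun g : Lp ℝ 1 P => ℓ g = Iv g) ?_ ?_ ?_ g
  · intro c s hs hμ
    rw [Lp.simpleFunc.coe_indicatorConst, hind, hI, ← integral_const_mul, ← integral_indicator hs]
    refine integral_congr_ae ?_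
    filter_upwards [indicatorConstLp_coeFn (p := 1) (hs := hs) (hμs := measure_ne_top P s) (c := c), hNN] with w b e
    rw [b, e]
    by_cases h : w ∈ s <;> simp [h, mul_comm]
  · intro f g hf hg _ h1 h2
    rw [map_add, map_add, h1, h2]
  · exact isClosed_eq ℓ.continuous Iv.continuous
lemma dense_of (W : Submodule ℝ (Lp ℝ 1 P))
 (h : ∀ N : Ω → ℝ, Measurable N → (∃ C, ∀ w, |N w| ≤ C) →
 (∀ g ∈ W, ∫ w, N w * g w ∂P = 0) → N =ᵐ[P] 0) : Dense (W : Set (Lp ℝ 1 P)) := by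
  intro x
  by_contra hx
  obtain ⟨ℓ, s, h1, h2⟩ := geometric_hahn_banach_closed_point (W.topologicalClosure.convex)
    W.isClosed_topologicalClosure (x := x) (by simpa using hx)
  have hW : ∀ g ∈ W, ℓ g = 0 := by
    intro g hg
    by_contra hne
    have h3 := h1 ((s / ℓ g) • g) (W.le_topologicalClosure (W.smul_mem _ hg))
    rw [map_smul, smul_eq_mul, div_mul_cancel₀ _ hne] at h3
    exact lt_irrefl _ h3
  obtain ⟨N, hNm, hNC, hN⟩ := dualL1 ℓ
  have h0 := h N hNm hNC (fun g hg => by rw [← hN, hW g hg])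
  have h4 : ℓ x = 0 := by
    rw [hN]
    refine integral_eq_zero_of_ae ?_
    filter_upwards [h0] with w h; simp [h]
  have h5 := h1 0 (Submodule.zero_mem _)
  rw [map_zero] at h5
  linarith
end Dual
section WGs
variable {Ω : Type*} {m : MeasurableSpace Ω} {P : Measure Ω} [IsPr P]
  {I : ℕ → Filtration ℕ m} {d : ℕ}
def WG (I : ℕ → Filtration ℕ m) (Q : Measure Ω) (o : Fin d → Ω → ℝ) : Prop := ∀ N : Ω → ℝ, Measurable N → (∃ C, ∀ w, |N w| ≤ C) →
    (∀ n i, ∀ A, MeasurableSet[I n i] A → ∀ c,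
      ∫ w, ind A w * ((N w - (Q[N | I n i]) w) * o c w) ∂Q = 0) → ∃ a : ℝ, N =ᵐ[Q] fun _ => a
def ext1 (o : Fin d → Ω → ℝ) : Fin (d+1) → Ω → ℝ := Fin.cons (fun _ => 1) o
lemma v_mem_HM {X E ι : Type*} [MeasurableSpace X] [NormedAddCommGroup E] [NormedSpace ℝ E]
 [Fintype ι] (ν : ℕ → Measure X) (u : ℕ → E →ₗ[ℝ] (X → ℝ)) (v : ι → E) (l : ι) :
 v l ∈ HMsub ν u v := by
  classical
  refine ⟨fun i _ => if i = l then 1 else 0, ⟨1, fun i x => by dsimp only; split_ifs <;> simp⟩, fun j => ?_⟩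
  refine Eventually.of_forall fun n => ae_of_all _ fun x => ?_
  simp
theorem dense_HM (href : ∀ n0 n i, n0 ≤ n → (I n (i * 2^(n - n0)) : MeasurableSpace Ω) = I n0 i)
 {D : Ω → ℝ} {Q : ℕ → Measure Ω} {L : ℕ → Ω → ℝ} {c : ℕ → ℝ}
 (hd : ∀ j n i, ∀ᵐ w ∂P, |dm (I n) (Q j) (L j) i w| ≤ c j)
 {u : ℕ → Lp ℝ 1 P →ₗ[ℝ] (ℕ × ℕ × Ω → ℝ)} (hum : ∀ j f, Measurable (u j f))
 (hu : ∀ j f n i, (fun w => u j f (n, i, w)) =ᵐ[P]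
 fun w => hb (I n) P (Q j) (L j) f i w / wb (I n) P D i w)
 {Z : Ω → ℝ} (hZ : Measurable Z) (hZ0 : ∀ w, 0 < Z w) [IsPr (wd P Z)]
 {o : Fin d → Ω → ℝ} (ho : ∀ l, Integrable (o l) (wd P Z)) (hWG : WG I (wd P Z) o)
 {v : Fin (d+1) → Lp ℝ 1 P} (hv : ∀ l, v l =ᵐ[P] fun w => Z w * ext1 o l w) :
 Dense (HMsub (nuD I P D) u v : Set (Lp ℝ 1 P)) := by
  refine dense_of _ fun N hN ⟨C, hC⟩ hW => ?_
  set HM := HMsub (nuD I P D) u v with hHM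
  set Q0 := wd P Z with hQ0
  have hZ0' : ∀ w, 0 ≤ Z w := fun w => (hZ0 w).le
  have hPQ : P ≪ Q0 := wd_ac' hZ hZ0
  have hQP : Q0 ≪ P := wd_ac Z
  have hC0 : ∀ᵐ w ∂Q0, |N w| ≤ C := ae_of_all _ hC
  have hCnn : 0 ≤ C := by
    obtain ⟨w⟩ := nonempty_of_isProbabilityMeasure P
    exact (abs_nonneg _).trans (hC w)
  have hNi : Integrable N Q0 := int_bdd hN.aestronglyMeasurable hC0
  have hmean : ∫ w, N w ∂Q0 = 0 := by
    have h1 := hW _ (v_mem_HM _ u v 0)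
    rw [hQ0, wd_int hZ hZ0', ← h1]
    refine integral_congr_ae ?_
    filter_upwards [hv 0] with w h
    rw [h]; simp [ext1, mul_comm]
  obtain ⟨a, ha⟩ := hWG N hN ⟨C, hC⟩ (by
    intro n i A hA l
    set G : MeasurableSpace Ω := I n i with hG
    have hGm : G ≤ m := (I n).le i
    set S := Q0[o l | G] with hS
    have hSm : StronglyMeasurable[G] S := stronglyMeasurable_condExp
    set Nb := Q0[N | G] with hNb
    have hNbm : StronglyMeasurable[G] Nb := stronglyMeasurable_condExp
    have hNbC : ∀ᵐ w ∂Q0, |Nb w| ≤ C := ce_abs hCnn hC0 G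
    set A' : ℕ → Set Ω := fun k => A ∩ {w | |S w| ≤ k} with hA'
    have hAmm : ∀ k, MeasurableSet[G] (A' k) := fun k =>
      hA.inter (@measurableSet_le _ _ _ _ _ G _ _ _ _ _
        (continuous_abs.measurable.comp hSm.measurable) measurable_const)
    have hAm2 : ∀ k, MeasurableSet[m] (A' k) := fun k => hGm _ (hAmm k)
    have hSb : ∀ k w, |ind (A' k) w * S w| ≤ k := fun k w => by
      by_cases h : w ∈ A' k
      · rw [ind_mem h, one_mul]; exact h.2
      · rw [ind_nmem h]; simp
    have hISm : ∀ k, StronglyMeasurable[G] (fun w => ind (A' k) w * S w) := fun k =>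
      (ind_sm (hAmm k)).mul hSm
    have hIS : ∀ k, AEStronglyMeasurable[m] (fun w => ind (A' k) w * S w) Q0 := fun k =>
      aesm_of hGm (hISm k)
    have hNo : Integrable (fun w => N w * o l w) Q0 := int_mul hN.aestronglyMeasurable hC0 (ho l)
    have hNbo : Integrable (fun w => Nb w * o l w) Q0 := int_mul (aesm_of hGm hNbm) hNbC (ho l)
    have hk : ∀ k : ℕ, ∫ w, ind (A' k) w * ((N w - Nb w) * o l w) ∂Q0 = 0 := by
      intro k
      set g0 : Ω → ℝ := fun w => ind (A' k) w * (Z w * o l w) + -(ind (A' k) w * S w) * Z w with hg0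
      have hZo : Integrable (fun w => Z w * o l w) P := (wd_itg hZ hZ0').1 (ho l)
      have hZi : Integrable Z P := by
        have := (wd_itg (P := P) hZ hZ0').1 (integrable_const (1:ℝ) (μ := wd P Z))
        simpa using this
      have hg0i : Integrable g0 P := (int_indm (hAm2 k) hZo).add (int_mul (c := k)
          ((hIS k).mono_ac hPQ).neg (ae_of_all _ fun w => by rw [abs_neg]; exact hSb k w) hZi)
      have hg0e : ∀ B, MeasurableSet[G] B → ∫ w in B, g0 w ∂P = 0 := by
        intro B hB
        rw [← int_ind_mul P (hGm _ hB)]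
        have e1 : ∫ w, ind B w * g0 w ∂P
            = ∫ w, (ind B w * ind (A' k) w * o l w - (ind B w * (ind (A' k) w * S w))) ∂Q0 := by
          rw [hQ0, wd_int hZ hZ0']
          congr 1; ext w; simp only [hg0]; ring
        have hBA : StronglyMeasurable[G] (fun w => ind B w * ind (A' k) w) := (ind_sm hB).mul (ind_sm (hAmm k))
        have hBAb : ∀ w, |ind B w * ind (A' k) w| ≤ 1 := fun w => by
          rw [abs_mul]; exact mul_le_one₀ (ind_abs _ _) (abs_nonneg _) (ind_abs _ _)
        have j1 := int_mul (aesm_of (Q := Q0) hGm hBA) (ae_of_all _ hBAb) (ho l)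
        have j2 : Integrable (fun w => ind B w * (ind (A' k) w * S w)) Q0 := int_indm (hGm _ hB) (int_bdd (c := k) (hIS k) (ae_of_all _ (hSb k)))
        rw [e1, integral_sub j1 j2, ← pull hGm hBA j1 (ho l)]
        rw [← integral_sub (pull_int hBA j1 (ho l)) j2]
        refine integral_eq_zero_of_ae (ae_of_all _ fun w => ?_)
        simp only [hS, Pi.zero_apply]; ring
      set g : Lp ℝ 1 P := hg0i.toL1 g0 with hg
      have hgg : g =ᵐ[P] g0 := hg0i.coeFn_toL1
      have hmem : g ∈ HM := by
        refine gen_mem href hd hum hu (n0 := n) (i0 := i) (a := ind (A' k))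
          (b := fun w => -(ind (A' k) w * S w)) (k := max 1 k) (ind_sm (hAmm k))
          (fun w => (ind_abs _ _).trans (le_max_left _ _)) (hISm k).neg
          (fun w => by rw [abs_neg]; exact (hSb k w).trans (le_max_right _ _))
          (z := 0) (y := l.succ) g ?_ ?_
        · filter_upwards [hgg, hv 0, hv l.succ] with w h1 h2 h3
          rw [h1, h2, h3]; simp [hg0, ext1]
        · refine (condExp_congr_ae hgg).trans ?_
          refine (ae_eq_condExp_of_forall_setIntegral_eq hGm hg0i (fun _ _ _ => ?_) ?_ ?_).symm
          · exact integrableOn_zero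
          · intro B hB _; rw [hg0e B hB]; simp
          · exact aestronglyMeasurable_zero
      have h0 := hW g hmem
      have h0' : ∫ w, (ind (A' k) w * (N w * o l w) - (ind (A' k) w * S w) * N w) ∂Q0 = 0 := by
        rw [← h0, hQ0, wd_int hZ hZ0']
        refine integral_congr_ae ?_
        filter_upwards [hgg] with w h
        rw [h]; simp only [hg0]; ring
      have i1 := int_indm (hAm2 k) hNo
      have i2 := int_mul (hIS k) (ae_of_all _ (hSb k)) hNi
      rw [integral_sub i1 i2, ← pull hGm (hISm k) i2 hNi] at h0'
      have i3 : Integrable (fun w => (ind (A' k) w * Nb w) * o l w) Q0 := by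
        refine (int_indm (hAm2 k) hNbo).congr (ae_of_all _ fun w => ?_)
        simp only; ring
      have h3 := pull hGm ((ind_sm (hAmm k)).mul hNbm) i3 (ho l)
      have h4 : ∫ w, ind (A' k) w * ((N w - Nb w) * o l w) ∂Q0
          = ∫ w, ind (A' k) w * (N w * o l w) ∂Q0 - ∫ w, (ind (A' k) w * Nb w) * o l w ∂Q0 := by
        rw [← integral_sub i1 i3]
        congr 1; ext w; ring
      rw [h4]
      have h5 : ∫ w, (ind (A' k) w * Nb w) * o l w ∂Q0 = ∫ w, ind (A' k) w * S w * Nb w ∂Q0 := by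
        refine Eq.trans h3.symm ?_
        congr 1; ext w; simp only [Pi.mul_apply, hS]; ring
      rw [h5]; exact h0'
    have hlim : Tendsto (fun k : ℕ => ∫ w, ind (A' k) w * ((N w - Nb w) * o l w) ∂Q0) atTop
        (nhds (∫ w, ind A w * ((N w - Nb w) * o l w) ∂Q0)) := by
      have hii : Integrable (fun w => (N w - Nb w) * o l w) Q0 := by
        refine (hNo.sub hNbo).congr (ae_of_all _ fun w => ?_)
        simp only [Pi.sub_apply]; ring
      refine tendsto_integral_of_dominated_convergence (fun w => |(N w - Nb w) * o l w|) ?_ hii.abs ?_ ?_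
      · intro k; exact (int_indm (hAm2 k) hii).1
      · intro k; refine ae_of_all _ fun w => ?_
        rw [norm_eq_abs, abs_mul (ind _ _)]
        exact mul_le_of_le_one_left (abs_nonneg _) (ind_abs _ _)
      · refine ae_of_all _ fun w => ?_
        refine tendsto_const_nhds.congr' ?_
        filter_upwards [eventually_ge_atTop ⌈|S w|⌉₊] with k hk
        have : |S w| ≤ k := (Nat.le_ceil _).trans (by exact_mod_cast hk)
        by_cases h : w ∈ A
        · rw [ind_mem h, ind_mem (show w ∈ A' k from ⟨h, this⟩)]
        · rw [ind_nmem h, ind_nmem (show w ∉ A' k from fun h' => h h'.1)]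
    simp_rw [hk] at hlim
    exact (tendsto_nhds_unique hlim tendsto_const_nhds))
  have ha0 : a = 0 := by
    rw [integral_congr_ae ha] at hmean
    simpa using hmean
  refine hPQ.ae_le ?_
  filter_upwards [ha] with w h
  rw [h, ha0]; rfl
end WGs
section StepA
variable {Ω : Type*} {m : MeasurableSpace Ω} {P : Measure Ω} [IsPr P]
  {I : ℕ → Filtration ℕ m} {d : ℕ}
lemma tendsto_toL1 {ι : Type*} {l : Filter ι} [l.IsCountablyGenerated] {F : ι → Lp ℝ 1 P}
 {G : Lp ℝ 1 P} {f : ι → Ω → ℝ} {g h : Ω → ℝ} (hF : ∀ i, F i =ᵐ[P] f i) (hG : G =ᵐ[P] g)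
 (hh : Integrable h P) (hb : ∀ᶠ i in l, ∀ᵐ w ∂P, |f i w| ≤ h w) (hg : ∀ᵐ w ∂P, |g w| ≤ h w)
 (hlim : ∀ᵐ w ∂P, Tendsto (fun i => f i w) l (nhds (g w))) : Tendsto F l (nhds G) := by
  rw [tendsto_iff_norm_sub_tendsto_zero]
  have e : ∀ i, ‖F i - G‖ = ∫ w, |f i w - g w| ∂P := fun i => by
    rw [L1.norm_eq_integral_norm]
    refine integral_congr_ae ?_
    filter_upwards [hF i, hG, Lp.coeFn_sub (F i) G] with w h1 h2 h3
    rw [h3, Pi.sub_apply, h1, h2]; rfl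
  simp_rw [e]
  rw [show (0:ℝ) = ∫ w, (0:ℝ) ∂P by simp]
  refine tendsto_integral_filter_of_dominated_convergence (fun w => 2 * h w) ?_ ?_ (hh.const_mul 2) ?_
  · refine Eventually.of_forall fun i => ?_
    have h1 : AEStronglyMeasurable (f i) P := (Lp.aestronglyMeasurable (F i)).congr (hF i)
    have h2 : AEStronglyMeasurable g P := (Lp.aestronglyMeasurable G).congr hG
    exact (h1.sub h2).norm
  · filter_upwards [hb] with i hi
    filter_upwards [hi, hg] with w h1 h2
    rw [norm_eq_abs, abs_abs]
    have := abs_sub (f i w) (g w)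
    linarith
  · filter_upwards [hlim] with w h
    have := (h.sub_const (g w)).abs
    simpa using this
lemma ext1_int {o : Fin d → Ω → ℝ} (h : ∀ l, Integrable (o l) P) (l : Fin (d+1)) :
 Integrable (ext1 o l) P := by
  refine Fin.cases ?_ (fun l => ?_) l
  · simp [ext1]
  · simpa [ext1] using h l
theorem stepA_core (href : ∀ n0 n i, n0 ≤ n → (I n (i * 2^(n - n0)) : MeasurableSpace Ω) = I n0 i)
 {Z : Ω → ℝ} (hZ : Measurable Z) (hZ0 : ∀ w, 0 < Z w) [IsPr (wd P Z)]
 {o : Fin d → Ω → ℝ} (ho : ∀ l, Integrable (o l) (wd P Z)) (hoP : ∀ l, Integrable (o l) P)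
 (hWG : WG I (wd P Z) o)
 {b : ℕ → Ω → ℝ} (hbm : ∀ k, Measurable (b k)) {Cb : ℝ} (hbC : ∀ k w, |b k w| ≤ Cb)
 {ζ : ℝ → Ω → ℝ} (hζm : ∀ y, Measurable (ζ y))
 (hζs : ∀ y, 0 ≤ y → y < 1 → ∀ w, HasSum (fun k => y^k * b k w) (ζ y w))
 (hζb : ∀ y, 0 ≤ y → y < 1 → ∀ w, |ζ y w| ≤ Cb * (1 + Z w))
 (hζ1 : ∀ w, Tendsto (fun y => ζ y w) (nhdsWithin 1 (Iio 1)) (nhds (Z w)))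
 (hZb : ∀ w, Z w ≤ Cb * (1 + Z w))
 {x : ℕ → ℝ} (hx : Function.Injective x) (hx0 : ∀ j, 0 ≤ x j) (hx1 : ∀ j, x j ≤ 1/4)
 {ρ : ℕ → Ω → ℝ} (hρ : ∀ j, Measurable (ρ j)) {κ : ℕ → ℝ} (hκ : ∀ j, 0 < κ j)
 (hρ1 : ∀ j w, (κ j)⁻¹ ≤ ρ j w) (hρ2 : ∀ j w, ρ j w ≤ κ j)
 [∀ j, IsPr (wd P (ρ j))]
 {L : ℕ → Ω → ℝ} (hLm : ∀ j, Measurable (L j)) (hL : ∀ j w, |L j w| ≤ 1)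
 (hz : ∀ j n i l, hb (I n) P (wd P (ρ j)) (L j) (fun w => ζ (x j) w * ext1 o l w) i =ᵐ[P] 0)
 {D : Ω → ℝ} (hDm : Measurable D) (hD : ∀ w, |D w| ≤ 1) {δ : ℝ} (hδ : 0 < δ)
 (hB : ∀ j, ∀ᶠ n in atTop, δ ≤ ∑ i ∈ Finset.range (2^n),
 ∫ w, ind {w | δ < |hb (I n) P (wd P (ρ j)) (L j) D i w / wb (I n) P D i w|} w
 * (dm (I n) P D i w)^2 ∂P) : False := by
  have hZ0' : ∀ w, 0 ≤ Z w := fun w => (hZ0 w).le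
  have hD' : ∀ᵐ w ∂P, |D w| ≤ 1 := ae_of_all _ hD
  have hCb : 0 ≤ Cb := by
    obtain ⟨w⟩ := nonempty_of_isProbabilityMeasure P
    exact (abs_nonneg _).trans (hbC 0 w)
  have hd : ∀ j n i, ∀ᵐ w ∂P, |dm (I n) (wd P (ρ j)) (L j) i w| ≤ (fun _ => 2 * 1 : ℕ → ℝ) j := fun j n i =>
    (wd_ac' (hρ j) (fun w => (inv_pos.2 (hκ j)).trans_le (hρ1 j w))).ae_le
      (dm_abs zero_le_one (ae_of_all _ (hL j)) i)
  choose u hum hu using fun j => sys_u (P := P) (I := I) (wd P (ρ j)) (L := L j) D (hd j)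
  have := fun n => nuD_fin (I := I) hD' n
  have hZo : ∀ l, Integrable (fun w => Z w * ext1 o l w) P := fun l =>
    (wd_itg hZ hZ0').1 (ext1_int ho l)
  have hei : ∀ l, Integrable (ext1 o l) P := fun l => ext1_int hoP l
  have hbi : ∀ k l, Integrable (fun w => b k w * ext1 o l w) P := fun k l =>
    int_mul (hbm k).aestronglyMeasurable (ae_of_all _ (hbC k)) (hei l)
  have hdom : ∀ l, Integrable (fun w => Cb * (|ext1 o l w| + |Z w * ext1 o l w|)) P := fun l =>
    ((hei l).abs.add (hZo l).abs).const_mul Cb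
  have hle : ∀ y, 0 ≤ y → y < 1 → ∀ l w, |ζ y w * ext1 o l w|
      ≤ Cb * (|ext1 o l w| + |Z w * ext1 o l w|) := fun y h0 h1 l w => by
    rw [abs_mul, abs_mul, abs_of_pos (hZ0 w)]
    have := mul_right_le (hζb y h0 h1 w) (abs_nonneg (ext1 o l w))
    linarith
  have hζi : ∀ y, 0 ≤ y → y < 1 → ∀ l, Integrable (fun w => ζ y w * ext1 o l w) P := fun y h0 h1 l =>
    (hdom l).mono ((hζm y).aestronglyMeasurable.mul (hei l).1) (ae_of_all _ fun w => by
      rw [norm_eq_abs]; exact (hle y h0 h1 l w).trans (le_abs_self _))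
  set v : Fin (d+1) → Lp ℝ 1 P := fun l => (hZo l).toL1 _ with hv
  set b' : ℕ → Fin (d+1) → Lp ℝ 1 P := fun k l => (hbi k l).toL1 _ with hb'
  set Ξ : Fin (d+1) → ℝ → Lp ℝ 1 P := fun l y => if h : 0 ≤ y ∧ y < 1 then (hζi y h.1 h.2 l).toL1 _ else 0 with hΞ
  have hΞe : ∀ l y, 0 ≤ y → y < 1 → Ξ l y =ᵐ[P] fun w => ζ y w * ext1 o l w := fun l y h0 h1 => by
    simp only [hΞ]; rw [dif_pos ⟨h0, h1⟩]; exact Integrable.coeFn_toL1 _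
  have hve : ∀ l, v l =ᵐ[P] fun w => Z w * ext1 o l w := fun l => Integrable.coeFn_toL1 _
  have hbe : ∀ k l, b' k l =ᵐ[P] fun w => b k w * ext1 o l w := fun k l => Integrable.coeFn_toL1 _
  have hDi : Integrable D P := int_bdd hDm.aestronglyMeasurable hD'
  have hbn : ∀ k l, ‖b' k l‖ ≤ Cb * ∑ l, ∫ w, |ext1 o l w| ∂P := by
    intro k l
    have h1 : ‖b' k l‖ ≤ Cb * ∫ w, |ext1 o l w| ∂P := by
      rw [L1.norm_eq_integral_norm, ← integral_const_mul]
      refine integral_mono_ae (L1.integrable_coeFn _).norm ((hei l).abs.const_mul _) ?_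
      filter_upwards [hbe k l] with w h
      rw [h, norm_mul]
      exact mul_right_le (hbC k w) (norm_nonneg _)
    refine h1.trans (mul_left_le ?_ hCb)
    exact Finset.single_le_sum (f := fun l => ∫ w, |ext1 o l w| ∂P)
      (fun l _ => integral_nonneg fun _ => abs_nonneg _) (Finset.mem_univ l)
  refine absA (nuD I P D) (nuD_mass hD') u hum (fun j => ⟨6 * 1 + κ j + 1, fun n f =>
      sys_F2 (hρ j) (hκ j) (hρ1 j) (hρ2 j) (hLm j) zero_lt_one (hL j) hD' (hum j) (hu j) n f⟩)
    (v := v) (G := (HMsub (nuD I P D) u v : Set (Lp ℝ 1 P)))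
    (dense_HM href hd hum hu hZ hZ0 ho hWG hve) (fun g hg => hg)
    (b := b') hbn (Ξ := Ξ) ?_ ?_ hx hx0 hx1 ?_ (f := hDi.toL1 D) hδ ?_
  · intro l y h0 h1
    have hsum : Summable (fun k => y^k • b' k l) := by
      refine Summable.of_norm_bounded (g := fun k => y^k * (Cb * ∑ l, ∫ w, |ext1 o l w| ∂P))
        ((summable_geometric_of_lt_one h0 h1).mul_right _) fun k => ?_
      rw [norm_smul, norm_eq_abs, abs_of_nonneg (pow_nonneg h0 k)]
      exact mul_left_le (hbn k l) (pow_nonneg h0 k)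
    rw [hsum.hasSum_iff_tendsto_nat]
    refine tendsto_toL1 (f := fun N w => (∑ k ∈ Finset.range N, y^k * b k w) * ext1 o l w)
      (h := fun w => (Cb * (1-y)⁻¹) * |ext1 o l w|) ?_ (hΞe l y h0 h1) ((hei l).abs.const_mul _) ?_ ?_ ?_
    · intro N
      induction N with
      | zero =>
        simp only [Finset.range_zero, sum_empty, zero_mul]
        exact Lp.coeFn_zero ℝ 1 P
      | succ N ih =>
        rw [sum_range_succ]
        filter_upwards [Lp.coeFn_add (∑ k ∈ Finset.range N, y^k • b' k l) (y^N • b' N l), ih,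
          Lp.coeFn_smul (y^N) (b' N l), hbe N l] with w h1 h2 h3 h4
        rw [h1, Pi.add_apply, h2, h3, Pi.smul_apply, h4, sum_range_succ, smul_eq_mul]; ring
    · refine Eventually.of_forall fun N => ae_of_all _ fun w => ?_
      rw [abs_mul]
      refine mul_right_le ?_ (abs_nonneg _)
      calc |∑ k ∈ Finset.range N, y^k * b k w| ≤ ∑ k ∈ Finset.range N, y^k * Cb := by
            refine (abs_sum_le_sum_abs _ _).trans (sum_le_sum fun k _ => ?_)
            rw [abs_mul, abs_of_nonneg (pow_nonneg h0 k)]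
            exact mul_left_le (hbC k w) (pow_nonneg h0 k)
        _ = Cb * ∑ k ∈ Finset.range N, y^k := by rw [← sum_mul, mul_comm]
        _ ≤ Cb * (1-y)⁻¹ := by
            refine mul_left_le ?_ hCb
            rw [← tsum_geometric_of_lt_one h0 h1]
            exact (summable_geometric_of_lt_one h0 h1).sum_le_tsum _ fun k _ => pow_nonneg h0 k
    · refine ae_of_all _ fun w => ?_
      rw [abs_mul]
      refine mul_right_le ?_ (abs_nonneg _)
      rw [← (hζs y h0 h1 w).tsum_eq]
      have hg := (hasSum_geometric_of_lt_one h0 h1).mul_left Cb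
      have : ‖∑' k, y^k * b k w‖ ≤ Cb * (1-y)⁻¹ := tsum_of_norm_bounded hg fun k => by
        rw [norm_mul, norm_eq_abs, abs_of_nonneg (pow_nonneg h0 k), mul_comm]
        exact mul_right_le (hbC k w) (pow_nonneg h0 k)
      exact this
    · refine ae_of_all _ fun w => ?_
      exact ((hζs y h0 h1 w).tendsto_sum_nat).mul_const _
  · intro l
    have hev : ∀ᶠ y in nhdsWithin (1:ℝ) (Iio 1), 0 ≤ y ∧ y < 1 := by
      have h1 : ∀ᶠ y in nhdsWithin (1:ℝ) (Iio 1), 0 ≤ y := nhdsWithin_le_nhds (by filter_upwards [Ioi_mem_nhds (show (0:ℝ) < 1 by norm_num)] with y hy using le_of_lt hy)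
      filter_upwards [h1, self_mem_nhdsWithin] with y a b using ⟨a, b⟩
    refine tendsto_toL1 (f := fun y w => if 0 ≤ y ∧ y < 1 then ζ y w * ext1 o l w else 0) ?_ (hve l) (hdom l) ?_ ?_ ?_
    · intro y
      by_cases h : 0 ≤ y ∧ y < 1
      · simp only [h, and_self, if_true]; exact hΞe l y h.1 h.2
      · simp only [hΞ]; rw [dif_neg h]; simp only [h, if_false]; exact Lp.coeFn_zero ℝ 1 P
    · filter_upwards [hev] with y h
      refine ae_of_all _ fun w => ?_
      rw [if_pos h]; exact hle y h.1 h.2 l w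
    · refine ae_of_all _ fun w => ?_
      rw [abs_mul, abs_of_pos (hZ0 w)]
      have := mul_right_le (hZb w) (abs_nonneg (ext1 o l w))
      linarith
    · refine ae_of_all _ fun w => ?_
      refine ((hζ1 w).mul_const (ext1 o l w)).congr' ?_
      filter_upwards [hev] with y h
      rw [if_pos h]
  · intro j l
    have h14 : x j < 1 := (hx1 j).trans_lt (by norm_num)
    refine Eventually.of_forall fun n => nuD_ae n (hum j _) measurable_const fun i _ => ?_
    filter_upwards [hu j (Ξ l (x j)) n i,
      hb_congr (O := I n) (Q := wd P (ρ j)) (L := L j) (i := i) (hΞe l (x j) (hx0 j) h14),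
      hz j n i l] with w h1 h2 h3
    rw [h1, h2, h3]; simp
  · intro j
    filter_upwards [hB j] with n hn
    refine hn.trans (le_of_eq ?_)
    rw [nuD_real hD' n (measurableSet_lt measurable_const (hum j _).abs)]
    refine sum_congr rfl fun i _ => integral_congr_ae ?_
    filter_upwards [hu j (hDi.toL1 D) n i, hb_congr (O := I n) (Q := wd P (ρ j)) (L := L j) (i := i)
      hDi.coeFn_toL1] with w h1 h2
    congr 1
    simp only [ind, indicator, mem_setOf_eq]
    rw [h1, h2]
end StepA
section F5
variable {Ω : Type*} {m : MeasurableSpace Ω} {P : Measure Ω} [IsPr P]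
  {O : Filtration ℕ m}
lemma wd_inv_int {ρ : Ω → ℝ} (hρ : Measurable ρ) (hρ0 : ∀ w, 0 < ρ w) (g : Ω → ℝ) :
 ∫ w, g w ∂P = ∫ w, (ρ w)⁻¹ * g w ∂(wd P ρ) := by
  rw [wd_int hρ (fun w => (hρ0 w).le)]
  congr 1; ext w
  rw [← mul_assoc, mul_inv_cancel₀ (hρ0 w).ne', one_mul]
lemma energy_dm {Q : Measure Ω} [IsPr Q] {L : Ω → ℝ} {c : ℝ} (hc : 0 ≤ c)
 (hb : ∀ᵐ w ∂Q, |L w| ≤ c) (N : ℕ) :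
 ∑ i ∈ Finset.range N, ∫ w, (dm O Q L i w)^2 ∂Q ≤ c^2 := energy_one (L := fun i => Q[L | O i]) (martingale_condExp L O Q)
    (fun i => ce_abs hc hb (O i)) N
lemma small_second {ρ : Ω → ℝ} (hρ : Measurable ρ) (hρ0 : ∀ w, 0 < ρ w) {s : ℝ} (hs0 : 0 ≤ s)
 (hs : ∀ w, |(ρ w)⁻¹ - 1| ≤ s) [IsPr (wd P ρ)]
 {L : Ω → ℝ} (hL : ∀ w, |L w| ≤ 1) {g : ℕ → Ω → ℝ}
 (hg : ∀ i, StronglyMeasurable[O i] (g i)) (hgb : ∀ i, ∀ᵐ w ∂P, |g i w| ≤ 1) (N : ℕ) :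
 |∑ i ∈ Finset.range N, ∫ w, g i w * dm O (wd P ρ) L i w ∂P| ≤ s := by
  set Q := wd P ρ with hQ
  have hQP : Q ≪ P := wd_ac ρ
  have hgb' : ∀ i, ∀ᵐ w ∂Q, |g i w| ≤ 1 := fun i => hQP.ae_le (hgb i)
  have hdb : ∀ i, ∀ᵐ w ∂Q, |dm O Q L i w| ≤ 2 := fun i => by
    simpa using dm_abs (O := O) zero_le_one (ae_of_all Q hL) i
  set h : Ω → ℝ := fun w => (ρ w)⁻¹ - 1 with hh
  have hhm : Measurable h := hρ.inv.sub_const 1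
  have hhi : Integrable h Q := int_bdd hhm.aestronglyMeasurable (ae_of_all _ hs)
  have hhb : ∀ i, ∀ᵐ w ∂Q, |(Q[h | O i]) w| ≤ s := fun i => ce_abs hs0 (ae_of_all _ hs) _
  have hgm : ∀ i, AEStronglyMeasurable (g i) Q := fun i => aesm_of (O.le i) (hg i)
  have hgd : ∀ i, Integrable (fun w => g i w * dm O Q L i w) Q := fun i =>
    int_mul (hgm i) (hgb' i) (int_bdd (dm_aesm Q Q L i) (hdb i))
  have hcm : ∀ i, AEStronglyMeasurable (Q[h | O i]) Q := fun i => integrable_condExp.1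
  have hterm : ∀ i, ∫ w, g i w * dm O Q L i w ∂P = ∫ w, (g i w * dm O Q L i w) * dm O Q h i w ∂Q := by
    intro i
    rw [wd_inv_int hρ hρ0]
    have hgd2 : ∀ w, |h w| ≤ s := hs
    have e1 : Integrable (fun w => h w * (g i w * dm O Q L i w)) Q := int_mul hhm.aestronglyMeasurable (ae_of_all _ hs) (hgd i)
    have z0 : ∫ w, g i w * dm O Q L i w ∂Q = 0 := dm_orth L (hg i)
      (int_mul (hgm i) (hgb' i) integrable_condExp)
    have s1 : ∫ w, (ρ w)⁻¹ * (g i w * dm O Q L i w) ∂Q = ∫ w, (g i w * dm O Q L i w) * h w ∂Q := by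
      have : ∀ w, (ρ w)⁻¹ * (g i w * dm O Q L i w) =
        h w * (g i w * dm O Q L i w) + g i w * dm O Q L i w := fun w => by simp only [hh]; ring
      simp_rw [this]
      rw [integral_add e1 (hgd i), z0, add_zero]
      congr 1; ext w; ring
    have hphi : StronglyMeasurable[O (i+1)] (fun w => g i w * dm O Q L i w) := ((hg i).mono (O.mono (Nat.le_succ i))).mul (dm_sm Q L i)
    rw [s1, ← pull (O.le (i+1)) hphi (by simpa [mul_comm] using e1) hhi]
    have z1 : ∫ w, (g i w * (Q[h|O i]) w) * dm O Q L i w ∂Q = 0 := by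
      refine dm_orth L ((hg i).mul stronglyMeasurable_condExp) ?_
      refine int_mul (c := 1 * s) ((hgm i).mul (hcm i)) ?_ integrable_condExp
      filter_upwards [hgb' i, hhb i] with w h1 h2
      rw [abs_mul]; exact mul_le_mul h1 h2 (abs_nonneg _) zero_le_one
    have i1 : Integrable (fun w => (g i w * dm O Q L i w) * (Q[h|O (i+1)]) w) Q := by
      simpa [mul_comm] using int_mul (hcm (i+1)) (hhb (i+1)) (hgd i)
    have i2 : Integrable (fun w => (g i w * (Q[h|O i]) w) * dm O Q L i w) Q := by
      refine (int_mul (hcm i) (hhb i) (hgd i)).congr (ae_of_all _ fun w => ?_)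
      dsimp; ring
    have : ∀ w, (g i w * dm O Q L i w) * dm O Q h i w =
      (g i w * dm O Q L i w) * (Q[h|O (i+1)]) w - (g i w * (Q[h|O i]) w) * dm O Q L i w := fun w => by
        simp only [dm]; ring
    simp_rw [this]
    rw [integral_sub i1 i2, z1, sub_zero]
  simp_rw [hterm]
  have hd2 : ∀ i, Integrable (fun w => (dm O Q L i w)^2) Q := fun i =>
    int_bdd (c := 4) ((dm_aesm Q Q L i).pow 2) (by
      filter_upwards [hdb i] with w h1
      rw [abs_pow]; have := abs_nonneg (dm O Q L i w); nlinarith)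
  have hh2 : ∀ i, Integrable (fun w => (dm O Q h i w)^2) Q := fun i =>
    int_bdd (c := (2*s)^2) ((dm_aesm Q Q h i).pow 2) (by
      filter_upwards [dm_abs (O := O) hs0 (ae_of_all Q hs) i] with w h1
      rw [abs_pow]; exact pow_le_pow_left₀ (abs_nonneg _) h1 2)
  have hgd2 : ∀ i, Integrable (fun w => (g i w * dm O Q L i w)^2) Q := fun i => by
    refine (hd2 i).mono (((hgm i).mul (dm_aesm Q Q L i)).pow 2) ?_
    filter_upwards [hgb' i] with w h1
    rw [norm_eq_abs, norm_eq_abs, abs_of_nonneg (sq_nonneg _)]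
    rw [abs_of_nonneg (sq_nonneg _), mul_pow]
    have : (g i w)^2 ≤ 1 := by rw [← sq_abs]; exact pow_le_one₀ (abs_nonneg _) h1
    nlinarith [sq_nonneg (dm O Q L i w)]
  have hab : ∀ i, Integrable (fun w => (g i w * dm O Q L i w) * dm O Q h i w) Q := fun i => by
    simpa [mul_comm] using int_mul (dm_aesm Q Q h i) (dm_abs (O := O) hs0 (ae_of_all Q hs) i) (hgd i)
  have hα : ∑ i ∈ Finset.range N, ∫ w, (g i w * dm O Q L i w)^2 ∂Q ≤ 1 := by
    refine (sum_le_sum fun i _ => ?_).trans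
      ((energy_dm (O := O) zero_le_one (ae_of_all Q hL) N).trans (by norm_num))
    refine integral_mono_ae (hgd2 i) (hd2 i) ?_
    filter_upwards [hgb' i] with w h1
    rw [mul_pow]
    have : (g i w)^2 ≤ 1 := by rw [← sq_abs]; exact pow_le_one₀ (abs_nonneg _) h1
    nlinarith [sq_nonneg (dm O Q L i w)]
  have := cs_sum (Finset.range N) hgd2 hh2 hab hα (energy_dm (O := O) hs0 (ae_of_all Q hs) N)
  rwa [Real.sqrt_one, one_mul, Real.sqrt_sq hs0] at this
lemma F5_level {ρ : Ω → ℝ} (hρ : Measurable ρ) (hρ0 : ∀ w, 0 < ρ w) {s : ℝ} (hs0 : 0 ≤ s) (hs1 : s ≤ 1)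
 (hs : ∀ w, |(ρ w)⁻¹ - 1| ≤ s) [IsPr (wd P ρ)]
 {L D : Ω → ℝ} (hL : ∀ w, |L w| ≤ 1) (hDm : Measurable D) (hD : ∀ w, |D w| ≤ 1)
 {i0 N : ℕ} (hi : i0 ≤ N) {A : Set Ω} (hA : MeasurableSet[O i0] A) {δ : ℝ} (hδ : 0 < δ) :
 |∫ w, ind A w * (((wd P ρ)[L|O N]) w - ((wd P ρ)[L|O i0]) w) * D w ∂P| ≤
 δ + √2 * √(∑ i ∈ Finset.range N,
 ∫ w, ind {w | δ < |hb O P (wd P ρ) L D i w / wb O P D i w|} w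
 * (dm O P D i w)^2 ∂P) + s := by
  set Q := wd P ρ with hQ
  have hPQ : P ≪ Q := wd_ac' hρ hρ0
  have hdb : ∀ i, ∀ᵐ w ∂P, |dm O Q L i w| ≤ 2 := fun i => by
    have h := dm_abs (O := O) zero_le_one (ae_of_all Q hL) i
    rw [mul_one] at h
    exact hPQ.ae_le h
  have hD' : ∀ᵐ w ∂P, |D w| ≤ 1 := ae_of_all _ hD
  have hDi : Integrable D P := int_bdd hDm.aestronglyMeasurable hD'
  set T : ℕ → Set Ω := fun i => {w | δ < |hb O P Q L D i w / wb O P D i w|} with hT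
  set W : ℕ → Set Ω := fun i => {w | wb O P D i w = 0} with hW
  set φ : ℕ → Ω → ℝ := fun r w => if i0 ≤ r then ind A w else 0 with hφ
  have hφm : ∀ r, StronglyMeasurable[O r] (φ r) := fun r => by
    by_cases h : i0 ≤ r
    · simp only [hφ, h, if_true]; exact (ind_sm hA).mono (O.mono h)
    · simp only [hφ, h, if_false]; exact stronglyMeasurable_const
  have hφb : ∀ r w, |φ r w| ≤ 1 := fun r w => by
    by_cases h : i0 ≤ r
    · simp only [hφ, h, if_true]; exact ind_abs _ _
    · simp only [hφ, h, if_false]; simp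
  have hTm : ∀ r, MeasurableSet[O r] (T r) := fun r => by
    have h1 : Measurable[O r] (fun w => |hb O P Q L D r w / wb O P D r w|) := by
      have a : StronglyMeasurable[O r] (hb O P Q L D r) := stronglyMeasurable_condExp
      have b : StronglyMeasurable[O r] (wb O P D r) := stronglyMeasurable_condExp
      have c : Measurable[O r] (fun w => hb O P Q L D r w / wb O P D r w) := Measurable.div a.measurable b.measurable
      exact continuous_abs.measurable.comp c
    exact @measurableSet_lt _ _ _ _ _ (O r) _ _ _ _ _ measurable_const h1
  have hWm : ∀ r, MeasurableSet[O r] (W r) := fun r => by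
    have b : StronglyMeasurable[O r] (wb O P D r) := stronglyMeasurable_condExp
    exact b.measurable (measurableSet_singleton 0)
  set B : ℕ → Set Ω := fun r => T r ∪ W r with hB
  have hBm : ∀ r, MeasurableSet[O r] (B r) := fun r => (hTm r).union (hWm r)
  have htel : ∀ w, ind A w * ((Q[L|O N]) w - (Q[L|O i0]) w) * D w
      = ∑ r ∈ Finset.range N, φ r w * dm O Q L r w * D w := by
    intro w
    rw [← sum_mul]; congr 1
    induction N, hi using Nat.le_induction with
    | base =>
      rw [sub_self, mul_zero]; symm
      refine sum_eq_zero fun r hr => ?_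
      simp [hφ, not_le.2 (Finset.mem_range.1 hr)]
    | succ N hN ih =>
      rw [sum_range_succ, ← ih]; simp only [hφ, hN, if_true, dm]; ring
  have hdI : ∀ r, Integrable (dm O Q L r) P := fun r => int_bdd (dm_aesm P Q L r) (hdb r)
  have hdD : ∀ r, Integrable (fun w => dm O Q L r w * D w) P := fun r =>
    (int_mul hDm.aestronglyMeasurable hD' (hdI r)).congr (ae_of_all _ fun w => mul_comm _ _)
  have hφa : ∀ r, AEStronglyMeasurable (φ r) P := fun r => aesm_of (O.le r) (hφm r)
  have hφd : ∀ r, Integrable (fun w => φ r w * dm O Q L r w * D w) P := fun r => by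
    simpa [mul_assoc] using int_mul (hφa r) (ae_of_all _ (hφb r)) (hdD r)
  simp_rw [htel]
  rw [integral_finsetSum _ fun r _ => hφd r]
  have hind : ∀ r (C : Set Ω), MeasurableSet[O r] C → StronglyMeasurable[O r] (fun w => ind C w * φ r w) := fun r C hC => (ind_sm hC).mul (hφm r)
  have hindb : ∀ r (C : Set Ω) w, |ind C w * φ r w| ≤ 1 := fun r C w => by
    rw [abs_mul]; exact mul_le_one₀ (ind_abs _ _) (abs_nonneg _) (hφb r w)
  have hcD : ∀ i, ∀ᵐ w ∂P, |(P[D | O i]) w| ≤ 1 := fun i => ce_abs zero_le_one hD' _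
  have hcm : ∀ i, AEStronglyMeasurable (P[D | O i]) P := fun i => integrable_condExp.1
  have hpart : ∀ r, ∫ w, φ r w * dm O Q L r w * D w ∂P =
      ∫ w, (ind (B r)ᶜ w * φ r w) * (dm O Q L r w * D w) ∂P
      + ∫ w, (ind (B r) w * φ r w * dm O P D r w) * dm O Q L r w ∂P
      + ∫ w, (ind (B r) w * φ r w * (P[D|O r]) w) * dm O Q L r w ∂P := by
    intro r
    have i1 : Integrable (fun w => (ind (B r)ᶜ w * φ r w) * (dm O Q L r w * D w)) P := int_mul (aesm_of (O.le r) (hind r _ (hBm r).compl)) (ae_of_all _ (hindb r _)) (hdD r)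
    have i2 : Integrable (fun w => (ind (B r) w * φ r w) * (dm O Q L r w * D w)) P := int_mul (aesm_of (O.le r) (hind r _ (hBm r))) (ae_of_all _ (hindb r _)) (hdD r)
    have i0' : Integrable (fun w => (ind (B r) w * φ r w) * dm O Q L r w) P := int_mul (aesm_of (O.le r) (hind r _ (hBm r))) (ae_of_all _ (hindb r _)) (hdI r)
    have e1 : ∀ w, φ r w * dm O Q L r w * D w = (ind (B r)ᶜ w * φ r w) * (dm O Q L r w * D w)
        + (ind (B r) w * φ r w) * (dm O Q L r w * D w) := fun w => by
      by_cases h : w ∈ B r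
      · rw [ind_mem h, ind_nmem (by simpa using h)]; ring
      · rw [ind_nmem h, ind_mem (by simpa using h)]; ring
    simp_rw [e1]
    rw [integral_add i1 i2, add_assoc]; congr 1
    have hsm : StronglyMeasurable[O (r+1)] (fun w => ind (B r) w * φ r w * dm O Q L r w) := ((hind r _ (hBm r)).mono (O.mono (Nat.le_succ r))).mul (dm_sm Q L r)
    have p := pull (Q := P) (O.le (r+1)) hsm (by simpa [mul_assoc] using i2) hDi
    have e2 : ∫ w, (ind (B r) w * φ r w) * (dm O Q L r w * D w) ∂P
       = ∫ w, (ind (B r) w * φ r w * dm O Q L r w) * D w ∂P := by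
      congr 1; ext w; ring
    rw [e2, ← p]
    have j : ∀ i, Integrable (fun w => (ind (B r) w * φ r w * (P[D|O i]) w) * dm O Q L r w) P := fun i =>
      (int_mul (hcm i) (hcD i) i0').congr (ae_of_all _ fun w => by dsimp only; ring)
    have j2 : Integrable (fun w => (ind (B r) w * φ r w * dm O P D r w) * dm O Q L r w) P := ((j (r+1)).sub (j r)).congr (ae_of_all _ fun w => by simp only [Pi.sub_apply, dm]; ring)
    rw [← integral_add j2 (j r)]
    congr 1; ext w; simp only [dm]; ring
  simp_rw [hpart]
  rw [sum_add_distrib, sum_add_distrib]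
  have b1 : |∑ r ∈ Finset.range N, ∫ w, (ind (B r)ᶜ w * φ r w) * (dm O Q L r w * D w) ∂P| ≤ δ := by
    calc _ ≤ ∑ r ∈ Finset.range N, |∫ w, (ind (B r)ᶜ w * φ r w) * (dm O Q L r w * D w) ∂P| := abs_sum_le_sum_abs _ _
      _ ≤ ∑ r ∈ Finset.range N, δ * ∫ w, (dm O P D r w)^2 ∂P := by
          refine sum_le_sum fun r _ => ?_
          have i1 : Integrable (fun w => (ind (B r)ᶜ w * φ r w) * (dm O Q L r w * D w)) P := int_mul (aesm_of (O.le r) (hind r _ (hBm r).compl)) (ae_of_all _ (hindb r _)) (hdD r)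
          rw [← pull (O.le r) (hind r _ (hBm r).compl) i1 (hdD r)]
          have e3 : ∫ w, (dm O P D r w)^2 ∂P = ∫ w, wb O P D r w ∂P := (integral_condExp (O.le r)).symm
          rw [e3, ← integral_const_mul]
          have := norm_integral_le_of_norm_le (μ := P) (f := fun w => (ind (B r)ᶜ w * φ r w) *
            (P[fun w => dm O Q L r w * D w | O r]) w) (g := fun w => δ * wb O P D r w)
            (integrable_condExp.const_mul δ) ?_
          · exact this
          filter_upwards [wb_nonneg (P := P) (O := O) D r] with w h0
          have h0 : 0 ≤ wb O P D r w := h0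
          by_cases h : w ∈ B r
          · rw [ind_nmem (by simpa using h), zero_mul, zero_mul, norm_zero]; positivity
          · have h1 : w ∉ T r := fun h' => h (Or.inl h')
            have h2 : wb O P D r w ≠ 0 := fun h' => h (Or.inr h')
            have h3 : |hb O P Q L D r w / wb O P D r w| ≤ δ := not_lt.1 h1
            rw [abs_div, abs_of_nonneg h0, div_le_iff₀ (lt_of_le_of_ne h0 h2.symm)] at h3
            rw [norm_mul]
            calc _ ≤ 1 * |hb O P Q L D r w| := mul_right_le (hindb r _ w) (abs_nonneg _)
              _ ≤ _ := by rw [one_mul]; exact h3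
      _ = δ * ∑ r ∈ Finset.range N, ∫ w, (dm O P D r w)^2 ∂P := by rw [mul_sum]
      _ ≤ δ * 1 := mul_left_le (energy_D hD' N) hδ.le
      _ = δ := mul_one δ
  have b3 : |∑ r ∈ Finset.range N, ∫ w, (ind (B r) w * φ r w * (P[D|O r]) w) * dm O Q L r w ∂P| ≤ s := by
    refine small_second hρ hρ0 hs0 hs hL (fun r => (hind r _ (hBm r)).mul stronglyMeasurable_condExp) ?_ N
    intro r
    filter_upwards [hcD r] with w h
    rw [Pi.mul_apply, abs_mul]; exact mul_le_one₀ (hindb r _ w) (abs_nonneg _) h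
  have hd2 : ∀ i, Integrable (fun w => (dm O Q L i w)^2) P := fun i =>
    int_bdd (c := 4) ((dm_aesm P Q L i).pow 2) (by
      filter_upwards [hdb i] with w h1
      rw [abs_pow]; have := abs_nonneg (dm O Q L i w); nlinarith)
  have hD2 : ∀ i, Integrable (fun w => (dm O P D i w)^2) P := fun i => wb_int hD' i
  have hBle : ∀ r w, (ind (B r) w * φ r w * dm O P D r w)^2 ≤ ind (B r) w * (dm O P D r w)^2 := fun r w => by
    have h1 : (φ r w)^2 ≤ 1 := by rw [← sq_abs]; exact pow_le_one₀ (abs_nonneg _) (hφb r w)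
    by_cases h : w ∈ B r
    · rw [ind_mem h]; nlinarith [sq_nonneg (dm O P D r w)]
    · rw [ind_nmem h]; simp
  have hBI : ∀ r, Integrable (fun w => ind (B r) w * (dm O P D r w)^2) P := fun r =>
    int_indm (O.le r _ (hBm r)) (hD2 r)
  have hTI : ∀ r, Integrable (fun w => ind (T r) w * (dm O P D r w)^2) P := fun r =>
    int_indm (O.le r _ (hTm r)) (hD2 r)
  have hWI : ∀ r, Integrable (fun w => ind (W r) w * (dm O P D r w)^2) P := fun r =>
    int_indm (O.le r _ (hWm r)) (hD2 r)
  have hBDI : ∀ r, Integrable (fun w => (ind (B r) w * φ r w * dm O P D r w)^2) P := fun r => by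
    refine (hBI r).mono (((aesm_of (O.le r) (hind r _ (hBm r))).mul (dm_aesm P P D r)).pow 2) ?_
    refine ae_of_all _ fun w => ?_
    rw [norm_eq_abs, norm_eq_abs]
    refine abs_le_abs_of_nonneg ?_ (hBle r w)
    exact sq_nonneg _
  have b2 := cs_sum (Q := P) (a := fun r w => ind (B r) w * φ r w * dm O P D r w)
    (b := fun r => dm O Q L r) (Finset.range N) hBDI hd2 (fun r => by
      refine (int_mul (c := 4) (φ := fun w => ind (B r) w * φ r w * dm O P D r w)
        ((aesm_of (O.le r) (hind r _ (hBm r))).mul (dm_aesm P P D r)) ?_ (hdI r))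
      filter_upwards [dm_abs (O := O) zero_le_one hD' r] with w h
      rw [abs_mul]
      have := mul_le_mul (hindb r (B r) w) h (abs_nonneg _) zero_le_one
      linarith) (α := ∑ i ∈ Finset.range N, ∫ w, ind (T i) w * (dm O P D i w)^2 ∂P) (β := 2) ?_ ?_
  · have t := abs_add_three (∑ r ∈ Finset.range N, ∫ w, (ind (B r)ᶜ w * φ r w) * (dm O Q L r w * D w) ∂P)
      (∑ r ∈ Finset.range N, ∫ w, (ind (B r) w * φ r w * dm O P D r w) * dm O Q L r w ∂P)
      (∑ r ∈ Finset.range N, ∫ w, (ind (B r) w * φ r w * (P[D|O r]) w) * dm O Q L r w ∂P)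
    rw [mul_comm] at b2
    linarith
  · refine sum_le_sum fun r _ => ?_
    have hW0 : ∫ w, ind (W r) w * (dm O P D r w)^2 ∂P = 0 := by
      rw [← pull (O.le r) (ind_sm (hWm r)) (hWI r) (hD2 r)]
      rw [show (0:ℝ) = ∫ w, (0:ℝ) ∂P by simp]
      congr 1; ext w
      by_cases h : w ∈ W r
      · have : (P[fun w => (dm O P D r w)^2 | O r]) w = 0 := h
        rw [this, mul_zero]
      · rw [ind_nmem h, zero_mul]
    rw [← add_zero (∫ w, ind (T r) w * (dm O P D r w)^2 ∂P), ← hW0, ← integral_add (hTI r) (hWI r)]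
    refine integral_mono (hBDI r) ((hTI r).add (hWI r)) fun w => (hBle r w).trans ?_
    have : ind (B r) w ≤ ind (T r) w + ind (W r) w := by
      by_cases h : w ∈ B r
      · rw [ind_mem h]
        rcases h with h | h
        · rw [ind_mem h]; linarith [ind_nn (W r) w]
        · rw [ind_mem h]; linarith [ind_nn (T r) w]
      · rw [ind_nmem h]; linarith [ind_nn (W r) w, ind_nn (T r) w]
    have := mul_right_le this (sq_nonneg (dm O P D r w))
    linarith
  · calc ∑ i ∈ Finset.range N, ∫ w, (dm O Q L i w)^2 ∂P
        ≤ ∑ i ∈ Finset.range N, 2 * ∫ w, (dm O Q L i w)^2 ∂Q := by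
          refine sum_le_sum fun r _ => ?_
          rw [wd_inv_int hρ hρ0, ← integral_const_mul]
          have hd2' : Integrable (fun w => (dm O Q L r w)^2) Q := int_bdd (c := 4) ((dm_aesm Q Q L r).pow 2) (by
              have hdbQ : ∀ᵐ w ∂Q, |dm O Q L r w| ≤ 2 := by
                simpa using dm_abs (O := O) zero_le_one (ae_of_all Q hL) r
              filter_upwards [hdbQ] with w h1
              rw [abs_pow]; have := abs_nonneg (dm O Q L r w); nlinarith)
          have h2 : ∀ w, |(ρ w)⁻¹| ≤ 2 := fun w => by
            rw [abs_of_pos (inv_pos.2 (hρ0 w))]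
            have := (abs_le.1 (hs w)).2; linarith
          refine integral_mono (int_mul hρ.inv.aestronglyMeasurable (ae_of_all _ h2) hd2')
            (hd2'.const_mul 2) fun w => ?_
          exact mul_right_le ((le_abs_self _).trans (h2 w)) (sq_nonneg _)
      _ = 2 * ∑ i ∈ Finset.range N, ∫ w, (dm O Q L i w)^2 ∂Q := by rw [mul_sum]
      _ ≤ 2 * 1^2 := mul_left_le
          (energy_dm (O := O) zero_le_one (ae_of_all Q hL) N) zero_le_two
      _ = 2 := by norm_num
end F5
section Zet
variable {Ω : Type*} {m : MeasurableSpace Ω}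
def bet (Z : Ω → ℝ) (w : Ω) : ℝ := Z w / (1 + Z w)
def bk (Z : Ω → ℝ) (k : ℕ) (w : Ω) : ℝ := (if k = 0 then 0 else (bet Z w)^k) +
  (if k = 0 then 1 else 0) - (if k = 1 then 1 else 0)
def zet (Z : Ω → ℝ) (y : ℝ) (w : Ω) : ℝ := 1 - y + y * bet Z w / (1 - y * bet Z w)
variable {Z : Ω → ℝ}
lemma bet_meas (hZ : Measurable Z) : Measurable (bet Z) := hZ.div (measurable_const.add hZ)
lemma bet_pos (h : ∀ w, 0 < Z w) (w : Ω) : 0 < bet Z w := div_pos (h w) (by linarith [h w])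
lemma bet_lt (h : ∀ w, 0 < Z w) (w : Ω) : bet Z w < 1 := by
  unfold bet; rw [div_lt_one (by linarith [h w])]; linarith
lemma zet_meas (hZ : Measurable Z) (y : ℝ) : Measurable (zet Z y) := by
  have := bet_meas hZ
  unfold zet; fun_prop
lemma bk_meas (hZ : Measurable Z) (k : ℕ) : Measurable (bk Z k) := by
  have := bet_meas hZ
  unfold bk
  by_cases h : k = 0
  · simp [h]
  · simp only [h, if_false]; fun_prop
lemma bk_abs (h : ∀ w, 0 < Z w) (k : ℕ) (w : Ω) : |bk Z k w| ≤ 1 := by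
  have h0 := bet_pos h w
  have h1 := bet_lt h w
  unfold bk
  rcases Nat.eq_zero_or_pos k with rfl | hk
  · simp
  have p0 : 0 ≤ bet Z w ^ k := pow_nonneg h0.le k
  have p1 : bet Z w ^ k ≤ 1 := pow_le_one₀ h0.le h1.le
  have hk0 : k ≠ 0 := by omega
  rw [abs_le]
  by_cases h2 : k = 1
  · simp [h2]; constructor <;> linarith
  · simp [hk0, h2]; constructor <;> linarith
lemma zet_sum (h : ∀ w, 0 < Z w) {y : ℝ} (hy : 0 ≤ y) (hy1 : y < 1) (w : Ω) :
 HasSum (fun k => y^k * bk Z k w) (zet Z y w) := by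
  have h0 := bet_pos h w
  have h1 := bet_lt h w
  have hb0 : 0 ≤ y * bet Z w := by positivity
  have hb1 : y * bet Z w < 1 := by nlinarith
  have g := hasSum_geometric_of_lt_one hb0 hb1
  have e1 : HasSum (fun k : ℕ => if k = 1 then y else 0) y := hasSum_ite_eq 1 y
  have := g.sub e1
  have hf : (fun k => y^k * bk Z k w) = fun k => (y * bet Z w)^k - (if k = 1 then y else 0) := by
    ext k
    unfold bk
    rcases Nat.eq_zero_or_pos k with rfl | hk
    · simp
    have hk0 : k ≠ 0 := by omega
    by_cases h2 : k = 1
    · subst h2; simp; ring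
    · simp [hk0, h2, mul_pow]
  have hv : zet Z y w = (1 - y * bet Z w)⁻¹ - y := by
    unfold zet
    have hne : 1 - y * bet Z w ≠ 0 := by linarith
    rw [eq_sub_iff_add_eq, ← one_div, eq_div_iff hne, add_mul, add_mul, div_mul_cancel₀ _ hne]; ring
  rw [hf, hv]; exact this
lemma zet_pos (h : ∀ w, 0 < Z w) {y : ℝ} (hy : 0 ≤ y) (hy1 : y < 1) (w : Ω) : 0 < zet Z y w := by
  have h0 := bet_pos h w
  have h1 := bet_lt h w
  have hb1 : y * bet Z w < 1 := by nlinarith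
  have : 0 ≤ y * bet Z w / (1 - y * bet Z w) := div_nonneg (by positivity) (by linarith)
  unfold zet; linarith
lemma zet_le (h : ∀ w, 0 < Z w) {y : ℝ} (hy : 0 ≤ y) (hy1 : y < 1) (w : Ω) : zet Z y w ≤ 1 + Z w := by
  have h0 := bet_pos h w
  have h1 := bet_lt h w
  have hb1 : y * bet Z w < 1 := by nlinarith
  have e : bet Z w / (1 - bet Z w) = Z w := by
    unfold bet
    have := h w
    field_simp; ring
  have : y * bet Z w / (1 - y * bet Z w) ≤ bet Z w / (1 - bet Z w) := div_le_div₀ h0.le (by nlinarith) (by linarith) (by nlinarith)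
  unfold zet; linarith
lemma zet_lim (h : ∀ w, 0 < Z w) (w : Ω) :
 Tendsto (fun y => zet Z y w) (nhdsWithin 1 (Iio 1)) (nhds (Z w)) := by
  have h1 := bet_lt h w
  have e : zet Z 1 w = Z w := by
    unfold zet bet
    have := h w
    field_simp; ring
  rw [← e]
  have : ContinuousAt (fun y => zet Z y w) 1 := by
    unfold zet
    refine ContinuousAt.add (by fun_prop) (ContinuousAt.div (by fun_prop) (by fun_prop) ?_)
    linarith
  exact this.tendsto.mono_left nhdsWithin_le_nhds
lemma zet_le2 (h : ∀ w, 0 < Z w) {y : ℝ} (hy : 0 ≤ y) (hy1 : y ≤ 1/4) (w : Ω) : zet Z y w ≤ 4/3 := by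
  have h0 := bet_pos h w
  have h1 := bet_lt h w
  have hb : y * bet Z w ≤ 1/4 := by nlinarith
  have : y * bet Z w / (1 - y * bet Z w) ≤ (1/4) / (3/4) := div_le_div₀ (by norm_num) hb (by norm_num) (by linarith)
  unfold zet; linarith
lemma zet_ge (h : ∀ w, 0 < Z w) {y : ℝ} (hy : 0 ≤ y) (hy1 : y ≤ 1/4) (w : Ω) : 3/4 ≤ zet Z y w := by
  have h0 := bet_pos h w
  have h1 := bet_lt h w
  have hb1 : y * bet Z w < 1 := by nlinarith
  have : 0 ≤ y * bet Z w / (1 - y * bet Z w) := div_nonneg (by positivity) (by linarith)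
  unfold zet; linarith
lemma zet_lip (h : ∀ w, 0 < Z w) {x y : ℝ} (hx : 0 ≤ x) (hx1 : x ≤ 1/4) (hy : 0 ≤ y) (hy1 : y ≤ 1/4)
 (w : Ω) : |zet Z x w - zet Z y w| ≤ 3 * |x - y| := by
  have h0 := bet_pos h w
  have h1 := bet_lt h w
  have a : 3/4 ≤ 1 - x * bet Z w := by nlinarith
  have b : 3/4 ≤ 1 - y * bet Z w := by nlinarith
  have e : zet Z x w - zet Z y w = (x - y) * (bet Z w / ((1 - x * bet Z w) * (1 - y * bet Z w)) - 1) := by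
    unfold zet
    have n1 : 1 - x * bet Z w ≠ 0 := by linarith
    have n2 : 1 - y * bet Z w ≠ 0 := by linarith
    have e1 : x * bet Z w / (1 - x * bet Z w) = (1 - x * bet Z w)⁻¹ - 1 := by
      rw [eq_sub_iff_add_eq, ← one_div, eq_div_iff n1, add_mul, div_mul_cancel₀ _ n1]; ring
    have e2 : y * bet Z w / (1 - y * bet Z w) = (1 - y * bet Z w)⁻¹ - 1 := by
      rw [eq_sub_iff_add_eq, ← one_div, eq_div_iff n2, add_mul, div_mul_cancel₀ _ n2]; ring
    have e3 := inv_sub_inv n1 n2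
    rw [e1, e2]
    have e4 : (x - y) * (bet Z w / ((1 - x * bet Z w) * (1 - y * bet Z w)) - 1) =
      (1 - y * bet Z w - (1 - x * bet Z w)) / ((1 - x * bet Z w) * (1 - y * bet Z w)) - (x - y) := by ring
    rw [e4, ← e3]; ring
  rw [e, abs_mul, mul_comm 3]
  refine mul_left_le ?_ (abs_nonneg _)
  have p : 9/16 ≤ (1 - x * bet Z w) * (1 - y * bet Z w) := by nlinarith
  have q0 : 0 ≤ bet Z w / ((1 - x * bet Z w) * (1 - y * bet Z w)) := div_nonneg h0.le (by linarith)
  have q1 : bet Z w / ((1 - x * bet Z w) * (1 - y * bet Z w)) ≤ 1 / (9/16) := div_le_div₀ zero_le_one h1.le (by norm_num) p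
  rw [abs_le]; constructor
  · linarith
  · have : (1:ℝ) / (9/16) = 16/9 := by norm_num
    linarith
variable {P : Measure Ω} [IsPr P]
def qd (P : Measure Ω) (Z : Ω → ℝ) (y : ℝ) (w : Ω) : ℝ := zet Z y w / ∫ w, zet Z y w ∂P
lemma zet_int (hZ : Measurable Z) (h : ∀ w, 0 < Z w) {y : ℝ} (hy : 0 ≤ y) (hy1 : y ≤ 1/4) :
 Integrable (zet Z y) P := int_bdd (c := 4/3) (zet_meas hZ y).aestronglyMeasurable
      (ae_of_all _ fun w => by
        rw [abs_of_nonneg (by linarith [zet_ge h hy hy1 w])]; exact zet_le2 h hy hy1 w)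
lemma cc_le (hZ : Measurable Z) (h : ∀ w, 0 < Z w) {y : ℝ} (hy : 0 ≤ y) (hy1 : y ≤ 1/4) :
 ∫ w, zet Z y w ∂P ≤ 4/3 := by
  have := integral_mono (zet_int (P := P) hZ h hy hy1) (integrable_const (4/3)) (fun w => zet_le2 h hy hy1 w)
  simpa using this
lemma cc_ge (hZ : Measurable Z) (h : ∀ w, 0 < Z w) {y : ℝ} (hy : 0 ≤ y) (hy1 : y ≤ 1/4) :
 3/4 ≤ ∫ w, zet Z y w ∂P := by
  have := integral_mono (integrable_const (3/4)) (zet_int (P := P) hZ h hy hy1) (fun w => zet_ge h hy hy1 w)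
  simpa using this
lemma cc_lip (hZ : Measurable Z) (h : ∀ w, 0 < Z w) {x y : ℝ} (hx : 0 ≤ x) (hx1 : x ≤ 1/4)
 (hy : 0 ≤ y) (hy1 : y ≤ 1/4) :
 |∫ w, zet Z x w ∂P - ∫ w, zet Z y w ∂P| ≤ 3 * |x - y| := by
  rw [← integral_sub (zet_int hZ h hx hx1) (zet_int hZ h hy hy1)]
  have := norm_integral_le_of_norm_le_const (μ := P) (f := fun w => zet Z x w - zet Z y w)
    (ae_of_all _ fun w => zet_lip h hx hx1 hy hy1 w)
  simpa using this
lemma qd_meas (hZ : Measurable Z) (y : ℝ) : Measurable (qd P Z y) := (zet_meas hZ y).div_const _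
lemma qd_le (hZ : Measurable Z) (h : ∀ w, 0 < Z w) {y : ℝ} (hy : 0 ≤ y) (hy1 : y ≤ 1/4) (w : Ω) :
 qd P Z y w ≤ 2 := by
  have := cc_ge (P := P) hZ h hy hy1
  have := zet_le2 h hy hy1 w
  unfold qd; rw [div_le_iff₀ (by linarith)]; linarith
lemma qd_ge (hZ : Measurable Z) (h : ∀ w, 0 < Z w) {y : ℝ} (hy : 0 ≤ y) (hy1 : y ≤ 1/4) (w : Ω) :
 1/2 ≤ qd P Z y w := by
  have := cc_le (P := P) hZ h hy hy1
  have := cc_ge (P := P) hZ h hy hy1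
  have := zet_ge h hy hy1 w
  unfold qd; rw [le_div_iff₀ (by linarith)]; linarith
lemma qd_rat (hZ : Measurable Z) (h : ∀ w, 0 < Z w) {x y : ℝ} (hx : 0 ≤ x) (hx1 : x ≤ 1/4)
 (hy : 0 ≤ y) (hy1 : y ≤ 1/4) (w : Ω) :
 |(qd P Z x w / qd P Z y w)⁻¹ - 1| ≤ 16 * |x - y| := by
  have a1 := cc_le (P := P) hZ h hx hx1
  have a2 := cc_ge (P := P) hZ h hx hx1
  have b1 := cc_le (P := P) hZ h hy hy1
  have b2 := cc_ge (P := P) hZ h hy hy1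
  have c1 := zet_ge h hx hx1 w
  have c2 := zet_le2 h hx hx1 w
  have d1 := zet_ge h hy hy1 w
  have d2 := zet_le2 h hy hy1 w
  have l1 := cc_lip (P := P) hZ h hx hx1 hy hy1
  have l2 := zet_lip h hx hx1 hy hy1 w
  unfold qd
  set A := ∫ w, zet Z x w ∂P
  set B := ∫ w, zet Z y w ∂P
  set a := zet Z x w
  set b := zet Z y w
  have e : (a / A / (b / B))⁻¹ - 1 = (a * (A - B) - (a - b) * A) / (a * B) := by
    have : a ≠ 0 := by linarith
    have : b ≠ 0 := by linarith
    have : A ≠ 0 := by linarith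
    have : B ≠ 0 := by linarith
    field_simp; ring
  rw [e, abs_div, abs_of_pos (show 0 < a * B by nlinarith), div_le_iff₀ (by nlinarith)]
  have t1 : |a * (A - B)| ≤ 4/3 * (3 * |x-y|) := by
    rw [abs_mul, abs_of_pos (by linarith : 0 < a)]
    exact mul_le_mul c2 l1 (abs_nonneg _) (by norm_num)
  have t2 : |(a - b) * A| ≤ (3 * |x-y|) * (4/3) := by
    rw [abs_mul, abs_of_pos (by linarith : 0 < A)]
    exact mul_le_mul l2 a1 (by linarith) (by positivity)
  have t3 := abs_sub (a * (A-B)) ((a-b)*A)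
  have t4 : 9/16 ≤ a * B := by nlinarith
  nlinarith [abs_nonneg (x-y)]
lemma qd_one (hZ : Measurable Z) (h : ∀ w, 0 < Z w) {x : ℝ} (hx : 0 ≤ x) (hx1 : x ≤ 1/4) (w : Ω) :
 |qd P Z x w - 1| ≤ 8 * x := by
  have a1 := cc_le (P := P) hZ h hx hx1
  have a2 := cc_ge (P := P) hZ h hx hx1
  have l1 := cc_lip (P := P) hZ h hx hx1 le_rfl (by norm_num)
  have l2 := zet_lip h hx hx1 le_rfl (by norm_num) w
  have e0 : ∀ w, zet Z 0 w = 1 := fun w => by simp [zet]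
  simp_rw [e0] at l1 l2
  simp only [integral_const, probReal_univ, smul_eq_mul, mul_one, sub_zero, abs_of_nonneg hx] at l1 l2
  unfold qd
  have e : zet Z x w / ∫ w, zet Z x w ∂P - 1 = (zet Z x w - ∫ w, zet Z x w ∂P) / ∫ w, zet Z x w ∂P := by
    field_simp [show (∫ w, zet Z x w ∂P) ≠ 0 by linarith]
  rw [e, abs_div, abs_of_pos (a := ∫ w, zet Z x w ∂P) (by linarith), div_le_iff₀ (by linarith)]
  rw [abs_le] at *
  constructor <;> nlinarith
lemma wd_prob {ρ : Ω → ℝ} (hρ : Measurable ρ) (h0 : ∀ w, 0 ≤ ρ w) (hi : Integrable ρ P) (h : ∫ w, ρ w ∂P = 1) :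
 IsPr (wd P ρ) := by
  constructor
  unfold wd
  rw [withDensity_apply _ MeasurableSet.univ, Measure.restrict_univ,
    ← ofReal_integral_eq_lintegral_ofReal hi (ae_of_all _ h0), h, ENNReal.ofReal_one]
lemma qd_prob (hZ : Measurable Z) (h : ∀ w, 0 < Z w) {y : ℝ} (hy : 0 ≤ y) (hy1 : y ≤ 1/4) :
 IsPr (wd P (qd P Z y)) := by
  have := cc_ge (P := P) hZ h hy hy1
  refine wd_prob (qd_meas hZ y) (fun w => by linarith [qd_ge (P := P) hZ h hy hy1 w])
    ((zet_int hZ h hy hy1).div_const _) ?_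
  unfold qd; rw [integral_div]; exact div_self (by linarith)
lemma wd_wd {a b : Ω → ℝ} (ha : Measurable a) (hb : Measurable b) (ha0 : ∀ w, 0 ≤ a w) :
 wd (wd P a) b = wd P (fun w => a w * b w) := by
  unfold wd
  rw [← withDensity_mul _ ha.ennreal_ofReal hb.ennreal_ofReal]
  congr 1; ext w; rw [Pi.mul_apply, ENNReal.ofReal_mul (ha0 w)]
end Zet
section StepA2
variable {Ω : Type*} {m : MeasurableSpace Ω} {P : Measure Ω} [IsPr P]
  {I : ℕ → Filtration ℕ m} {d : ℕ}
def Orth (I : ℕ → Filtration ℕ m) (Q : Measure Ω) (o : Fin d → Ω → ℝ) (N : Ω → ℝ) : Prop := ∀ n i, ∀ A, MeasurableSet[I n i] A → ∀ c,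
      ∫ w, ind A w * ((N w - (Q[N | I n i]) w) * o c w) ∂Q = 0
lemma notWG_norm {Q : Measure Ω} [IsPr Q] {o : Fin d → Ω → ℝ} (h : ¬ WG I Q o) :
 ∃ L : Ω → ℝ, Measurable L ∧ (∀ w, |L w| ≤ 1) ∧ Orth I Q o L ∧ ∀ a : ℝ, ¬ L =ᵐ[Q] fun _ => a := by
  unfold WG at h
  push Not at h
  obtain ⟨N, hN, ⟨C, hC⟩, h1, h2⟩ := h
  have hC0 : 0 ≤ C := by
    obtain ⟨w⟩ := nonempty_of_isProbabilityMeasure Q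
    exact (abs_nonneg _).trans (hC w)
  set k : ℝ := (C+1)⁻¹ with hk
  have hk0 : 0 < k := by positivity
  refine ⟨fun w => k * N w, hN.const_mul k, fun w => ?_, ?_, fun a ha => ?_⟩
  · rw [abs_mul, abs_of_pos hk0, hk, inv_mul_le_iff₀ (by positivity)]; linarith [hC w]
  · intro n i A hA c
    have e : (Q[fun w => k * N w | I n i]) =ᵐ[Q] fun w => k * (Q[N | I n i]) w := condExp_smul k N (I n i)
    have : ∫ w, ind A w * ((k * N w - (Q[fun w => k * N w | I n i]) w) * o c w) ∂Q =
      ∫ w, k * (ind A w * ((N w - (Q[N | I n i]) w) * o c w)) ∂Q := by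
      refine integral_congr_ae ?_
      filter_upwards [e] with w h
      rw [h]; ring
    rw [this, integral_const_mul, h1 n i A hA c, mul_zero]
  · refine h2 (a / k) ?_
    filter_upwards [ha] with w h
    rw [eq_div_iff hk0.ne', mul_comm]; exact h
lemma resid_abs {Q : Measure Ω} [IsPr Q] {L : Ω → ℝ} (hL : ∀ w, |L w| ≤ 1)
 (G : MeasurableSpace Ω) : ∀ᵐ w ∂Q, |L w - (Q[L|G]) w| ≤ 2 := by
  filter_upwards [ce_abs zero_le_one (ae_of_all Q hL) G] with w h
  have := abs_sub (L w) ((Q[L|G]) w)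
  linarith [hL w]
lemma resid_aesm {R Q : Measure Ω} {L : Ω → ℝ} (hL : Measurable L) {G : MeasurableSpace Ω} (hG : G ≤ m) :
 AEStronglyMeasurable[m] (fun w => L w - (Q[L|G]) w) R := hL.aestronglyMeasurable.sub (stronglyMeasurable_condExp.mono hG).aestronglyMeasurable
lemma hz_of {ρ : Ω → ℝ} (hρ : Measurable ρ) (hρ0 : ∀ w, 0 < ρ w) [IsPr (wd P ρ)]
 {o : Fin d → Ω → ℝ} (ho : ∀ c, Integrable (o c) (wd P ρ)) {L : Ω → ℝ} (hLm : Measurable L)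
 (hL : ∀ w, |L w| ≤ 1) (hoo : Orth I (wd P ρ) o L) (k : ℝ) (n i : ℕ) (l : Fin (d+1)) :
 hb (I n) P (wd P ρ) L (fun w => k * ρ w * ext1 o l w) i =ᵐ[P] 0 := by
  set Q := wd P ρ with hQ
  have hPQ : P ≪ Q := wd_ac' hρ hρ0
  have hext : Integrable (ext1 o l) Q := ext1_int ho l
  have hdbQ : ∀ᵐ w ∂Q, |dm (I n) Q L i w| ≤ 2 * 1 := dm_abs zero_le_one (ae_of_all Q hL) i
  have key : ∀ A, MeasurableSet[I n i] A → ∫ w, ind A w * (dm (I n) Q L i w * ext1 o l w) ∂Q = 0 := by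
    intro A hA
    refine Fin.cases ?_ (fun c => ?_) l
    · simp only [ext1, Fin.cons_zero, mul_one]
      exact dm_orth L (ind_sm hA) (int_indm ((I n).le i A hA) integrable_condExp)
    · simp only [ext1, Fin.cons_succ]
      have e1 := hoo n i A hA c
      have e2 := hoo n (i+1) A ((I n).mono (Nat.le_succ i) A hA) c
      have Iv : ∀ j, Integrable (fun w => ind A w * ((L w - (Q[L | I n j]) w) * o c w)) Q := fun j =>
        int_indm ((I n).le i A hA)
          (int_mul (resid_aesm hLm ((I n).le j)) (resid_abs hL _) (ho c))
      have e3 := integral_sub (Iv i) (Iv (i+1))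
      rw [e1, e2, sub_zero] at e3
      rw [← e3]
      congr 1; ext w; simp only [dm]; ring
  have hI : Integrable (fun w => dm (I n) Q L i w * (k * ρ w * ext1 o l w)) P := by
    have : Integrable (fun w => k * (dm (I n) Q L i w * ext1 o l w)) Q := (int_mul (dm_aesm Q Q L i) hdbQ hext).const_mul k
    refine ((wd_itg hρ (fun w => (hρ0 w).le)).1 this).congr (ae_of_all _ fun w => ?_)
    dsimp only; ring
  unfold hb
  symm
  refine ae_eq_condExp_of_forall_setIntegral_eq ((I n).le i) hI (fun s _ _ => integrableOn_zero) ?_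
    stronglyMeasurable_const.aestronglyMeasurable
  intro A hA _
  rw [← int_ind_mul P ((I n).le i A hA), ← int_ind_mul P ((I n).le i A hA)]
  have e : ∫ w, ind A w * (dm (I n) Q L i w * (k * ρ w * ext1 o l w)) ∂P =
      k * ∫ w, ind A w * (dm (I n) Q L i w * ext1 o l w) ∂Q := by
    rw [wd_int hρ (fun w => (hρ0 w).le), ← integral_const_mul]
    congr 1; ext w; ring
  rw [e, key A hA]; simp
def clamp (K : ℝ) (y : ℝ) : ℝ := max (-K) (min K y)
lemma clamp_abs {K : ℝ} (hK : 0 ≤ K) (y : ℝ) : |clamp K y| ≤ K := by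
  unfold clamp; rw [abs_le]; exact ⟨le_max_left _ _, max_le (by linarith) (min_le_left _ _)⟩
lemma clamp_abs' {K : ℝ} (hK : 0 ≤ K) (y : ℝ) : |clamp K y| ≤ |y| := by
  unfold clamp
  rw [abs_le]; constructor
  · rcases le_total K y with h | h
    · rw [min_eq_left h]; exact le_trans (by linarith [abs_nonneg y]) (le_max_right _ _)
    · rw [min_eq_right h]; exact (neg_abs_le y).trans (le_max_right _ _)
  · exact max_le (by linarith [abs_nonneg y]) ((min_le_right _ _).trans (le_abs_self y))
lemma clamp_eq {K y : ℝ} (h : |y| ≤ K) : clamp K y = y := by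
  unfold clamp; rw [abs_le] at h; rw [min_eq_right h.2, max_eq_right h.1]
lemma clamp_meas (K : ℝ) : Measurable (clamp K) := by unfold clamp; fun_prop
lemma exists_cov {Z : Ω → ℝ} (hZ : Measurable Z) (hZ0 : ∀ w, 0 < Z w) [IsPr (wd P Z)]
 {o : Fin d → Ω → ℝ} (ho : ∀ l, Integrable (o l) (wd P Z)) (hom : ∀ l, Measurable (o l))
 (hWG : WG I (wd P Z) o) (htop : ∀ n i, 2^n ≤ i → (I n i : MeasurableSpace Ω) = m)
 {Q : Measure Ω} [IsPr Q] (hQP : Q ≪ P) (hPQ : P ≪ Q)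
 {L : Ω → ℝ} (hLm : Measurable L)
 (hL : ∀ w, |L w| ≤ 1) (hnc : ∀ a : ℝ, ¬ L =ᵐ[Q] fun _ => a) :
 ∃ n i A, i ≤ 2^n ∧ MeasurableSet[I n i] A ∧ ∃ (c : Fin (d+1)) (K : ℕ),
 ∫ w, ind A w * (L w - (Q[L | I n i]) w) * clamp ((K:ℝ)+1) (Z w * ext1 o c w) ∂P ≠ 0 := by
  by_contra hcon
  push Not at hcon
  set Q0 := wd P Z with hQ0
  have hZ0' : ∀ w, 0 ≤ Z w := fun w => (hZ0 w).le
  have hQ0Q : Q0 ≪ Q := (wd_ac Z).trans hPQ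
  have hQQ0 : Q ≪ Q0 := hQP.trans (wd_ac' hZ hZ0)
  have hres : ∀ G : MeasurableSpace Ω, ∀ᵐ w ∂P, |L w - (Q[L|G]) w| ≤ 2 := fun G => hPQ.ae_le (resid_abs hL G)
  have hem : ∀ c : Fin (d+1), Measurable (ext1 o c) := fun c => by
    refine Fin.cases ?_ (fun c => ?_) c
    · simp only [ext1, Fin.cons_zero]; exact measurable_const
    · simpa [ext1] using hom c
  have z1 : ∀ n i A, MeasurableSet[I n i] A → ∀ c : Fin (d+1),
      ∫ w, ind A w * (L w - (Q[L | I n i]) w) * ext1 o c w ∂Q0 = 0 := by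
    intro n i A hA c
    by_cases hi : i ≤ 2^n
    · rw [wd_int hZ hZ0']
      have hd : Integrable (fun w => 2 * |Z w * ext1 o c w|) P := (((wd_itg hZ hZ0').1 (ext1_int ho c)).abs).const_mul 2
      have T : Tendsto (fun K : ℕ => ∫ w, ind A w * (L w - (Q[L | I n i]) w) * clamp ((K:ℝ)+1) (Z w * ext1 o c w) ∂P)
          atTop (nhds (∫ w, ind A w * (L w - (Q[L | I n i]) w) * (Z w * ext1 o c w) ∂P)) := by
        refine tendsto_integral_of_dominated_convergence (fun w => 2 * |Z w * ext1 o c w|) ?_ hd ?_ ?_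
        · intro K
          refine ((aesm_of ((I n).le i) (ind_sm hA)).mul (resid_aesm hLm ((I n).le i))).mul ?_
          exact ((clamp_meas _).comp (hZ.mul (hem c))).aestronglyMeasurable
        · intro K
          filter_upwards [hres (I n i)] with w h
          rw [norm_eq_abs, abs_mul, abs_mul]
          refine mul_le_mul ?_ (clamp_abs' (by positivity) _) (abs_nonneg _) zero_le_two
          calc _ ≤ 1 * 2 := mul_le_mul (ind_abs _ _) h (abs_nonneg _) zero_le_one
            _ = 2 := by norm_num
        · refine ae_of_all _ fun w => ?_
          refine tendsto_const_nhds.congr' ?_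
          obtain ⟨K, hK⟩ := exists_nat_ge |Z w * ext1 o c w|
          filter_upwards [eventually_ge_atTop K] with k hk
          rw [clamp_eq]
          have : (K:ℝ) ≤ k := by exact_mod_cast hk
          linarith
      simp_rw [hcon n i A hi hA c] at T
      have := tendsto_nhds_unique T tendsto_const_nhds
      rw [← this]; congr 1; ext w; ring
    · have e : (Q[L | I n i]) = L := by
        rw [htop n i (by omega)]
        exact condExp_of_stronglyMeasurable le_rfl hLm.stronglyMeasurable
          (int_bdd hLm.aestronglyMeasurable (ae_of_all _ hL))
      simp [e]
  have hLi : Integrable L Q0 := int_bdd hLm.aestronglyMeasurable (ae_of_all _ hL)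
  have hce : ∀ n i, (Q[L | I n i]) =ᵐ[Q0] (Q0[L | I n i]) := by
    intro n i
    have hci : Integrable (Q[L | I n i]) Q0 := int_bdd
      (stronglyMeasurable_condExp.mono ((I n).le i)).aestronglyMeasurable
      (hQ0Q.ae_le (ce_abs zero_le_one (ae_of_all Q hL) _))
    refine ae_eq_condExp_of_forall_setIntegral_eq ((I n).le i) hLi (fun s _ _ => hci.integrableOn) ?_
      stronglyMeasurable_condExp.aestronglyMeasurable
    intro A hA _
    have h := z1 n i A hA 0
    simp only [ext1, Fin.cons_zero, mul_one] at h
    have mA := (I n).le i A hA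
    rw [← int_ind_mul Q0 mA, ← int_ind_mul Q0 mA]
    simp_rw [mul_sub] at h
    rw [integral_sub (int_indm mA hLi) (int_indm mA hci)] at h
    linarith
  obtain ⟨a, ha⟩ := hWG L hLm ⟨1, hL⟩ fun n i A hA c => by
    rw [← z1 n i A hA c.succ]
    refine integral_congr_ae ?_
    filter_upwards [hce n i] with w h
    simp only [ext1, Fin.cons_succ]
    rw [h]; ring
  exact hnc a (hQQ0.ae_le ha)
end StepA2
section StepA3
variable {Ω : Type*} {m : MeasurableSpace Ω} {P : Measure Ω} [IsPr P]
  {I : ℕ → Filtration ℕ m} {d : ℕ}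
def rat (P : Measure Ω) (Z : Ω → ℝ) (x q : ℝ) (w : Ω) : ℝ := qd P Z x w / qd P Z q w
def DD (P : Measure Ω) (Z : Ω → ℝ) (o : Fin d → Ω → ℝ) (c : Fin (d+1)) (K : ℕ) (q : ℝ) (w : Ω) : ℝ := clamp ((K:ℝ)+1) (Z w * ext1 o c w) / (2 * ((K:ℝ)+1) * qd P Z q w)
def Fib (I : ℕ → Filtration ℕ m) (P : Measure Ω) (Z : Ω → ℝ) (o : Fin d → Ω → ℝ)
    (p : Fin (d+1) × ℕ × ℚ × ℕ) (x : ℝ) : Prop := 0 ≤ x ∧ x ≤ 1/4 ∧ (0:ℝ) ≤ p.2.2.1 ∧ (p.2.2.1 : ℝ) ≤ 1/4 ∧ ∃ L : Ω → ℝ, Measurable L ∧ (∀ w, |L w| ≤ 1) ∧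
    Orth I (wd P (qd P Z x)) o L ∧ ∀ᶠ n in atTop, 1/((p.2.2.2:ℝ)+1) ≤ ∑ i ∈ Finset.range (2^n),
      ∫ w, ind {w | 1/((p.2.2.2:ℝ)+1) < |hb (I n) (wd P (qd P Z p.2.2.1)) (wd (wd P (qd P Z p.2.2.1))
        (rat P Z x p.2.2.1)) L (DD P Z o p.1 p.2.1 p.2.2.1) i w /
          wb (I n) (wd P (qd P Z p.2.2.1)) (DD P Z o p.1 p.2.1 p.2.2.1) i w|} w
        * (dm (I n) (wd P (qd P Z p.2.2.1)) (DD P Z o p.1 p.2.1 p.2.2.1) i w)^2 ∂(wd P (qd P Z p.2.2.1))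
variable {Z : Ω → ℝ}
lemma rat_meas (hZ : Measurable Z) (x q : ℝ) : Measurable (rat P Z x q) := (qd_meas hZ x).div (qd_meas hZ q)
lemma qd_pos (hZ : Measurable Z) (hZ0 : ∀ w, 0 < Z w) {x : ℝ} (hx : 0 ≤ x) (hx1 : x ≤ 1/4) (w : Ω) :
 0 < qd P Z x w := by linarith [qd_ge (P := P) hZ hZ0 hx hx1 w]
lemma wd_rat (hZ : Measurable Z) (hZ0 : ∀ w, 0 < Z w) (x : ℝ)
 {q : ℝ} (hq : 0 ≤ q) (hq1 : q ≤ 1/4) : wd (wd P (qd P Z q)) (rat P Z x q) = wd P (qd P Z x) := by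
  rw [wd_wd (qd_meas hZ q) (rat_meas hZ x q) (fun w => (qd_pos hZ hZ0 hq hq1 w).le)]
  congr 1; ext w
  have := (qd_pos (P := P) hZ hZ0 hq hq1 w).ne'
  unfold rat; field_simp
lemma rat_le (hZ : Measurable Z) (hZ0 : ∀ w, 0 < Z w) {x : ℝ} (hx : 0 ≤ x) (hx1 : x ≤ 1/4)
 {q : ℝ} (hq : 0 ≤ q) (hq1 : q ≤ 1/4) (w : Ω) : rat P Z x q w ≤ 4 := by
  unfold rat
  rw [div_le_iff₀ (qd_pos hZ hZ0 hq hq1 w)]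
  linarith [qd_le (P := P) hZ hZ0 hx hx1 w, qd_ge (P := P) hZ hZ0 hq hq1 w]
lemma rat_ge (hZ : Measurable Z) (hZ0 : ∀ w, 0 < Z w) {x : ℝ} (hx : 0 ≤ x) (hx1 : x ≤ 1/4)
 {q : ℝ} (hq : 0 ≤ q) (hq1 : q ≤ 1/4) (w : Ω) : (4:ℝ)⁻¹ ≤ rat P Z x q w := by
  unfold rat
  rw [le_div_iff₀ (qd_pos hZ hZ0 hq hq1 w)]
  linarith [qd_le (P := P) hZ hZ0 hq hq1 w, qd_ge (P := P) hZ hZ0 hx hx1 w]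
lemma qd_integrable (hZ : Measurable Z) (hZ0 : ∀ w, 0 < Z w) {x : ℝ} (hx : 0 ≤ x) (hx1 : x ≤ 1/4)
 {f : Ω → ℝ} (hf : Integrable f P) : Integrable f (wd P (qd P Z x)) := by
  rw [wd_itg (qd_meas hZ x) (fun w => (qd_pos hZ hZ0 hx hx1 w).le)]
  exact int_mul (c := 2) (qd_meas hZ x).aestronglyMeasurable (ae_of_all _ fun w => by
    rw [abs_of_pos (qd_pos hZ hZ0 hx hx1 w)]; exact qd_le hZ hZ0 hx hx1 w) hf
lemma ext1_meas {o : Fin d → Ω → ℝ} (hom : ∀ l, Measurable (o l)) (c : Fin (d+1)) : Measurable (ext1 o c) := by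
  refine Fin.cases ?_ (fun c => ?_) c
  · simp only [ext1, Fin.cons_zero]; exact measurable_const
  · simpa [ext1] using hom c
lemma DD_meas (hZ : Measurable Z) {o : Fin d → Ω → ℝ} (hom : ∀ l, Measurable (o l)) (c : Fin (d+1)) (K : ℕ) (q : ℝ) :
 Measurable (DD P Z o c K q) := ((clamp_meas _).comp (hZ.mul (ext1_meas hom c))).div ((qd_meas hZ q).const_mul _)
lemma DD_abs (hZ : Measurable Z) (hZ0 : ∀ w, 0 < Z w) {o : Fin d → Ω → ℝ} (c : Fin (d+1)) (K : ℕ)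
 {q : ℝ} (hq : 0 ≤ q) (hq1 : q ≤ 1/4) (w : Ω) : |DD P Z o c K q w| ≤ 1 := by
  unfold DD
  have h1 := qd_ge (P := P) hZ hZ0 hq hq1 w
  have hK : (0:ℝ) < (K:ℝ)+1 := by positivity
  have h2 := clamp_abs hK.le (Z w * ext1 o c w)
  have h3 : 0 < 2 * ((K:ℝ)+1) * qd P Z q w := by
    have := qd_pos (P := P) hZ hZ0 hq hq1 w; positivity
  rw [abs_div, abs_of_pos h3, div_le_one h3]
  nlinarith
lemma fib_fin (href : ∀ n0 n i, n0 ≤ n → (I n (i * 2^(n - n0)) : MeasurableSpace Ω) = I n0 i)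
 (hZ : Measurable Z) (hZ0 : ∀ w, 0 < Z w) [IsPr (wd P Z)]
 {o : Fin d → Ω → ℝ} (hom : ∀ l, Measurable (o l)) (ho : ∀ l, Integrable (o l) (wd P Z))
 (hoP : ∀ l, Integrable (o l) P)
 (hWG : WG I (wd P Z) o) (p : Fin (d+1) × ℕ × ℚ × ℕ) : {x | Fib I P Z o p x}.Finite := by
  obtain ⟨c, K, q', M⟩ := p
  by_contra hinf
  have hinf : {x | Fib I P Z o (c, K, q', M) x}.Infinite := hinf
  set e := hinf.natEmbedding with he
  set q : ℝ := (q' : ℝ) with hqdef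
  set x : ℕ → ℝ := fun j => (e j : ℝ) with hxdef
  have hxinj : Function.Injective x := fun i j h => e.injective (Subtype.ext h)
  have hF : ∀ j, Fib I P Z o (c, K, q', M) (x j) := fun j => (e j).2
  unfold Fib at hF
  simp only at hF
  have hq : 0 ≤ q := (hF 0).2.2.1
  have hq1 : q ≤ 1/4 := (hF 0).2.2.2.1
  have hx0 : ∀ j, 0 ≤ x j := fun j => (hF j).1
  have hx1 : ∀ j, x j ≤ 1/4 := fun j => (hF j).2.1
  choose L hLm hL hoo hB using fun j => (hF j).2.2.2.2
  have hP1 : IsPr (wd P (qd P Z q)) := qd_prob hZ hZ0 hq hq1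
  have qpos : ∀ w, 0 < qd P Z q w := qd_pos hZ hZ0 hq hq1
  have eZ : wd (wd P (qd P Z q)) (fun w => Z w / qd P Z q w) = wd P Z := by
    rw [wd_wd (P := P) (b := fun w => Z w / qd P Z q w) (qd_meas hZ q) (hZ.div (qd_meas hZ q)) (fun w => (qpos w).le)]
    congr 1; ext w
    have := (qpos w).ne'
    field_simp
  have erx : ∀ j, wd (wd P (qd P Z q)) (rat P Z (x j) q) = wd P (qd P Z (x j)) := fun j =>
    wd_rat hZ hZ0 (x j) hq hq1
  have hpx : ∀ j, IsPr (wd (wd P (qd P Z q)) (rat P Z (x j) q)) := fun j => by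
    rw [erx j]; exact qd_prob hZ hZ0 (hx0 j) (hx1 j)
  have hpZ : IsPr (wd (wd P (qd P Z q)) (fun w => Z w / qd P Z q w)) := by rw [eZ]; infer_instance
  have hqi : ∀ w, (qd P Z q w)⁻¹ ≤ 2 := fun w => by
    rw [inv_le_comm₀ (qpos w) (by norm_num)]; linarith [qd_ge (P := P) hZ hZ0 hq hq1 w]
  have hqi' : ∀ w, 0 < (qd P Z q w)⁻¹ := fun w => inv_pos.2 (qpos w)
  have hZq : ∀ w, Z w ≤ 2 * (Z w / qd P Z q w) := fun w => by
    have h := div_mul_cancel₀ (Z w) (qpos w).ne'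
    have h2 : 0 < Z w / qd P Z q w := div_pos (hZ0 w) (qpos w)
    nlinarith [qd_le (P := P) hZ hZ0 hq hq1 w]
  refine stepA_core (P := wd P (qd P Z q)) (Z := fun w => Z w / qd P Z q w) (Cb := 4)
    (b := fun k w => bk Z k w / qd P Z q w) (ζ := fun y w => zet Z y w / qd P Z q w) (o := o)
    (x := x) (ρ := fun j => rat P Z (x j) q) (κ := fun _ => 4) (L := L) (D := DD P Z o c K q)
    (δ := 1/((M:ℝ)+1)) href (hZ.div (qd_meas hZ q)) (fun w => div_pos (hZ0 w) (qpos w)) ?_ ?_ ?_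
    (fun k => (bk_meas hZ k).div (qd_meas hZ q)) ?_ (fun y => (zet_meas hZ y).div (qd_meas hZ q)) ?_ ?_ ?_ ?_
    hxinj hx0 hx1 (fun j => rat_meas hZ _ _) (fun _ => by norm_num)
    (fun j => rat_ge hZ hZ0 (hx0 j) (hx1 j) hq hq1) (fun j => rat_le hZ hZ0 (hx0 j) (hx1 j) hq hq1)
    hLm hL ?_ (DD_meas hZ hom c K q) (DD_abs hZ hZ0 c K hq hq1) (by positivity) hB
  · rw [eZ]; exact ho
  · exact fun l => qd_integrable hZ hZ0 hq hq1 (hoP l)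
  · rw [eZ]; exact hWG
  · intro k w
    rw [div_eq_mul_inv, abs_mul, abs_of_pos (hqi' w)]
    have := mul_le_mul (bk_abs hZ0 k w) (hqi w) (hqi' w).le zero_le_one
    linarith
  · intro y h0 h1 w
    simp_rw [← mul_div_assoc]
    exact (zet_sum hZ0 h0 h1 w).div_const _
  · intro y h0 h1 w
    rw [abs_of_pos (div_pos (zet_pos hZ0 h0 h1 w) (qpos w))]
    have h2 := zet_le hZ0 h0 h1 w
    have h3 : zet Z y w / qd P Z q w ≤ (1 + Z w) * 2 := by
      rw [div_eq_mul_inv]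
      exact mul_le_mul h2 (hqi w) (hqi' w).le (by linarith [hZ0 w])
    linarith [hZq w]
  · intro w
    exact (zet_lim hZ0 w).div_const _
  · intro w
    have h2 : 0 < Z w / qd P Z q w := div_pos (hZ0 w) (qpos w)
    linarith
  · intro j n i l
    have hox : ∀ l, Integrable (o l) (wd (wd P (qd P Z q)) (rat P Z (x j) q)) := fun l => by
      rw [erx j]; exact qd_integrable hZ hZ0 (hx0 j) (hx1 j) (hoP l)
    have := hz_of (P := wd P (qd P Z q)) (I := I) (rat_meas (P := P) hZ (x j) q) (fun w => by
      have := rat_ge (P := P) hZ hZ0 (hx0 j) (hx1 j) hq hq1 w; linarith) hox (hLm j) (hL j)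
      (by rw [erx j]; exact hoo j) (∫ w, zet Z (x j) w ∂P) n i l
    have e1 : (fun w => (∫ w, zet Z (x j) w ∂P) * rat P Z (x j) q w * ext1 o l w) =
        fun w => zet Z (x j) w / qd P Z q w * ext1 o l w := by
      ext w
      congr 1
      have hc := cc_ge (P := P) hZ hZ0 (hx0 j) (hx1 j)
      unfold rat
      rw [← mul_div_assoc]; congr 1
      unfold qd
      rw [mul_div_cancel₀]; linarith
    rw [e1] at this
    exact this
lemma exists_small {e s : ℝ} (h : s < e) : ∃ M : ℕ, 1/((M:ℝ)+1) + √2 * √(1/((M:ℝ)+1)) + s < e := by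
  have h1 : Tendsto (fun M : ℕ => 1/((M:ℝ)+1)) atTop (nhds 0) := tendsto_one_div_add_atTop_nhds_zero_nat
  have h2 : Tendsto (fun M : ℕ => 1/((M:ℝ)+1) + √2 * √(1/((M:ℝ)+1)) + s) atTop (nhds (0 + √2 * √0 + s)) := (h1.add ((Real.continuous_sqrt.tendsto _).comp h1 |>.const_mul _)).add_const s
  simp only [Real.sqrt_zero, mul_zero, zero_add] at h2
  exact (h2.eventually (gt_mem_nhds h)).exists
lemma fib_cover (href : ∀ n0 n i, n0 ≤ n → (I n (i * 2^(n - n0)) : MeasurableSpace Ω) = I n0 i)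
 (htop : ∀ n i, 2^n ≤ i → (I n i : MeasurableSpace Ω) = m)
 (hZ : Measurable Z) (hZ0 : ∀ w, 0 < Z w) [IsPr (wd P Z)]
 {o : Fin d → Ω → ℝ} (hom : ∀ l, Measurable (o l)) (ho : ∀ l, Integrable (o l) (wd P Z))
 (hWG : WG I (wd P Z) o) {x : ℝ} (hx : 0 < x) (hx1 : x ≤ 1/4)
 (hbad : ¬ WG I (wd P (qd P Z x)) o) : ∃ p, Fib I P Z o p x := by
  have hp := qd_prob (P := P) hZ hZ0 hx.le hx1
  obtain ⟨L, hLm, hL, hoo, hnc⟩ := notWG_norm hbad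
  obtain ⟨n, i, A, hi, hA, c, K, hne⟩ := exists_cov hZ hZ0 ho hom hWG htop (wd_ac _)
    (wd_ac' (qd_meas hZ x) (qd_pos hZ hZ0 hx.le hx1)) hLm hL hnc
  set e0 := ∫ w, ind A w * (L w - ((wd P (qd P Z x))[L | I n i]) w) * clamp ((K:ℝ)+1) (Z w * ext1 o c w) ∂P
  set e := e0 / (2 * ((K:ℝ)+1)) with he
  have hK : (0:ℝ) < 2 * ((K:ℝ)+1) := by positivity
  have hepos : 0 < |e| := abs_pos.2 (div_ne_zero hne hK.ne')
  set s := min 1 (|e|/2) with hs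
  have hs0 : 0 < s := lt_min one_pos (by linarith)
  have hse : s < |e| := (min_le_right _ _).trans_lt (by linarith)
  obtain ⟨M, hM⟩ := exists_small hse
  obtain ⟨q, hq0, hqx⟩ : ∃ q : ℚ, max 0 (x - s/16) < (q:ℝ) ∧ (q:ℝ) < x := exists_rat_btwn
    (max_lt hx (by linarith))
  have hq : (0:ℝ) ≤ q := (le_max_left _ _).trans hq0.le
  have hq2 : x - s/16 < q := (le_max_right _ _).trans_lt hq0
  have hq1 : (q:ℝ) ≤ 1/4 := hqx.le.trans hx1
  refine ⟨(c, K, q, M), hx.le, hx1, hq, hq1, L, hLm, hL, hoo, ?_⟩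
  filter_upwards [eventually_ge_atTop n] with n' hn'
  have hP1 : IsPr (wd P (qd P Z q)) := qd_prob hZ hZ0 hq hq1
  have er : wd (wd P (qd P Z q)) (rat P Z x q) = wd P (qd P Z x) := wd_rat hZ hZ0 x hq hq1
  have hpr : IsPr (wd (wd P (qd P Z q)) (rat P Z x q)) := by rw [er]; exact hp
  have hA' : MeasurableSet[I n' (i * 2^(n'-n))] A := by rw [href n n' i hn']; exact hA
  have hiN : i * 2^(n'-n) ≤ 2^n' := by
    calc i * 2^(n'-n) ≤ 2^n * 2^(n'-n) := Nat.mul_le_mul_right _ hi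
      _ = 2^n' := by rw [← pow_add]; congr 1; omega
  have F := F5_level (P := wd P (qd P Z q)) (O := I n') (rat_meas (P := P) hZ x q)
    (fun w => by have := rat_ge (P := P) hZ hZ0 hx.le hx1 hq hq1 w; linarith) hs0.le (min_le_left _ _)
    (fun w => (qd_rat (P := P) hZ hZ0 hx.le hx1 hq hq1 w).trans (by
      rw [abs_of_pos (by linarith)]; linarith)) hL (DD_meas (P := P) hZ hom c K q)
    (DD_abs hZ hZ0 c K hq hq1) hiN hA' (δ := 1/((M:ℝ)+1)) (by positivity)
  have hLN : ((wd (wd P (qd P Z q)) (rat P Z x q))[L | I n' (2^n')]) = L := by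
    rw [htop n' _ le_rfl]
    exact condExp_of_stronglyMeasurable le_rfl hLm.stronglyMeasurable
      (int_bdd hLm.aestronglyMeasurable (ae_of_all _ hL))
  have ee : ∫ w, ind A w * (L w - ((wd (wd P (qd P Z q)) (rat P Z x q))[L | I n' (i * 2^(n'-n))]) w)
      * DD P Z o c K q w ∂(wd P (qd P Z q)) = e := by
    rw [href n n' i hn', er, wd_int (qd_meas hZ _) (fun w => (qd_pos hZ hZ0 hq hq1 w).le), he,
      ← integral_div]
    congr 1; ext w
    have := (qd_pos (P := P) hZ hZ0 hq hq1 w).ne'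
    unfold DD; field_simp
  rw [hLN, ee] at F
  by_contra hlt
  rw [not_le] at hlt
  have := Real.sqrt_le_sqrt hlt.le
  have := mul_left_le this (Real.sqrt_nonneg 2)
  linarith
theorem stepA (href : ∀ n0 n i, n0 ≤ n → (I n (i * 2^(n - n0)) : MeasurableSpace Ω) = I n0 i)
 (htop : ∀ n i, 2^n ≤ i → (I n i : MeasurableSpace Ω) = m)
 (hZ : Measurable Z) (hZ0 : ∀ w, 0 < Z w) [IsPr (wd P Z)]
 {o : Fin d → Ω → ℝ} (hom : ∀ l, Measurable (o l)) (ho : ∀ l, Integrable (o l) (wd P Z))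
 (hoP : ∀ l, Integrable (o l) P)
 (hWG : WG I (wd P Z) o) {ε : ℝ} (hε : 0 < ε) :
 ∃ x, 0 < x ∧ x ≤ 1/4 ∧ x ≤ ε ∧ WG I (wd P (qd P Z x)) o := by
  by_contra hcon
  push Not at hcon
  have hsub : Ioc 0 (min (1/4) ε) ⊆ ⋃ p, {x | Fib I P Z o p x} := fun x hx => by
    have h1 := hx.2.trans (min_le_left _ _)
    have h2 := hx.2.trans (min_le_right _ _)
    exact mem_iUnion.2 (fib_cover href htop hZ hZ0 hom ho hWG hx.1 h1 (hcon x hx.1 h1 h2))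
  have hc : (⋃ p, {x | Fib I P Z o p x}).Countable := countable_iUnion fun p =>
    (fib_fin href hZ hZ0 hom ho hoP hWG p).countable
  have h0 : (0:ℝ) < min (1/4) ε := lt_min (by norm_num) hε
  have h1 := (hc.mono hsub).measure_zero volume
  rw [Real.volume_Ioc, sub_zero, ENNReal.ofReal_eq_zero] at h1
  linarith
end StepA3
section StepB
variable {Ω : Type*} {m : MeasurableSpace Ω} {Q : Measure Ω} [IsPr Q]
  {O : Filtration ℕ m}
lemma wd_mul_int {L g : Ω → ℝ} (hL : Measurable L) (hL0 : ∀ w, 0 ≤ L w)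
 (hg : Integrable g (wd Q L)) : Integrable (fun w => L w * g w) Q := (wd_itg hL hL0).1 hg
lemma pull_R {L g : Ω → ℝ} (hL : Measurable L) (hL0 : ∀ w, 0 ≤ L w) (hLi : Integrable L Q)
 {G : MeasurableSpace Ω} (hG : G ≤ m) (hg : StronglyMeasurable[G] g) (hgi : Integrable g (wd Q L)) :
 ∫ w, g w * (Q[L|G]) w ∂Q = ∫ w, g w ∂(wd Q L) ∧ Integrable (fun w => g w * (Q[L|G]) w) Q := by
  have h1 : Integrable (fun w => g w * L w) Q := by
    have := wd_mul_int hL hL0 hgi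
    exact this.congr (ae_of_all _ fun w => mul_comm _ _)
  refine ⟨?_, pull_int hg h1 hLi⟩
  rw [pull hG hg h1 hLi, wd_int hL hL0]
  congr 1; ext w; ring
lemma step1 {L U0 U1 o χ : Ω → ℝ} (hL : Measurable L) (hL0 : ∀ w, 0 ≤ L w) (hLi : Integrable L Q)
 {k : ℝ} (hk : 0 ≤ k) {i : ℕ} (ho : Integrable o Q)
 (hχ : StronglyMeasurable[O i] χ) (hχ1 : ∀ w, |χ w| ≤ 1)
 (hU0 : StronglyMeasurable[O i] U0) (hU1 : StronglyMeasurable[O (i+1)] U1)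
 (hU0i : Integrable U0 (wd Q L)) (hU1i : Integrable U1 (wd Q L))
 (hU : ∫ w, χ w * (U1 w - U0 w) ∂(wd Q L) = 0)
 {err : Ω → ℝ} (herr : Integrable err Q)
 (he : ∀ᵐ w ∂Q, χ w ≠ 0 → U1 w - U0 w = (Q[o|O (i+1)]) w - (Q[o|O i]) w + err w) :
 |∫ w, χ w * (dm O Q (fun w => min (L w) k) i w * o w) ∂Q| ≤ k * ∫ w, |err w| ∂Q +
 |∫ w, χ w * (Q[fun w => max (L w - k) 0|O (i+1)]) w * (U1 w - U0 w) ∂Q| := by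
  set S0 := Q[o|O i] with hS0
  set S1 := Q[o|O (i+1)] with hS1
  set N0 := Q[fun w => min (L w) k|O i] with hN0
  set N1 := Q[fun w => min (L w) k|O (i+1)] with hN1
  set A1 := Q[fun w => max (L w - k) 0|O (i+1)] with hA1
  have le0 := O.le i
  have le1 := O.le (i+1)
  have lei : O i ≤ O (i+1) := O.mono (Nat.le_succ i)
  have hmb : ∀ w, |min (L w) k| ≤ k := fun w => by
    rw [abs_of_nonneg (le_min (hL0 w) hk)]; exact min_le_right _ _
  have hmi : Integrable (fun w => min (L w) k) Q := int_bdd (hL.min measurable_const).aestronglyMeasurable (ae_of_all _ hmb)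
  have hAi : Integrable (fun w => max (L w - k) 0) Q := (hLi.sub (integrable_const k)).sup (integrable_const 0)
  have b0 : ∀ᵐ w ∂Q, |N0 w| ≤ k := ce_abs hk (ae_of_all _ hmb) _
  have b1 : ∀ᵐ w ∂Q, |N1 w| ≤ k := ce_abs hk (ae_of_all _ hmb) _
  have sN0 : StronglyMeasurable[O i] N0 := stronglyMeasurable_condExp
  have sN1 : StronglyMeasurable[O (i+1)] N1 := stronglyMeasurable_condExp
  have sS0 : StronglyMeasurable[O i] S0 := stronglyMeasurable_condExp
  have sS1 : StronglyMeasurable[O (i+1)] S1 := stronglyMeasurable_condExp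
  have hχ' := hχ.mono lei
  have bχN0 : ∀ᵐ w ∂Q, |χ w * N0 w| ≤ k := b0.mono fun w h => by
    rw [abs_mul]; nlinarith [hχ1 w, abs_nonneg (χ w), abs_nonneg (N0 w)]
  have bχN1 : ∀ᵐ w ∂Q, |χ w * N1 w| ≤ k := b1.mono fun w h => by
    rw [abs_mul]; nlinarith [hχ1 w, abs_nonneg (χ w), abs_nonneg (N1 w)]
  have i1 : ∀ {f : Ω → ℝ}, Integrable f Q → Integrable (fun w => χ w * N1 w * f w) Q := fun hf =>
    int_mul (aesm_of le1 (hχ'.mul sN1)) bχN1 hf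
  have i0 : ∀ {f : Ω → ℝ}, Integrable f Q → Integrable (fun w => χ w * N0 w * f w) Q := fun hf =>
    int_mul (aesm_of le0 (hχ.mul sN0)) bχN0 hf
  have e1 : ∫ w, χ w * (dm O Q (fun w => min (L w) k) i w * o w) ∂Q = ∫ w, χ w * N1 w * (S1 w - S0 w) ∂Q := by
    have p1 := pull le1 (hχ'.mul sN1) (i1 ho) ho
    have p0 := pull le0 (hχ.mul sN0) (i0 ho) ho
    have ib : Integrable (fun w => χ w * S0 w * min (L w) k) Q := by
      refine (int_mul (φ := fun w => χ w * min (L w) k) (c := k)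
        ((aesm_of le0 hχ).mul (hL.min measurable_const).aestronglyMeasurable) (ae_of_all _ fun w => ?_)
        (integrable_condExp (m := O i) (f := o) (μ := Q))).congr (ae_of_all _ fun w => ?_)
      · rw [abs_mul]; nlinarith [hχ1 w, abs_nonneg (χ w), hmb w, abs_nonneg (min (L w) k)]
      · simp only [← hS0]; ring
    have q1 := pull le1 (hχ'.mul (sS0.mono lei)) ib hmi
    have q0 := pull le0 (hχ.mul sS0) ib hmi
    have j1 := i1 ho
    have j0 := i0 ho
    have j2 := i1 (integrable_condExp (m := O i) (f := o) (μ := Q))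
    have j3 := i1 (integrable_condExp (m := O (i+1)) (f := o) (μ := Q))
    simp only [Pi.mul_apply] at p1 p0 q1 q0
    calc _ = ∫ w, (χ w * N1 w * o w - χ w * N0 w * o w) ∂Q := by
            congr 1; ext w; simp only [dm]; ring
      _ = ∫ w, χ w * N1 w * S1 w ∂Q - ∫ w, χ w * N0 w * S0 w ∂Q := by
            rw [integral_sub j1 j0, ← p1, ← p0]
      _ = ∫ w, χ w * N1 w * S1 w ∂Q - ∫ w, χ w * N1 w * S0 w ∂Q := by
            congr 1
            have : ∀ N : Ω → ℝ, ∫ w, χ w * N w * S0 w ∂Q = ∫ w, χ w * S0 w * N w ∂Q := fun N => by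
              congr 1; ext w; ring
            rw [this, this, q0, q1]
      _ = _ := by
            rw [← integral_sub j3 j2]; congr 1; ext w; ring
  have iX : Integrable (fun w => χ w * (U1 w - U0 w)) (wd Q L) := by
    refine int_mul (c := 1) ?_ (ae_of_all _ hχ1) (hU1i.sub hU0i)
    exact (hχ.mono le0).aestronglyMeasurable
  have sX : StronglyMeasurable[O (i+1)] (fun w => χ w * (U1 w - U0 w)) := hχ'.mul (hU1.sub (hU0.mono lei))
  obtain ⟨r1, r2⟩ := pull_R hL hL0 hLi le1 sX iX
  have hsum : ∀ᵐ w ∂Q, (Q[L|O (i+1)]) w = N1 w + A1 w := by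
    have := condExp_add hmi hAi (O (i+1)) (μ := Q)
    have e : (fun w => min (L w) k) + (fun w => max (L w - k) 0) = L := by
      ext w; simp only [Pi.add_apply]
      rcases le_total (L w) k with h | h
      · rw [min_eq_left h, max_eq_right (by linarith)]; ring
      · rw [min_eq_right h, max_eq_left (by linarith)]; ring
    rw [e] at this
    exact this
  have iNX : Integrable (fun w => χ w * N1 w * (S1 w - S0 w + err w)) Q := i1 ((integrable_condExp.sub integrable_condExp).add herr)
  have eNX : ∀ᵐ w ∂Q, χ w * N1 w * (S1 w - S0 w + err w) = χ w * N1 w * (U1 w - U0 w) := by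
    filter_upwards [he] with w h
    by_cases h0 : χ w = 0
    · simp [h0]
    · rw [h h0]
  have iNX' := iNX.congr eNX
  have e2 : ∫ w, χ w * N1 w * (S1 w - S0 w) ∂Q =
      - ∫ w, χ w * A1 w * (U1 w - U0 w) ∂Q - ∫ w, χ w * N1 w * err w ∂Q := by
    have t1 : ∫ w, χ w * N1 w * (S1 w - S0 w + err w) ∂Q = ∫ w, χ w * N1 w * (S1 w - S0 w) ∂Q +
        ∫ w, χ w * N1 w * err w ∂Q := by
      have j : Integrable (fun w => S1 w - S0 w) Q := integrable_condExp.sub integrable_condExp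
      rw [← integral_add (i1 j) (i1 herr)]
      congr 1; ext w; ring
    have t2 : ∫ w, χ w * A1 w * (U1 w - U0 w) ∂Q =
        ∫ w, (χ w * (U1 w - U0 w)) * (Q[L|O (i+1)]) w ∂Q - ∫ w, χ w * N1 w * (U1 w - U0 w) ∂Q := by
      rw [← integral_sub r2 iNX']
      refine integral_congr_ae ?_
      filter_upwards [hsum] with w h
      rw [h]; ring
    rw [t2, r1, hU, ← integral_congr_ae eNX, t1]; ring
  rw [e1, e2]
  have f1 : |∫ w, χ w * N1 w * err w ∂Q| ≤ k * ∫ w, |err w| ∂Q := by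
    rw [← integral_const_mul]
    refine (abs_integral_le_integral_abs).trans (integral_mono_ae (i1 herr).abs (herr.abs.const_mul k) ?_)
    filter_upwards [bχN1] with w h
    rw [abs_mul]; exact mul_right_le h (abs_nonneg _)
  have := abs_add_le (- ∫ w, χ w * A1 w * (U1 w - U0 w) ∂Q) (- ∫ w, χ w * N1 w * err w ∂Q)
  rw [abs_neg, abs_neg, ← sub_eq_add_neg] at this
  linarith
lemma step2 {L U0 U1 o χ : Ω → ℝ} (hL : Measurable L) (hL0 : ∀ w, 0 ≤ L w) (hLi : Integrable L Q)
 {k c b : ℝ} (hk : 0 ≤ k) (hc0 : 0 ≤ c) (hb0 : 0 ≤ b) {i : ℕ} (ho : Integrable o Q)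
 (hχ : StronglyMeasurable[O i] χ) (hχ1 : ∀ w, |χ w| ≤ 1)
 (hU1 : StronglyMeasurable[O (i+1)] U1) (hU0 : StronglyMeasurable[O i] U0)
 (hU1i : Integrable U1 (wd Q L)) (hU0i : Integrable U0 (wd Q L))
 {err : Ω → ℝ} (herr : Integrable err Q) {G J : Set Ω}
 (hG : MeasurableSet[O (i+1)] G) (hJ : MeasurableSet[O (i+1)] J)
 (hJG : ∀ w, χ w ≠ 0 → w ∉ G → w ∈ J)
 (hc : ∀ᵐ w ∂Q, χ w ≠ 0 → |(Q[o|O i]) w| ≤ c)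
 (hUc : ∀ᵐ w ∂Q, χ w ≠ 0 → |U0 w| ≤ c)
 (hA0 : ∀ᵐ w ∂Q, χ w ≠ 0 → (Q[fun w => max (L w - k) 0|O i]) w ≤ b)
 (hA1 : ∀ᵐ w ∂Q, w ∈ G → (Q[fun w => max (L w - k) 0|O (i+1)]) w ≤ b)
 (he : ∀ᵐ w ∂Q, χ w ≠ 0 → U1 w - U0 w = (Q[o|O (i+1)]) w - (Q[o|O i]) w + err w) :
 |∫ w, χ w * (Q[fun w => max (L w - k) 0|O (i+1)]) w * (U1 w - U0 w) ∂Q| ≤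
 |∫ w, χ w * ind G w * (dm O Q (fun w => max (L w - k) 0) i w * dm O Q o i w) ∂Q|
 + b * ∫ w, |err w| ∂Q + b * (∫ w, ind J w * (Q[(fun w => |o w|)|O (i+1)]) w ∂Q + c * Q.real J)
 + (∫ w, L w * (ind {w | k < L w} w * (ind J w * |U1 w|)) ∂Q + c * ∫ w, ind J w *
 (Q[fun w => max (L w - k) 0|O (i+1)]) w ∂Q) := by
  set a : Ω → ℝ := fun w => max (L w - k) 0 with ha
  set S0 := Q[o|O i] with hS0
  set S1 := Q[o|O (i+1)] with hS1
  set A0 := Q[a|O i] with hA0d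
  set A1 := Q[a|O (i+1)] with hA1d
  set Y1 := Q[(fun w => |o w|)|O (i+1)] with hY1
  have le0 := O.le i
  have le1 := O.le (i+1)
  have lei : O i ≤ O (i+1) := O.mono (Nat.le_succ i)
  have hAi : Integrable a Q := (hLi.sub (integrable_const k)).sup (integrable_const 0)
  have a0 : ∀ w, 0 ≤ a w := fun w => le_max_right _ _
  have aL : ∀ w, a w ≤ L w * ind {w | k < L w} w := fun w => by
    by_cases h : k < L w
    · rw [ind_mem (show w ∈ {w | k < L w} from h), mul_one]; exact max_le (by linarith) (hL0 w)
    · rw [ind_nmem (show w ∉ {w | k < L w} from h), mul_zero]; exact max_le (by linarith [not_lt.1 h]) le_rfl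
  have aL' : ∀ w, a w ≤ L w := fun w => max_le (by linarith) (hL0 w)
  have p0 : 0 ≤ᵐ[Q] A0 := condExp_nonneg (ae_of_all _ a0)
  have p1 : 0 ≤ᵐ[Q] A1 := condExp_nonneg (ae_of_all _ a0)
  have sA0 : StronglyMeasurable[O i] A0 := stronglyMeasurable_condExp
  have sA1 : StronglyMeasurable[O (i+1)] A1 := stronglyMeasurable_condExp
  have sS0 : StronglyMeasurable[O i] S0 := stronglyMeasurable_condExp
  have sS1 : StronglyMeasurable[O (i+1)] S1 := stronglyMeasurable_condExp
  have iS0 : Integrable S0 Q := integrable_condExp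
  have iS1 : Integrable S1 Q := integrable_condExp
  have iY1 : Integrable Y1 Q := integrable_condExp
  have iA1 : Integrable A1 Q := integrable_condExp
  have hχ' := hχ.mono lei
  have hJm := le1 _ hJ
  have hGm := le1 _ hG
  have SY : ∀ᵐ w ∂Q, |S1 w| ≤ Y1 w := by
    have := abs_condExp_ae_le_condExp_abs (m := O (i+1)) (μ := Q) (f := o)
    filter_upwards [this] with w h using h
  have dS : dm O Q o i = fun w => S1 w - S0 w := rfl
  have dA : dm O Q a i = fun w => A1 w - A0 w := rfl
  have bχA0 : ∀ᵐ w ∂Q, |χ w * A0 w| ≤ b := by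
    filter_upwards [hA0, p0] with w h h'
    by_cases h0 : χ w = 0
    · simpa [h0] using hb0
    · have h' : 0 ≤ A0 w := h'
      rw [abs_mul, abs_of_nonneg h']; nlinarith [hχ1 w, h h0, abs_nonneg (χ w)]
  have z0 : ∫ w, χ w * A0 w * (S1 w - S0 w) ∂Q = 0 := by
    have := dm_orth (O := O) (Q := Q) o (hχ.mul sA0) (int_mul (aesm_of le0 (hχ.mul sA0)) bχA0 iS1)
    simpa only [dS, Pi.mul_apply] using this
  have bG : ∀ᵐ w ∂Q, |χ w * ind G w * A1 w| ≤ b := by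
    filter_upwards [hA1, p1] with w h h'
    by_cases h0 : w ∈ G
    · have h' : 0 ≤ A1 w := h'
      rw [ind_mem h0, mul_one, abs_mul, abs_of_nonneg h']; nlinarith [hχ1 w, h h0, abs_nonneg (χ w)]
    · simpa [ind_nmem h0] using hb0
  have bG0 : ∀ᵐ w ∂Q, |χ w * ind G w * A0 w| ≤ b := by
    filter_upwards [bχA0] with w h
    rw [mul_right_comm, abs_mul]; nlinarith [ind_abs G w, abs_nonneg (ind G w), abs_nonneg (χ w * A0 w)]
  have mG := aesm_of (Q := Q) le1 ((hχ'.mul (ind_sm hG)).mul sA1)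
  have mG0 := aesm_of (Q := Q) le1 ((hχ'.mul (ind_sm hG)).mul (sA0.mono lei))
  have k1 : Integrable (fun w => χ w * ind G w * A1 w * err w) Q := int_mul mG bG herr
  have k2 : Integrable (fun w => χ w * ind G w * A1 w * (S1 w - S0 w)) Q := int_mul mG bG (iS1.sub iS0)
  have k3 : Integrable (fun w => χ w * ind G w * A0 w * (S1 w - S0 w)) Q := int_mul mG0 bG0 (iS1.sub iS0)
  have k4 : Integrable (fun w => χ w * A0 w * (S1 w - S0 w)) Q := int_mul (aesm_of le0 (hχ.mul sA0)) bχA0 (iS1.sub iS0)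
  have iLU : Integrable (fun w => ind J w * |U1 w| * a w) Q := by
    have h1 := wd_mul_int hL hL0 hU1i
    refine h1.norm.mono' (((ind_sm hJm).aestronglyMeasurable.mul (aesm_of le1 hU1).norm).mul hAi.1) (ae_of_all _ fun w => ?_)
    rw [norm_eq_abs, norm_eq_abs, abs_mul, abs_mul, abs_abs, abs_of_nonneg (a0 w), abs_of_nonneg (ind_nn J w),
      abs_mul, abs_of_nonneg (hL0 w), mul_comm (L w)]
    exact mul_le_mul (mul_le_of_le_one_left (abs_nonneg _) (ind_le_one J w)) (aL' w) (a0 w) (abs_nonneg _)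
  have sJU : StronglyMeasurable[O (i+1)] (fun w => ind J w * |U1 w|) := (ind_sm hJ).mul hU1.norm
  have iJUA : Integrable (fun w => ind J w * |U1 w| * A1 w) Q := pull_int sJU iLU hAi
  have eJUA := pull le1 sJU iLU hAi
  have iJA : Integrable (fun w => ind J w * A1 w) Q := int_indm hJm iA1
  have iJY : Integrable (fun w => ind J w * Y1 w) Q := int_indm hJm iY1
  have k5 : Integrable (fun w => χ w * ind Gᶜ w * A1 w * (U1 w - U0 w)) Q := by
    refine (iJUA.add (iJA.const_mul c)).mono' (((aesm_of le0 hχ).mul (ind_sm hGm.compl).aestronglyMeasurable).mul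
      iA1.1 |>.mul ((aesm_of le1 hU1).sub (aesm_of le0 hU0))) ?_
    filter_upwards [hUc, p1] with w h h'
    have h' : 0 ≤ A1 w := h'
    by_cases h0 : χ w = 0
    · simp only [h0, zero_mul, norm_zero, Pi.add_apply]
      have := ind_nn J w
      positivity
    by_cases hg : w ∈ G
    · rw [ind_nmem (by simpa using hg)]
      simp only [mul_zero, zero_mul, norm_zero, Pi.add_apply]
      have := ind_nn J w
      positivity
    · simp only [Pi.add_apply]
      rw [ind_mem (show w ∈ Gᶜ from hg), ind_mem (hJG w h0 hg), norm_eq_abs, mul_one, abs_mul, abs_mul, abs_of_nonneg h']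
      have h3 : |U1 w - U0 w| ≤ |U1 w| + c := (abs_sub _ _).trans (by linarith [h h0])
      have h4 : |χ w| * A1 w ≤ A1 w := mul_le_of_le_one_left h' (hχ1 w)
      have := mul_le_mul h4 h3 (abs_nonneg _) h'
      linarith
  have k6 : Integrable (fun w => χ w * ind Gᶜ w * A0 w * (S1 w - S0 w)) Q := by
    refine (k4.sub k3).congr (ae_of_all _ fun w => ?_)
    have : ind Gᶜ w = 1 - ind G w := by
      by_cases hg : w ∈ G
      · rw [ind_mem hg, ind_nmem (by simpa using hg)]; ring
      · rw [ind_nmem hg, ind_mem (show w ∈ Gᶜ from hg)]; ring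
    simp only [Pi.sub_apply, this]; ring
  have hcompl : ∀ w, ind Gᶜ w = 1 - ind G w := fun w => by
    by_cases hg : w ∈ G
    · rw [ind_mem hg, ind_nmem (by simpa using hg)]; ring
    · rw [ind_nmem hg, ind_mem (show w ∈ Gᶜ from hg)]; ring
  have key : ∫ w, χ w * A1 w * (U1 w - U0 w) ∂Q =
      ∫ w, χ w * ind G w * (dm O Q a i w * dm O Q o i w) ∂Q + ∫ w, χ w * ind G w * A1 w * err w ∂Q
      - ∫ w, χ w * ind Gᶜ w * A0 w * (S1 w - S0 w) ∂Q + ∫ w, χ w * ind Gᶜ w * A1 w * (U1 w - U0 w) ∂Q := by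
    have kd : Integrable (fun w => χ w * ind G w * (dm O Q a i w * dm O Q o i w)) Q := by
      refine (k2.sub k3).congr (ae_of_all _ fun w => ?_)
      simp only [Pi.sub_apply, dS, dA]; ring
    have e1 : ∫ w, χ w * ind G w * (dm O Q a i w * dm O Q o i w) ∂Q - ∫ w, χ w * ind Gᶜ w * A0 w * (S1 w - S0 w) ∂Q
       = ∫ w, (χ w * ind G w * (dm O Q a i w * dm O Q o i w) - χ w * ind Gᶜ w * A0 w * (S1 w - S0 w)
          + χ w * A0 w * (S1 w - S0 w)) ∂Q := by
      have t1 : Integrable (fun w => χ w * ind G w * (dm O Q a i w * dm O Q o i w) - χ w * ind Gᶜ w * A0 w * (S1 w - S0 w)) Q := kd.sub k6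
      rw [integral_add t1 k4, integral_sub kd k6, z0, add_zero]
    have e2 : ∫ w, (χ w * ind G w * (dm O Q a i w * dm O Q o i w) - χ w * ind Gᶜ w * A0 w * (S1 w - S0 w)
          + χ w * A0 w * (S1 w - S0 w)) ∂Q = ∫ w, χ w * ind G w * A1 w * (S1 w - S0 w) ∂Q := by
      congr 1; ext w; simp only [dS, dA, hcompl]; ring
    have e3 : ∫ w, χ w * A1 w * (U1 w - U0 w) ∂Q = ∫ w, ((χ w * ind G w * A1 w * (S1 w - S0 w) + χ w * ind G w * A1 w * err w)
        + χ w * ind Gᶜ w * A1 w * (U1 w - U0 w)) ∂Q := by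
      refine integral_congr_ae ?_
      filter_upwards [he] with w h
      by_cases h0 : χ w = 0
      · simp [h0]
      · rw [h h0, hcompl]; ring
    have t2 : Integrable (fun w => χ w * ind G w * A1 w * (S1 w - S0 w) + χ w * ind G w * A1 w * err w) Q := k2.add k1
    rw [e3, integral_add t2 k5, integral_add k2 k1]
    linarith [e1, e2]
  have B1 : |∫ w, χ w * ind G w * A1 w * err w ∂Q| ≤ b * ∫ w, |err w| ∂Q := by
    rw [← integral_const_mul]
    refine (abs_integral_le_integral_abs).trans (integral_mono_ae k1.abs (herr.abs.const_mul b) ?_)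
    filter_upwards [bG] with w h
    rw [abs_mul]; exact mul_right_le h (abs_nonneg _)
  have B2 : |∫ w, χ w * ind Gᶜ w * A0 w * (S1 w - S0 w) ∂Q| ≤ b * (∫ w, ind J w * Y1 w ∂Q + c * Q.real J) := by
    have ij : Integrable (fun w => c * ind J w) Q := ((integrable_const (1:ℝ)).indicator hJm).const_mul c
    have t1 : b * (∫ w, ind J w * Y1 w ∂Q + c * Q.real J) = ∫ w, b * (ind J w * Y1 w + c * ind J w) ∂Q := by
      rw [integral_const_mul, integral_add iJY ij, integral_const_mul, int_ind Q hJm]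
    rw [t1]
    refine (abs_integral_le_integral_abs).trans (integral_mono_ae k6.abs ((iJY.add ij).const_mul b) ?_)
    filter_upwards [bχA0, hc, SY] with w h1 h2 h3
    have hY0 : 0 ≤ Y1 w := (abs_nonneg _).trans h3
    have := ind_nn J w
    have hz : 0 ≤ b * (ind J w * Y1 w + c * ind J w) := by positivity
    by_cases h0 : χ w = 0
    · simpa [h0] using hz
    by_cases hg : w ∈ G
    · rw [ind_nmem (by simpa using hg)]
      simpa using hz
    · rw [ind_mem (show w ∈ Gᶜ from hg), ind_mem (hJG w h0 hg), mul_one, abs_mul, mul_one, one_mul]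
      exact mul_le_mul h1 ((abs_sub _ _).trans (add_le_add h3 (h2 h0))) (abs_nonneg _) hb0
  have B3 : |∫ w, χ w * ind Gᶜ w * A1 w * (U1 w - U0 w) ∂Q| ≤
      ∫ w, L w * (ind {w | k < L w} w * (ind J w * |U1 w|)) ∂Q + c * ∫ w, ind J w * A1 w ∂Q := by
    have t0 : ∫ w, ind J w * |U1 w| * A1 w ∂Q ≤ ∫ w, L w * (ind {w | k < L w} w * (ind J w * |U1 w|)) ∂Q := by
      rw [eJUA]
      refine integral_mono iLU ?_ fun w => ?_
      · have h1 := wd_mul_int hL hL0 hU1i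
        refine h1.norm.mono' (hL.aestronglyMeasurable.mul ((ind_sm (measurableSet_lt measurable_const hL)).aestronglyMeasurable.mul
          (aesm_of le1 sJU))) (ae_of_all _ fun w => ?_)
        rw [norm_eq_abs, norm_eq_abs, abs_mul, abs_mul, abs_mul, abs_mul, abs_abs]
        refine mul_left_le ?_ (abs_nonneg _)
        have := mul_le_of_le_one_left (abs_nonneg (U1 w)) (ind_abs J w)
        exact (mul_le_of_le_one_left (by positivity) (ind_abs _ w)).trans this
      · have := mul_left_le (aL w) (mul_nonneg (ind_nn J w) (abs_nonneg (U1 w)))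
        refine this.trans (le_of_eq ?_)
        ring
    refine le_trans ?_ (add_le_add_left t0 _)
    have t1 : ∫ w, ind J w * |U1 w| * A1 w ∂Q + c * ∫ w, ind J w * A1 w ∂Q = ∫ w, (ind J w * |U1 w| * A1 w + c * (ind J w * A1 w)) ∂Q := by
      rw [integral_add iJUA (iJA.const_mul c), integral_const_mul]
    rw [t1]
    refine (abs_integral_le_integral_abs).trans (integral_mono_ae k5.abs (iJUA.add (iJA.const_mul c)) ?_)
    filter_upwards [hUc, p1] with w h h'
    have h' : 0 ≤ A1 w := h'
    have := ind_nn J w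
    have hz : 0 ≤ ind J w * |U1 w| * A1 w + c * (ind J w * A1 w) := by positivity
    by_cases h0 : χ w = 0
    · simpa [h0] using hz
    by_cases hg : w ∈ G
    · rw [ind_nmem (by simpa using hg)]
      simpa using hz
    · rw [ind_mem (show w ∈ Gᶜ from hg), ind_mem (hJG w h0 hg), mul_one, abs_mul, abs_mul, abs_of_nonneg h']
      have h3 : |U1 w - U0 w| ≤ |U1 w| + c := (abs_sub _ _).trans (by linarith [h h0])
      have h4 : |χ w| * A1 w ≤ A1 w := mul_le_of_le_one_left h' (hχ1 w)
      have := mul_le_mul h4 h3 (abs_nonneg _) h'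
      linarith
  rw [key]
  set x1 := ∫ w, χ w * ind G w * (dm O Q a i w * dm O Q o i w) ∂Q
  rw [abs_le] at B1 B2 B3 ⊢
  have := le_abs_self x1
  have := neg_abs_le x1
  constructor <;> linarith [B1.1, B1.2, B2.1, B2.2, B3.1, B3.2]
end StepB
section StepB2
variable {Ω : Type*} {m : MeasurableSpace Ω} {Q : Measure Ω} [IsPr Q]
  {O : Filtration ℕ m}
lemma sum_jump {A : ℕ → Set Ω} (hanti : Antitone A) (N : ℕ) (w : Ω) :
 ∑ i ∈ Finset.range N, ind (A i \ A (i+1)) w ≤ 1 := by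
  have : ∀ i, ind (A i \ A (i+1)) w = ind (A i) w - ind (A (i+1)) w := fun i => by
    by_cases h1 : w ∈ A i <;> by_cases h2 : w ∈ A (i+1)
    · rw [ind_nmem (fun h => h.2 h2), ind_mem h1, ind_mem h2]; ring
    · rw [ind_mem (A := A i \ A (i+1)) ⟨h1, h2⟩, ind_mem h1, ind_nmem h2]; ring
    · exact absurd (hanti (Nat.le_succ i) h2) h1
    · rw [ind_nmem (fun h => h1 h.1), ind_nmem h1, ind_nmem h2]; ring
  simp_rw [this]
  rw [Finset.sum_range_sub']
  linarith [ind_le_one (A 0) w, ind_nn (A N) w]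
lemma excess_le {f : Ω → ℝ} (hf : Integrable f Q) (K : ℝ) {G : MeasurableSpace Ω} (hG : G ≤ m) :
 ∀ᵐ w ∂Q, max (|(Q[f|G]) w| - K) 0 ≤ (Q[fun w => max (|f w| - K) 0|G]) w := by
  have hi : Integrable (fun w => max (|f w| - K) 0) Q := (hf.abs.sub (integrable_const K)).sup (integrable_const 0)
  have h1 := abs_condExp_ae_le_condExp_abs (m := G) (μ := Q) (f := f)
  have h2 : Q[fun w => |f w| - K|G] ≤ᵐ[Q] Q[fun w => max (|f w| - K) 0|G] := condExp_mono (hf.abs.sub (integrable_const K)) hi (ae_of_all _ fun w => le_max_left _ _)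
  have h3 : Q[fun w => |f w| - K|G] =ᵐ[Q] Q[(fun w => |f w|)|G] - Q[fun _ => K|G] := condExp_sub hf.abs (integrable_const K) G
  have h4 : 0 ≤ᵐ[Q] Q[fun w => max (|f w| - K) 0|G] := condExp_nonneg (ae_of_all _ fun w => le_max_right _ _)
  rw [condExp_const hG] at h3
  filter_upwards [h1, h2, h3, h4] with w e1 e2 e3 e4
  refine max_le ?_ e4
  rw [e3] at e2
  simp only [Pi.sub_apply] at e2
  exact (sub_le_sub_right e1 K).trans e2
lemma jump_conv {U : ℕ → Ω → ℝ} (hU : Martingale U O Q) {A : ℕ → Set Ω}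
 (hA : ∀ i, MeasurableSet[O i] (A i)) (hanti : Antitone A) (N : ℕ) (K : ℝ) :
 ∑ i ∈ Finset.range N, ∫ w, ind (A i \ A (i+1)) w * max (|U (i+1) w| - K) 0 ∂Q
 ≤ ∫ w, max (|U N w| - K) 0 ∂Q := by
  have hV : ∀ i, Integrable (fun w => max (|U i w| - K) 0) Q := fun i =>
    ((hU.integrable i).abs.sub (integrable_const K)).sup (integrable_const 0)
  have hJ : ∀ i, MeasurableSet[O (i+1)] (A i \ A (i+1)) := fun i =>
    ((O.mono (Nat.le_succ i)) _ (hA i)).diff (hA (i+1))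
  have hJV : ∀ i, Integrable (fun w => ind (A i \ A (i+1)) w * max (|U N w| - K) 0) Q := fun i =>
    int_indm (O.le _ _ (hJ i)) (hV N)
  calc _ ≤ ∑ i ∈ Finset.range N, ∫ w, ind (A i \ A (i+1)) w * max (|U N w| - K) 0 ∂Q := by
        refine sum_le_sum fun i hi => ?_
        rw [← pull (O.le (i+1)) (ind_sm (hJ i)) (hJV i) (hV N)]
        refine integral_mono_ae (int_indm (O.le _ _ (hJ i)) (hV _))
          (int_indm (O.le _ _ (hJ i)) integrable_condExp) ?_
        have h1 := excess_le (hU.integrable N) K (O.le (i+1))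
        have h2 := hU.2 (i+1) N (by have := Finset.mem_range.1 hi; omega)
        filter_upwards [h1, h2] with w e1 e2
        rw [e2] at e1
        exact mul_left_le e1 (ind_nn _ _)
    _ = ∫ w, ∑ i ∈ Finset.range N, ind (A i \ A (i+1)) w * max (|U N w| - K) 0 ∂Q := (integral_finsetSum _ fun i _ => hJV i).symm
    _ ≤ _ := by
        refine integral_mono (integrable_finsetSum _ fun i _ => hJV i) (hV N) fun w => ?_
        rw [← sum_mul]
        exact mul_le_of_le_one_left (le_max_right _ _) (sum_jump hanti N w)
lemma jump_big {U : ℕ → Ω → ℝ} (hU : Martingale U O Q) {A : ℕ → Set Ω}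
 (hA : ∀ i, MeasurableSet[O i] (A i)) (hanti : Antitone A) (N : ℕ) {K : ℝ} (hK : 0 ≤ K) {H : Set Ω}
 (hH : MeasurableSet H) :
 ∑ i ∈ Finset.range N, ∫ w, ind H w * (ind (A i \ A (i+1)) w * |U (i+1) w|) ∂Q
 ≤ K * Q.real H + ∫ w, max (|U N w| - K) 0 ∂Q := by
  refine le_trans ?_ (add_le_add_right (jump_conv hU hA hanti N K) _)
  have hV : ∀ i, Integrable (fun w => max (|U i w| - K) 0) Q := fun i =>
    ((hU.integrable i).abs.sub (integrable_const K)).sup (integrable_const 0)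
  have hJ : ∀ i, MeasurableSet (A i \ A (i+1)) := fun i => (O.le _ _ (hA i)).diff (O.le _ _ (hA (i+1)))
  have iH : Integrable (ind H) Q := (integrable_const (1:ℝ)).indicator hH
  have i1 : ∀ i, Integrable (fun w => ind (A i \ A (i+1)) w * ind H w) Q := fun i => int_indm (hJ i) iH
  have i2 : ∀ i, Integrable (fun w => ind (A i \ A (i+1)) w * max (|U (i+1) w| - K) 0) Q := fun i => int_indm (hJ i) (hV _)
  have s1 : ∑ i ∈ Finset.range N, ∫ w, ind (A i \ A (i+1)) w * ind H w ∂Q ≤ Q.real H := by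
    rw [← integral_finsetSum _ fun i _ => i1 i, ← int_ind Q hH]
    refine integral_mono (integrable_finsetSum _ fun i _ => i1 i) iH fun w => ?_
    rw [← sum_mul]
    exact mul_le_of_le_one_left (ind_nn _ _) (sum_jump hanti N w)
  have s2 : ∀ i, ∫ w, ind H w * (ind (A i \ A (i+1)) w * |U (i+1) w|) ∂Q ≤
      K * ∫ w, ind (A i \ A (i+1)) w * ind H w ∂Q + ∫ w, ind (A i \ A (i+1)) w * max (|U (i+1) w| - K) 0 ∂Q := fun i => by
    rw [← integral_const_mul, ← integral_add ((i1 i).const_mul K) (i2 i)]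
    refine integral_mono (int_indm hH (int_indm (hJ i) (hU.integrable _).abs)) (((i1 i).const_mul K).add (i2 i)) fun w => ?_
    have h1 := le_max_left (|U (i+1) w| - K) 0
    have h2 := le_max_right (|U (i+1) w| - K) 0
    have h3 := ind_nn (A i \ A (i+1)) w
    have h4 := ind_nn H w
    have h5 := ind_le_one H w
    set x := max (|U (i+1) w| - K) 0
    set j := ind (A i \ A (i+1)) w
    set h := ind H w
    have e1 : |U (i+1) w| ≤ K + x := by linarith
    calc h * (j * |U (i+1) w|) ≤ h * (j * (K + x)) := by gcongr
      _ = K * (j * h) + h * (j * x) := by ring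
      _ ≤ K * (j * h) + 1 * (j * x) := by gcongr
      _ = _ := by ring
  calc _ ≤ ∑ i ∈ Finset.range N, (K * ∫ w, ind (A i \ A (i+1)) w * ind H w ∂Q + ∫ w, ind (A i \ A (i+1)) w * max (|U (i+1) w| - K) 0 ∂Q) := sum_le_sum fun i _ => s2 i
    _ ≤ _ := by
        rw [sum_add_distrib, ← mul_sum]
        exact add_le_add_left (mul_left_le s1 hK) _
lemma cs_part {a o : Ω → ℝ} (hai : Integrable a Q) (ha0 : ∀ w, 0 ≤ a w) (ho : Integrable o Q)
 {b c : ℝ} (hb : 0 < b) (hb1 : b ≤ 1) (hc : 0 < c) (hab : ∫ w, a w ∂Q ≤ b^2)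
 {χ : ℕ → Ω → ℝ} (hχ1 : ∀ i w, |χ i w| ≤ 1)
 (h1 : ∀ i, ∀ᵐ w ∂Q, χ i w ≠ 0 → (Q[a|O i]) w ≤ b ∧ (Q[a|O (i+1)]) w ≤ b ∧
 (Q[(fun w => |o w|)|O i]) w ≤ c ∧ (Q[(fun w => |o w|)|O (i+1)]) w ≤ c) (N : ℕ) :
 ∑ i ∈ Finset.range N, |∫ w, χ i w * (dm O Q a i w * dm O Q o i w) ∂Q| ≤
 4 * b * √(c * ∫ w, |o w| ∂Q) := by
  set p : Ω → ℝ := fun w => max (o w) 0 with hp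
  set q : Ω → ℝ := fun w => max (- o w) 0 with hq
  have ip : Integrable p Q := ho.sup (integrable_const 0)
  have iq : Integrable q Q := ho.neg.sup (integrable_const 0)
  have e1 : o = fun w => p w - q w := by
    ext w; simp only [hp, hq]
    rcases le_total 0 (o w) with h | h
    · rw [max_eq_left h, max_eq_right (by linarith)]; ring
    · rw [max_eq_right h, max_eq_left (by linarith)]; ring
  have p0 : ∀ w, 0 ≤ p w := fun w => le_max_right _ _
  have q0 : ∀ w, 0 ≤ q w := fun w => le_max_right _ _
  have po : ∀ w, p w ≤ |o w| := fun w => max_le (le_abs_self _) (abs_nonneg _)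
  have qo : ∀ w, q w ≤ |o w| := fun w => max_le (neg_le_abs _) (abs_nonneg _)
  have cp : ∀ i, Q[p|O i] ≤ᵐ[Q] Q[(fun w => |o w|)|O i] := fun i => condExp_mono ip ho.abs (ae_of_all _ po)
  have cq : ∀ i, Q[q|O i] ≤ᵐ[Q] Q[(fun w => |o w|)|O i] := fun i => condExp_mono iq ho.abs (ae_of_all _ qo)
  have cs : ∀ i, ∀ᵐ w ∂Q, (Q[o|O i]) w = (Q[p|O i]) w - (Q[q|O i]) w := fun i => by
    have := condExp_sub ip iq (O i) (μ := Q)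
    have e : p - q = o := by rw [e1]; rfl
    rw [e] at this
    exact this
  let D : (Ω → ℝ) → ℝ → ℕ → Ω → ℝ := fun f c i w => |min ((Q[f|O (i+1)]) w) c - min ((Q[f|O i]) w) c|
  have mart : ∀ f : Ω → ℝ, Martingale (fun i => Q[f|O i]) O Q := fun f => martingale_condExp f O Q
  have Dpos : ∀ f c i w, 0 ≤ D f c i w := fun f c i w => abs_nonneg _
  have Dm : ∀ f c i, AEStronglyMeasurable (D f c i) Q := fun f c i =>
    ((sm_min (stronglyMeasurable_condExp (m := O (i+1)) (f := f) (μ := Q)) c).mono (O.le _) |>.sub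
      ((sm_min (stronglyMeasurable_condExp (m := O i) (f := f) (μ := Q)) c).mono (O.le _))).norm.aestronglyMeasurable
  have Db : ∀ f c, (∀ w, 0 ≤ f w) → 0 < c → ∀ i, ∀ᵐ w ∂Q, D f c i w ≤ c := fun f c hf hc i => by
    have n1 : 0 ≤ᵐ[Q] Q[f|O i] := condExp_nonneg (ae_of_all _ hf)
    have n2 : 0 ≤ᵐ[Q] Q[f|O (i+1)] := condExp_nonneg (ae_of_all _ hf)
    filter_upwards [n1, n2] with w e1 e2
    have e1 : 0 ≤ (Q[f|O i]) w := e1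
    have e2 : 0 ≤ (Q[f|O (i+1)]) w := e2
    have t1 := le_min e1 hc.le
    have t2 := le_min e2 hc.le
    have t3 := min_le_right ((Q[f|O i]) w) c
    have t4 := min_le_right ((Q[f|O (i+1)]) w) c
    exact abs_le.2 ⟨by linarith, by linarith⟩
  have Dprod : ∀ f g c c', (∀ w, 0 ≤ f w) → (∀ w, 0 ≤ g w) → 0 < c → 0 < c' → ∀ i,
      Integrable (fun w => D f c i w * D g c' i w) Q := fun f g c c' hf hg h h' i => by
    refine int_bdd (c := c * c') ((Dm f c i).mul (Dm g c' i)) ?_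
    filter_upwards [Db f c hf h i, Db g c' hg h' i] with w e1 e2
    rw [abs_mul, abs_of_nonneg (Dpos _ _ _ _), abs_of_nonneg (Dpos _ _ _ _)]
    exact mul_le_mul e1 e2 (Dpos _ _ _ _) h.le
  have Dsq : ∀ f c, (∀ w, 0 ≤ f w) → 0 < c → ∀ i, Integrable (fun w => (D f c i w)^2) Q := fun f c hf h i =>
    (Dprod f f c c hf hf h h i).congr (ae_of_all _ fun w => (sq _).symm)
  have En : ∀ f c, Integrable f Q → (∀ w, 0 ≤ f w) → 0 < c → ∑ i ∈ Finset.range N, ∫ w, (D f c i w)^2 ∂Q ≤ 2 * c * ∫ w, f w ∂Q := by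
    intro f c hfi hf h
    have := energy_min (mart f) (fun i => condExp_nonneg (ae_of_all _ hf)) h N
    rw [integral_condExp (O.le 0)] at this
    simpa only [D, sq_abs] using this
  set Ψ := ∫ w, |o w| ∂Q with hΨ
  have hΨ0 : 0 ≤ Ψ := integral_nonneg fun w => abs_nonneg _
  have Ea : ∑ i ∈ Finset.range N, ∫ w, (D a b i w)^2 ∂Q ≤ 2 * b^2 := (En a b hai ha0 hb).trans (by nlinarith [sq_nonneg b])
  have Ep : ∑ i ∈ Finset.range N, ∫ w, (D p c i w)^2 ∂Q ≤ 2 * (c * Ψ) := (En p c ip p0 hc).trans (by nlinarith [integral_mono ip ho.abs po])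
  have Eq : ∑ i ∈ Finset.range N, ∫ w, (D q c i w)^2 ∂Q ≤ 2 * (c * Ψ) := (En q c iq q0 hc).trans (by nlinarith [integral_mono iq ho.abs qo])
  have C1 := cs_sum (Finset.range N) (Dsq a b ha0 hb) (Dsq p c p0 hc) (Dprod a p b c ha0 p0 hb hc) Ea Ep
  have C2 := cs_sum (Finset.range N) (Dsq a b ha0 hb) (Dsq q c q0 hc) (Dprod a q b c ha0 q0 hb hc) Ea Eq
  have hs : √(2 * b^2) * √(2 * (c * Ψ)) = 2 * b * √(c * Ψ) := by
    rw [Real.sqrt_mul (by norm_num), Real.sqrt_mul (by norm_num), Real.sqrt_sq hb.le]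
    have : √2 * √2 = (2:ℝ) := Real.mul_self_sqrt (by norm_num)
    linear_combination b * √(c * Ψ) * this
  rw [hs] at C1 C2
  have key : ∀ i, |∫ w, χ i w * (dm O Q a i w * dm O Q o i w) ∂Q| ≤
      ∫ w, D a b i w * D p c i w ∂Q + ∫ w, D a b i w * D q c i w ∂Q := fun i => by
    rw [← integral_add (Dprod a p b c ha0 p0 hb hc i) (Dprod a q b c ha0 q0 hb hc i)]
    rw [← norm_eq_abs]
    refine norm_integral_le_of_norm_le ((Dprod a p b c ha0 p0 hb hc i).add (Dprod a q b c ha0 q0 hb hc i)) ?_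
    filter_upwards [h1 i, cp i, cp (i+1), cq i, cq (i+1), cs i, cs (i+1)] with w e e1 e2 e3 e4 e5 e6
    have hz := add_nonneg (mul_nonneg (Dpos a b i w) (Dpos p c i w)) (mul_nonneg (Dpos a b i w) (Dpos q c i w))
    by_cases h0 : χ i w = 0
    · simpa [h0] using hz
    obtain ⟨f1, f2, f3, f4⟩ := e h0
    have da : |dm O Q a i w| = D a b i w := by
      simp only [D, dm]; rw [min_eq_left f1, min_eq_left f2]
    have dp : D p c i w = |(Q[p|O (i+1)]) w - (Q[p|O i]) w| := by
      simp only [D]; rw [min_eq_left (e1.trans f3), min_eq_left (e2.trans f4)]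
    have dq : D q c i w = |(Q[q|O (i+1)]) w - (Q[q|O i]) w| := by
      simp only [D]; rw [min_eq_left (e3.trans f3), min_eq_left (e4.trans f4)]
    have dpsi : |dm O Q o i w| ≤ D p c i w + D q c i w := by
      rw [dp, dq]; simp only [dm]; rw [e5, e6]
      refine le_trans (le_of_eq ?_) (abs_sub _ _)
      congr 1; ring
    rw [norm_eq_abs, abs_mul, abs_mul, da, ← mul_add]
    calc _ ≤ 1 * (D a b i w * |dm O Q o i w|) := mul_right_le (hχ1 i w) (mul_nonneg (Dpos _ _ _ _) (abs_nonneg _))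
      _ ≤ _ := by rw [one_mul]; exact mul_left_le dpsi (Dpos _ _ _ _)
  calc _ ≤ ∑ i ∈ Finset.range N, (∫ w, D a b i w * D p c i w ∂Q + ∫ w, D a b i w * D q c i w ∂Q) := sum_le_sum fun i _ => key i
    _ ≤ _ := by
      rw [sum_add_distrib]
      linarith [(abs_le.1 C1).2, (abs_le.1 C2).2]
theorem stepB_disc {L o : Ω → ℝ} (hL : Measurable L) (hL0 : ∀ w, 0 ≤ L w) [IsPr (wd Q L)]
 (hLi : Integrable L Q) (ho : Integrable o Q)
 {k c b e K : ℝ} (hk : 0 ≤ k) (hc : 0 < c) (hb : 0 < b) (hb1 : b ≤ 1) (hK : 0 ≤ K)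
 (hab : ∫ w, max (L w - k) 0 ∂Q ≤ b^2)
 {U : ℕ → Ω → ℝ} (hU : Martingale U O (wd Q L)) {B : ℕ → Set Ω} (hB : ∀ i, MeasurableSet[O i] (B i))
 (hUS : ∀ i, ∀ᵐ w ∂Q, w ∈ B i → U i w = (Q[o|O i]) w) (N : ℕ)
 (herr : ∀ i, Integrable (fun w => ind (B i) w * (U (i+1) w - (Q[o|O (i+1)]) w)) Q)
 (hes : ∑ i ∈ Finset.range N, ∫ w, |ind (B i) w * (U (i+1) w - (Q[o|O (i+1)]) w)| ∂Q ≤ e)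
 {φ : ℕ → Ω → ℝ} (hφ : ∀ i, StronglyMeasurable[O i] (φ i)) (hφ1 : ∀ i w, |φ i w| ≤ 1) :
 ∑ i ∈ Finset.range N, |∫ w, φ i w * ind (B i ∩ (stay (fun i => Q[fun w => max (L w - k) 0|O i]) b i ∩
 stay (fun i => Q[(fun w => |o w|)|O i]) c i)) w * (dm O Q (fun w => min (L w) k) i w * o w) ∂Q| ≤
 (k + b) * e + 4 * b * √(c * ∫ w, |o w| ∂Q) + b * (∫ w, |o w| ∂Q + c) + c * b^2 +
 (K * (wd Q L).real {w | k < L w} + ∫ w, max (|U N w| - K) 0 ∂(wd Q L)) := by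
  set a : Ω → ℝ := fun w => max (L w - k) 0 with ha
  have hai : Integrable a Q := (hLi.sub (integrable_const k)).sup (integrable_const 0)
  have ha0 : ∀ w, 0 ≤ a w := fun w => le_max_right _ _
  set A : ℕ → Ω → ℝ := fun i => Q[a|O i] with hA
  set Y : ℕ → Ω → ℝ := fun i => Q[(fun w => |o w|)|O i] with hY
  have mA : Martingale A O Q := martingale_condExp a O Q
  have mY : Martingale Y O Q := martingale_condExp _ O Q
  have m1 : Martingale (fun _ _ => (1:ℝ)) O Q := martingale_const O Q 1
  have A0 : ∀ i, 0 ≤ᵐ[Q] A i := fun i => condExp_nonneg (ae_of_all _ ha0)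
  have Y0 : ∀ i, 0 ≤ᵐ[Q] Y i := fun i => condExp_nonneg (ae_of_all _ fun w => abs_nonneg _)
  set G : ℕ → Set Ω := fun i => stay A b i ∩ stay Y c i with hG
  have Gm : ∀ i, MeasurableSet[O i] (G i) := fun i => (stay_meas mA.1 b i).inter (stay_meas mY.1 c i)
  have Ga : Antitone G := fun i j h => inter_subset_inter (stay_anti A b h) (stay_anti Y c h)
  set χ : ℕ → Ω → ℝ := fun i w => φ i w * ind (B i ∩ G i) w with hχd
  have hχ : ∀ i, StronglyMeasurable[O i] (χ i) := fun i => (hφ i).mul (ind_sm ((hB i).inter (Gm i)))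
  have hχ1 : ∀ i w, |χ i w| ≤ 1 := fun i w => by
    simp only [hχd, abs_mul]
    exact mul_le_one₀ (hφ1 i w) (abs_nonneg _) (ind_abs _ w)
  have hχm : ∀ i w, χ i w ≠ 0 → w ∈ B i ∩ G i := fun i w h => by
    by_contra hn
    exact h (by simp only [hχd]; rw [ind_nmem hn, mul_zero])
  have SY : ∀ i, ∀ᵐ w ∂Q, |(Q[o|O i]) w| ≤ Y i w := fun i => by
    filter_upwards [abs_condExp_ae_le_condExp_abs (m := O i) (μ := Q) (f := o)] with w h using h
  have hJ : ∀ i, MeasurableSet[O (i+1)] (G i \ G (i+1)) := fun i =>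
    ((O.mono (Nat.le_succ i)) _ (Gm i)).diff (Gm (i+1))
  set err : ℕ → Ω → ℝ := fun i w => ind (B i) w * (U (i+1) w - (Q[o|O (i+1)]) w) with herrd
  have hSc : ∀ i, ∀ᵐ w ∂Q, χ i w ≠ 0 → |(Q[o|O i]) w| ≤ c := fun i => by
    filter_upwards [SY i] with w h h0
    exact h.trans ((hχm i w h0).2.2 i le_rfl)
  have hUc : ∀ i, ∀ᵐ w ∂Q, χ i w ≠ 0 → |U i w| ≤ c := fun i => by
    filter_upwards [hSc i, hUS i] with w h h' h0
    rw [h' (hχm i w h0).1]; exact h h0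
  have he : ∀ i, ∀ᵐ w ∂Q, χ i w ≠ 0 → U (i+1) w - U i w = (Q[o|O (i+1)]) w - (Q[o|O i]) w + err i w := fun i => by
    filter_upwards [hUS i] with w h' h0
    rw [h' (hχm i w h0).1]
    simp only [herrd]; rw [ind_mem (hχm i w h0).1]; ring
  have hUR : ∀ i, ∫ w, χ i w * (U (i+1) w - U i w) ∂(wd Q L) = 0 := fun i => by
    have hm := (hχ i).mono (O.le i)
    have i1 : Integrable (fun w => χ i w * U (i+1) w) (wd Q L) := int_mul hm.aestronglyMeasurable (ae_of_all _ (hχ1 i)) (hU.integrable _)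
    have i0 : Integrable (fun w => χ i w * U i w) (wd Q L) := int_mul hm.aestronglyMeasurable (ae_of_all _ (hχ1 i)) (hU.integrable _)
    have := mg_int hU (Nat.le_succ i) (hχ i) i1
    simp_rw [mul_sub]
    rw [integral_sub i1 i0, this, sub_self]
  have T : ∀ i, |∫ w, χ i w * (dm O Q (fun w => min (L w) k) i w * o w) ∂Q| ≤
      (k + b) * ∫ w, |err i w| ∂Q + |∫ w, χ i w * ind (G (i+1)) w * (dm O Q a i w * dm O Q o i w) ∂Q|
       + b * (∫ w, ind (G i \ G (i+1)) w * Y (i+1) w ∂Q + c * Q.real (G i \ G (i+1)))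
       + (∫ w, ind {w | k < L w} w * (ind (G i \ G (i+1)) w * |U (i+1) w|) ∂(wd Q L) +
          c * ∫ w, ind (G i \ G (i+1)) w * A (i+1) w ∂Q) := fun i => by
    have s1 := step1 (O := O) (i := i) hL hL0 hLi hk ho (hχ i) (hχ1 i) (hU.1 i) (hU.1 (i+1)) (hU.integrable i)
      (hU.integrable (i+1)) (hUR i) (herr i) (he i)
    have s2 := step2 (O := O) (i := i) (G := G (i+1)) (J := G i \ G (i+1)) hL hL0 hLi hk hc.le hb.le ho (hχ i) (hχ1 i)
      (hU.1 (i+1)) (hU.1 i) (hU.integrable (i+1)) (hU.integrable i) (herr i) (Gm (i+1)) (hJ i)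
      (fun w h h' => ⟨(hχm i w h).2, h'⟩) (hSc i) (hUc i)
      (ae_of_all _ fun w h => (hχm i w h).2.1 i le_rfl) (ae_of_all _ fun w h => h.1 (i+1) le_rfl) (he i)
    rw [wd_int hL hL0]
    linarith [s1, s2]
  have e1 := cs_part (O := O) (χ := fun i w => χ i w * ind (G (i+1)) w) hai ha0 ho hb hb1 hc hab
    (fun i w => by rw [abs_mul]; exact mul_le_one₀ (hχ1 i w) (abs_nonneg _) (ind_abs _ w))
    (fun i => ae_of_all _ fun w h => by
      have h1 := hχm i w (left_ne_zero_of_mul h)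
      have h2 : w ∈ G (i+1) := by
        by_contra hn
        exact right_ne_zero_of_mul h (ind_nmem hn)
      exact ⟨h1.2.1 i le_rfl, h2.1 (i+1) le_rfl, h1.2.2 i le_rfl, h2.2 (i+1) le_rfl⟩) N
  have e2 := jump_le' mY Gm Ga N Y0
  have e3 := jump_le' m1 Gm Ga N (fun i => ae_of_all _ fun w => zero_le_one)
  have e4 := jump_le' mA Gm Ga N A0
  have e5 := jump_big hU Gm Ga N hK (H := {w | k < L w}) (measurableSet_lt measurable_const hL)
  have y0 : ∫ w, Y 0 w ∂Q = ∫ w, |o w| ∂Q := integral_condExp (O.le 0)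
  have a0 : ∫ w, A 0 w ∂Q = ∫ w, a w ∂Q := integral_condExp (O.le 0)
  have e3' : ∑ i ∈ Finset.range N, Q.real (G i \ G (i+1)) ≤ 1 := by
    simp only [mul_one, integral_const, probReal_univ, smul_eq_mul] at e3
    calc _ = ∑ i ∈ Finset.range N, ∫ w, ind (G i \ G (i+1)) w ∂Q := sum_congr rfl fun i _ => (int_ind Q (O.le _ _ (hJ i))).symm
      _ ≤ 1 := e3
  have hs := sum_le_sum fun i (_ : i ∈ Finset.range N) => T i
  simp only [sum_add_distrib, ← mul_sum] at hs
  have f1 := mul_left_le hes (add_nonneg hk hb.le)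
  have f2 := mul_left_le (add_le_add e2 (mul_left_le e3' hc.le)) hb.le
  have f3 := mul_left_le e4 hc.le
  have f4 := mul_left_le hab hc.le
  rw [y0] at f2
  rw [a0] at f3
  linarith [hs, f1, f2, f3, f4, e1, e5]
end StepB2
section StepB3
variable {Ω : Type*} {m : MeasurableSpace Ω} {Q : Measure Ω} [IsPr Q]
  {O : Filtration ℕ m}
def Tl (O : Filtration ℕ m) (Q : Measure Ω) (l : ℝ) (L f D : Ω → ℝ) (i : ℕ) : Set Ω :=
  {w | l * wb O Q D i w < |hb O Q Q L f i w|}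
lemma Tl_meas (l : ℝ) (L f D : Ω → ℝ) (i : ℕ) : MeasurableSet[O i] (Tl O Q l L f D i) := @measurableSet_lt _ _ _ _ _ (O i) _ _ _ _ _
    ((stronglyMeasurable_condExp.measurable).const_mul l) (continuous_abs.measurable.comp stronglyMeasurable_condExp.measurable)
def sgn (O : Filtration ℕ m) (Q : Measure Ω) (l : ℝ) (L f D : Ω → ℝ) (i : ℕ) (w : Ω) : ℝ := ind (Tl O Q l L f D i) w * (2 * ind {w | 0 ≤ hb O Q Q L f i w} w - 1)
lemma sgn_sm (l : ℝ) (L f D : Ω → ℝ) (i : ℕ) : StronglyMeasurable[O i] (sgn O Q l L f D i) := by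
  have h : MeasurableSet[O i] {w | 0 ≤ hb O Q Q L f i w} := @measurableSet_le _ _ _ _ _ (O i) _ _ _ _ _ measurable_const stronglyMeasurable_condExp.measurable
  exact (ind_sm (Tl_meas l L f D i)).mul (((ind_sm h).const_mul 2).sub stronglyMeasurable_const)
lemma sgn_abs (l : ℝ) (L f D : Ω → ℝ) (i : ℕ) (w : Ω) : |sgn O Q l L f D i w| ≤ 1 := by
  unfold sgn
  rw [abs_mul]
  refine mul_le_one₀ (ind_abs _ _) (abs_nonneg _) ?_
  have h1 := ind_nn {w | 0 ≤ hb O Q Q L f i w} w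
  have h2 := ind_le_one {w | 0 ≤ hb O Q Q L f i w} w
  exact abs_le.2 ⟨by linarith, by linarith⟩
lemma sgn_hb (l : ℝ) (L f D : Ω → ℝ) (i : ℕ) (w : Ω) :
 sgn O Q l L f D i w * hb O Q Q L f i w = ind (Tl O Q l L f D i) w * |hb O Q Q L f i w| := by
  unfold sgn
  by_cases h : 0 ≤ hb O Q Q L f i w
  · rw [ind_mem (show w ∈ {w | 0 ≤ hb O Q Q L f i w} from h), abs_of_nonneg h]; ring
  · rw [ind_nmem (show w ∉ {w | 0 ≤ hb O Q Q L f i w} from h), abs_of_neg (not_le.1 h)]; ring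
lemma sign_int {l : ℝ} {L f D : Ω → ℝ} {k : ℝ} (hk : 0 ≤ k) (hL : ∀ w, |L w| ≤ k)
 (hD : ∀ᵐ w ∂Q, |D w| ≤ 1) (hf : Integrable f Q) {i : ℕ} {C : Set Ω} (hC : MeasurableSet[O i] C) :
 l * ∫ w, ind (Tl O Q l L f D i ∩ C) w * (dm O Q D i w)^2 ∂Q ≤
 |∫ w, sgn O Q l L f D i w * ind C w * (dm O Q L i w * f w) ∂Q| := by
  have le0 := O.le i
  have hT := Tl_meas (O := O) (Q := Q) l L f D i
  have hTC := hT.inter hC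
  have hdf : Integrable (fun w => dm O Q L i w * f w) Q := int_mul (dm_aesm Q Q L i) (dm_abs hk (ae_of_all _ hL) i) hf
  have hwv := wb_int (O := O) hD i
  have iw : Integrable (fun w => ind (Tl O Q l L f D i ∩ C) w * (dm O Q D i w)^2) Q := int_indm (le0 _ hTC) hwv
  have hsm := (sgn_sm (O := O) (Q := Q) l L f D i).mul (ind_sm hC)
  have is : Integrable (fun w => sgn O Q l L f D i w * ind C w * (dm O Q L i w * f w)) Q := by
    refine int_mul (c := 1) (aesm_of le0 hsm) (ae_of_all _ fun w => ?_) hdf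
    rw [abs_mul]; exact mul_le_one₀ (sgn_abs _ _ _ _ _ _) (abs_nonneg _) (ind_abs _ _)
  have e1 := pull le0 hsm is hdf
  have e2 := pull le0 (ind_sm hTC) iw hwv
  rw [← e2]
  simp only [Pi.mul_apply] at e1
  rw [← e1, ← integral_const_mul]
  refine le_trans ?_ (le_abs_self _)
  refine integral_mono ((int_indm (le0 _ hTC) integrable_condExp).const_mul l) (pull_int hsm is hdf) fun w => ?_
  have h3 : sgn O Q l L f D i w * ind C w * hb O Q Q L f i w = ind (Tl O Q l L f D i) w * ind C w * |hb O Q Q L f i w| := by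
    rw [mul_right_comm, sgn_hb]; ring
  have h4 : ind (Tl O Q l L f D i ∩ C) w = ind (Tl O Q l L f D i) w * ind C w := by
    by_cases h1 : w ∈ Tl O Q l L f D i <;> by_cases h2 : w ∈ C
    · rw [ind_mem (A := Tl O Q l L f D i ∩ C) ⟨h1, h2⟩, ind_mem h1, ind_mem h2]; ring
    · rw [ind_nmem (fun h => h2 h.2), ind_nmem h2]; ring
    · rw [ind_nmem (fun h => h1 h.1), ind_nmem h1]; ring
    · rw [ind_nmem (fun h => h1 h.1), ind_nmem h1]; ring
  change l * (ind (Tl O Q l L f D i ∩ C) w * wb O Q D i w) ≤ sgn O Q l L f D i w * ind C w * hb O Q Q L f i w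
  rw [h3, h4]
  by_cases h1 : w ∈ Tl O Q l L f D i
  · have h1' : l * wb O Q D i w < |hb O Q Q L f i w| := h1
    rw [ind_mem h1]; have := ind_nn C w; nlinarith
  · rw [ind_nmem h1]; simp
lemma tail_energy {D : Ω → ℝ} (hD : ∀ᵐ w ∂Q, |D w| ≤ 1) (N M : ℕ) (hNM : N ≤ M) :
 ∑ i ∈ Finset.range M, ∫ w, (if N ≤ i then 1 else 0) * (dm O Q D i w)^2 ∂Q ≤
 2 * ∫ w, |D w - (Q[D|O N]) w| ∂Q := by
  by_cases hDi : Integrable D Q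
  swap
  · have : ∀ i, dm O Q D i = fun _ => 0 := fun i => by
      ext w; simp only [dm]; rw [condExp_of_not_integrable hDi, condExp_of_not_integrable hDi]; simp
    simp only [this]
    simp only [ne_eq, OfNat.ofNat_ne_zero, not_false_eq_true, zero_pow, mul_zero, integral_zero, Finset.sum_const_zero]
    positivity
  set D' : Ω → ℝ := Q[D|O N] with hD'
  set X : ℕ → Ω → ℝ := fun i => Q[fun w => D w - D' w|O i] with hX
  have b' : ∀ᵐ w ∂Q, |D' w| ≤ 1 := ce_abs zero_le_one hD _
  have hb : ∀ᵐ w ∂Q, |D w - D' w| ≤ 2 := by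
    filter_upwards [hD, b'] with w h1 h2
    exact (abs_sub _ _).trans (by linarith)
  have hXb : ∀ i, ∀ᵐ w ∂Q, |X i w| ≤ 2 := fun i => ce_abs zero_le_two hb _
  have hXm : Martingale X O Q := martingale_condExp _ _ _
  set E : ℕ → Set Ω := fun i => {_w | N ≤ i} with hE
  have := energy_inc hXm hXb (E := E) (fun i => MeasurableSet.const _) (fun i j hij w h => le_trans h hij) M
  have hi : ∀ i, ∀ᵐ w ∂Q, N ≤ i → X i w = (Q[D|O i]) w - D' w := fun i => by
    by_cases hNi : N ≤ i
    · have h1 : X i =ᵐ[Q] Q[D|O i] - Q[D'|O i] := condExp_sub hDi integrable_condExp _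
      have h2 : Q[D'|O i] = D' := condExp_of_stronglyMeasurable (O.le i)
        (stronglyMeasurable_condExp.mono (O.mono hNi)) integrable_condExp
      rw [h2] at h1
      filter_upwards [h1] with w h _ using h
    · exact ae_of_all _ fun w h => absurd h hNi
  have e1 : ∑ i ∈ Finset.range M, ∫ w, (if N ≤ i then 1 else 0) * (dm O Q D i w)^2 ∂Q =
      ∑ i ∈ Finset.range M, ∫ w, ind (E i) w * (X (i+1) w - X i w)^2 ∂Q := by
    refine sum_congr rfl fun i _ => integral_congr_ae ?_
    filter_upwards [hi i, hi (i+1)] with w h1 h2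
    by_cases hNi : N ≤ i
    · rw [if_pos hNi, ind_mem (show w ∈ E i from hNi), h1 hNi, h2 (hNi.trans (Nat.le_succ i))]
      simp only [dm]; ring
    · rw [if_neg hNi, ind_nmem (show w ∉ E i from hNi)]; ring
  rw [e1]
  refine this.trans ?_
  have hDD : Integrable (fun w => D w - D' w) Q := hDi.sub integrable_condExp
  have f1 : ∫ w, |X M w| ∂Q ≤ ∫ w, |D w - D' w| ∂Q := integral_abs_condExp_le _
  calc _ ≤ ∫ w, 2 * |X M w| ∂Q := by
        refine integral_mono_ae ?_ (integrable_condExp.abs.const_mul 2) ?_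
        · refine int_indm (MeasurableSet.const _) ?_
          refine int_bdd (c := 4) ((hXm.integrable M).1.pow 2) ?_
          filter_upwards [hXb M] with w h
          rw [abs_pow]; nlinarith [abs_nonneg (X M w)]
        · filter_upwards [hXb M] with w h
          have h1 := ind_nn (E M) w
          have h2 := ind_le_one (E M) w
          have h3 : X M w ^ 2 ≤ 2 * |X M w| := by rw [← sq_abs]; nlinarith [abs_nonneg (X M w)]
          nlinarith [sq_nonneg (X M w)]
    _ ≤ _ := by rw [integral_const_mul]; linarith
theorem stepB_level {L o D : Ω → ℝ} (hL : Measurable L) (hL0 : ∀ w, 0 ≤ L w) [IsPr (wd Q L)]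
 (hLi : Integrable L Q) (ho : Integrable o Q) (hD : ∀ᵐ w ∂Q, |D w| ≤ 1)
 {k c b e K l : ℝ} (hk : 0 ≤ k) (hc : 0 < c) (hb : 0 < b) (hb1 : b ≤ 1) (hK : 0 ≤ K) (hl : 0 < l)
 (hab : ∫ w, max (L w - k) 0 ∂Q ≤ b^2)
 {U : ℕ → Ω → ℝ} (hU : Martingale U O (wd Q L)) {B : ℕ → Set Ω} (hB : ∀ i, MeasurableSet[O i] (B i))
 (hBa : Antitone B) (N M : ℕ) (hNM : N ≤ M)
 (hUS : ∀ i < N, ∀ᵐ w ∂Q, w ∈ B i → U i w = (Q[o|O i]) w)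
 (herr : ∀ i < N, Integrable (fun w => ind (B i) w * (U (i+1) w - (Q[o|O (i+1)]) w)) Q)
 (hes : ∑ i ∈ Finset.range N, ∫ w, |ind (B i) w * (U (i+1) w - (Q[o|O (i+1)]) w)| ∂Q ≤ e) :
 ∑ i ∈ Finset.range M, ∫ w, ind (Tl O Q l (fun w => min (L w) k) o D i) w * (dm O Q D i w)^2 ∂Q ≤
 ((k + b) * e + 4 * b * √(c * ∫ w, |o w| ∂Q) + b * (∫ w, |o w| ∂Q + c) + c * b^2 +
 (K * (wd Q L).real {w | k < L w} + ∫ w, max (|U N w| - K) 0 ∂(wd Q L))) / l +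
 (Q.real (B N)ᶜ + b + (∫ w, |o w| ∂Q) / c) + 2 * ∫ w, |D w - (Q[D|O N]) w| ∂Q := by
  set Lk : Ω → ℝ := fun w => min (L w) k with hLk
  have hmb : ∀ w, |Lk w| ≤ k := fun w => by
    simp only [hLk]
    rw [abs_of_nonneg (le_min (hL0 w) hk)]; exact min_le_right _ _
  set a : Ω → ℝ := fun w => max (L w - k) 0 with ha
  have hai : Integrable a Q := (hLi.sub (integrable_const k)).sup (integrable_const 0)
  have ha0 : ∀ w, 0 ≤ a w := fun w => le_max_right _ _
  set A : ℕ → Ω → ℝ := fun i => Q[a|O i] with hA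
  set Y : ℕ → Ω → ℝ := fun i => Q[(fun w => |o w|)|O i] with hY
  have mA : Martingale A O Q := martingale_condExp a O Q
  have mY : Martingale Y O Q := martingale_condExp _ O Q
  have A0 : ∀ i, 0 ≤ᵐ[Q] A i := fun i => condExp_nonneg (ae_of_all _ ha0)
  have Y0 : ∀ i, 0 ≤ᵐ[Q] Y i := fun i => condExp_nonneg (ae_of_all _ fun w => abs_nonneg _)
  set G : ℕ → Set Ω := fun i => stay A b i ∩ stay Y c i with hG
  have Gm : ∀ i, MeasurableSet[O i] (G i) := fun i => (stay_meas mA.1 b i).inter (stay_meas mY.1 c i)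
  have Ga : Antitone G := fun i j h => inter_subset_inter (stay_anti A b h) (stay_anti Y c h)
  set B' : ℕ → Set Ω := fun i => if i < N then B i else ∅ with hB'
  have B'm : ∀ i, MeasurableSet[O i] (B' i) := fun i => by
    simp only [hB']; split_ifs
    · exact hB i
    · exact @MeasurableSet.empty _ (O i)
  have B'e : ∀ i, i < N → B' i = B i := fun i h => by simp only [hB', if_pos h]
  have B'n : ∀ i, ¬ i < N → B' i = ∅ := fun i h => by simp only [hB', if_neg h]
  have main := stepB_disc (O := O) hL hL0 hLi ho hk hc hb hb1 hK hab hU B'm (fun i => by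
      by_cases h : i < N
      · rw [B'e i h]; exact hUS i h
      · rw [B'n i h]; exact ae_of_all _ fun w h => absurd h (notMem_empty w)) N (fun i => by
      by_cases h : i < N
      · rw [B'e i h]; exact herr i h
      · rw [B'n i h]; refine (integrable_zero _ _ _).congr (ae_of_all _ fun w => ?_)
        simp [ind]) (e := e) (by
      refine le_trans (le_of_eq (sum_congr rfl fun i hi => ?_)) hes
      rw [B'e i (Finset.mem_range.1 hi)]) (φ := fun i => sgn O Q l Lk o D i)
      (fun i => sgn_sm l Lk o D i) (fun i w => sgn_abs l Lk o D i w)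
  set θ := (k + b) * e + 4 * b * √(c * ∫ w, |o w| ∂Q) + b * (∫ w, |o w| ∂Q + c) + c * b^2 +
      (K * (wd Q L).real {w | k < L w} + ∫ w, max (|U N w| - K) 0 ∂(wd Q L)) with hθ
  have hwv := fun i => wb_int (O := O) hD i
  have hTm := fun i => O.le i _ (Tl_meas (O := O) (Q := Q) l Lk o D i)
  have hCm : ∀ i, MeasurableSet[O i] (B i ∩ G i) := fun i => (hB i).inter (Gm i)
  have s1 : ∑ i ∈ Finset.range N, ∫ w, ind (Tl O Q l Lk o D i ∩ (B i ∩ G i)) w * (dm O Q D i w)^2 ∂Q ≤ θ / l := by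
    rw [le_div_iff₀ hl, mul_comm, mul_sum]
    refine le_trans (sum_le_sum fun i hi => ?_) main
    rw [B'e i (Finset.mem_range.1 hi)]
    exact sign_int hk hmb hD ho (hCm i)
  have s2 : ∑ i ∈ Finset.range N, ∫ w, ind (B i ∩ G i)ᶜ w * (dm O Q D i w)^2 ∂Q ≤
      Q.real (B N)ᶜ + b + (∫ w, |o w| ∂Q) / c := by
    refine (mass_compl hD hCm (fun i j h => inter_subset_inter (hBa h) (Ga h)) N).trans ?_
    have u1 := maximal_stay mA A0 (c := b) N
    have u2 := maximal_stay mY Y0 (c := c) N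
    have y0 : ∫ w, Y 0 w ∂Q = ∫ w, |o w| ∂Q := integral_condExp (O.le 0)
    have a0 : ∫ w, A 0 w ∂Q = ∫ w, a w ∂Q := integral_condExp (O.le 0)
    rw [a0] at u1
    rw [y0] at u2
    have v1 : Q.real (stay A b N)ᶜ ≤ b := by nlinarith
    have v2 : Q.real (stay Y c N)ᶜ ≤ (∫ w, |o w| ∂Q) / c := by rw [le_div_iff₀ hc, mul_comm]; exact u2
    rw [compl_inter, hG, compl_inter]
    have w1 := measureReal_union_le (μ := Q) (B N)ᶜ ((stay A b N)ᶜ ∪ (stay Y c N)ᶜ)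
    have w2 := measureReal_union_le (μ := Q) (stay A b N)ᶜ (stay Y c N)ᶜ
    linarith
  have s3 := tail_energy (O := O) hD N M hNM
  have split : ∀ i, ∫ w, ind (Tl O Q l Lk o D i) w * (dm O Q D i w)^2 ∂Q ≤
     (if i < N then (∫ w, ind (Tl O Q l Lk o D i ∩ (B i ∩ G i)) w * (dm O Q D i w)^2 ∂Q +
       ∫ w, ind (B i ∩ G i)ᶜ w * (dm O Q D i w)^2 ∂Q) else 0) + ∫ w, (if N ≤ i then 1 else 0) * (dm O Q D i w)^2 ∂Q := by
    intro i
    have hCm' := O.le i _ (hCm i)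
    by_cases h : i < N
    · rw [if_pos h, if_neg (not_le.2 h), ← integral_add (int_indm ((hTm i).inter hCm') (hwv i)) (int_indm hCm'.compl (hwv i))]
      simp only [zero_mul, integral_zero, add_zero]
      refine integral_mono (int_indm (hTm i) (hwv i)) ((int_indm ((hTm i).inter hCm') (hwv i)).add (int_indm hCm'.compl (hwv i))) fun w => ?_
      simp only [Pi.add_apply]
      rw [← add_mul]
      refine mul_right_le ?_ (sq_nonneg _)
      by_cases h1 : w ∈ B i ∩ G i
      · by_cases h2 : w ∈ Tl O Q l Lk o D i
        · rw [ind_mem (A := Tl O Q l Lk o D i ∩ (B i ∩ G i)) ⟨h2, h1⟩]; linarith [ind_le_one (Tl O Q l Lk o D i) w, ind_nn (B i ∩ G i)ᶜ w]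
        · rw [ind_nmem h2]; exact add_nonneg (ind_nn _ _) (ind_nn _ _)
      · rw [ind_mem (show w ∈ (B i ∩ G i)ᶜ from h1)]; linarith [ind_le_one (Tl O Q l Lk o D i) w, ind_nn (Tl O Q l Lk o D i ∩ (B i ∩ G i)) w]
    · rw [if_neg h, if_pos (not_lt.1 h), zero_add]
      simp only [one_mul]
      refine integral_mono (int_indm (hTm i) (hwv i)) (hwv i) fun w => ?_
      exact mul_le_of_le_one_left (sq_nonneg _) (ind_le_one _ _)
  have tot := sum_le_sum fun i (_ : i ∈ Finset.range M) => split i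
  rw [sum_add_distrib, ← Finset.sum_filter] at tot
  have hfil : (Finset.range M).filter (fun i => i < N) = Finset.range N := by
    ext i; simp only [Finset.mem_filter, Finset.mem_range]; omega
  rw [hfil, sum_add_distrib] at tot
  linarith
end StepB3
section P20
variable {Ω : Type*} {m : MeasurableSpace Ω} {Q : Measure Ω} [IsPr Q]
  {O : Filtration ℕ m}
lemma rat_meas' (l : ℝ) (L f D : Ω → ℝ) (r : ℕ) :
 MeasurableSet[O r] {w | l < |hb O Q Q L f r w / wb O Q D r w|} := by
  have h1 : Measurable[O r] (fun w => |hb O Q Q L f r w / wb O Q D r w|) := by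
    have a : StronglyMeasurable[O r] (hb O Q Q L f r) := stronglyMeasurable_condExp
    have b : StronglyMeasurable[O r] (wb O Q D r) := stronglyMeasurable_condExp
    have c : Measurable[O r] (fun w => hb O Q Q L f r w / wb O Q D r w) := Measurable.div a.measurable b.measurable
    exact continuous_abs.measurable.comp c
  exact @measurableSet_lt _ _ _ _ _ (O r) _ _ _ _ _ measurable_const h1
lemma Tl_eq {l : ℝ} {L f D : Ω → ℝ} (hD : ∀ᵐ w ∂Q, |D w| ≤ 1) (i : ℕ) :
 ∫ w, ind (Tl O Q l L f D i) w * (dm O Q D i w)^2 ∂Q =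
 ∫ w, ind {w | l < |hb O Q Q L f i w / wb O Q D i w|} w * (dm O Q D i w)^2 ∂Q := by
  have hwv := wb_int (O := O) hD i
  have hT := Tl_meas (O := O) (Q := Q) l L f D i
  have hR := rat_meas' (O := O) (Q := Q) l L f D i
  rw [← pull (O.le i) (ind_sm hT) (int_indm (O.le i _ hT) hwv) hwv,
    ← pull (O.le i) (ind_sm hR) (int_indm (O.le i _ hR) hwv) hwv]
  refine integral_congr_ae ?_
  filter_upwards [wb_nonneg (P := Q) (O := O) D i] with w h0
  have h0 : 0 ≤ wb O Q D i w := h0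
  change ind _ w * wb O Q D i w = ind _ w * wb O Q D i w
  by_cases hz : wb O Q D i w = 0
  · rw [hz]; ring
  have hp := lt_of_le_of_ne h0 (Ne.symm hz)
  have : w ∈ Tl O Q l L f D i ↔ w ∈ {w | l < |hb O Q Q L f i w / wb O Q D i w|} := by
    simp only [Tl, mem_setOf_eq]; rw [abs_div, abs_of_pos hp, lt_div_iff₀ hp]
  by_cases h : w ∈ Tl O Q l L f D i
  · rw [ind_mem h, ind_mem (this.1 h)]
  · rw [ind_nmem h, ind_nmem (fun h' => h (this.2 h'))]
lemma pt1 {A : ℕ → Set Ω} (hA : Antitone A) {w : Ω} {y : ℕ → ℝ} (hy : ∀ i, |y i| ≤ 2)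
 (hY : ∀ r, w ∈ A r → |∑ i ∈ Finset.range r, y i| ≤ 1) (M : ℕ) :
 |∑ i ∈ Finset.range M, ind (A i) w * y i| ≤ 3 := by
  induction M with
  | zero => simp
  | succ M ih =>
    rw [sum_range_succ]
    by_cases h : w ∈ A M
    · have e : ∑ i ∈ Finset.range M, ind (A i) w * y i = ∑ i ∈ Finset.range M, y i := sum_congr rfl fun i hi => by rw [ind_mem (hA (Finset.mem_range.1 hi).le h), one_mul]
      rw [e, ind_mem h, one_mul]
      have := abs_add_le (∑ i ∈ Finset.range M, y i) (y M)
      linarith [hY M h, hy M]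
    · rw [ind_nmem h, zero_mul, add_zero]; exact ih
lemma pt2 {A : ℕ → Set Ω} (hA : Antitone A) {w : Ω} (x : ℕ → ℝ) (M : ℕ) :
 (w ∈ A M → ∑ i ∈ Finset.range M, ind (A i)ᶜ w * (x (i+1) - x i) = 0) ∧
 ∃ r, ∑ i ∈ Finset.range M, ind (A i)ᶜ w * (x (i+1) - x i) = x M - x r := by
  have h0 : ∀ M, w ∈ A M → ∑ i ∈ Finset.range M, ind (A i)ᶜ w * (x (i+1) - x i) = 0 := fun M h =>
    sum_eq_zero fun i hi => by
      rw [ind_nmem (by simpa using hA (Finset.mem_range.1 hi).le h), zero_mul]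
  refine ⟨h0 M, ?_⟩
  induction M with
  | zero => exact ⟨0, by simp⟩
  | succ M ih =>
    rw [sum_range_succ]
    by_cases h : w ∈ A M
    · exact ⟨M+1, by rw [h0 M h, ind_nmem (by simpa using h)]; ring⟩
    · obtain ⟨r, hr⟩ := ih
      exact ⟨r, by rw [hr, ind_mem (by simpa using h)]; ring⟩
lemma swap1 {G : MeasurableSpace Ω} (hG : G ≤ m) {φ D L : Ω → ℝ} {a b c : ℝ}
 (hφ : StronglyMeasurable[G] φ) (hφb : ∀ w, |φ w| ≤ a)
 (hDm : AEStronglyMeasurable[m] D Q) (hLm : AEStronglyMeasurable[m] L Q)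
 (hb0 : 0 ≤ b) (hc0 : 0 ≤ c)
 (hD : ∀ᵐ w ∂Q, |D w| ≤ b) (hL : ∀ᵐ w ∂Q, |L w| ≤ c) :
 ∫ w, φ w * (Q[D|G]) w * L w ∂Q = ∫ w, φ w * ((Q[L|G]) w * D w) ∂Q := by
  have iD := int_bdd hDm hD
  have iL := int_bdd hLm hL
  have s1 : StronglyMeasurable[G] (fun w => φ w * (Q[D|G]) w) := hφ.mul stronglyMeasurable_condExp
  have s2 : StronglyMeasurable[G] (fun w => φ w * (Q[L|G]) w) := hφ.mul stronglyMeasurable_condExp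
  have p1 := pull hG s1 (int_mul (c := a * b) (aesm_of hG s1) (by
    filter_upwards [ce_abs hb0 hD G] with w h
    rw [abs_mul]; exact mul_le_mul (hφb w) h (abs_nonneg _) ((abs_nonneg _).trans (hφb w))) iL) iL
  have p2 := pull hG s2 (int_mul (c := a * c) (aesm_of hG s2) (by
    filter_upwards [ce_abs hc0 hL G] with w h
    rw [abs_mul]; exact mul_le_mul (hφb w) h (abs_nonneg _) ((abs_nonneg _).trans (hφb w))) iD) iD
  rw [← p1]
  simp only [mul_assoc] at p2 ⊢
  rw [← p2]; congr 1; ext w; ring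
lemma energy_eq {D : Ω → ℝ} (hD : ∀ᵐ w ∂Q, |D w| ≤ 1) {φ : ℕ → Ω → ℝ}
 (hφ : ∀ i, StronglyMeasurable[O i] (φ i)) (hφb : ∀ i w, |φ i w| ≤ 1) (M : ℕ) :
 StronglyMeasurable[O M] (fun w => ∑ i ∈ Finset.range M, φ i w * dm O Q D i w) ∧
 (∀ᵐ w ∂Q, |∑ i ∈ Finset.range M, φ i w * dm O Q D i w| ≤ 2 * M) ∧
 (∀ A, MeasurableSet[O M] A → ∫ w, ind A w * (φ M w * dm O Q D M w) ∂Q = 0) ∧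
 ∫ w, (∑ i ∈ Finset.range M, φ i w * dm O Q D i w)^2 ∂Q =
 ∑ i ∈ Finset.range M, ∫ w, (φ i w)^2 * (dm O Q D i w)^2 ∂Q := by
  have hdb : ∀ i, ∀ᵐ w ∂Q, |φ i w * dm O Q D i w| ≤ 2 := fun i => by
    filter_upwards [dm_abs (O := O) zero_le_one hD i] with w h
    rw [abs_mul]; have := mul_le_mul (hφb i w) h (abs_nonneg _) zero_le_one; linarith
  have hsm : ∀ M, StronglyMeasurable[O M] (fun w => ∑ i ∈ Finset.range M, φ i w * dm O Q D i w) := fun M =>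
    Finset.stronglyMeasurable_fun_sum _ fun i hi =>
      (((hφ i).mono (O.mono (Nat.le_succ i))).mul (dm_sm Q D i)).mono (O.mono (Finset.mem_range.1 hi))
  have hbd : ∀ M : ℕ, ∀ᵐ w ∂Q, |∑ i ∈ Finset.range M, φ i w * dm O Q D i w| ≤ 2 * M := fun M => by
    filter_upwards [ae_all_iff.2 hdb] with w h
    refine (abs_sum_le_sum_abs _ _).trans ((sum_le_sum fun i _ => h i).trans ?_)
    simp [mul_comm]
  have horth : ∀ (M : ℕ) (g : Ω → ℝ) (c : ℝ), StronglyMeasurable[O M] g → (∀ᵐ w ∂Q, |g w| ≤ c) →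
      ∫ w, g w * (φ M w * dm O Q D M w) ∂Q = 0 := fun M g c hg hgb => by
    have := dm_orth (Q := Q) D (hg.mul (hφ M)) (int_mul (c := c) (aesm_of (O.le M) (hg.mul (hφ M))) (by
      filter_upwards [hgb] with w h
      rw [Pi.mul_apply, abs_mul]
      exact (mul_le_mul h (hφb M w) (abs_nonneg _) ((abs_nonneg _).trans h)).trans (by rw [mul_one])) integrable_condExp)
    simpa [mul_assoc] using this
  refine ⟨hsm M, hbd M, fun A hA => horth M _ 1 (ind_sm hA) (ae_of_all _ (ind_abs A)), ?_⟩
  induction M with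
  | zero => simp
  | succ M ih =>
    simp_rw [sum_range_succ]
    rw [← ih]
    set V : Ω → ℝ := fun w => ∑ i ∈ Finset.range M, φ i w * dm O Q D i w with hV
    set y : Ω → ℝ := fun w => φ M w * dm O Q D M w with hy
    have ym : AEStronglyMeasurable y Q := (aesm_of (O.le M) (hφ M)).mul (dm_aesm Q Q D M)
    have Vm : AEStronglyMeasurable V Q := aesm_of (O.le M) (hsm M)
    have iy : Integrable y Q := int_bdd ym (hdb M)
    have iV : Integrable V Q := int_bdd Vm (hbd M)
    have ov : ∫ w, V w * y w ∂Q = 0 := horth M V _ (hsm M) (hbd M)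
    have iVy : Integrable (fun w => V w * y w) Q := int_mul Vm (hbd M) iy
    have iVV : Integrable (fun w => V w * V w) Q := int_mul Vm (hbd M) iV
    have iyy : Integrable (fun w => y w * y w) Q := int_mul ym (hdb M) iy
    have e : ∀ w, (V w + y w)^2 = V w * V w + 2 * (V w * y w) + y w * y w := fun w => by ring
    have t1 : Integrable (fun w => V w * V w + 2 * (V w * y w)) Q := iVV.add (iVy.const_mul 2)
    calc ∫ w, (V w + y w)^2 ∂Q = ∫ w, (V w * V w + 2 * (V w * y w) + y w * y w) ∂Q := by simp_rw [e]
      _ = ∫ w, V w * V w ∂Q + ∫ w, y w * y w ∂Q := by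
        rw [integral_add t1 iyy, integral_add iVV (iVy.const_mul 2), integral_const_mul, ov]; ring
      _ = _ := by
        congr 1
        · congr 1; ext w; rw [sq]
        · congr 1; ext w; simp only [hy]; ring
lemma l1_l2 {Y : Ω → ℝ} {c : ℝ} (hm : AEStronglyMeasurable Y Q) (hc : ∀ᵐ w ∂Q, |Y w| ≤ c) :
 ∫ w, |Y w| ∂Q ≤ √(∫ w, (Y w)^2 ∂Q) := by
  have iY := int_bdd hm hc
  have i2 : Integrable (fun w => |Y w|^2) Q := by
    refine (int_mul hm hc iY).congr (ae_of_all _ fun w => ?_)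
    change Y w * Y w = |Y w|^2
    rw [sq_abs, sq]
  have := cs_sum (Q := Q) (a := fun _ w => |Y w|) (b := fun _ _ => 1) {0} (fun _ => i2)
    (fun _ => by simp) (fun _ => by simpa using iY.abs) (α := ∫ w, (Y w)^2 ∂Q) (β := 1)
    (by simp) (by simp)
  have h2 : |∫ w, |Y w| ∂Q| ≤ √(∫ w, (Y w)^2 ∂Q) := by simpa using this
  exact (le_abs_self _).trans h2
theorem fin_level {L D : Ω → ℝ} (hL : Measurable L) (hL0 : ∀ w, 0 ≤ L w)
 (hLi : Integrable L Q) (hDm : Measurable D) (hD : ∀ w, |D w| ≤ 1)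
 {k K δ s : ℝ} (hk : 0 ≤ k) (hK : 0 ≤ K) (hδ : 0 ≤ δ) (M : ℕ)
 (hs : ∑ i ∈ Finset.range M, ∫ w, ind {w | δ < |hb O Q Q (fun w => min (L w) k) D i w / wb O Q D i w|} w
 * (dm O Q D i w)^2 ∂Q ≤ s) :
 |∫ w, ((Q[D|O M]) w - (Q[D|O 0]) w) * min (L w) k ∂Q| ≤
 δ + 5 * K * √s + 5 * ∫ w, max (L w - K) 0 ∂Q := by
  set Lk : Ω → ℝ := fun w => min (L w) k with hLk
  have Lk0 : ∀ w, 0 ≤ Lk w := fun w => le_min (hL0 w) hk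
  have Lkb : ∀ w, |Lk w| ≤ k := fun w => by rw [abs_of_nonneg (Lk0 w)]; exact min_le_right _ _
  have Lkm : Measurable Lk := hL.min measurable_const
  have hD' : ∀ᵐ w ∂Q, |D w| ≤ 1 := ae_of_all _ hD
  set X : ℕ → Ω → ℝ := fun i => Q[D|O i] with hX
  have Xb : ∀ i, ∀ᵐ w ∂Q, |X i w| ≤ 1 := fun i => ce_abs zero_le_one hD' _
  set T : ℕ → Set Ω := fun i => Tl O Q δ Lk D D i with hT
  have Tm : ∀ i, MeasurableSet[O i] (T i) := fun i => Tl_meas δ Lk D D i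
  set Y : ℕ → Ω → ℝ := fun r w => ∑ i ∈ Finset.range r, ind (T i) w * dm O Q D i w with hY
  have enY := fun r => energy_eq (O := O) hD' (φ := fun i => ind (T i)) (fun i => ind_sm (Tm i)) (fun i w => ind_abs _ w) r
  have Ym : Martingale Y O Q := by
    refine martingale_of_setIntegral_eq_succ (fun i => (enY i).1)
      (fun i => int_bdd (aesm_of (O.le i) (enY i).1) (enY i).2.1) fun i A hA => ?_
    have hA' := O.le i _ hA
    rw [← int_ind_mul Q hA', ← int_ind_mul Q hA']
    have e : ∀ w, ind A w * Y (i+1) w = ind A w * Y i w + ind A w * (ind (T i) w * dm O Q D i w) := fun w => by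
      simp only [hY, sum_range_succ]; ring
    simp_rw [e]
    have i1 : Integrable (fun w => ind A w * Y i w) Q := int_indm hA' (int_bdd (aesm_of (O.le i) (enY i).1) (enY i).2.1)
    have i2 : Integrable (fun w => ind A w * (ind (T i) w * dm O Q D i w)) Q := int_indm hA' (int_indm (O.le i _ (Tm i)) (int_bdd (dm_aesm Q Q D i) (dm_abs zero_le_one hD' i)))
    rw [integral_add i1 i2, (enY i).2.2.1 A hA, add_zero]
  have hsT : ∑ i ∈ Finset.range M, ∫ w, ind (T i) w * (dm O Q D i w)^2 ∂Q ≤ s := (sum_congr rfl fun i _ => Tl_eq hD' i).le.trans hs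
  have hind2 : ∀ (A : Set Ω) w, (ind A w)^2 = ind A w := fun A w => by
    by_cases h : w ∈ A
    · rw [ind_mem h]; ring
    · rw [ind_nmem h]; ring
  have YMm : AEStronglyMeasurable (Y M) Q := aesm_of (O.le M) (enY M).1
  have hYs : ∫ w, |Y M w| ∂Q ≤ √s := by
    refine (l1_l2 YMm (enY M).2.1).trans (Real.sqrt_le_sqrt ?_)
    refine (enY M).2.2.2.le.trans ?_
    simp_rw [hind2]; exact hsT
  set Z : ℕ → Ω → ℝ := fun i => Q[(fun w => |Y M w|)|O i] with hZ
  have Zm : Martingale Z O Q := martingale_condExp _ _ _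
  have Z0 : ∀ i, 0 ≤ᵐ[Q] Z i := fun i => condExp_nonneg (ae_of_all _ fun w => abs_nonneg _)
  set A : ℕ → Set Ω := stay Z 1 with hA
  have Aa : Antitone A := stay_anti Z 1
  have Am : ∀ i, MeasurableSet[O i] (A i) := fun i => stay_meas Zm.1 1 i
  have iYM : Integrable (Y M) Q := int_bdd YMm (enY M).2.1
  have hAM : Q.real (A M)ᶜ ≤ √s := by
    have := maximal_stay Zm Z0 (c := 1) M
    rw [one_mul] at this
    refine this.trans ?_
    rw [integral_condExp (O.le 0)]; exact hYs
  have YZ : ∀ r, r ≤ M → ∀ᵐ w ∂Q, w ∈ A r → |Y r w| ≤ 1 := fun r hr => by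
    have h1 := Ym.2 r M hr
    have h2 := excess_le (Q := Q) iYM 0 (O.le r)
    have e0 : (fun w => max (|Y M w| - 0) 0) = fun w => |Y M w| := by
      ext w; rw [sub_zero]; exact max_eq_left (abs_nonneg (Y M w))
    rw [e0] at h2
    filter_upwards [h1, h2] with w e1 e2 h
    rw [e1, sub_zero] at e2
    exact ((le_max_left _ _).trans e2).trans (h r le_rfl)
  have db : ∀ᵐ w ∂Q, ∀ i, |dm O Q D i w| ≤ 2 := ae_all_iff.2 fun i => by
    simpa using dm_abs (O := O) zero_le_one hD' i
  set V : Ω → ℝ := fun w => ∑ i ∈ Finset.range M, (ind (A i) w * ind (T i) w) * dm O Q D i w with hV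
  have enV := energy_eq (O := O) hD' (φ := fun i w => ind (A i) w * ind (T i) w) (fun i => (ind_sm (Am i)).mul (ind_sm (Tm i)))
    (fun i w => by rw [abs_mul]; exact mul_le_one₀ (ind_abs _ _) (abs_nonneg _) (ind_abs _ _)) M
  have Vm : AEStronglyMeasurable V Q := aesm_of (O.le M) enV.1
  have hVs : ∫ w, |V w| ∂Q ≤ √s := by
    refine (l1_l2 Vm enV.2.1).trans (Real.sqrt_le_sqrt ?_)
    refine enV.2.2.2.le.trans (le_trans (sum_le_sum fun i _ => ?_) hsT)
    simp_rw [mul_pow, hind2, mul_assoc]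
    have i1 := int_indm (O.le i _ (Tm i)) (wb_int (O := O) hD' i)
    refine integral_mono (int_indm (O.le i _ (Am i)) i1) i1 fun w => ?_
    have := mul_right_le (ind_le_one (A i) w) (mul_nonneg (ind_nn (T i) w) (sq_nonneg (dm O Q D i w)))
    dsimp only; linarith
  have hV3 : ∀ᵐ w ∂Q, |V w| ≤ 3 := by
    have : ∀ᵐ w ∂Q, ∀ r, r ≤ M → w ∈ A r → |Y r w| ≤ 1 := ae_all_iff.2 fun r => by
      by_cases h : r ≤ M
      · filter_upwards [YZ r h] with w h' _ using h'
      · exact ae_of_all _ fun w h' => absurd h' h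
    filter_upwards [db, this] with w h1 h2
    have hA' : Antitone (fun i => if i ≤ M then A i else ∅) := fun i j hij => by
      dsimp only
      by_cases hj : j ≤ M
      · rw [if_pos hj, if_pos (hij.trans hj)]; exact Aa hij
      · rw [if_neg hj]; exact empty_subset _
    have := pt1 hA' (w := w) (y := fun i => ind (T i) w * dm O Q D i w) (fun i => by
      rw [abs_mul]; have := mul_le_mul (ind_abs (T i) w) (h1 i) (abs_nonneg _) zero_le_one; linarith)
      (fun r hr => by
        by_cases h : r ≤ M
        · rw [if_pos h] at hr; exact h2 r h hr
        · rw [if_neg h] at hr; exact absurd hr (notMem_empty _)) M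
    refine le_trans (le_of_eq ?_) this
    simp only [hV]; congr 1
    refine sum_congr rfl fun i hi => ?_
    rw [if_pos (Finset.mem_range.1 hi).le]; ring
  set W : Ω → ℝ := fun w => ∑ i ∈ Finset.range M, ind (A i)ᶜ w * dm O Q D i w with hW
  have enW := energy_eq (O := O) hD' (φ := fun i w => ind (A i)ᶜ w) (fun i => ind_sm (Am i).compl)
    (fun i w => ind_abs _ _) M
  have Wm : AEStronglyMeasurable W Q := aesm_of (O.le M) enW.1
  have hWb : ∀ᵐ w ∂Q, |W w| ≤ 2 * ind (A M)ᶜ w := by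
    filter_upwards [ae_all_iff.2 Xb] with w h
    obtain ⟨h1, r, h2⟩ := pt2 Aa (w := w) (fun i => X i w) M
    by_cases hw : w ∈ A M
    · have : W w = 0 := h1 hw
      rw [this, abs_zero]; have := ind_nn (A M)ᶜ w; linarith
    · have : W w = X M w - X r w := h2
      rw [this, ind_mem (by simpa using hw)]
      have := abs_sub (X M w) (X r w); linarith [h M, h r]
  have hW2 : ∀ᵐ w ∂Q, |W w| ≤ 2 := by
    filter_upwards [hWb] with w h
    linarith [ind_le_one (A M)ᶜ w]
  have hWs : ∫ w, |W w| ∂Q ≤ 2 * √s := by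
    have i1 : Integrable (ind (A M)ᶜ) Q := (integrable_const (1:ℝ)).indicator (O.le M _ (Am M).compl)
    refine (integral_mono_ae (int_bdd Wm hW2).abs (i1.const_mul 2) hWb).trans ?_
    rw [integral_const_mul, int_ind Q (O.le M _ (Am M).compl)]
    linarith
  have UI : ∀ (F : Ω → ℝ) (c : ℝ), AEStronglyMeasurable F Q → (∀ᵐ w ∂Q, |F w| ≤ c) →
      |∫ w, F w * Lk w ∂Q| ≤ K * ∫ w, |F w| ∂Q + c * ∫ w, max (L w - K) 0 ∂Q := fun F c hF hFb => by
    have iF := int_bdd hF hFb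
    have im : Integrable (fun w => max (L w - K) 0) Q := (hLi.sub (integrable_const K)).pos_part
    rw [← integral_const_mul, ← integral_const_mul, ← integral_add (iF.abs.const_mul K) (im.const_mul c)]
    have iG : Integrable (fun w => K * |F w| + c * max (L w - K) 0) Q := (iF.abs.const_mul K).add (im.const_mul c)
    rw [← norm_eq_abs]
    refine norm_integral_le_of_norm_le iG ?_
    filter_upwards [hFb] with w h
    rw [norm_mul, norm_eq_abs, norm_eq_abs, abs_of_nonneg (Lk0 w)]
    have h1 : Lk w ≤ K + max (L w - K) 0 := (min_le_left _ _).trans (by linarith [le_max_left (L w - K) 0])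
    have h2 := le_max_right (L w - K) 0
    have h3 := abs_nonneg (F w)
    change |F w| * Lk w ≤ K * |F w| + c * max (L w - K) 0
    nlinarith [mul_left_le h1 h3, mul_right_le h h2]
  set φ : ℕ → Ω → ℝ := fun i w => ind (A i) w * ind (T i)ᶜ w with hφ
  have φm : ∀ i, StronglyMeasurable[O i] (φ i) := fun i => (ind_sm (Am i)).mul (ind_sm (Tm i).compl)
  have φb : ∀ i w, |φ i w| ≤ 1 := fun i w => by
    rw [abs_mul]; exact mul_le_one₀ (ind_abs _ _) (abs_nonneg _) (ind_abs _ _)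
  have φi : ∀ i, Integrable (fun w => φ i w * dm O Q D i w) Q := fun i =>
    int_mul (aesm_of (O.le i) (φm i)) (ae_of_all _ (φb i)) (int_bdd (dm_aesm Q Q D i) (dm_abs zero_le_one hD' i))
  have mulL : ∀ {F : Ω → ℝ}, Integrable F Q → Integrable (fun w => F w * Lk w) Q := fun {F} hF =>
    (int_mul Lkm.aestronglyMeasurable (ae_of_all _ Lkb) hF).congr (ae_of_all _ fun w => mul_comm _ _)
  have b1 : ∀ i, |∫ w, φ i w * dm O Q D i w * Lk w ∂Q| ≤ δ * ∫ w, (dm O Q D i w)^2 ∂Q := by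
    intro i
    have hdD : Integrable (fun w => dm O Q Lk i w * D w) Q := int_mul (dm_aesm Q Q Lk i) (dm_abs hk (ae_of_all _ Lkb) i) (int_bdd hDm.aestronglyMeasurable hD')
    have sw : ∫ w, φ i w * dm O Q D i w * Lk w ∂Q = ∫ w, φ i w * (dm O Q Lk i w * D w) ∂Q := by
      have s1 := swap1 (Q := Q) (O.le (i+1)) ((φm i).mono (O.mono (Nat.le_succ i))) (φb i) hDm.aestronglyMeasurable Lkm.aestronglyMeasurable
        zero_le_one hk hD' (ae_of_all _ Lkb)
      have s0 := swap1 (Q := Q) (O.le i) (φm i) (φb i) hDm.aestronglyMeasurable Lkm.aestronglyMeasurable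
        zero_le_one hk hD' (ae_of_all _ Lkb)
      have a : ∀ j, Integrable (fun w => φ i w * (Q[D|O j]) w * Lk w) Q := fun j =>
        mulL (int_mul (aesm_of (O.le i) (φm i)) (ae_of_all _ (φb i)) integrable_condExp)
      have b : ∀ j, Integrable (fun w => φ i w * ((Q[Lk|O j]) w * D w)) Q := fun j =>
        int_mul (aesm_of (O.le i) (φm i)) (ae_of_all _ (φb i))
          ((int_mul hDm.aestronglyMeasurable hD' integrable_condExp).congr (ae_of_all _ fun w => mul_comm _ _))
      have e1 : ∀ w, φ i w * dm O Q D i w * Lk w = φ i w * (Q[D|O (i+1)]) w * Lk w - φ i w * (Q[D|O i]) w * Lk w := fun w => by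
        simp only [dm]; ring
      have e2 : ∀ w, φ i w * (dm O Q Lk i w * D w) = φ i w * ((Q[Lk|O (i+1)]) w * D w) - φ i w * ((Q[Lk|O i]) w * D w) := fun w => by
        simp only [dm]; ring
      simp_rw [e1, e2]
      rw [integral_sub (a _) (a _), integral_sub (b _) (b _), s1, s0]
    rw [sw, ← pull (O.le i) (φm i) (int_mul (aesm_of (O.le i) (φm i)) (ae_of_all _ (φb i)) hdD) hdD]
    have e3 : ∫ w, (dm O Q D i w)^2 ∂Q = ∫ w, wb O Q D i w ∂Q := (integral_condExp (O.le i)).symm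
    rw [e3, ← integral_const_mul]
    have iG : Integrable (fun w => δ * wb O Q D i w) Q := integrable_condExp.const_mul δ
    rw [← norm_eq_abs]
    refine norm_integral_le_of_norm_le iG ?_
    filter_upwards [wb_nonneg (P := Q) (O := O) D i] with w h0
    have h0 : 0 ≤ wb O Q D i w := h0
    change ‖φ i w * hb O Q Q Lk D i w‖ ≤ δ * wb O Q D i w
    rw [norm_mul]
    by_cases h : w ∈ T i
    · simp only [hφ]; rw [ind_nmem (A := (T i)ᶜ) (by simpa using h), mul_zero, norm_zero, zero_mul]; positivity
    · have h1 : |hb O Q Q Lk D i w| ≤ δ * wb O Q D i w := not_lt.1 h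
      calc _ ≤ 1 * |hb O Q Q Lk D i w| := mul_right_le (φb i w) (abs_nonneg _)
        _ ≤ _ := by rw [one_mul]; exact h1
  have dec : ∀ w, ((Q[D|O M]) w - (Q[D|O 0]) w) * Lk w =
      ∑ i ∈ Finset.range M, φ i w * dm O Q D i w * Lk w + V w * Lk w + W w * Lk w := fun w => by
    rw [← sum_mul, ← add_mul, ← add_mul, hV, hW, ← sum_add_distrib, ← sum_add_distrib]
    congr 1
    rw [← Finset.sum_range_sub (fun i => (Q[D|O i]) w) M]
    refine sum_congr rfl fun i _ => ?_
    simp only [hφ, dm]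
    by_cases h1 : w ∈ A i <;> by_cases h2 : w ∈ T i
    · rw [ind_mem h1, ind_mem h2, ind_nmem (A := (A i)ᶜ) (by simpa using h1), ind_nmem (A := (T i)ᶜ) (by simpa using h2)]; ring
    · rw [ind_mem h1, ind_nmem h2, ind_nmem (A := (A i)ᶜ) (by simpa using h1), ind_mem (A := (T i)ᶜ) (by simpa using h2)]; ring
    · rw [ind_nmem h1, ind_mem (A := (A i)ᶜ) (by simpa using h1)]; ring
    · rw [ind_nmem h1, ind_mem (A := (A i)ᶜ) (by simpa using h1)]; ring
  rw [show ∫ w, ((Q[D|O M]) w - (Q[D|O 0]) w) * Lk w ∂Q = _ from integral_congr_ae (ae_of_all _ dec)]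
  have iS : Integrable (fun w => ∑ i ∈ Finset.range M, φ i w * dm O Q D i w * Lk w) Q := integrable_finsetSum _ fun i _ => mulL (φi i)
  have iV := mulL (int_bdd Vm hV3)
  have iW := mulL (int_bdd Wm hW2)
  have iSV : Integrable (fun w => ∑ i ∈ Finset.range M, φ i w * dm O Q D i w * Lk w + V w * Lk w) Q := iS.add iV
  rw [integral_add iSV iW, integral_add iS iV, integral_finsetSum _ fun i _ => mulL (φi i)]
  have c1 : |∑ i ∈ Finset.range M, ∫ w, φ i w * dm O Q D i w * Lk w ∂Q| ≤ δ := by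
    refine (abs_sum_le_sum_abs _ _).trans ((sum_le_sum fun i _ => b1 i).trans ?_)
    rw [← mul_sum]
    have := mul_left_le (energy_D (O := O) hD' M) hδ
    linarith
  have c2 := UI V 3 Vm hV3
  have c3 := UI W 2 Wm hW2
  refine (abs_add_three _ _ _).trans ?_
  have hs0 := Real.sqrt_nonneg s
  nlinarith [mul_left_le hVs hK, mul_left_le hWs hK, mul_nonneg hK hs0]
end P20
section P21
variable {Ω : Type*} {m : MeasurableSpace Ω} {Q : Measure Ω} [IsPr Q]
  {I : ℕ → Filtration ℕ m} {d : ℕ}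
lemma tail_max {ν : Measure Ω} [IsFiniteMeasure ν] {f : Ω → ℝ} (hf : Integrable f ν) :
 Tendsto (fun k : ℕ => ∫ w, max (|f w| - k) 0 ∂ν) atTop (nhds 0) := by
  have := tendsto_integral_of_dominated_convergence (μ := ν) (F := fun (k : ℕ) w => max (|f w| - k) 0) (f := fun _ => 0)
    (fun w => |f w|) (fun k => ((hf.abs.sub (integrable_const (k:ℝ))).pos_part).1) hf.abs
    (fun k => ae_of_all _ fun w => by
      rw [norm_eq_abs, abs_of_nonneg (le_max_right _ _)]
      exact max_le (by linarith [(Nat.cast_nonneg k : (0:ℝ) ≤ k)]) (abs_nonneg _))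
    (ae_of_all _ fun w => by
      refine tendsto_const_nhds.congr' ?_
      filter_upwards [eventually_ge_atTop ⌈|f w|⌉₊] with k hk
      rw [max_eq_right]; have := Nat.ceil_le.1 hk; linarith)
  simpa using this
lemma trunc_int {ν : Measure Ω} [IsFiniteMeasure ν] {f g : Ω → ℝ} {c : ℝ} (hf : Integrable f ν) (hf0 : ∀ w, 0 ≤ f w)
 (hg : AEStronglyMeasurable g ν) (hgb : ∀ᵐ w ∂ν, |g w| ≤ c) :
 Tendsto (fun k : ℕ => ∫ w, g w * min (f w) k ∂ν) atTop (nhds (∫ w, g w * f w ∂ν)) := by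
  refine tendsto_integral_of_dominated_convergence (fun w => c * f w)
    (fun k => hg.mul (hf.inf (integrable_const (k:ℝ))).1) (hf.const_mul c)
    (fun k => ?_) (ae_of_all _ fun w => ?_)
  · filter_upwards [hgb] with w h
    have h0 : 0 ≤ min (f w) k := le_min (hf0 w) (Nat.cast_nonneg k)
    rw [norm_mul, norm_eq_abs, norm_eq_abs, abs_of_nonneg h0]
    exact mul_le_mul h (min_le_left _ _) h0 ((abs_nonneg _).trans h)
  · refine tendsto_const_nhds.congr' ?_
    filter_upwards [eventually_ge_atTop ⌈f w⌉₊] with k hk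
    rw [min_eq_left (Nat.ceil_le.1 hk)]
theorem stepB_abs (href : ∀ n0 n i, n0 ≤ n → (I n (i * 2^(n - n0)) : MeasurableSpace Ω) = I n0 i)
 (htop : ∀ n i, 2^n ≤ i → (I n i : MeasurableSpace Ω) = m)
 (htriv : ∀ n (f : Ω → ℝ), Integrable f Q → Q[f|I n 0] =ᵐ[Q] fun _ => ∫ w, f w ∂Q)
 {o : Fin d → Ω → ℝ} (ho : ∀ l, Integrable (o l) Q) (hWG : WG I Q o)
 {L : Ω → ℝ} (hL : Measurable L) (hL0 : ∀ w, 0 ≤ L w) (hLi : Integrable L Q) (hL1 : ∫ w, L w ∂Q = 1)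
 (hv : ∀ c, ∀ l > 0, ∀ᶠ k : ℕ in atTop, ∀ᶠ n in atTop, ∑ i ∈ Finset.range (2^n),
 ∫ w, ind (Tl (I n) Q l (fun w => min (L w) k) (o c) (fun w => min (L w) 2 / 2) i) w *
 (dm (I n) Q (fun w => min (L w) 2 / 2) i w)^2 ∂Q ≤ l) : L =ᵐ[Q] fun _ => 1 := by
  set D : Ω → ℝ := fun w => min (L w) 2 / 2 with hDdef
  have Dm : Measurable D := (hL.min measurable_const).div_const 2
  have Db : ∀ w, |D w| ≤ 1 := fun w => by
    have h0 : 0 ≤ min (L w) 2 := le_min (hL0 w) zero_le_two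
    have := min_le_right (L w) 2
    simp only [hDdef]; rw [abs_of_nonneg (by positivity)]; linarith
  have hD' : ∀ᵐ w ∂Q, |D w| ≤ 1 := ae_of_all _ Db
  have hDi : Integrable D Q := int_bdd Dm.aestronglyMeasurable hD'
  set Lk : ℕ → Ω → ℝ := fun k w => min (L w) k with hLk
  have Lk0 : ∀ k w, 0 ≤ Lk k w := fun k w => le_min (hL0 w) (Nat.cast_nonneg k)
  have Lkb : ∀ (k : ℕ) w, |Lk k w| ≤ k := fun k w => by rw [abs_of_nonneg (Lk0 k w)]; exact min_le_right _ _
  have Lkm : ∀ k, Measurable (Lk k) := fun k => hL.min measurable_const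
  have hd : ∀ (j n i : ℕ), ∀ᵐ w ∂Q, |dm (I n) Q (Lk j) i w| ≤ 2 * j := fun j n i =>
    dm_abs (Nat.cast_nonneg j) (ae_of_all _ (Lkb j)) i
  choose u hum hu using fun j => sys_u (I := I) (P := Q) Q D (hd j)
  have wo : wd Q (fun _ => 1) = Q := wd_one
  have : IsPr (wd Q (fun _ => 1)) := by rw [wo]; infer_instance
  have hE : ∀ l, Integrable (ext1 o l) Q := fun l => by
    refine Fin.cases ?_ (fun c => ?_) l
    · exact integrable_const (1:ℝ)
    · exact ho c
  set v : Fin (d+1) → Lp ℝ 1 Q := fun l => (hE l).toL1 (ext1 o l) with hvdef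
  have hvv : ∀ l, v l =ᵐ[Q] fun w => (1:ℝ) * ext1 o l w := fun l => by
    filter_upwards [(hE l).coeFn_toL1] with w h
    rw [one_mul]; exact h
  have hdense := dense_HM (P := Q) href hd hum hu (Z := fun _ => 1) measurable_const (fun _ => one_pos)
    (by rw [wo]; exact ho) (by rw [wo]; exact hWG) hvv
  have hF2 : ∀ j, ∃ K, ∀ n f, (nuD I Q D n).real {x | 1 < |u j f x|} ≤ K * √‖f‖ := fun j =>
    ⟨_, fun n f => sys_F2 (P := Q) (ρ := fun _ => 1) measurable_const one_pos (fun _ => by simp) (fun _ => le_rfl)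
      (Lkm j) (c := j + 1) (by positivity) (fun w => (Lkb j w).trans (by linarith)) hD' (hum j)
      (by rw [wo]; exact hu j) n f⟩
  have hfin : ∀ n, IsFiniteMeasure (nuD I Q D n) := fun n => nuD_fin hD' n
  have htrans : ∀ (k n : ℕ) (l : ℝ) (f : Lp ℝ 1 Q) (g : Ω → ℝ), f =ᵐ[Q] g →
      (nuD I Q D n).real {x | l < |u k f x|} = ∑ i ∈ Finset.range (2^n),
      ∫ w, ind {w | l < |hb (I n) Q Q (Lk k) g i w / wb (I n) Q D i w|} w * (dm (I n) Q D i w)^2 ∂Q := by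
    intro k n l f g hfg
    have hS : MeasurableSet {x | l < |u k f x|} := measurableSet_lt measurable_const (continuous_abs.measurable.comp (hum k f))
    rw [nuD_real hD' n hS]
    refine sum_congr rfl fun i _ => integral_congr_ae ?_
    filter_upwards [hu k f n i, hb_congr (O := I n) (Q := Q) (L := Lk k) (i := i) hfg] with w h1 h2
    rw [h2] at h1
    simp only [ind, indicator, mem_setOf_eq, h1]
  have key := fun (δ : ℝ) (hδ : 0 < δ) => absB (nuD I Q D) (fun n => nuD_mass hD' n) u hum hF2 hdense (fun g hg => hg) (by
    intro l ρ hρ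
    refine Fin.cases ?_ (fun c => ?_) l
    · refine Eventually.of_forall fun k => Eventually.of_forall fun n => ?_
      rw [htrans k n ρ (v 0) (fun _ => 1) (hE 0).coeFn_toL1]
      refine le_trans (le_of_eq (sum_eq_zero fun i _ => ?_)) hρ.le
      rw [show (0:ℝ) = ∫ w, (0:ℝ) ∂Q by simp]
      refine integral_congr_ae ?_
      have h0 : hb (I n) Q Q (Lk k) (fun _ => 1) i =ᵐ[Q] 0 := by
        unfold hb
        simp only [mul_one]
        have a := condExp_sub (μ := Q) (integrable_condExp (f := Lk k) (m := I n (i+1))) (integrable_condExp (f := Lk k) (m := I n i)) (I n i)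
        have b := condExp_condExp_of_le (μ := Q) (f := Lk k) ((I n).mono (Nat.le_succ i)) ((I n).le (i+1))
        have c := condExp_of_stronglyMeasurable (μ := Q) ((I n).le i) (f := Q[Lk k|I n i]) stronglyMeasurable_condExp integrable_condExp
        refine (show Q[dm (I n) Q (Lk k) i|I n i] =ᵐ[Q] _ from a).trans ?_
        filter_upwards [b] with w hb'
        rw [Pi.sub_apply, hb', c]; simp
      filter_upwards [h0] with w h
      rw [ind_nmem, zero_mul]
      simp [h, hρ.le]
    · filter_upwards [hv c ρ hρ] with k hk
      filter_upwards [hk] with n hn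
      rw [htrans k n ρ (v c.succ) (o c) (hE c.succ).coeFn_toL1]
      refine le_trans (le_of_eq (sum_congr rfl fun i _ => ?_)) hn
      rw [← Tl_eq hD' i]) (hDi.toL1 D) hδ
  set g : Ω → ℝ := fun w => D w - ∫ w, D w ∂Q with hg
  have gm : AEStronglyMeasurable g Q := (Dm.sub_const _).aestronglyMeasurable
  have gb : ∀ᵐ w ∂Q, |g w| ≤ 2 := ae_of_all _ fun w => by
    have h1 : |∫ w, D w ∂Q| ≤ 1 := by
      have := norm_integral_le_of_norm_le_const (μ := Q) (f := D) (C := 1) hD'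
      simpa using this
    have := abs_sub (D w) (∫ w, D w ∂Q); have := Db w
    simp only [hg]; linarith
  have lim := trunc_int hLi hL0 gm gb
  have hzero : ∫ w, g w * L w ∂Q = 0 := by
    have small : ∀ ε > 0, |∫ w, g w * L w ∂Q| ≤ 3 * ε := by
      intro ε hε
      have t1 := (tail_max hLi).const_mul (5:ℝ)
      rw [mul_zero] at t1
      obtain ⟨K, hK⟩ := (t1.eventually (gt_mem_nhds hε)).exists
      obtain ⟨δ, hδ0, hδ1, hδ2⟩ : ∃ δ : ℝ, 0 < δ ∧ δ ≤ ε ∧ 5 * K * √δ ≤ ε := by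
        refine ⟨min ε ((ε / (5 * K + 1))^2), lt_min hε (by positivity), min_le_left _ _, ?_⟩
        have h2 : √(min ε ((ε / (5 * K + 1))^2)) ≤ ε / (5 * K + 1) := by
          refine (Real.sqrt_le_sqrt (min_le_right _ _)).trans (le_of_eq (Real.sqrt_sq (by positivity)))
        have h3 : (5 * K + 1) * (ε / (5 * K + 1)) = ε := by field_simp
        have h4 := mul_left_le h2 (by positivity : (0:ℝ) ≤ 5 * K)
        have : 0 ≤ ε / (5 * K + 1) := by positivity
        linarith
      refine le_of_tendsto lim.abs ?_
      filter_upwards [key δ hδ0] with k hk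
      obtain ⟨n, hn⟩ := hk.exists
      rw [htrans k n δ _ D hDi.coeFn_toL1] at hn
      have := fin_level (O := I n) hL hL0 hLi Dm Db (Nat.cast_nonneg k) (Nat.cast_nonneg K) hδ0.le (2^n) hn.le
      rw [htop n _ le_rfl, condExp_of_stronglyMeasurable le_rfl Dm.stronglyMeasurable hDi] at this
      have e : ∫ w, (D w - (Q[D|I n 0]) w) * min (L w) k ∂Q = ∫ w, g w * min (L w) k ∂Q := by
        refine integral_congr_ae ?_
        filter_upwards [htriv n D hDi] with w h
        rw [h]
      rw [e] at this
      have e2 : ∫ w, max (L w - K) 0 ∂Q = ∫ w, max (|L w| - K) 0 ∂Q := by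
        congr 1; ext w; rw [abs_of_nonneg (hL0 w)]
      rw [e2] at this
      linarith
    by_contra hne
    have hp := abs_pos.2 hne
    have := small (|∫ w, g w * L w ∂Q| / 6) (by positivity)
    linarith
  have iDL : Integrable (fun w => D w * L w) Q := int_mul Dm.aestronglyMeasurable hD' hLi
  have e1 : ∫ w, D w * L w ∂Q = ∫ w, D w ∂Q := by
    have : ∀ w, g w * L w = D w * L w - (∫ w, D w ∂Q) * L w := fun w => by simp only [hg]; ring
    simp_rw [this] at hzero
    rw [integral_sub iDL (hLi.const_mul _), integral_const_mul, hL1] at hzero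
    linarith
  have nn : ∀ w, 0 ≤ (D w - 1/2) * (L w - 1) := fun w => by
    simp only [hDdef]
    rcases le_total (L w) 1 with h | h
    · rw [min_eq_left (by linarith)]; nlinarith
    · have : 1 ≤ min (L w) 2 := le_min h (by norm_num)
      exact mul_nonneg (by linarith) (by linarith)
  have ee : ∀ w, (D w - 1/2) * (L w - 1) = D w * L w - D w - (1/2) * (L w - 1) := fun w => by ring
  have i1 : Integrable (fun w => D w * L w - D w) Q := iDL.sub hDi
  have i2 : Integrable (fun w => (1/2) * (L w - 1)) Q := (hLi.sub (integrable_const 1)).const_mul _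
  have z : ∫ w, (D w - 1/2) * (L w - 1) ∂Q = 0 := by
    simp_rw [ee]
    rw [integral_sub i1 i2, integral_sub iDL hDi, integral_const_mul, integral_sub hLi (integrable_const 1), hL1, e1]; simp
  have ii : Integrable (fun w => (D w - 1/2) * (L w - 1)) Q := (i1.sub i2).congr (ae_of_all _ fun w => (ee w).symm)
  have := (integral_eq_zero_iff_of_nonneg nn ii).1 z
  filter_upwards [this] with w h
  rcases mul_eq_zero.1 h with h | h
  · simp only [hDdef] at h
    have h2 : min (L w) 2 = 1 := by linarith
    rcases min_choice (L w) 2 with h3 | h3 <;> rw [h3] at h2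
    · exact h2
    · norm_num at h2
  · linarith
end P21
section P22
variable {Ω : Type*} {m : MeasurableSpace Ω}
def gt (n i : ℕ) : ℝ≥0 := (i : ℝ≥0) / ((2^n - i : ℕ) : ℝ≥0)
lemma gt_zero (n : ℕ) : gt n 0 = 0 := by simp [gt]
lemma gt_mono {n i j : ℕ} (hij : i ≤ j) (hj : j < 2^n) : gt n i ≤ gt n j := by
  unfold gt
  have h1 : (0:ℝ≥0) < ((2^n - j : ℕ) : ℝ≥0) := by exact_mod_cast Nat.sub_pos_of_lt hj
  have h2 : ((2^n - j : ℕ) : ℝ≥0) ≤ ((2^n - i : ℕ) : ℝ≥0) := by exact_mod_cast Nat.sub_le_sub_left hij _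
  exact div_le_div₀ (by positivity) (by exact_mod_cast hij) h1 h2
lemma gt_ref {n0 n i : ℕ} (h : n0 ≤ n) : gt n (i * 2^(n - n0)) = gt n0 i := by
  unfold gt
  have e : 2^n - i * 2^(n-n0) = (2^n0 - i) * 2^(n-n0) := by
    rw [Nat.sub_mul, ← pow_add, Nat.add_sub_cancel' h]
  rw [e]; push_cast
  rw [mul_div_mul_right _ _ (by positivity)]
lemma gt_last (p : ℕ) : gt p (2^p - 1) = ((2^p - 1 : ℕ) : ℝ≥0) := by
  unfold gt
  have : 2^p - (2^p - 1) = 1 := by have := Nat.one_le_two_pow (n := p); omega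
  rw [this]; simp
lemma gt_mesh {p n i : ℕ} (hpn : p ≤ n) (hi : i + 1 ≤ (2^p - 1) * 2^(n-p)) :
 (gt n (i+1) : ℝ) ≤ gt n i + 4^p / 2^n := by
  have e : 2^n = 2^p * 2^(n-p) := by rw [← pow_add, Nat.add_sub_cancel' hpn]
  have h1 := Nat.one_le_two_pow (n := p)
  have h3 : i + 1 + 2^(n-p) ≤ 2^n := by
    rw [e]; calc i + 1 + 2^(n-p) ≤ (2^p-1) * 2^(n-p) + 2^(n-p) := by omega
      _ = (2^p - 1 + 1) * 2^(n-p) := by ring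
      _ = _ := by rw [Nat.sub_add_cancel h1]
  have hq := Nat.one_le_two_pow (n := n-p)
  have c1 : ((2^n - (i+1) : ℕ) : ℝ) = 2^n - (i+1) := by
    rw [Nat.cast_sub (by omega)]; push_cast; ring
  have c2 : ((2^n - i : ℕ) : ℝ) = 2^n - i := by
    rw [Nat.cast_sub (by omega)]; push_cast; ring
  have h3' : (i:ℝ) + 1 + 2^(n-p) ≤ 2^n := by exact_mod_cast h3
  have e' : (2:ℝ)^n = 2^p * 2^(n-p) := by exact_mod_cast e
  have hq' : (0:ℝ) < 2^(n-p) := by positivity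
  have hp' : (0:ℝ) < 2^p := by positivity
  have g1 : (gt n (i+1) : ℝ) = ((i:ℝ)+1)/(2^n - (i+1)) := by
    rw [gt, NNReal.coe_div, NNReal.coe_natCast, NNReal.coe_natCast, c1, Nat.cast_add, Nat.cast_one]
  have g2 : (gt n i : ℝ) = (i:ℝ)/(2^n - i) := by
    rw [gt, NNReal.coe_div, NNReal.coe_natCast, NNReal.coe_natCast, c2]
  rw [g1, g2]
  have a1 : (0:ℝ) < 2^n - (i+1) := by linarith
  have a2 : (0:ℝ) < 2^n - i := by linarith
  have k1 : ((i:ℝ)+1)/(2^n - (i+1)) = i/(2^n - i) + 2^n / ((2^n - (i+1)) * (2^n - i)) := by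
    field_simp; ring
  rw [k1]
  have k2 : (2:ℝ)^n / ((2^n - (i+1)) * (2^n - i)) ≤ 2^n / (2^(n-p) * 2^(n-p)) := by
    refine div_le_div_of_nonneg_left (by positivity) (by positivity) ?_
    exact mul_le_mul (by linarith) (by linarith) hq'.le a1.le
  have k3 : (2:ℝ)^n / (2^(n-p) * 2^(n-p)) = 4^p / 2^n := by
    rw [e', show (4:ℝ) = 2 * 2 by norm_num, mul_pow]; field_simp
  linarith
def grid (F : Filtration ℝ≥0 m) (n : ℕ) : Filtration ℕ m where
  seq i := if i < 2^n then F (gt n i) else m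
  mono' i j h := by
    dsimp only
    by_cases hj : j < 2^n
    · rw [if_pos hj, if_pos (h.trans_lt hj)]; exact F.mono (gt_mono h hj)
    · rw [if_neg hj]; split_ifs
      · exact F.le _
      · exact le_rfl
  le' i := by
    split_ifs
    · exact F.le _
    · exact le_rfl
variable {F : Filtration ℝ≥0 m}
lemma grid_lt {n i : ℕ} (h : i < 2^n) : (grid F n i : MeasurableSpace Ω) = F (gt n i) := if_pos h
lemma grid_top (n i : ℕ) (h : 2^n ≤ i) : (grid F n i : MeasurableSpace Ω) = m := if_neg (not_lt.2 h)
lemma grid_ref (n0 n i : ℕ) (h : n0 ≤ n) : (grid F n (i * 2^(n - n0)) : MeasurableSpace Ω) = grid F n0 i := by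
  have e : 2^n = 2^n0 * 2^(n-n0) := by rw [← pow_add, Nat.add_sub_cancel' h]
  by_cases hi : i < 2^n0
  · rw [grid_lt hi, grid_lt (by rw [e]; exact Nat.mul_lt_mul_of_pos_right hi (by positivity)), gt_ref h]
  · rw [grid_top _ _ (not_lt.1 hi), grid_top _ _ (by rw [e]; exact Nat.mul_le_mul_right _ (not_lt.1 hi))]
lemma gN_lt {p n : ℕ} (h : p ≤ n) : (2^p - 1) * 2^(n-p) < 2^n := by
  have e : 2^n = 2^p * 2^(n-p) := by rw [← pow_add, Nat.add_sub_cancel' h]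
  have h1 := Nat.one_le_two_pow (n := p)
  rw [e]; exact Nat.mul_lt_mul_of_pos_right (by omega) (by positivity)
lemma gt_N {p n : ℕ} (h : p ≤ n) : gt n ((2^p - 1) * 2^(n-p)) = ((2^p - 1 : ℕ) : ℝ≥0) := by
  rw [gt_ref h, gt_last]
lemma levy {Q : Measure Ω} [IsPr Q] (hgen : (⨆ t : ℝ≥0, (F t : MeasurableSpace Ω)) = m)
 {D : Ω → ℝ} (hDm : Measurable D) (hD : Integrable D Q) :
 Tendsto (fun p : ℕ => ∫ w, |D w - (Q[D|F ((2^p - 1 : ℕ) : ℝ≥0)]) w| ∂Q) atTop (nhds 0) := by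
  set G : Filtration ℕ m := ⟨fun p => F ((2^p - 1 : ℕ) : ℝ≥0), fun a b h => F.mono (by
    exact_mod_cast Nat.sub_le_sub_right (Nat.pow_le_pow_right (by norm_num) h) 1), fun p => F.le _⟩ with hG
  have hsup : (⨆ p, (G p : MeasurableSpace Ω)) = m := by
    refine le_antisymm (iSup_le fun p => G.le p) ?_
    conv_lhs => rw [← hgen]
    refine iSup_le fun t => ?_
    obtain ⟨p, hp⟩ := exists_nat_ge t
    refine le_trans (F.mono (?_ : t ≤ ((2^p - 1 : ℕ) : ℝ≥0))) (le_iSup (fun p => (G p : MeasurableSpace Ω)) p)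
    refine hp.trans ?_
    have := Nat.lt_two_pow_self (n := p)
    exact_mod_cast (by omega : p ≤ 2^p - 1)
  have h := hD.tendsto_eLpNorm_condExp (ℱ := G) (by rw [hsup]; exact hDm.stronglyMeasurable)
  have h2 := (ENNReal.tendsto_toReal ENNReal.zero_ne_top).comp h
  simp only [ENNReal.toReal_zero] at h2
  refine h2.congr fun p => ?_
  have i : Integrable (fun w => (Q[D|G p]) w - D w) Q := integrable_condExp.sub hD
  rw [Function.comp, eLpNorm_one_eq_lintegral_enorm]
  rw [show (∫⁻ w, ‖(Q[D|G p] - D) w‖ₑ ∂Q) = ∫⁻ w, ENNReal.ofReal ‖(Q[D|G p]) w - D w‖ ∂Q by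
    congr 1; ext w; rw [ofReal_norm]; rfl]
  rw [← integral_eq_lintegral_of_nonneg_ae (ae_of_all _ fun w => norm_nonneg _) i.norm.1]
  congr 1; ext w; rw [norm_eq_abs, abs_sub_comm]
end P22
section P23
variable {Ω : Type*} {m : MeasurableSpace Ω}
lemma fatou_int {μ : Measure Ω} {f : ℕ → Ω → ℝ} {g : Ω → ℝ} {C : ℝ} (hf : ∀ n, Integrable (f n) μ)
 (hf0 : ∀ n w, 0 ≤ f n w) (hC : ∀ᶠ n in atTop, ∫ w, f n w ∂μ ≤ C)
 (hlim : ∀ᵐ w ∂μ, Tendsto (fun n => f n w) atTop (nhds (g w))) :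
 Integrable g μ ∧ ∫ w, g w ∂μ ≤ C := by
  have gm : AEStronglyMeasurable g μ := aestronglyMeasurable_of_tendsto_ae atTop (fun n => (hf n).1) hlim
  have g0 : ∀ᵐ w ∂μ, 0 ≤ g w := by
    filter_upwards [hlim] with w h using ge_of_tendsto' h fun n => hf0 n w
  have C0 : 0 ≤ C := by
    obtain ⟨n, hn⟩ := hC.exists
    exact (integral_nonneg (hf0 n)).trans hn
  have key : ∫⁻ w, ENNReal.ofReal (g w) ∂μ ≤ ENNReal.ofReal C := by
    calc ∫⁻ w, ENNReal.ofReal (g w) ∂μ = ∫⁻ w, liminf (fun n => ENNReal.ofReal (f n w)) atTop ∂μ := by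
          refine lintegral_congr_ae ?_
          filter_upwards [hlim] with w h
          exact ((ENNReal.continuous_ofReal.tendsto _).comp h).liminf_eq.symm
      _ ≤ liminf (fun n => ∫⁻ w, ENNReal.ofReal (f n w) ∂μ) atTop := lintegral_liminf_le' fun n => (hf n).1.aemeasurable.ennreal_ofReal
      _ ≤ ENNReal.ofReal C := by
          refine liminf_le_of_frequently_le' (Eventually.frequently ?_)
          filter_upwards [hC] with n hn
          rw [← ofReal_integral_eq_lintegral_ofReal (hf n) (ae_of_all _ (hf0 n))]
          exact ENNReal.ofReal_le_ofReal hn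
  have gi : Integrable g μ := ⟨gm, by
    rw [hasFiniteIntegral_iff_ofReal g0]; exact key.trans_lt ENNReal.ofReal_lt_top⟩
  refine ⟨gi, ?_⟩
  rw [← ofReal_integral_eq_lintegral_ofReal gi g0] at key
  exact (ENNReal.ofReal_le_ofReal_iff C0).1 key
def clampR (K x : ℝ) : ℝ := max (-K) (min x K)
lemma clampR_abs {K : ℝ} (hK : 0 ≤ K) (x : ℝ) : |clampR K x| ≤ K := abs_le.2 ⟨le_max_left _ _, max_le (by linarith) (min_le_right _ _)⟩
lemma clamp_near {K : ℝ} (hK : 0 ≤ K) (x : ℝ) : |x - clampR K x| ≤ max (|x| - K) 0 := by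
  unfold clampR
  rcases le_total x K with h | h
  · rw [min_eq_left h]
    rcases le_total (-K) x with h2 | h2
    · rw [max_eq_right h2, sub_self, abs_zero]; exact le_max_right _ _
    · rw [max_eq_left h2, abs_of_nonpos (by linarith), abs_of_nonpos (by linarith)]
      exact le_trans (by linarith) (le_max_left _ _)
  · rw [min_eq_right h, max_eq_right (by linarith), abs_of_nonneg (by linarith), abs_of_nonneg (by linarith)]
    exact le_max_left _ _
lemma clamp_cont (K : ℝ) : Continuous (clampR K) := by unfold clampR; fun_prop
lemma vit {μ : Measure Ω} [IsFiniteMeasure μ] {X : ℕ → Ω → ℝ} {H : Ω → ℝ} {r : ℕ → ℝ}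
 (hX : ∀ n, Integrable (X n) μ)
 (hlim : ∀ᵐ w ∂μ, Tendsto (fun n => X n w) atTop (nhds (H w)))
 (hr : Tendsto r atTop (nhds 0)) (hb : ∀ K : ℕ, ∀ᶠ n in atTop, ∫ w, max (|X n w| - K) 0 ∂μ ≤ r K) :
 Integrable H μ ∧ Tendsto (fun n => ∫ w, |H w - X n w| ∂μ) atTop (nhds 0) := by
  have mi : ∀ {Y : Ω → ℝ} (K : ℕ), Integrable Y μ → Integrable (fun w => max (|Y w| - K) 0) μ := fun K h =>
    (h.abs.sub (integrable_const (K:ℝ))).pos_part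
  have hF : ∀ K : ℕ, Integrable (fun w => max (|H w| - K) 0) μ ∧ ∫ w, max (|H w| - K) 0 ∂μ ≤ r K := fun K =>
    fatou_int (fun n => mi K (hX n)) (fun n w => le_max_right _ _) (hb K) (by
      filter_upwards [hlim] with w h
      exact ((h.abs.sub_const _).max tendsto_const_nhds))
  have Hm : AEStronglyMeasurable H μ := aestronglyMeasurable_of_tendsto_ae atTop (fun n => (hX n).1) hlim
  have Hi : Integrable H μ := by
    refine (hF 0).1.mono Hm (ae_of_all _ fun w => ?_)
    simp
  refine ⟨Hi, ?_⟩
  rw [Metric.tendsto_atTop']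
  intro ε hε
  obtain ⟨K, hK⟩ := (hr.eventually (gt_mem_nhds (by positivity : 0 < ε/4))).exists
  have hcl : Tendsto (fun n => ∫ w, |clampR K (H w) - clampR K (X n w)| ∂μ) atTop (nhds 0) := by
    have := tendsto_integral_of_dominated_convergence (μ := μ) (F := fun n w => |clampR K (H w) - clampR K (X n w)|) (f := fun _ => 0)
      (fun _ => 2 * K) (fun n => (((clamp_cont K).comp_aestronglyMeasurable Hm).sub ((clamp_cont K).comp_aestronglyMeasurable (hX n).1)).norm)
      (integrable_const _) (fun n => ae_of_all _ fun w => by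
        have h1 := clampR_abs (Nat.cast_nonneg K) (H w)
        have h2 := clampR_abs (Nat.cast_nonneg K) (X n w)
        rw [norm_eq_abs, abs_abs]
        exact (abs_sub _ _).trans (by linarith)) (by
        filter_upwards [hlim] with w h
        have := (((clamp_cont K).tendsto (H w)).comp h).const_sub (clampR K (H w))
        simpa using this.abs)
    simpa using this
  obtain ⟨n1, h1⟩ := eventually_atTop.1 ((hcl.eventually (gt_mem_nhds (by positivity : 0 < ε/4))).and (hb K))
  refine ⟨n1, fun n hn => ?_⟩
  obtain ⟨h2, h3⟩ := h1 n hn.le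
  rw [Real.dist_eq, sub_zero, abs_of_nonneg (integral_nonneg fun w => abs_nonneg _)]
  have ci : ∀ {Y : Ω → ℝ}, Integrable Y μ → Integrable (fun w => clampR K (Y w)) μ := fun hY =>
    Integrable.of_bound ((clamp_cont K).comp_aestronglyMeasurable hY.1) K (ae_of_all _ fun w => clampR_abs (Nat.cast_nonneg K) _)
  have ia : Integrable (fun w => |clampR K (H w) - clampR K (X n w)|) μ := ((ci Hi).sub (ci (hX n))).abs
  have iab : Integrable (fun w => |clampR K (H w) - clampR K (X n w)| + max (|H w| - K) 0) μ := ia.add (mi K Hi)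
  have iabc : Integrable (fun w => |clampR K (H w) - clampR K (X n w)| + max (|H w| - K) 0 + max (|X n w| - K) 0) μ := iab.add (mi K (hX n))
  have le : ∫ w, |H w - X n w| ∂μ ≤ ∫ w, (|clampR K (H w) - clampR K (X n w)| + max (|H w| - K) 0 + max (|X n w| - K) 0) ∂μ := by
    refine integral_mono (Hi.sub (hX n)).abs iabc fun w => ?_
    have a := clamp_near (Nat.cast_nonneg K) (H w)
    have b := clamp_near (Nat.cast_nonneg K) (X n w)
    have t : H w - X n w = (clampR K (H w) - clampR K (X n w)) + (H w - clampR K (H w)) + (clampR K (X n w) - X n w) := by ring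
    have := abs_add_three (clampR K (H w) - clampR K (X n w)) (H w - clampR K (H w)) (clampR K (X n w) - X n w)
    rw [← t, abs_sub_comm (clampR K (X n w))] at this
    change |H w - X n w| ≤ _
    linarith
  rw [integral_add iab (mi K (hX n)), integral_add ia (mi K Hi)] at le
  have := (hF K).2
  linarith
section pieces
variable {F : Filtration ℝ≥0 m} {Q : Measure Ω} [IsPr Q] {o : Ω → ℝ} {S : ℝ≥0 → Ω → ℝ} {τ : Ω → ℝ≥0∞}
def gN (p n : ℕ) : ℕ := (2^p - 1) * 2^(n-p)
def BB (τ : Ω → ℝ≥0∞) (p n i : ℕ) : Set Ω := {w | (gt n (min i (gN p n)) : ℝ≥0∞) < τ w}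
def XX (S : ℝ≥0 → Ω → ℝ) (τ : Ω → ℝ≥0∞) (p n : ℕ) (w : Ω) : ℝ := ∑ i ∈ Finset.range (gN p n), ind (BB τ p n i \ BB τ p n (i+1)) w * S (gt n (i+1)) w
def HH (S : ℝ≥0 → Ω → ℝ) (τ : Ω → ℝ≥0∞) (p : ℕ) (w : Ω) : ℝ := ind {w | 0 < τ w ∧ τ w ≤ (((2^p - 1 : ℕ) : ℝ≥0) : ℝ≥0∞)} w * S (τ w).toNNReal w
lemma BB_anti {p n : ℕ} (h : p ≤ n) : Antitone (BB τ p n) := fun i j hij w hw => by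
  have : gt n (min i (gN p n)) ≤ gt n (min j (gN p n)) := gt_mono (min_le_min_right _ hij) ((min_le_right _ _).trans_lt (gN_lt h))
  have h1 : (gt n (min j (gN p n)) : ℝ≥0∞) < τ w := hw
  show (gt n (min i (gN p n)) : ℝ≥0∞) < τ w
  exact lt_of_le_of_lt (by exact_mod_cast this) h1
lemma BB_meas (hτ : IsStoppingTimeENN F τ) {p n : ℕ} (h : p ≤ n) (i : ℕ) : MeasurableSet[grid F n i] (BB τ p n i) := by
  have h1 : min i (gN p n) < 2^n := (min_le_right _ _).trans_lt (gN_lt h)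
  have h2 : MeasurableSet[grid F n (min i (gN p n))] (BB τ p n i) := by
    rw [grid_lt h1]
    have : BB τ p n i = {w | τ w ≤ (gt n (min i (gN p n)) : ℝ≥0∞)}ᶜ := by ext w; simp [BB]
    rw [this]; exact (hτ _).compl
  exact (grid F n).mono (min_le_left _ _) _ h2
lemma CC_mem {p n i : ℕ} (hi : i < gN p n) {w : Ω} :
 w ∈ BB τ p n i \ BB τ p n (i+1) ↔ (gt n i : ℝ≥0∞) < τ w ∧ τ w ≤ gt n (i+1) := by
  simp only [BB, mem_diff, mem_setOf_eq, not_lt]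
  rw [min_eq_left hi.le, min_eq_left (Nat.succ_le_of_lt hi)]
lemma CC_disj {p n i j : ℕ} (h : p ≤ n) {w : Ω} (hi : w ∈ BB τ p n i \ BB τ p n (i+1))
 (hj : w ∈ BB τ p n j \ BB τ p n (j+1)) : i = j := by
  rcases lt_trichotomy i j with h1 | h1 | h1
  · exact absurd (BB_anti h h1 hj.1) hi.2
  · exact h1
  · exact absurd (BB_anti h h1 hi.1) hj.2
lemma XX_mem {p n i : ℕ} (h : p ≤ n) (hi : i < gN p n) {w : Ω} (hw : w ∈ BB τ p n i \ BB τ p n (i+1)) :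
 XX S τ p n w = S (gt n (i+1)) w := by
  unfold XX
  rw [Finset.sum_eq_single i, ind_mem hw, one_mul]
  · intro j _ hj
    rw [ind_nmem (fun h' => hj (CC_disj h h' hw)), zero_mul]
  · intro h'; exact absurd (Finset.mem_range.2 hi) h'
lemma CC_exists {p n : ℕ} (h : p ≤ n) {w : Ω} (h0 : 0 < τ w) (h1 : τ w ≤ (((2^p - 1 : ℕ) : ℝ≥0) : ℝ≥0∞)) :
 ∃ i < gN p n, w ∈ BB τ p n i \ BB τ p n (i+1) := by
  by_contra! hc
  have : ∀ i ≤ gN p n, w ∈ BB τ p n i := by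
    intro i hi
    induction i with
    | zero => simp [BB, gt_zero, h0]
    | succ i ih =>
      by_contra hn
      exact hc i hi ⟨ih (Nat.le_of_succ_le hi), hn⟩
  have h2 := this (gN p n) le_rfl
  simp only [BB, mem_setOf_eq, min_self] at h2
  rw [gN, gt_N h] at h2
  exact absurd h1 (not_le.2 h2)
lemma XX_nmem {p n : ℕ} (h : p ≤ n) {w : Ω} (h0 : ¬ (0 < τ w ∧ τ w ≤ (((2^p - 1 : ℕ) : ℝ≥0) : ℝ≥0∞))) :
 XX S τ p n w = 0 := by
  unfold XX
  refine sum_eq_zero fun i hi => ?_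
  rw [ind_nmem, zero_mul]
  intro hw
  have hi := Finset.mem_range.1 hi
  rw [CC_mem hi] at hw
  refine h0 ⟨lt_of_le_of_lt bot_le hw.1, hw.2.trans ?_⟩
  have : gt n (i+1) ≤ gt n (gN p n) := gt_mono hi (gN_lt h)
  rw [gN, gt_N h] at this
  exact_mod_cast this
lemma XX_lim (hrc : ∀ w, ∀ t : ℝ≥0, ContinuousWithinAt (fun s => S s w) (Ici t) t) (p : ℕ) (w : Ω) :
 Tendsto (fun n => XX S τ p n w) atTop (nhds (HH S τ p w)) := by
  by_cases h0 : 0 < τ w ∧ τ w ≤ (((2^p - 1 : ℕ) : ℝ≥0) : ℝ≥0∞)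
  · have hH : HH S τ p w = S (τ w).toNNReal w := by
      unfold HH; rw [ind_mem (by exact h0), one_mul]
    rw [hH]
    have hfin : τ w ≠ ∞ := (h0.2.trans_lt ENNReal.coe_lt_top).ne
    set t := (τ w).toNNReal with ht
    have hte : (t : ℝ≥0∞) = τ w := ENNReal.coe_toNNReal hfin
    have hv : ∀ n, ∃ v : ℝ≥0, p ≤ n → t ≤ v ∧ (v:ℝ) ≤ t + 4^p / 2^n ∧ XX S τ p n w = S v w := fun n => by
      by_cases h : p ≤ n
      · obtain ⟨i, hi, hw⟩ := CC_exists h h0.1 h0.2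
        refine ⟨gt n (i+1), fun _ => ?_⟩
        have hm := gt_mesh h (show i + 1 ≤ (2^p - 1) * 2^(n-p) from hi)
        have hx := XX_mem (S := S) h hi hw
        rw [CC_mem hi, ← hte] at hw
        have a1 : (gt n i : ℝ) < t := by exact_mod_cast hw.1
        refine ⟨by exact_mod_cast hw.2, by linarith, hx⟩
      · exact ⟨0, fun h' => absurd h' h⟩
    choose v hv using hv
    have hvt : Tendsto v atTop (nhds t) := by
      rw [← NNReal.tendsto_coe]
      have hz : Tendsto (fun n : ℕ => (t:ℝ) + 4^p / 2^n) atTop (nhds t) := by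
        have : Tendsto (fun n : ℕ => (4:ℝ)^p * (1/2)^n) atTop (nhds (4^p * 0)) := (tendsto_pow_atTop_nhds_zero_of_lt_one (by norm_num) (by norm_num)).const_mul _
        have := this.const_add (t:ℝ)
        simpa [div_eq_mul_inv] using this
      refine tendsto_of_tendsto_of_tendsto_of_le_of_le' tendsto_const_nhds hz ?_ ?_
      · filter_upwards [eventually_ge_atTop p] with n hn
        exact_mod_cast (hv n hn).1
      · filter_upwards [eventually_ge_atTop p] with n hn
        exact (hv n hn).2.1
    have hvw : Tendsto v atTop (nhdsWithin t (Ici t)) := by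
      refine tendsto_nhdsWithin_iff.2 ⟨hvt, ?_⟩
      filter_upwards [eventually_ge_atTop p] with n hn using (hv n hn).1
    refine ((hrc w t).tendsto.comp hvw).congr' ?_
    filter_upwards [eventually_ge_atTop p] with n hn
    exact (hv n hn).2.2.symm
  · have hH : HH S τ p w = 0 := by unfold HH; rw [ind_nmem (by exact h0), zero_mul]
    rw [hH]
    refine tendsto_const_nhds.congr' ?_
    filter_upwards [eventually_ge_atTop p] with n hn using (XX_nmem hn h0).symm
end pieces
end P23
section P24
variable {Ω : Type*} {m : MeasurableSpace Ω} {F : Filtration ℝ≥0 m}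
  {Q : Measure Ω} [IsPr Q] {o : Ω → ℝ} {S : ℝ≥0 → Ω → ℝ} {τ : Ω → ℝ≥0∞}
lemma grid_mart {ν : Measure Ω} [IsFiniteMeasure ν] {V : ℝ≥0 → Ω → ℝ} (hV : Martingale V F ν) {n N : ℕ} (hN : N < 2^n) :
 Martingale (fun i => V (gt n (min i N))) (grid F n) ν := by
  have hm : ∀ i, StronglyMeasurable[grid F n i] (V (gt n (min i N))) := fun i => by
    have h1 : min i N < 2^n := (min_le_right _ _).trans_lt hN
    have h2 := hV.1 (gt n (min i N))
    rw [← grid_lt h1] at h2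
    exact h2.mono ((grid F n).mono (min_le_left _ _))
  refine ⟨hm, fun i j hij => ?_⟩
  rcases lt_or_ge i N with h | h
  · have h1 : i < 2^n := h.trans hN
    rw [grid_lt h1]
    simp only [min_eq_left h.le]
    exact hV.2 _ _ (gt_mono (le_min hij h.le) ((min_le_right _ _).trans_lt hN))
  · have hj := hm i
    simp only [min_eq_right h, min_eq_right (h.trans hij)] at hj ⊢
    rw [condExp_of_stronglyMeasurable ((grid F n).le i) hj (hV.integrable _)]
lemma XX_excess (ho : Integrable o Q) (hS : ∀ t, S t =ᵐ[Q] Q[o|F t]) (hτ : IsStoppingTimeENN F τ) {p n : ℕ} (h : p ≤ n) (K : ℕ) :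
 Integrable (XX S τ p n) Q ∧ ∫ w, max (|XX S τ p n w| - K) 0 ∂Q ≤ ∫ w, max (|o w| - K) 0 ∂Q := by
  have hCm : ∀ i, MeasurableSet (BB τ p n i \ BB τ p n (i+1)) := fun i =>
    ((grid F n).le _ _ (BB_meas hτ h i)).diff ((grid F n).le _ _ (BB_meas hτ h (i+1)))
  have hSi : ∀ t, Integrable (S t) Q := fun t => integrable_condExp.congr (hS t).symm
  have hmi : ∀ {f : Ω → ℝ}, Integrable f Q → Integrable (fun w => max (|f w| - K) 0) Q := fun hf =>
    (hf.abs.sub (integrable_const (K:ℝ))).pos_part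
  have hi : ∀ {f : Ω → ℝ} i, Integrable f Q → Integrable (fun w => ind (BB τ p n i \ BB τ p n (i+1)) w * f w) Q := fun i hf =>
    int_mul (ind_sm (hCm i)).aestronglyMeasurable (ae_of_all _ fun w => ind_abs _ w) hf
  refine ⟨integrable_finsetSum _ fun i _ => hi i (hSi _), ?_⟩
  have hle : ∀ w, max (|XX S τ p n w| - K) 0 ≤ ∑ i ∈ Finset.range (gN p n), ind (BB τ p n i \ BB τ p n (i+1)) w * max (|S (gt n (i+1)) w| - K) 0 := fun w => by
    have h0 : ∀ i, 0 ≤ ind (BB τ p n i \ BB τ p n (i+1)) w * max (|S (gt n (i+1)) w| - K) 0 := fun i =>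
      mul_nonneg (ind_nn _ _) (le_max_right _ _)
    by_cases hw : 0 < τ w ∧ τ w ≤ (((2^p - 1 : ℕ) : ℝ≥0) : ℝ≥0∞)
    · obtain ⟨i, hi, hwi⟩ := CC_exists h hw.1 hw.2
      rw [XX_mem h hi hwi]
      refine le_trans (le_of_eq ?_) (Finset.single_le_sum (fun j _ => h0 j) (Finset.mem_range.2 hi))
      rw [ind_mem hwi, one_mul]
    · rw [XX_nmem h hw]
      refine le_trans (max_le ?_ le_rfl) (sum_nonneg fun i _ => h0 i)
      simp
  have hUm : Martingale (fun i => Q[o|grid F n i]) (grid F n) Q := martingale_condExp _ _ _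
  calc _ ≤ ∫ w, ∑ i ∈ Finset.range (gN p n), ind (BB τ p n i \ BB τ p n (i+1)) w * max (|S (gt n (i+1)) w| - K) 0 ∂Q := integral_mono (hmi (integrable_finsetSum _ fun i _ => hi i (hSi _))) (integrable_finsetSum _ fun i _ => hi i (hmi (hSi _))) hle
    _ = ∑ i ∈ Finset.range (gN p n), ∫ w, ind (BB τ p n i \ BB τ p n (i+1)) w * max (|(Q[o|grid F n (i+1)]) w| - K) 0 ∂Q := by
        rw [integral_finsetSum _ fun i _ => hi i (hmi (hSi _))]
        refine sum_congr rfl fun i hi => integral_congr_ae ?_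
        rw [grid_lt (lt_of_le_of_lt (Finset.mem_range.1 hi) (gN_lt h))]
        filter_upwards [hS (gt n (i+1))] with w hw
        rw [hw]
    _ ≤ ∫ w, max (|(Q[o|grid F n (gN p n)]) w| - K) 0 ∂Q := jump_conv hUm (BB_meas hτ h) (BB_anti h) _ _
    _ ≤ ∫ w, (Q[fun w => max (|o w| - K) 0|grid F n (gN p n)]) w ∂Q := integral_mono_ae (hmi integrable_condExp) integrable_condExp (excess_le ho K ((grid F n).le _))
    _ = _ := integral_condExp ((grid F n).le _)
lemma err_lim (ho : Integrable o Q) (hS : ∀ t, S t =ᵐ[Q] Q[o|F t]) (hτ : IsStoppingTimeENN F τ)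
 (hrc : ∀ w, ∀ t : ℝ≥0, ContinuousWithinAt (fun s => S s w) (Ici t) t) (p : ℕ) :
 Integrable (HH S τ p) Q ∧ Tendsto (fun n => ∫ w, |HH S τ p w - XX S τ p n w| ∂Q) atTop (nhds 0) := by
  have h := vit (μ := Q) (X := fun n => XX S τ p (n+p)) (H := HH S τ p) (fun n => (XX_excess ho hS hτ (Nat.le_add_left _ _) 0).1)
    (ae_of_all _ fun w => (XX_lim hrc p w).comp (tendsto_add_atTop_nat p)) (tail_max ho)
    (fun K => Eventually.of_forall fun n => (XX_excess ho hS hτ (Nat.le_add_left _ _) K).2)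
  exact ⟨h.1, (tendsto_add_atTop_iff_nat (f := fun n => ∫ w, |HH S τ p w - XX S τ p n w| ∂Q) p).1 h.2⟩
lemma err_eq (hS : ∀ t, S t =ᵐ[Q] Q[o|F t]) {p n : ℕ} (h : p ≤ n) {i : ℕ} (hi : i < gN p n) :
 (fun w => ind (BB τ p n i) w * (stoppedAtENN S τ (gt n (min (i+1) (gN p n))) w - (Q[o|grid F n (i+1)]) w)) =ᵐ[Q]
 fun w => ind (BB τ p n i \ BB τ p n (i+1)) w * (HH S τ p w - XX S τ p n w) := by
  rw [grid_lt (lt_of_le_of_lt hi (gN_lt h)), min_eq_left (Nat.succ_le_of_lt hi)]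
  filter_upwards [hS (gt n (i+1))] with w hw
  rw [← hw]
  by_cases h1 : w ∈ BB τ p n i
  · by_cases h2 : w ∈ BB τ p n (i+1)
    · rw [ind_nmem (A := BB τ p n i \ BB τ p n (i+1)) (fun h' => h'.2 h2), zero_mul]
      have h3 : (gt n (min (i+1) (gN p n)) : ℝ≥0∞) < τ w := h2
      rw [min_eq_left (Nat.succ_le_of_lt hi)] at h3
      rw [stoppedAtENN, if_neg (not_le.2 h3), sub_self, mul_zero]
    · have hm : w ∈ BB τ p n i \ BB τ p n (i+1) := ⟨h1, h2⟩
      rw [ind_mem h1, ind_mem hm, XX_mem h hi hm]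
      rw [CC_mem hi] at hm
      have h4 : gt n (i+1) ≤ ((2^p-1 : ℕ):ℝ≥0) := by
        have : gt n (i+1) ≤ gt n (gN p n) := gt_mono hi (gN_lt h)
        rwa [gN, gt_N h] at this
      rw [stoppedAtENN, if_pos hm.2, HH, ind_mem (by exact ⟨lt_of_le_of_lt bot_le hm.1, hm.2.trans (by exact_mod_cast h4)⟩), one_mul, one_mul, one_mul]
  · rw [ind_nmem h1, ind_nmem (A := BB τ p n i \ BB τ p n (i+1)) (fun h' => h1 h'.1), zero_mul, zero_mul]
theorem hv_level (ho : Integrable o Q) (hS : ∀ t, S t =ᵐ[Q] Q[o|F t]) (hτ : IsStoppingTimeENN F τ)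
 (hrc : ∀ w, ∀ t : ℝ≥0, ContinuousWithinAt (fun s => S s w) (Ici t) t)
 {L D : Ω → ℝ} (hL : Measurable L) (hL0 : ∀ w, 0 ≤ L w) [IsPr (wd Q L)]
 (hLi : Integrable L Q) (hD : ∀ᵐ w ∂Q, |D w| ≤ 1) (hU : Martingale (stoppedAtENN S τ) F (wd Q L))
 {k c b K l : ℝ} (hk : 0 ≤ k) (hc : 0 < c) (hb : 0 < b) (hb1 : b ≤ 1) (hK : 0 ≤ K) (hl : 0 < l)
 (hab : ∫ w, max (L w - k) 0 ∂Q ≤ b^2) {p n : ℕ} (h : p ≤ n) :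
 ∑ i ∈ Finset.range (2^n), ∫ w, ind (Tl (grid F n) Q l (fun w => min (L w) k) o D i) w * (dm (grid F n) Q D i w)^2 ∂Q ≤
 ((k + b) * (∫ w, |HH S τ p w - XX S τ p n w| ∂Q) + 4 * b * √(c * ∫ w, |o w| ∂Q) + b * (∫ w, |o w| ∂Q + c) + c * b^2 +
 (K * (wd Q L).real {w | k < L w} + ∫ w, max (|stoppedAtENN S τ ((2^p-1:ℕ):ℝ≥0) w| - K) 0 ∂(wd Q L))) / l +
 (Q.real {w | τ w ≤ (((2^p-1:ℕ):ℝ≥0):ℝ≥0∞)} + b + (∫ w, |o w| ∂Q) / c) + 2 * ∫ w, |D w - (Q[D|F ((2^p-1:ℕ):ℝ≥0)]) w| ∂Q := by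
  have hCm : ∀ i, MeasurableSet (BB τ p n i \ BB τ p n (i+1)) := fun i =>
    ((grid F n).le _ _ (BB_meas hτ h i)).diff ((grid F n).le _ _ (BB_meas hτ h (i+1)))
  have hdi : Integrable (fun w => HH S τ p w - XX S τ p n w) Q := (err_lim ho hS hτ hrc p).1.sub (XX_excess ho hS hτ h 0).1
  have hi : ∀ i, Integrable (fun w => ind (BB τ p n i \ BB τ p n (i+1)) w * (HH S τ p w - XX S τ p n w)) Q := fun i =>
    int_mul (ind_sm (hCm i)).aestronglyMeasurable (ae_of_all _ fun w => ind_abs _ w) hdi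
  have main := stepB_level (O := grid F n) hL hL0 hLi ho hD hk hc hb hb1 hK hl hab (grid_mart hU (gN_lt h)) (BB_meas hτ h) (BB_anti h)
    (gN p n) (2^n) (gN_lt h).le (fun i hi => by
      rw [grid_lt (hi.trans (gN_lt h))]
      filter_upwards [hS (gt n i)] with w hw hB
      have hB : (gt n (min i (gN p n)) : ℝ≥0∞) < τ w := hB
      rw [← hw, show (2^p-1) * 2^(n-p) = gN p n from rfl]
      rw [min_eq_left hi.le] at hB ⊢
      rw [stoppedAtENN, if_neg (not_le.2 hB)])
    (fun i hi' => (hi i).congr (err_eq hS h hi').symm)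
    (e := ∫ w, |HH S τ p w - XX S τ p n w| ∂Q) (by
      calc _ = ∑ i ∈ Finset.range (gN p n), ∫ w, |ind (BB τ p n i \ BB τ p n (i+1)) w * (HH S τ p w - XX S τ p n w)| ∂Q := by
            refine sum_congr rfl fun i hi => integral_congr_ae ?_
            filter_upwards [err_eq hS h (Finset.mem_range.1 hi)] with w hw
            exact congrArg _ hw
        _ = ∫ w, ∑ i ∈ Finset.range (gN p n), |ind (BB τ p n i \ BB τ p n (i+1)) w * (HH S τ p w - XX S τ p n w)| ∂Q := (integral_finsetSum _ fun i _ => (hi i).abs).symm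
        _ ≤ _ := by
            refine integral_mono (integrable_finsetSum _ fun i _ => (hi i).abs) hdi.abs fun w => ?_
            have := sum_jump (A := BB τ p n) (BB_anti h) (gN p n) w
            simp only [abs_mul, abs_of_nonneg (ind_nn _ w)]
            rw [← sum_mul]
            exact mul_le_of_le_one_left (abs_nonneg _) this)
  have e1 : (BB τ p n (gN p n))ᶜ = {w | τ w ≤ (((2^p-1:ℕ):ℝ≥0):ℝ≥0∞)} := by
    ext w; simp only [BB, mem_compl_iff, mem_ofPred_eq, not_lt, min_self]; rw [gN, gt_N h]
  rw [e1, show (2^p-1) * 2^(n-p) = gN p n from rfl, min_self, grid_lt (show gN p n < 2^n from gN_lt h)] at main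
  rw [gN, gt_N h] at main
  exact main
lemma real_to_zero {ν : Measure Ω} [IsFiniteMeasure ν] {A : ℕ → Set Ω} (hA : ∀ n, MeasurableSet (A n)) (ha : Antitone A)
 (he : ∀ w, ∃ n, w ∉ A n) : Tendsto (fun n => ν.real (A n)) atTop (nhds 0) := by
  have h := tendsto_measure_iInter_atTop (μ := ν) (fun n => (hA n).nullMeasurableSet) ha ⟨0, measure_ne_top _ _⟩
  have e : ⋂ n, A n = ∅ := by
    ext w; simpa using he w
  rw [e, measure_empty] at h
  have h2 := (ENNReal.tendsto_toReal ENNReal.zero_ne_top).comp h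
  rw [ENNReal.toReal_zero] at h2
  exact h2
theorem hv_all (hgen : (⨆ t : ℝ≥0, (F t : MeasurableSpace Ω)) = m) (ho : Integrable o Q) (hS : ∀ t, S t =ᵐ[Q] Q[o|F t])
 {τ : ℕ → Ω → ℝ≥0∞} (hτ : ∀ q, IsStoppingTimeENN F (τ q)) (hmono : ∀ w, Monotone fun n => τ n w)
 (hsup : ∀ w, (⨆ n, τ n w) = ∞)
 (hrc : ∀ w, ∀ t : ℝ≥0, ContinuousWithinAt (fun s => S s w) (Ici t) t)
 {L D : Ω → ℝ} (hL : Measurable L) (hL0 : ∀ w, 0 ≤ L w) [IsPr (wd Q L)]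
 (hLi : Integrable L Q) (hDm : Measurable D) (hD : ∀ w, |D w| ≤ 1) (hU : ∀ q, Martingale (stoppedAtENN S (τ q)) F (wd Q L))
 {l : ℝ} (hl : 0 < l) : ∀ᶠ k : ℕ in atTop, ∀ᶠ n in atTop,
 ∑ i ∈ Finset.range (2^n), ∫ w, ind (Tl (grid F n) Q l (fun w => min (L w) k) o D i) w * (dm (grid F n) Q D i w)^2 ∂Q ≤ l := by
  obtain ⟨p, hp⟩ := ((levy (Q := Q) hgen hDm (int_bdd hDm.aestronglyMeasurable (ae_of_all _ hD))).eventually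
    (gt_mem_nhds (by positivity : 0 < l/16))).exists
  set t : ℝ≥0 := ((2^p-1:ℕ):ℝ≥0) with ht
  have hq : Tendsto (fun q => Q.real {w | τ q w ≤ (t:ℝ≥0∞)}) atTop (nhds 0) := real_to_zero (fun q => F.le _ _ (hτ q t))
    (fun a b hab w hw => le_trans (hmono w hab) hw) (fun w => by
      by_contra! hc
      have : (⨆ n, τ n w) ≤ t := iSup_le hc
      rw [hsup] at this
      exact absurd this (not_le.2 ENNReal.coe_lt_top))
  obtain ⟨q, hq⟩ := (hq.eventually (gt_mem_nhds (by positivity : 0 < l/8))).exists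
  obtain ⟨K, hK⟩ := ((tail_max ((hU q).integrable t)).eventually (gt_mem_nhds (by positivity : 0 < l^2/16))).exists
  set Ψ := ∫ w, |o w| ∂Q with hΨ
  have hΨ0 : 0 ≤ Ψ := integral_nonneg fun w => abs_nonneg _
  set c := 8 * Ψ / l + 1 with hc
  have hc0 : 0 < c := by positivity
  have hcΨ : Ψ / c ≤ l/8 := by
    rw [div_le_iff₀ hc0, hc]
    have : l/8 * (8 * Ψ / l + 1) = Ψ + l/8 := by field_simp
    linarith
  set A := 4 * √(c*Ψ) + Ψ + c + c with hA
  have hA0 : 0 ≤ A := by positivity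
  obtain ⟨b, hb0, hb1, hb2, hb3⟩ : ∃ b : ℝ, 0 < b ∧ b ≤ 1 ∧ b ≤ l/8 ∧ A * b ≤ l^2/16 := by
    refine ⟨min 1 (min (l/8) (l^2/16/(A+1))), by positivity, min_le_left _ _, (min_le_right _ _).trans (min_le_left _ _), ?_⟩
    calc A * _ ≤ A * (l^2/16/(A+1)) := mul_left_le ((min_le_right _ _).trans (min_le_right _ _)) hA0
      _ ≤ (A+1) * (l^2/16/(A+1)) := by
        refine mul_right_le (by linarith) (by positivity)
      _ = _ := by field_simp
  have hk1 : ∀ᶠ k : ℕ in atTop, ∫ w, max (L w - k) 0 ∂Q < b^2 := by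
    have := (tail_max hLi).eventually (gt_mem_nhds (by positivity : 0 < b^2))
    simpa only [abs_of_nonneg (hL0 _)] using this
  have hk2 : ∀ᶠ k : ℕ in atTop, K * (wd Q L).real {w | (k:ℝ) < L w} < l^2/16 := by
    have h1 : Tendsto (fun k : ℕ => (wd Q L).real {w | (k:ℝ) < L w}) atTop (nhds 0) := real_to_zero (fun k => measurableSet_lt measurable_const hL) (fun i j hij w hw => show (i:ℝ) < L w from lt_of_le_of_lt (Nat.cast_le.2 hij) (show (j:ℝ) < L w from hw))
        (fun w => by obtain ⟨k, hk⟩ := exists_nat_ge (L w); exact ⟨k, not_lt.2 hk⟩)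
    have h2 := h1.const_mul (K:ℝ)
    rw [mul_zero] at h2
    exact h2.eventually (gt_mem_nhds (by positivity))
  filter_upwards [hk1, hk2] with k h1 h2
  have he := ((err_lim ho hS (hτ q) hrc p).2.const_mul ((k:ℝ)+b))
  rw [mul_zero] at he
  filter_upwards [he.eventually (gt_mem_nhds (by positivity : 0 < l^2/16)), eventually_ge_atTop p] with n h3 hn
  refine (hv_level ho hS (hτ q) hrc hL hL0 hLi (ae_of_all _ hD) (hU q) (Nat.cast_nonneg k) hc0 hb0 hb1 (Nat.cast_nonneg K) hl h1.le hn).trans ?_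
  rw [← ht, ← hΨ]
  have hbb : 4 * b * √(c * Ψ) + b * (Ψ + c) + c * b^2 ≤ A * b := by
    rw [hA]; nlinarith [mul_nonneg hc0.le (mul_nonneg hb0.le (sub_nonneg.2 hb1))]
  have hdiv : ∀ a : ℝ, a ≤ l^2/4 → a / l ≤ l/4 := fun a ha => by
    rw [div_le_iff₀ hl]; linarith [sq l]
  have := hdiv _ (show (k + b) * (∫ w, |HH S (τ q) p w - XX S (τ q) p n w| ∂Q) + 4 * b * √(c * Ψ) + b * (Ψ + c) + c * b^2 +
      (K * (wd Q L).real {w | (k:ℝ) < L w} + ∫ w, max (|stoppedAtENN S (τ q) t w| - K) 0 ∂(wd Q L)) ≤ l^2/4 by linarith)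
  linarith
end P24
section P25
variable {Ω : Type*} {m : MeasurableSpace Ω} {F : Filtration ℝ≥0 m} {Q : Measure Ω} [IsPr Q]
lemma grid_seq (t : ℝ≥0) : ∃ v : ℕ → ℝ≥0, (∀ᶠ n in atTop, t ≤ v n ∧ ∃ i < 2^n, v n = gt n i) ∧
 Tendsto v atTop (nhdsWithin t (Ici t)) := by
  rcases eq_or_ne t 0 with rfl | ht
  · exact ⟨fun _ => 0, Eventually.of_forall fun n => ⟨le_rfl, 0, by positivity, (gt_zero n).symm⟩,
      tendsto_nhdsWithin_iff.2 ⟨tendsto_const_nhds, Eventually.of_forall fun _ => self_mem_Ici⟩⟩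
  have ht0 : 0 < (t : ℝ≥0∞) := by exact_mod_cast pos_iff_ne_zero.2 ht
  obtain ⟨p, hp⟩ : ∃ p : ℕ, t ≤ ((2^p-1 : ℕ) : ℝ≥0) := by
    obtain ⟨p, hp⟩ := exists_nat_ge t
    exact ⟨p, hp.trans (Nat.cast_le.2 (Nat.le_sub_one_of_lt p.lt_two_pow_self))⟩
  have hp' : (t : ℝ≥0∞) ≤ (((2^p-1 : ℕ) : ℝ≥0) : ℝ≥0∞) := by exact_mod_cast hp
  have hl := XX_lim (Ω := Unit) (S := fun s _ => (s:ℝ)) (τ := fun _ => (t:ℝ≥0∞))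
    (fun _ s => NNReal.continuous_coe.continuousWithinAt) p ()
  have hH : HH (fun s (_ : Unit) => (s:ℝ)) (fun _ => (t:ℝ≥0∞)) p () = t := by
    rw [HH, ind_mem (by exact ⟨ht0, hp'⟩), one_mul]; simp
  have hv : ∀ n, ∃ v : ℝ≥0, p ≤ n → (t ≤ v ∧ ∃ i < 2^n, v = gt n i) ∧ XX (fun s (_ : Unit) => (s:ℝ)) (fun _ => (t:ℝ≥0∞)) p n () = v := fun n => by
    by_cases h : p ≤ n
    · obtain ⟨i, hi, hw⟩ := CC_exists (τ := fun _ : Unit => (t:ℝ≥0∞)) (w := ()) h ht0 hp'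
      refine ⟨gt n (i+1), fun _ => ⟨⟨?_, i+1, lt_of_le_of_lt hi (gN_lt h), rfl⟩, XX_mem h hi hw⟩⟩
      exact_mod_cast ((CC_mem hi).1 hw).2
    · exact ⟨0, fun h' => absurd h' h⟩
  choose v hv using hv
  refine ⟨v, (eventually_ge_atTop p).mono fun n hn => (hv n hn).1, tendsto_nhdsWithin_iff.2 ⟨?_, ?_⟩⟩
  · rw [← NNReal.tendsto_coe, ← hH]
    exact hl.congr' ((eventually_ge_atTop p).mono fun n hn => (hv n hn).2)
  · exact (eventually_ge_atTop p).mono fun n hn => (hv n hn).1.1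
lemma grid_ge {f : ℝ≥0 → ℝ} (hf : ∀ t, ContinuousWithinAt f (Ici t) t) {r : ℝ} (h : ∀ n i, i < 2^n → r ≤ f (gt n i)) (t : ℝ≥0) :
 r ≤ f t := by
  obtain ⟨v, hv, hl⟩ := grid_seq t
  refine ge_of_tendsto ((hf t).tendsto.comp hl) (hv.mono fun n hn => ?_)
  obtain ⟨_, i, hi, e⟩ := hn
  rw [Function.comp, e]; exact h n i hi
lemma max_ineq {f : Ω → ℝ} (hf0 : ∀ w, 0 ≤ f w) {V : ℝ≥0 → Ω → ℝ}
 (hV : ∀ t, V t ≤ᵐ[Q] Q[f|F t]) {c : ℝ} (hc : 0 < c) :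
 c * Q.real {w | ∃ n i, i < 2^n ∧ c < V (gt n i) w} ≤ ∫ w, f w ∂Q := by
  set B : ℕ → Set Ω := fun n => {w | ∃ i < 2^n, c < V (gt n i) w} with hB
  have hBn : ∀ n, c * Q.real (B n) ≤ ∫ w, f w ∂Q := fun n => by
    have h1 := maximal_stay (martingale_condExp f (grid F n) Q) (fun i => condExp_nonneg (ae_of_all _ hf0)) (c := c) (2^n)
    rw [integral_condExp ((grid F n).le _)] at h1
    refine le_trans (mul_left_le ?_ hc.le) h1
    refine ENNReal.toReal_mono (measure_ne_top _ _) (measure_mono_ae ?_)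
    have := ae_all_iff.2 fun i => hV (gt n i)
    filter_upwards [this] with w hw
    rintro ⟨i, hi, h2⟩ h3
    have h3 : (Q[f|grid F n i]) w ≤ c := h3 i hi.le
    rw [grid_lt hi] at h3
    linarith [hw i]
  have hmono : Monotone B := monotone_nat_of_le_succ fun n w ⟨i, hi, h⟩ => by
    refine ⟨i * 2^(n+1-n), ?_, ?_⟩
    · rw [Nat.add_sub_cancel_left, pow_one, pow_succ]; omega
    · rw [gt_ref (Nat.le_succ n)]; exact h
  have hU : {w | ∃ n i, i < 2^n ∧ c < V (gt n i) w} = ⋃ n, B n := by ext w; simp [hB]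
  have ht := (ENNReal.tendsto_toReal (measure_ne_top Q (⋃ n, B n))).comp (tendsto_measure_iUnion_atTop (μ := Q) hmono)
  rw [hU]
  exact le_of_tendsto (ht.const_mul c) (Eventually.of_forall hBn)
def RCV (F : Filtration ℝ≥0 m) (Q : Measure Ω) (X : Ω → ℝ) : Prop := ∃ V : ℝ≥0 → Ω → ℝ, (∀ t, Measurable[F t] (V t)) ∧
    (∀ w, ∀ t : ℝ≥0, ContinuousWithinAt (fun s => V s w) (Ici t) t) ∧ ∀ t, V t =ᵐ[Q] Q[X|F t]
lemma RCV_congr {X Y : Ω → ℝ} (h : X =ᵐ[Q] Y) : RCV F Q X → RCV F Q Y := fun ⟨V, h1, h2, h3⟩ =>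
  ⟨V, h1, h2, fun t => (h3 t).trans (condExp_congr_ae h)⟩
lemma RCV_lim (hcomp : ∀ s : Set Ω, MeasurableSet s → Q s = 0 → MeasurableSet[F 0] s) {X : Ω → ℝ} (hX : Integrable X Q)
 {g : ℕ → Ω → ℝ} (hg : ∀ k, Integrable (g k) Q) (hgX : ∀ k, ∫ w, |g k w - X w| ∂Q ≤ (1/4)^k) (hR : ∀ k, RCV F Q (g k)) :
 RCV F Q X := by
  choose V hVm hVc hV using hR
  have hdom : ∀ k t, (fun w => |V k t w - (Q[X|F t]) w|) ≤ᵐ[Q] Q[(fun w => |g k w - X w|)|F t] := fun k t => by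
    filter_upwards [hV k t, condExp_sub (hg k) hX (F t), excess_le ((hg k).sub hX) 0 (F.le t)] with w h1 h2 h3
    rw [h1]
    rw [h2, sub_zero, max_eq_left (abs_nonneg _)] at h3
    refine h3.trans (le_of_eq ?_)
    have : (fun w => max (|(g k - X) w| - 0) 0) = fun w => |g k w - X w| := by
      ext w; simp
    rw [this]
  set B : ℕ → Set Ω := fun k => {w | ∃ n i, i < 2^n ∧ (1/2:ℝ)^k < |V k (gt n i) w - (Q[X|F (gt n i)]) w|} with hB
  have hBk : ∀ k, Q.real (B k) ≤ (1/2)^k := fun k => by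
    have h1 := (max_ineq (fun w => abs_nonneg _) (hdom k) (by positivity : (0:ℝ) < (1/2)^k)).trans (hgX k)
    have h2 : (1/4:ℝ)^k = (1/2)^k * (1/2)^k := by rw [← mul_pow]; norm_num
    rw [h2] at h1
    exact le_of_mul_le_mul_left h1 (by positivity)
  have hBC : ∀ᵐ w ∂Q, ∀ᶠ k in atTop, w ∉ B k := by
    refine ae_eventually_notMem (ne_top_of_le_ne_top (b := ∑' k : ℕ, ENNReal.ofReal ((1/2)^k)) ?_ (ENNReal.tsum_le_tsum fun k => ?_))
    · rw [← ENNReal.ofReal_tsum_of_nonneg (fun k => by positivity) summable_geometric_two]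
      exact ENNReal.ofReal_ne_top
    · exact (ENNReal.le_ofReal_iff_toReal_le (measure_ne_top _ _) (by positivity)).2 (hBk k)
  obtain ⟨G, hG, hGm, hG0⟩ := exists_measurable_superset_of_null (ae_iff.1 hBC)
  have hGF : ∀ t, MeasurableSet[F t] Gᶜ := fun t => F.mono (zero_le) _ (hcomp G hGm hG0).compl
  set W : ℕ → ℝ≥0 → Ω → ℝ := fun k t => Gᶜ.indicator (V k t) with hW
  have hWc : ∀ k w t, ContinuousWithinAt (fun s => W k s w) (Ici t) t := fun k w t => by
    by_cases h : w ∈ Gᶜ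
    · simp only [hW, indicator_of_mem h]; exact hVc k w t
    · simp only [hW, indicator_of_notMem h]; exact continuousWithinAt_const
  have hWm : ∀ k t, Measurable[F t] (W k t) := fun k t => (hVm k t).indicator (hGF t)
  have hG1 : ∀ᵐ w ∂Q, w ∈ Gᶜ := measure_eq_zero_iff_ae_notMem.1 hG0
  have hunif : ∀ w, ∃ k0, ∀ k ≥ k0, ∀ j ≥ k, ∀ t, |W k t w - W j t w| ≤ 2 * (1/2)^k := fun w => by
    by_cases h : w ∈ Gᶜ
    · have h1 : ∀ᶠ k in atTop, w ∉ B k := by by_contra h'; exact h (hG h')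
      obtain ⟨k0, h1⟩ := eventually_atTop.1 h1
      refine ⟨k0, fun k hk j hj t => ?_⟩
      simp only [hW, indicator_of_mem h]
      rw [← neg_le_neg_iff]
      refine grid_ge (f := fun t => -|V k t w - V j t w|) (fun t => ((hVc k w t).sub (hVc j w t)).abs.neg) (fun n i hi => ?_) t
      have a1 : ∀ k ≥ k0, |V k (gt n i) w - (Q[X|F (gt n i)]) w| ≤ (1/2)^k := fun k hk => by
        by_contra! hc; exact h1 k hk ⟨n, i, hi, hc⟩
      have a2 := a1 k hk
      have a3 := a1 j (hk.trans hj)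
      have a4 : (1/2:ℝ)^j ≤ (1/2)^k := pow_le_pow_of_le_one (by norm_num) (by norm_num) hj
      have a5 := abs_sub_le (V k (gt n i) w) ((Q[X|F (gt n i)]) w) (V j (gt n i) w)
      rw [abs_sub_comm ((Q[X|F (gt n i)]) w)] at a5
      linarith
    · refine ⟨0, fun k _ j _ t => ?_⟩
      simp only [hW, indicator_of_notMem h, sub_self, abs_zero]; positivity
  have hlim0 : Tendsto (fun k : ℕ => 2 * (1/2:ℝ)^k) atTop (nhds 0) := by
    simpa using (tendsto_pow_atTop_nhds_zero_of_lt_one (by norm_num) (by norm_num : (1/2:ℝ) < 1)).const_mul 2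
  have hex : ∀ t w, ∃ y, Tendsto (fun k => W k t w) atTop (nhds y) := fun t w => by
    obtain ⟨k0, h⟩ := hunif w
    refine cauchySeq_tendsto_of_complete ((cauchySeq_shift k0).1 (cauchySeq_of_le_tendsto_0' (fun k => 2 * (1/2:ℝ)^(k+k0)) (fun k j hkj => ?_)
      ((tendsto_add_atTop_iff_nat k0).2 hlim0)))
    exact h (k+k0) (by omega) (j+k0) (by omega) t
  choose S hS using hex
  refine ⟨S, fun t => @measurable_of_tendsto_metrizable _ _ (F t) _ _ _ _ _ _ (fun k => hWm k t) (tendsto_pi_nhds.2 (hS t)), fun w t => ?_, fun t => ?_⟩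
  · have hu : TendstoUniformly (fun k s => W k s w) (fun s => S s w) atTop := by
      obtain ⟨k0, h⟩ := hunif w
      rw [Metric.tendstoUniformly_iff]
      intro ε hε
      filter_upwards [hlim0.eventually (gt_mem_nhds hε), eventually_ge_atTop k0] with k h1 h2 s
      refine lt_of_le_of_lt ?_ h1
      rw [dist_comm, Real.dist_eq]
      refine le_of_tendsto ((hS s w).const_sub (W k s w)).abs ?_
      filter_upwards [eventually_ge_atTop k] with j hj using h k h2 j hj s
    refine continuousWithinAt_of_locally_uniform_approx_of_continuousWithinAt self_mem_Ici fun u hu' => ?_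
    obtain ⟨k, hk⟩ := (hu u hu').exists
    exact ⟨Ici t, self_mem_nhdsWithin, fun s => W k s w, hWc k w t, fun y _ => hk y⟩
  · have h1 : Tendsto (fun k => ∫ w, |V k t w - (Q[X|F t]) w| ∂Q) atTop (nhds 0) := by
      refine squeeze_zero (fun k => integral_nonneg fun w => abs_nonneg _) (fun k => ?_)
        (tendsto_pow_atTop_nhds_zero_of_lt_one (by norm_num) (by norm_num : (1/4:ℝ) < 1))
      refine le_trans ?_ (hgX k)
      rw [← integral_condExp (F.le t) (f := fun w => |g k w - X w|)]
      exact integral_mono_ae ((integrable_condExp.congr (hV k t).symm).sub integrable_condExp).abs integrable_condExp (hdom k t)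
    have h2 : ∀ ε > 0, Integrable (fun w => |S t w - (Q[X|F t]) w|) Q ∧ ∫ w, |S t w - (Q[X|F t]) w| ∂Q ≤ ε := fun ε hε =>
      fatou_int (f := fun k w => |V k t w - (Q[X|F t]) w|)
        (fun k => ((integrable_condExp.congr (hV k t).symm).sub integrable_condExp).abs) (fun k w => abs_nonneg _)
        ((h1.eventually (gt_mem_nhds hε)).mono fun k hk => hk.le) (by
          filter_upwards [hG1] with w hw
          have := hS t w
          simp only [hW, indicator_of_mem hw] at this
          exact (this.sub_const _).abs)
    have h3 : ∫ w, |S t w - (Q[X|F t]) w| ∂Q = 0 := le_antisymm (le_of_forall_pos_le_add fun ε hε => by rw [zero_add]; exact (h2 ε hε).2) (integral_nonneg fun w => abs_nonneg _)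
    rw [integral_eq_zero_iff_of_nonneg (fun w => abs_nonneg _) (h2 1 one_pos).1] at h3
    filter_upwards [h3] with w hw
    exact sub_eq_zero.1 (abs_eq_zero.1 hw)
end P25
section P26
variable {Ω : Type*} {m : MeasurableSpace Ω} {F : Filtration ℝ≥0 m} {Q : Measure Ω} [IsPr Q] {d : ℕ}
lemma wg_eq {G : MeasurableSpace Ω} (hG : G ≤ m) {N o V : Ω → ℝ} {C : ℝ} (hN : Measurable[m] N) (hC : ∀ w, |N w| ≤ C) (hC0 : 0 ≤ C)
 (ho : Integrable o Q) (hVm : Measurable[G] V) (hV : V =ᵐ[Q] Q[o|G]) {A : Set Ω} (hA : MeasurableSet[G] A) :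
 ∫ w, ind A w * ((N w - (Q[N|G]) w) * o w) ∂Q = ∫ w, N w * (ind A w * (o w - V w)) ∂Q := by
  have hVi : Integrable V Q := integrable_condExp.congr hV.symm
  have hNi : Integrable N Q := int_bdd hN.aestronglyMeasurable (ae_of_all _ hC)
  have hi : ∀ {f : Ω → ℝ}, Integrable f Q → Integrable (fun w => ind A w * f w) Q := fun hf => int_indm (hG _ hA) hf
  have hi2 : ∀ {f : Ω → ℝ}, Integrable f Q → Integrable (fun w => N w * f w) Q := fun hf =>
    int_mul hN.aestronglyMeasurable (ae_of_all _ hC) hf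
  have hnb := ce_abs hC0 (ae_of_all Q hC) G
  have hφ : StronglyMeasurable[G] (fun w => ind A w * (Q[N|G]) w) := (ind_sm hA).mul stronglyMeasurable_condExp
  have i1 : Integrable (fun w => ind A w * (Q[N|G]) w * o w) Q := by
    have := hi (int_mul (aesm_of hG stronglyMeasurable_condExp) hnb ho)
    exact this.congr (ae_of_all _ fun w => (mul_assoc _ _ _).symm)
  have i2 : Integrable (fun w => ind A w * V w * N w) Q := (hi2 (hi hVi)).congr (ae_of_all _ fun w => mul_comm _ _)
  have p1 := pull hG hφ i1 ho
  have p2 : ∫ w, ind A w * V w * (Q[N|G]) w ∂Q = ∫ w, ind A w * V w * N w ∂Q := pull hG ((ind_sm hA).mul hVm.stronglyMeasurable) i2 hNi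
  have e : ∫ w, ind A w * (Q[N|G]) w * (Q[o|G]) w ∂Q = ∫ w, ind A w * V w * (Q[N|G]) w ∂Q := integral_congr_ae (by filter_upwards [hV] with w h; rw [h]; ring)
  have e1 : ∫ w, ind A w * ((N w - (Q[N|G]) w) * o w) ∂Q = ∫ w, (N w * (ind A w * o w) - ind A w * (Q[N|G]) w * o w) ∂Q := integral_congr_ae (ae_of_all _ fun w => by simp only; ring)
  have e2 : ∫ w, N w * (ind A w * (o w - V w)) ∂Q = ∫ w, (N w * (ind A w * o w) - ind A w * V w * N w) ∂Q := integral_congr_ae (ae_of_all _ fun w => by simp only; ring)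
  rw [e1, e2, integral_sub (hi2 (hi ho)) i1, integral_sub (hi2 (hi ho)) i2, ← p1, e, p2]
lemma orth_self {G : MeasurableSpace Ω} (hG : G ≤ m) {o V : Ω → ℝ} (ho : Integrable o Q) (hV : V =ᵐ[Q] Q[o|G]) {A : Set Ω}
 (hA : MeasurableSet[G] A) : ∫ w, ind A w * (o w - V w) ∂Q = 0 := by
  have hVi : Integrable V Q := integrable_condExp.congr hV.symm
  have e : ∫ w, ind A w * (o w - V w) ∂Q = ∫ w, (ind A w * o w - ind A w * V w) ∂Q := integral_congr_ae (ae_of_all _ fun w => mul_sub _ _ _)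
  rw [e, integral_sub (int_indm (hG _ hA) ho) (int_indm (hG _ hA) hVi),
    ← pull hG (ind_sm hA) (int_indm (hG _ hA) ho) ho, sub_eq_zero]
  exact integral_congr_ae (by filter_upwards [hV] with w h; rw [h])
theorem WG_of {o : Fin d → Ω → ℝ} (ho : ∀ c, Integrable (o c) Q) {S : Fin d → ℝ≥0 → Ω → ℝ} (hSm : ∀ c t, Measurable[F t] (S c t))
 (hrc : ∀ c w, ∀ t : ℝ≥0, ContinuousWithinAt (fun s => S c s w) (Ici t) t) (hS : ∀ c t, S c t =ᵐ[Q] Q[o c|F t])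
 (huniq : ∀ ν : Measure Ω, IsPr ν → ν ≪ Q → Q ≪ ν → (∀ c, Integrable (o c) ν) →
 (∀ c t, S c t =ᵐ[ν] ν[o c|F t]) → ν = Q) : WG (grid F) Q o := by
  intro N hN ⟨C, hC⟩ hW
  have hC0 : 0 ≤ C := by
    obtain ⟨w⟩ := nonempty_of_isProbabilityMeasure Q
    exact (abs_nonneg _).trans (hC w)
  have hSi : ∀ c t, Integrable (S c t) Q := fun c t => integrable_condExp.congr (hS c t).symm
  have hNi : Integrable N Q := int_bdd hN.aestronglyMeasurable (ae_of_all _ hC)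
  have hi2 : ∀ {f : Ω → ℝ}, Integrable f Q → Integrable (fun w => N w * f w) Q := fun hf =>
    int_mul hN.aestronglyMeasurable (ae_of_all _ hC) hf
  have hgrid : ∀ c n i, i < 2^n → ∀ A, MeasurableSet[F (gt n i)] A → ∫ w, N w * (ind A w * (o c w - S c (gt n i) w)) ∂Q = 0 := by
    intro c n i hi A hA
    rw [← wg_eq (F.le _) hN hC hC0 (ho c) (hSm c _) (hS c _) hA, ← grid_lt hi]
    exact hW n i A (by rw [grid_lt hi]; exact hA) c
  have hall : ∀ c s A, MeasurableSet[F s] A → ∫ w, N w * (ind A w * (o c w - S c s w)) ∂Q = 0 := by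
    intro c s A hA
    have hAm := F.le _ _ hA
    obtain ⟨v, hv, hvl⟩ := grid_seq s
    have hvit := (vit (μ := Q) (X := fun n => S c (v n)) (H := S c s) (fun n => hSi c _)
      (ae_of_all _ fun w => (hrc c w s).tendsto.comp hvl) (tail_max (ho c)) (fun K => Eventually.of_forall fun n => by
        rw [← integral_condExp (F.le (v n)) (f := fun w => max (|o c w| - K) 0)]
        refine integral_mono_ae ((hSi c _).abs.sub (integrable_const (K:ℝ))).pos_part integrable_condExp ?_
        filter_upwards [excess_le (ho c) K (F.le (v n)), hS c (v n)] with w h1 h2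
        rw [h2]; exact h1)).2.const_mul C
    rw [mul_zero] at hvit
    have hle : |∫ w, N w * (ind A w * (o c w - S c s w)) ∂Q| ≤ 0 := by
      refine ge_of_tendsto hvit (hv.mono fun n hn => ?_)
      obtain ⟨h1, i, hi, e⟩ := hn
      have h2 := hgrid c n i hi A (by rw [← e]; exact F.mono h1 _ hA)
      rw [← e] at h2
      have j : ∀ t, Integrable (fun w => N w * (ind A w * (o c w - S c t w))) Q := fun t =>
        hi2 (int_indm hAm ((ho c).sub (hSi c t)))
      have h3 : ∫ w, N w * (ind A w * (o c w - S c s w)) ∂Q =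
          ∫ w, (N w * (ind A w * (o c w - S c s w)) - N w * (ind A w * (o c w - S c (v n) w))) ∂Q := by
        rw [integral_sub (j s) (j _), h2, sub_zero]
      rw [h3, ← norm_eq_abs, ← integral_const_mul]
      refine norm_integral_le_of_norm_le (((hSi c s).sub (hSi c (v n))).abs.const_mul C) (ae_of_all _ fun w => ?_)
      have : N w * (ind A w * (o c w - S c s w)) - N w * (ind A w * (o c w - S c (v n) w)) = N w * (ind A w * -(S c s w - S c (v n) w)) := by ring
      rw [this, norm_eq_abs, abs_mul, abs_mul, abs_neg]
      exact mul_le_mul (hC w) (mul_le_of_le_one_left (abs_nonneg _) (ind_abs _ _)) (by positivity) hC0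
    exact abs_eq_zero.1 (le_antisymm hle (abs_nonneg _))
  set a := ∫ w, N w ∂Q with ha
  have haC : |a| ≤ C := by
    have := norm_integral_le_of_norm_le (f := N) (integrable_const C) (ae_of_all Q hC)
    simpa using this
  set ρ : Ω → ℝ := fun w => 1 + (N w - a) / (4 * (C+1)) with hρ
  have hρm : Measurable ρ := measurable_const.add ((hN.sub measurable_const).div_const _)
  have hρb : ∀ w, 1/2 ≤ ρ w ∧ ρ w ≤ 3/2 := fun w => by
    have h1 := abs_le.1 (hC w)
    have h2 := abs_le.1 haC
    have h3 : |(N w - a) / (4 * (C+1))| ≤ 1/2 := by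
      rw [abs_div, abs_of_pos (by positivity : 0 < 4 * (C+1)), div_le_iff₀ (by positivity), abs_le]
      constructor <;> linarith
    rw [abs_le] at h3
    simp only [hρ]; constructor <;> linarith [h3.1, h3.2]
  have hρ0 : ∀ w, 0 ≤ ρ w := fun w => by linarith [(hρb w).1]
  have hρa : ∀ w, |ρ w| ≤ 3/2 := fun w => by rw [abs_of_nonneg (hρ0 w)]; exact (hρb w).2
  have hρi : Integrable ρ Q := int_bdd hρm.aestronglyMeasurable (ae_of_all _ hρa)
  have hρ1 : ∫ w, ρ w ∂Q = 1 := by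
    simp only [hρ]
    have t : Integrable (fun w => (N w - a) / (4 * (C+1))) Q := (hNi.sub (integrable_const _)).div_const _
    rw [integral_add (integrable_const _) t, integral_div, integral_sub hNi (integrable_const _)]
    simp [ha]
  have hpr : IsPr (wd Q ρ) := wd_prob hρm hρ0 hρi hρ1
  have hitg : ∀ {f : Ω → ℝ}, Integrable f Q → Integrable f (wd Q ρ) := fun hf =>
    (wd_itg hρm hρ0).2 (int_mul hρm.aestronglyMeasurable (ae_of_all _ hρa) hf)
  have heq := huniq (wd Q ρ) hpr (wd_ac _) (wd_ac' hρm fun w => by linarith [(hρb w).1]) (fun c => hitg (ho c)) (fun c t => by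
    refine ae_eq_condExp_of_forall_setIntegral_eq (F.le t) (hitg (ho c)) (fun _ _ _ => (hitg (hSi c t)).integrableOn) (fun A hA _ => ?_)
      (hSm c t).stronglyMeasurable.aestronglyMeasurable
    have hAm := F.le _ _ hA
    rw [← int_ind_mul _ hAm, ← int_ind_mul _ hAm, eq_comm, ← sub_eq_zero,
      ← integral_sub (int_indm hAm (hitg (ho c))) (int_indm hAm (hitg (hSi c t))), wd_int hρm hρ0]
    have jA : Integrable (fun w => ind A w * (o c w - S c t w)) Q := int_indm hAm ((ho c).sub (hSi c t))
    have e : ∀ w, ρ w * (ind A w * o c w - ind A w * S c t w) = (1 - a / (4*(C+1))) * (ind A w * (o c w - S c t w)) +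
        1/(4*(C+1)) * (N w * (ind A w * (o c w - S c t w))) := fun w => by simp only [hρ]; ring
    simp only [e]
    rw [integral_add (jA.const_mul _) ((hi2 jA).const_mul _), integral_const_mul, integral_const_mul, hall c t A hA,
      orth_self (F.le t) (ho c) (hS c t) hA]; simp)
  refine ⟨a, ?_⟩
  have h1 : ∫ w, (N w - a) ∂(wd Q ρ) = ∫ w, (N w - a) ∂Q := by rw [heq]
  have hNa : Integrable (fun w => N w - a) Q := hNi.sub (integrable_const _)
  have hNa0 : ∫ w, (N w - a) ∂Q = 0 := by rw [integral_sub hNi (integrable_const _)]; simp [ha]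
  have hsq : Integrable (fun w => (N w - a)^2) Q := int_bdd (c := (2*C)^2) ((hN.sub measurable_const).pow_const 2).aestronglyMeasurable
    (ae_of_all _ fun w => by
      rw [abs_pow]
      exact pow_le_pow_left₀ (abs_nonneg _) ((abs_sub _ _).trans (by linarith [hC w])) 2)
  rw [wd_int hρm hρ0] at h1
  have e : ∀ w, ρ w * (N w - a) = (N w - a) + 1/(4*(C+1)) * (N w - a)^2 := fun w => by simp only [hρ]; ring
  simp only [e] at h1
  rw [integral_add hNa (hsq.const_mul _), integral_const_mul, add_eq_left] at h1
  have h2 : ∫ w, (N w - a)^2 ∂Q = 0 := by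
    rcases mul_eq_zero.1 h1 with h | h
    · exact absurd h (by positivity)
    · exact h
  rw [integral_eq_zero_iff_of_nonneg (fun w => sq_nonneg _) hsq] at h2
  filter_upwards [h2] with w hw
  have := pow_eq_zero_iff (two_ne_zero) |>.1 hw
  linarith
end P26
section P27
variable {Ω : Type*} {m : MeasurableSpace Ω} {F : Filtration ℝ≥0 m} {Q : Measure Ω} [IsPr Q] {d : ℕ}
lemma RCV_const (c : ℝ) : RCV F Q (fun _ => c) := ⟨fun _ _ => c, fun _ => measurable_const, fun _ _ => continuousWithinAt_const, fun t => by rw [condExp_const (F.le t)]⟩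
lemma RCV_add {X Y : Ω → ℝ} (hX : Integrable X Q) (hY : Integrable Y Q) (h1 : RCV F Q X) (h2 : RCV F Q Y) : RCV F Q (X + Y) := by
  obtain ⟨V, a, b, c⟩ := h1
  obtain ⟨W, a', b', c'⟩ := h2
  refine ⟨fun t w => V t w + W t w, fun t => (a t).add (a' t), fun w t => (b w t).add (b' w t), fun t => ?_⟩
  filter_upwards [c t, c' t, condExp_add hX hY (F t)] with w h h' h''
  rw [h, h', h'']; rfl
lemma RCV_smul {X : Ω → ℝ} (r : ℝ) (h1 : RCV F Q X) : RCV F Q (r • X) := by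
  obtain ⟨V, a, b, c⟩ := h1
  refine ⟨fun t w => r * V t w, fun t => (a t).const_mul r, fun w t => continuousWithinAt_const.mul (b w t), fun t => ?_⟩
  filter_upwards [c t, condExp_smul r X (F t) (μ := Q)] with w h h''
  rw [h, h'']; rfl
lemma RCV_gen {o : Ω → ℝ} (ho : Integrable o Q) {V : ℝ≥0 → Ω → ℝ} (hVm : ∀ t, Measurable[F t] (V t))
 (hrc : ∀ w, ∀ t : ℝ≥0, ContinuousWithinAt (fun s => V s w) (Ici t) t) (hV : ∀ t, V t =ᵐ[Q] Q[o|F t]) {s : ℝ≥0} {A : Set Ω}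
 (hA : MeasurableSet[F s] A) : RCV F Q (fun w => ind A w * (o w - V s w)) := by
  have hVi : ∀ t, Integrable (V t) Q := fun t => integrable_condExp.congr (hV t).symm
  have hsub : Integrable (o - V s) Q := ho.sub (hVi s)
  have hprod : Integrable (ind A * (o - V s)) Q := int_indm (F.le _ _ hA) hsub
  have key : ∀ t, s ≤ t → (fun w => ind A w * (V t w - V s w)) =ᵐ[Q] Q[fun w => ind A w * (o w - V s w)|F t] := fun t ht => by
    have e1 := condExp_mul_of_stronglyMeasurable_left (m := F t) (ind_sm (F.mono ht _ hA)) hprod hsub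
    have e2 := condExp_sub ho (hVi s) (F t)
    have e3 := condExp_of_stronglyMeasurable (F.le t) ((hVm s).mono (F.mono ht) le_rfl).stronglyMeasurable (hVi s)
    rw [e3] at e2
    filter_upwards [e1, e2, hV t] with w h1 h2 h3
    have h1' : (Q[fun w => ind A w * (o w - V s w)|F t]) w = ind A w * (Q[o - V s|F t]) w := h1
    rw [h1', h2, h3]; rfl
  refine ⟨fun t w => if s ≤ t then ind A w * (V t w - V s w) else 0, fun t => ?_, fun w t => ?_, fun t => ?_⟩
  · by_cases ht : s ≤ t
    · simp only [ht, if_true]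
      exact (ind_sm (F.mono ht _ hA)).measurable.mul ((hVm t).sub ((hVm s).mono (F.mono ht) le_rfl))
    · simp only [ht, if_false]; exact measurable_const
  · by_cases ht : s ≤ t
    · have h1 : ContinuousWithinAt (fun r => ind A w * (V r w - V s w)) (Ici t) t := continuousWithinAt_const.mul ((hrc w t).sub continuousWithinAt_const)
      refine h1.congr (fun r hr => ?_) ?_
      · exact if_pos (ht.trans hr)
      · exact if_pos ht
    · refine ContinuousAt.continuousWithinAt ?_
      refine (continuousAt_const (y := (0:ℝ))).congr ?_
      filter_upwards [Iio_mem_nhds (not_le.1 ht)] with r hr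
      rw [if_neg (not_le.2 hr)]
  · by_cases ht : s ≤ t
    · simp only [ht, if_true]; exact key t ht
    · simp only [ht, if_false]
      have h1 := condExp_condExp_of_le (μ := Q) (F.mono (not_le.1 ht).le) (F.le s) (f := fun w => ind A w * (o w - V s w))
      have h2 : Q[fun w => ind A w * (o w - V s w)|F s] =ᵐ[Q] (0 : Ω → ℝ) := by
        filter_upwards [key s le_rfl] with w h
        rw [← h]; simp
      have h3 := condExp_congr_ae (m := F t) h2
      rw [condExp_zero] at h3
      exact (h1.symm.trans h3).symm
theorem RCV_all (hcomp : ∀ s : Set Ω, MeasurableSet s → Q s = 0 → MeasurableSet[F 0] s)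
 {o : Fin d → Ω → ℝ} (ho : ∀ c, Integrable (o c) Q) (hR : ∀ c, RCV F Q (o c)) (hW : WG (grid F) Q o)
 {X : Ω → ℝ} (hX : Integrable X Q) : RCV F Q X := by
  let W : Submodule ℝ (Lp ℝ 1 Q) :=
    { carrier := {g | RCV F Q g}
      add_mem' := fun {a b} ha hb => RCV_congr (Lp.coeFn_add a b).symm
        (RCV_add (L1.integrable_coeFn a) (L1.integrable_coeFn b) ha hb)
      zero_mem' := RCV_congr (Lp.coeFn_zero ℝ 1 Q).symm (RCV_const 0)
      smul_mem' := fun r a ha => RCV_congr (Lp.coeFn_smul r a).symm (RCV_smul r ha) }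
  have hWm : ∀ {f : Ω → ℝ} (hf : Integrable f Q), RCV F Q f → hf.toL1 f ∈ W := fun hf h =>
    RCV_congr hf.coeFn_toL1.symm h
  have hd : Dense (W : Set (Lp ℝ 1 Q)) := by
    refine dense_of W fun N hN ⟨C, hC⟩ hO => ?_
    have hC0 : 0 ≤ C := by
      obtain ⟨w⟩ := nonempty_of_isProbabilityMeasure Q
      exact (abs_nonneg _).trans (hC w)
    have hO' : ∀ {f : Ω → ℝ} (_ : Integrable f Q), RCV F Q f → ∫ w, N w * f w ∂Q = 0 := fun hf h => by
      rw [← hO _ (hWm hf h)]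
      exact integral_congr_ae (by filter_upwards [hf.coeFn_toL1] with w h; rw [h])
    have h1 := hO' (integrable_const 1) (RCV_const 1)
    obtain ⟨a, ha⟩ := hW N hN ⟨C, hC⟩ (fun n i A hA c => by
      by_cases hi : i < 2^n
      · rw [grid_lt hi] at hA ⊢
        obtain ⟨V, v1, v2, v3⟩ := hR c
        rw [wg_eq (F.le _) hN hC hC0 (ho c) (v1 _) (v3 _) hA]
        exact hO' (int_indm (F.le _ _ hA) ((ho c).sub (integrable_condExp.congr (v3 _).symm)))
          (RCV_gen (ho c) v1 v2 v3 hA)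
      · rw [grid_top n i (not_lt.1 hi), condExp_of_stronglyMeasurable le_rfl hN.stronglyMeasurable
          (int_bdd hN.aestronglyMeasurable (ae_of_all _ hC))]
        simp)
    have h2 : ∫ w, N w * 1 ∂Q = a := by
      rw [integral_congr_ae (g := fun _ => a) (by filter_upwards [ha] with w h; rw [h, mul_one])]; simp
    rw [h1] at h2
    filter_upwards [ha] with w h
    rw [h, ← h2]; rfl
  have hap : ∀ k : ℕ, ∃ g ∈ W, ∫ w, |g w - X w| ∂Q ≤ (1/4)^k := fun k => by
    obtain ⟨g, hg, hgd⟩ := Metric.dense_iff.1 hd (hX.toL1 X) ((1/4)^k) (by positivity)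
    refine ⟨g, hgd, ?_⟩
    rw [Metric.mem_ball, L1.dist_eq_integral_dist] at hg
    refine le_trans (le_of_eq (integral_congr_ae ?_)) hg.le
    filter_upwards [hX.coeFn_toL1] with w h
    rw [h, Real.dist_eq]
  choose g hg hgX using hap
  exact RCV_lim hcomp hX (g := fun k => g k) (fun k => L1.integrable_coeFn _) hgX hg
end P27
section P28
variable {Ω : Type*} {m : MeasurableSpace Ω} {F : Filtration ℝ≥0 m} {Q : Measure Ω} [IsPr Q] {d : ℕ}
lemma bayes {G : MeasurableSpace Ω} (hG : G ≤ m) {ρ o : Ω → ℝ} (hρ : Measurable[m] ρ) (h0 : ∀ w, 0 ≤ ρ w) (hρi : Integrable ρ Q)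
 [IsPr (wd Q ρ)] (ho : Integrable o (wd Q ρ)) :
 (fun w => ((wd Q ρ)[o|G]) w * (Q[ρ|G]) w) =ᵐ[Q] Q[fun w => ρ w * o w|G] := by
  set φ := (wd Q ρ)[o|G] with hφ
  have hφs : StronglyMeasurable[G] φ := stronglyMeasurable_condExp
  have hφi : Integrable φ (wd Q ρ) := integrable_condExp
  have j1 : Integrable (fun w => φ w * ρ w) Q := ((wd_itg hρ h0).1 hφi).congr (ae_of_all _ fun w => mul_comm _ _)
  have j2 := pull_int hφs j1 hρi
  refine ae_eq_condExp_of_forall_setIntegral_eq hG ((wd_itg hρ h0).1 ho) (fun _ _ _ => j2.integrableOn) (fun A hA _ => ?_)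
    (hφs.mul stronglyMeasurable_condExp).aestronglyMeasurable
  have hAm := hG _ hA
  have e1 : ∫ w, ind A w * φ w * (Q[ρ|G]) w ∂Q = ∫ w, ind A w * φ w * ρ w ∂Q := pull hG ((ind_sm hA).mul hφs) ((int_indm hAm j1).congr (ae_of_all _ fun w => (mul_assoc _ _ _).symm)) hρi
  have e2 := pull hG (ind_sm hA) (int_indm hAm ho) ho
  rw [wd_int hρ h0, wd_int hρ h0] at e2
  rw [← int_ind_mul _ hAm, ← int_ind_mul _ hAm]
  calc _ = ∫ w, ind A w * φ w * (Q[ρ|G]) w ∂Q := integral_congr_ae (ae_of_all _ fun w => (mul_assoc _ _ _).symm)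
    _ = _ := e1
    _ = ∫ w, ρ w * (ind A w * φ w) ∂Q := integral_congr_ae (ae_of_all _ fun w => by simp only; ring)
    _ = _ := e2
    _ = _ := integral_congr_ae (ae_of_all _ fun w => by simp only; ring)
lemma RCV_bayes (hcomp : ∀ s : Set Ω, MeasurableSet s → Q s = 0 → MeasurableSet[F 0] s)
 (hall : ∀ X : Ω → ℝ, Integrable X Q → RCV F Q X) {ρ o : Ω → ℝ} (hρ : Measurable ρ) (h0 : ∀ w, 0 < ρ w) (hρi : Integrable ρ Q)
 [IsPr (wd Q ρ)] (ho : Integrable o (wd Q ρ)) : RCV F (wd Q ρ) o := by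
  have h0' : ∀ w, 0 ≤ ρ w := fun w => (h0 w).le
  have ac := wd_ac (P := Q) ρ
  have ac' := wd_ac' (P := Q) hρ h0
  obtain ⟨D, d1, d2, d3⟩ := hall ρ hρi
  obtain ⟨N, n1, n2, n3⟩ := hall _ ((wd_itg hρ h0').1 ho)
  have hri : Integrable (fun w => (ρ w)⁻¹) (wd Q ρ) := (wd_itg hρ h0').2
    ((integrable_const (1:ℝ)).congr (ae_of_all _ fun w => (mul_inv_cancel₀ (h0 w).ne').symm))
  have hDY : ∀ t, ∀ᵐ w ∂(wd Q ρ), ((wd Q ρ)[fun w => (ρ w)⁻¹|F t]) w * D t w = 1 := fun t => by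
    refine ac.ae_le ?_
    have h1 := bayes (F.le t) hρ h0' hρi hri
    have h2 : (fun w => ρ w * (ρ w)⁻¹) = fun _ => (1:ℝ) := funext fun w => mul_inv_cancel₀ (h0 w).ne'
    rw [h2, condExp_const (F.le t)] at h1
    filter_upwards [h1, d3 t] with w a b
    rw [b]; exact a
  have hY0 : ∀ t, ∀ᵐ w ∂(wd Q ρ), 0 ≤ ((wd Q ρ)[fun w => (ρ w)⁻¹|F t]) w := fun t =>
    condExp_nonneg (ae_of_all _ fun w => (inv_pos.2 (h0 w)).le)
  set Y : ℝ≥0 → Ω → ℝ := fun t => (wd Q ρ)[fun w => (ρ w)⁻¹|F t] with hY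
  set B : ℕ → Set Ω := fun k => {w | ∃ n i, i < 2^n ∧ ((k:ℝ)+1) < Y (gt n i) w} with hB
  have hBm : ∀ k : ℕ, ((k:ℝ)+1) * (wd Q ρ).real (B k) ≤ ∫ w, (ρ w)⁻¹ ∂(wd Q ρ) := fun k =>
    max_ineq (Q := wd Q ρ) (F := F) (V := Y) (fun w => (inv_pos.2 (h0 w)).le) (fun t => EventuallyLE.refl _ _) (by positivity)
  have hB0 : (wd Q ρ).real (⋂ k, B k) = 0 := by
    have hle : ∀ k : ℕ, (wd Q ρ).real (⋂ k, B k) ≤ (∫ w, (ρ w)⁻¹ ∂(wd Q ρ)) / ((k:ℝ)+1) := fun k => by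
      rw [le_div_iff₀ (by positivity), mul_comm]
      refine le_trans (mul_left_le (measureReal_mono (iInter_subset _ k)) (by positivity)) (hBm k)
    have ht : Tendsto (fun k : ℕ => (∫ w, (ρ w)⁻¹ ∂(wd Q ρ)) / ((k:ℝ)+1)) atTop (nhds 0) := tendsto_const_nhds.div_atTop (tendsto_natCast_atTop_atTop.atTop_add tendsto_const_nhds)
    exact le_antisymm (ge_of_tendsto' ht hle) measureReal_nonneg
  set G : Set Ω := {w | ∃ k : ℕ, ∀ n i, i < 2^n → 1/((k:ℝ)+1) ≤ D (gt n i) w} with hGdef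
  have hGm : MeasurableSet G := by
    have : G = ⋃ k : ℕ, ⋂ n, ⋂ i, ⋂ (_ : i < 2^n), {w | 1/((k:ℝ)+1) ≤ D (gt n i) w} := by
      ext w; simp [hGdef]
    rw [this]
    exact MeasurableSet.iUnion fun k => MeasurableSet.iInter fun n => MeasurableSet.iInter fun i => MeasurableSet.iInter fun _ =>
      measurableSet_le measurable_const ((d1 _).mono (F.le _) le_rfl)
  have hGae : ∀ᵐ w ∂(wd Q ρ), w ∈ G := by
    have hBae : ∀ᵐ w ∂(wd Q ρ), w ∉ ⋂ k, B k := by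
      rw [measureReal_eq_zero_iff] at hB0
      exact measure_eq_zero_iff_ae_notMem.1 hB0
    have hA : ∀ᵐ w ∂(wd Q ρ), ∀ n i, Y (gt n i) w * D (gt n i) w = 1 := by
      rw [ae_all_iff]; intro n; rw [ae_all_iff]; intro i; exact hDY _
    have hA' : ∀ᵐ w ∂(wd Q ρ), ∀ n i, 0 ≤ Y (gt n i) w := by
      rw [ae_all_iff]; intro n; rw [ae_all_iff]; intro i; exact hY0 _
    filter_upwards [hBae, hA, hA'] with w b a a'
    rw [mem_iInter, not_forall] at b
    obtain ⟨k, hk⟩ := b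
    refine ⟨k, fun n i hi => ?_⟩
    have h1 : Y (gt n i) w ≤ (k:ℝ)+1 := by
      by_contra hc
      exact hk ⟨n, i, hi, not_le.1 hc⟩
    have h2 := a n i
    have h3 : 0 < Y (gt n i) w := lt_of_le_of_ne (a' n i) fun e => by rw [← e] at h2; simp at h2
    rw [mul_comm] at h2
    rw [eq_div_of_mul_eq h3.ne' h2]
    exact one_div_le_one_div_of_le h3 h1
  have hpos : ∀ w ∈ G, ∀ t, 0 < D t w := fun w ⟨k, hk⟩ t =>
    lt_of_lt_of_le (by positivity : (0:ℝ) < 1/((k:ℝ)+1)) (grid_ge (d2 w) hk t)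
  have hG0 : MeasurableSet[F 0] G := by
    have h1 : Q Gᶜ = 0 := ac' (by rw [← mem_ae_iff]; exact hGae)
    have := (hcomp _ hGm.compl h1).compl
    rwa [compl_compl] at this
  refine ⟨fun t w => ind G w * (N t w / D t w), fun t => ?_, fun w t => ?_, fun t => ?_⟩
  · exact (ind_sm (F.mono bot_le _ hG0)).measurable.mul ((n1 t).div (d1 t))
  · by_cases hw : w ∈ G
    · exact continuousWithinAt_const.mul ((n2 w t).div (d2 w t) (hpos w hw t).ne')
    · simp only [ind_nmem hw, zero_mul]; exact continuousWithinAt_const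
  · have h1 := bayes (F.le t) hρ h0' hρi ho
    filter_upwards [hGae, ac.ae_le h1, ac.ae_le (n3 t), ac.ae_le (d3 t)] with w g a b c
    rw [ind_mem g, one_mul, b, ← a, ← c, mul_div_assoc, div_self (hpos w g t).ne', mul_one]
end P28
section P29
variable {Ω : Type*} {m : MeasurableSpace Ω} {F : Filtration ℝ≥0 m} {d : ℕ}
lemma exists_dens {ν P : Measure Ω} [IsPr ν] [IsPr P] (h : ν ≪ P) (h' : P ≪ ν) :
 ∃ Z : Ω → ℝ, Measurable Z ∧ (∀ w, 0 < Z w) ∧ wd P Z = ν := by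
  have hm : Measurable (fun w => (ν.rnDeriv P w).toReal) := (Measure.measurable_rnDeriv ν P).ennreal_toReal
  refine ⟨fun w => if 0 < (ν.rnDeriv P w).toReal then (ν.rnDeriv P w).toReal else 1,
    Measurable.ite (measurableSet_lt measurable_const hm) hm measurable_const, fun w => ?_, ?_⟩
  · dsimp only; split_ifs with h
    · exact h
    · exact one_pos
  · rw [← Measure.withDensity_rnDeriv_eq ν P h]
    unfold wd
    refine withDensity_congr_ae ?_
    rw [Measure.withDensity_rnDeriv_eq ν P h]
    filter_upwards [Measure.rnDeriv_pos' h', Measure.rnDeriv_lt_top ν P] with w h1 h2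
    rw [if_pos (ENNReal.toReal_pos h1.ne' h2.ne), ENNReal.ofReal_toReal h2.ne]
lemma wd_dens_int {Q : Measure Ω} [IsPr Q] {L : Ω → ℝ} (hL : Measurable L) (h0 : ∀ w, 0 ≤ L w)
 [IsPr (wd Q L)] : Integrable L Q ∧ ∫ w, L w ∂Q = 1 := by
  have h1 : Integrable (fun _ => (1:ℝ)) (wd Q L) := integrable_const _
  have h2 := (wd_itg hL h0).1 h1
  have h3 := wd_int (P := Q) hL h0 (fun _ => 1)
  simp only [mul_one] at h2 h3
  exact ⟨h2, by rw [← h3]; simp⟩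
variable {ν : Measure Ω} [IsPr ν]
lemma vec_comp {f : Ω → EuclideanSpace ℝ (Fin d)} (hf : Integrable f ν) (t : ℝ≥0) (c : Fin d) :
 (fun w => (ν[f|F t]) w c) =ᵐ[ν] ν[fun w => f w c|F t] := ContinuousLinearMap.comp_condExp_comm (m := F t) hf (EuclideanSpace.proj (𝕜 := ℝ) c)
lemma vec_of {f g : Ω → EuclideanSpace ℝ (Fin d)} (h : ∀ c, (fun w => f w c) =ᵐ[ν] fun w => g w c) : f =ᵐ[ν] g := by
  have := ae_all_iff.2 h
  filter_upwards [this] with w hw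
  ext c; exact hw c
lemma mart_comp {U : ℝ≥0 → Ω → EuclideanSpace ℝ (Fin d)} (hU : Martingale U F ν) (c : Fin d) :
 Martingale (fun t w => U t w c) F ν := by
  refine ⟨fun t => (EuclideanSpace.proj (𝕜 := ℝ) c).continuous.comp_stronglyMeasurable (hU.1 t), fun i j hij => ?_⟩
  filter_upwards [vec_comp (F := F) (hU.integrable j) i c, hU.2 i j hij] with w h1 h2
  rw [← h1, h2]
lemma mart_of {S : ℝ≥0 → Ω → EuclideanSpace ℝ (Fin d)} {o : Ω → EuclideanSpace ℝ (Fin d)} (hS : Adapted F S)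
 (h : ∀ t, S t =ᵐ[ν] ν[o|F t]) : Martingale S F ν := ⟨fun t => (hS t).stronglyMeasurable, fun i j hij =>
    ((condExp_congr_ae (h j)).trans (condExp_condExp_of_le (F.mono hij) (F.le j))).trans (h i).symm⟩
lemma loc_of {S : ℝ≥0 → Ω → EuclideanSpace ℝ (Fin d)} (h : Martingale S F ν) : IsLocalMartingale F S ν := by
  refine ⟨fun _ _ => ∞, fun n t => ?_, fun w => monotone_const, fun w => by simp, fun n => ?_⟩
  · simp
  · have : stoppedAtENN S (fun _ => ∞) = S := by
      funext t w; simp [stoppedAtENN]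
    rw [this]; exact h
lemma triv_cond (htr : ∀ s : Set Ω, MeasurableSet[F 0] s → ν s = 0 ∨ ν sᶜ = 0) {f : Ω → ℝ} (hf : Integrable f ν) :
 ν[f|F 0] =ᵐ[ν] fun _ => ∫ w, f w ∂ν := by
  refine (ae_eq_condExp_of_forall_setIntegral_eq (F.le 0) hf (fun _ _ _ => (integrable_const _).integrableOn) (fun A hA _ => ?_)
    stronglyMeasurable_const.aestronglyMeasurable).symm
  rcases htr A hA with h | h
  · rw [setIntegral_measure_zero _ h, setIntegral_measure_zero _ h]
  · have hA1 : A =ᵐ[ν] univ := by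
      rw [ae_eq_univ]; exact h
    rw [setIntegral_congr_set hA1, setIntegral_congr_set hA1]; simp
lemma uniq_of {Q : Measure Ω} [IsPr Q] (hgen : (⨆ t : ℝ≥0, (F t : MeasurableSpace Ω)) = m)
 (htr : ∀ s : Set Ω, MeasurableSet[F 0] s → Q s = 0 ∨ Q sᶜ = 0)
 {o : Ω → EuclideanSpace ℝ (Fin d)} (ho : Integrable o Q) (hWG : WG (grid F) Q (fun c w => o w c))
 {S : ℝ≥0 → Ω → EuclideanSpace ℝ (Fin d)} (hrc : ∀ w, ∀ t : ℝ≥0, ContinuousWithinAt (fun s => S s w) (Ici t) t)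
 (hS : ∀ t, S t =ᵐ[Q] Q[o|F t]) (h1 : ν ≪ Q) (h2 : Q ≪ ν) (hloc : IsLocalMartingale F S ν) : ν = Q := by
  obtain ⟨L, hL, hL0, hLQ⟩ := exists_dens h1 h2
  have hL0' : ∀ w, 0 ≤ L w := fun w => (hL0 w).le
  obtain ⟨τ, t1, t2, t3, t4⟩ := hloc
  rw [← hLQ] at t4
  have hp : IsPr (wd Q L) := by rw [hLQ]; infer_instance
  obtain ⟨hLi, hL1⟩ := wd_dens_int (Q := Q) hL hL0'
  have hoc : ∀ c, Integrable (fun w => o w c) Q := fun c => ho.eval_piLp c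
  have key := stepB_abs (grid_ref (F := F)) grid_top (fun n f hf => by
      rw [grid_lt (by positivity : 0 < 2^n), gt_zero]; exact triv_cond htr hf) hoc hWG hL hL0' hLi hL1 (fun c l hl => by
      refine hv_all hgen (hoc c) (S := fun t w => S t w c) (fun t => ?_) t1 t2 t3 (fun w t => ?_) hL hL0' hLi
        ((hL.min measurable_const).div_const _) (fun w => ?_) (fun q => ?_) hl
      · filter_upwards [hS t, vec_comp (F := F) ho t c] with w a b
        rw [← b, a]
      · exact ((EuclideanSpace.proj (𝕜 := ℝ) c).continuous.continuousAt).comp_continuousWithinAt (hrc w t)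
      · have a : 0 ≤ min (L w) 2 := le_min (hL0' w) (by norm_num)
        have b : min (L w) 2 ≤ 2 := min_le_right _ _
        rw [abs_of_nonneg (by positivity)]; linarith
      · have := mart_comp (t4 q) c
        have e : (fun t w => stoppedAtENN S (τ q) t w c) = stoppedAtENN (fun t w => S t w c) (τ q) := by
          funext t w; simp only [stoppedAtENN]; split_ifs <;> rfl
        rw [← e]; exact this)
  rw [← hLQ]
  unfold wd
  rw [withDensity_congr_ae (g := fun _ => 1) (by filter_upwards [key] with w h; rw [h]; simp)]
  simp
theorem core {P : Measure Ω} [IsPr P]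
 (hcomplete : ∀ s : Set Ω, MeasurableSet[m] s → P s = 0 → MeasurableSet[F 0] s)
 (htrivial : ∀ s : Set Ω, MeasurableSet[F 0] s → P s = 0 ∨ P s = 1)
 (hgen : (⨆ t : ℝ≥0, (F t : MeasurableSpace Ω)) = m)
 {o : Ω → EuclideanSpace ℝ (Fin d)} (hom : StronglyMeasurable o) (ho : Integrable o P)
 {Q : Measure Ω} [IsPr Q] (h1 : Q ≪ P) (h2 : P ≪ Q) (hoQ : Integrable o Q)
 {S : ℝ≥0 → Ω → EuclideanSpace ℝ (Fin d)} (hSa : Adapted F S)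
 (hrc : ∀ w, ∀ t : ℝ≥0, ContinuousWithinAt (fun s => S s w) (Ici t) t)
 (hS : ∀ t, S t =ᵐ[Q] Q[o|F t]) (hM : HasMRP F S P Q) {ε : ℝ} (hε : 0 < ε) :
 ∃ K : Measure Ω, IsPr K ∧ (K ≪ P ∧ P ≪ K) ∧ Integrable o K ∧
 (∃ S : ℝ≥0 → Ω → EuclideanSpace ℝ (Fin d),
 Adapted F S ∧
 (∀ w, ∀ t : ℝ≥0, ContinuousWithinAt (fun s => S s w) (Ici t) t) ∧
 (∀ t : ℝ≥0, S t =ᵐ[K] K[o | F t]) ∧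
 Martingale S F K ∧
 HasMRP F S P K) ∧ ∀ᵐ w ∂P, |(K.rnDeriv P w).toReal - 1| ≤ ε := by
  have htr : ∀ s : Set Ω, MeasurableSet[F 0] s → P s = 0 ∨ P sᶜ = 0 := fun s hs =>
    (htrivial s hs).imp id fun h => (prob_compl_eq_zero_iff (F.le _ _ hs)).2 h
  have hSc : ∀ c t, (fun w => S t w c) =ᵐ[Q] Q[fun w => o w c|F t] := fun c t => by
    filter_upwards [hS t, vec_comp (F := F) hoQ t c] with w a b
    rw [← b, a]
  have hSm : ∀ c t, Measurable[F t] (fun w => S t w c) := fun c t =>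
    (EuclideanSpace.proj (𝕜 := ℝ) c).continuous.measurable.comp (hSa t)
  have hSrc : ∀ c w, ∀ t : ℝ≥0, ContinuousWithinAt (fun s => S s w c) (Ici t) t := fun c w t =>
    ((EuclideanSpace.proj (𝕜 := ℝ) c).continuous.continuousAt).comp_continuousWithinAt (hrc w t)
  have hoc : ∀ c, Integrable (fun w => o w c) Q := fun c => hoQ.eval_piLp c
  have hoP : ∀ c, Integrable (fun w => o w c) P := fun c => ho.eval_piLp c
  have hocm : ∀ c, Measurable (fun w => o w c) := fun c =>
    (EuclideanSpace.proj (𝕜 := ℝ) c).continuous.measurable.comp hom.measurable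
  have hWG : WG (grid F) Q (fun c w => o w c) := by
    refine WG_of hoc hSm hSrc hSc fun μ hμ m1 m2 mi mS => hM.2 μ hμ ⟨m1.trans h1, h2.trans m2⟩ ?_
    have hi : Integrable o μ := Integrable.of_eval_piLp mi
    refine loc_of (mart_of (o := o) hSa fun t => vec_of fun c => ?_)
    exact (mS c t).trans (vec_comp hi t c).symm
  obtain ⟨Z, hZ, hZ0, hZQ⟩ := exists_dens h1 h2
  have hpZ : IsPr (wd P Z) := by rw [hZQ]; infer_instance
  obtain ⟨x, x0, x1, x2, hx⟩ := stepA (grid_ref (F := F)) grid_top hZ hZ0 hocm (by rw [hZQ]; exact hoc) hoP (by rw [hZQ]; exact hWG)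
    (by positivity : 0 < ε / 8)
  have hpK : IsPr (wd P (qd P Z x)) := qd_prob hZ hZ0 x0.le x1
  have qm := qd_meas (P := P) hZ x
  have q0 := fun w => qd_pos (P := P) hZ hZ0 x0.le x1 w
  have hK : wd Q (fun w => qd P Z x w / Z w) = wd P (qd P Z x) := by
    have := wd_wd (P := P) (b := fun w => qd P Z x w / Z w) hZ (qm.div hZ) fun w => (hZ0 w).le
    rw [← hZQ, this]
    congr 1; funext w; exact mul_div_cancel₀ _ (hZ0 w).ne'
  have k1 := wd_ac (P := P) (qd P Z x)
  have k2 := wd_ac' (P := P) qm q0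
  have hoK : ∀ c, Integrable (fun w => o w c) (wd P (qd P Z x)) := fun c => qd_integrable hZ hZ0 x0.le x1 (hoP c)
  have hoKv : Integrable o (wd P (qd P Z x)) := Integrable.of_eval_piLp hoK
  have hcQ : ∀ s : Set Ω, MeasurableSet s → Q s = 0 → MeasurableSet[F 0] s := fun s hs h => hcomplete s hs (h2 h)
  have hR : ∀ c, RCV F (wd P (qd P Z x)) (fun w => o w c) := fun c => by
    have hi := hoK c
    rw [← hK] at hi hpK ⊢
    have ρ0 : ∀ w, 0 < qd P Z x w / Z w := fun w => div_pos (q0 w) (hZ0 w)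
    refine RCV_bayes hcQ (fun X hX => RCV_all hcQ hoc (fun c => ⟨_, hSm c, hSrc c, hSc c⟩) hWG hX) (qm.div hZ) ρ0
      (wd_dens_int (qm.div hZ) fun w => (ρ0 w).le).1 hi
  choose V v1 v2 v3 using hR
  have hUa : Adapted F (fun t w => (WithLp.toLp 2 (fun c => V c t w) : EuclideanSpace ℝ (Fin d))) := fun t =>
    (WithLp.measurable_toLp 2 _).comp (@measurable_pi_lambda _ _ _ (F t) _ _ fun c => v1 c t)
  have hUrc : ∀ w, ∀ t : ℝ≥0, ContinuousWithinAt (fun t => (WithLp.toLp 2 (fun c => V c t w) : EuclideanSpace ℝ (Fin d))) (Ici t) t := fun w t => (PiLp.continuous_toLp 2 _).continuousAt.comp_continuousWithinAt (continuousWithinAt_pi.2 fun c => v2 c w t)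
  have hUv : ∀ t : ℝ≥0, (fun w => (WithLp.toLp 2 (fun c => V c t w) : EuclideanSpace ℝ (Fin d))) =ᵐ[wd P (qd P Z x)]
      (wd P (qd P Z x))[o|F t] := fun t => vec_of fun c => (v3 c t).trans (vec_comp hoKv t c).symm
  have hUm := mart_of hUa hUv
  refine ⟨wd P (qd P Z x), hpK, ⟨k1, k2⟩, hoKv, ⟨_, hUa, hUrc, hUv, hUm, loc_of hUm, fun μ hμ ⟨m1, m2⟩ hl => ?_⟩, ?_⟩
  · exact uniq_of hgen (fun s hs => (htr s hs).imp (fun h => k1 h) fun h => k1 h) hoKv hx hUrc hUv (m1.trans k2) (k1.trans m2) hl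
  · have := Measure.rnDeriv_withDensity P (qm.ennreal_ofReal)
    filter_upwards [this] with w hw
    have e : (wd P (qd P Z x)).rnDeriv P w = ENNReal.ofReal (qd P Z x w) := hw
    rw [e, ENNReal.toReal_ofReal (q0 w).le]
    exact (qd_one hZ hZ0 x0.le x1 w).trans (by linarith)
end P29
theorem density_of_measures_with_MRP
    {Ω : Type*} {m : MeasurableSpace Ω} {P : Measure Ω} [IsProbabilityMeasure P]
    (F : Filtration ℝ≥0 m)
    -- usual conditions: right-continuity and completeness of the filtration
    (hright : ∀ t : ℝ≥0, (F t : MeasurableSpace Ω) = ⨅ (s : ℝ≥0) (_ : t < s), F s)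
    (hcomplete : ∀ s : Set Ω, MeasurableSet[m] s → P s = 0 → MeasurableSet[F 0] s)
    -- `F 0` is `P`-trivial and `F = ⋁ t, F t`
    (htrivial : ∀ s : Set Ω, MeasurableSet[F 0] s → P s = 0 ∨ P s = 1)
    (hgen : (⨆ t : ℝ≥0, (F t : MeasurableSpace Ω)) = m)
    {d : ℕ} (ψ : Ω → EuclideanSpace ℝ (Fin d)) (hψ : Integrable ψ P)
    -- `𝒬(ψ)`: probability measures `Q ∼ P` with `E_Q |ψ| < ∞` such that some right-continuous
    -- adapted version of the `Q`-martingale `t ↦ E_Q[ψ | F t]` has the MRP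
    (𝒬 : Set (Measure Ω))
    (h𝒬 : 𝒬 = {Q : Measure Ω | IsProbabilityMeasure Q ∧ (Q ≪ P ∧ P ≪ Q) ∧
      Integrable ψ Q ∧
      ∃ S : ℝ≥0 → Ω → EuclideanSpace ℝ (Fin d),
        Adapted F S ∧
        (∀ ω, ∀ t : ℝ≥0, ContinuousWithinAt (fun s => S s ω) (Ici t) t) ∧
        (∀ t : ℝ≥0, S t =ᵐ[Q] Q[ψ | F t]) ∧
        Martingale S F Q ∧
        HasMRP F S P Q})
    (hne : 𝒬.Nonempty) :
    ∀ ε : ℝ, 0 < ε → ∃ Q ∈ 𝒬, ∀ᵐ ω ∂P, |(Q.rnDeriv P ω).toReal - 1| ≤ ε := by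
  intro ε hε
  obtain ⟨Q, hQ⟩ := hne
  rw [h𝒬] at hQ
  obtain ⟨hp, ⟨h1, h2⟩, hψQ, S, hSa, hrc, hS, -, hM⟩ := hQ
  have hae : ψ =ᵐ[P] hψ.aestronglyMeasurable.mk ψ := hψ.aestronglyMeasurable.ae_eq_mk
  obtain ⟨K, hK, ⟨k1, k2⟩, hψK, ⟨U, u1, u2, u3, u4, u5⟩, hKε⟩ := core hcomplete htrivial hgen
    hψ.aestronglyMeasurable.stronglyMeasurable_mk (hψ.congr hae) h1 h2 (hψQ.congr (h1.ae_le hae)) hSa hrc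
    (fun t => (hS t).trans (condExp_congr_ae (h1.ae_le hae))) hM hε
  refine ⟨K, ?_, hKε⟩
  rw [h𝒬]
  exact ⟨hK, ⟨k1, k2⟩, hψK.congr (k1.ae_le hae.symm), U, u1, u2,
    fun t => (u3 t).trans (condExp_congr_ae (k1.ae_le hae.symm)), u4, u5⟩
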